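/- Let c ≥ 20 be a constant and let G ~ G(n, c/n). Let G′ be the subgraph of G induced by V_{4,black}(G) ∪ V_{4,blue}(G). Then with probability 1 − o(n^{−1}) the following holds: for every U ⊆ V_{4,blue}(G) and every matching M on V_{4,blue}(G) ∖ U, the graph G′[V(G′) ∖ U] ∪ M has a Hamilton cycle that contains every edge of M. -/

import Mathlib

open Filter

/-- A set `S` of vertices of `G` is a "strong `k`-set" if every vertex of
`S ∪ N(S)` has at least `k` neighbours in `S`. -/
def IsStrongSet {V : Type*} (G : SimpleGraph V) (k : ℕ) (S : Set V) : Prop :=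
  ∀ v, v ∈ S ∪ {x | ∃ s ∈ S, G.Adj x s} → k ≤ {u | u ∈ S ∧ G.Adj v u}.ncard

/-- The strong `k`-core `V_{k,black}(G)` of `G`: the maximal strong `k`-set,
i.e. the union of all strong `k`-sets. -/
def strongCore {V : Type*} (G : SimpleGraph V) (k : ℕ) : Set V :=
  ⋃₀ {S | IsStrongSet G k S}

/-- `V_{k,blue}(G)`: the neighbourhood of the strong `k`-core, minus the core. -/
def strongBlue {V : Type*} (G : SimpleGraph V) (k : ℕ) : Set V :=
  {v | v ∉ strongCore G k ∧ ∃ u ∈ strongCore G k, G.Adj v u}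

/-- The non-diagonal edges of the complete graph on `Fin n`. -/
def allEdges (n : ℕ) : Finset (Sym2 (Fin n)) :=
  Finset.univ.filter fun e => ¬ e.IsDiag

/-- The probability that the binomial random graph `G(n,p)` (each of the
`C(n,2)` possible edges present independently with probability `p`) satisfies
the predicate `Q`. -/
noncomputable def prG (n : ℕ) (p : ℝ) (Q : SimpleGraph (Fin n) → Prop) : ℝ :=
  ∑ S ∈ (allEdges n).powerset,
    Set.indicator {S : Finset (Sym2 (Fin n)) | Q (SimpleGraph.fromEdgeSet ↑S)}
      (fun S => p ^ S.card * (1 - p) ^ ((allEdges n).card - S.card)) S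

/-- The robust Hamiltonicity property of the strong `4`-core: writing
`Z = V_{4,black}(G) ∪ V_{4,blue}(G)` and `G' = G[Z]`, for every `U ⊆ V_{4,blue}(G)`
and every matching `M` on `V_{4,blue}(G) \ U`, the graph `G'[Z \ U] ∪ M` has a
Hamilton cycle containing every edge of `M`.  The Hamilton cycle is expressed as a
cycle of `G ⊔ M` whose support is exactly `Z \ U` (all its non-`M` edges then
automatically lie in the induced subgraph `G[Z \ U]`). -/
def RobustHam (n : ℕ) (G : SimpleGraph (Fin n)) : Prop :=
  ∀ U ⊆ strongBlue G 4, ∀ M : Finset (Sym2 (Fin n)),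
    (∀ e ∈ M, ¬ e.IsDiag) →
    (∀ e ∈ M, ∀ v : Fin n, v ∈ e → v ∈ strongBlue G 4 ∧ v ∉ U) →
    (∀ e ∈ M, ∀ f ∈ M, e ≠ f → ∀ v : Fin n, v ∈ e → v ∉ f) →
    ∃ (a : Fin n) (p : (G ⊔ SimpleGraph.fromEdgeSet ↑M).Walk a a),
      p.IsCycle ∧
      (∀ x : Fin n, x ∈ p.support ↔ x ∈ (strongCore G 4 ∪ strongBlue G 4) \ U) ∧
      (∀ e ∈ M, e ∈ p.edges)

section BernoulliSubsets

variable {α : Type*}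

/-- The expectation of `f` on a random subset of `Ω` that contains each element independently with
probability `p`. -/
noncomputable def bern (Ω : Finset α) (p : ℝ) (f : Finset α → ℝ) : ℝ :=
  ∑ S ∈ Ω.powerset, p ^ S.card * (1 - p) ^ (Ω.card - S.card) * f S

open Classical in
/-- The indicator of a proposition. -/
noncomputable def ind (P : Prop) : ℝ := if P then 1 else 0

lemma ind_nonneg (P : Prop) : 0 ≤ ind P := by unfold ind; split_ifs <;> norm_num

lemma ind_le_one (P : Prop) : ind P ≤ 1 := by unfold ind; split_ifs <;> norm_num

lemma ind_true {P : Prop} (h : P) : ind P = 1 := if_pos h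

lemma ind_false {P : Prop} (h : ¬ P) : ind P = 0 := if_neg h

lemma ind_mono {P Q : Prop} (h : P → Q) : ind P ≤ ind Q := by
  by_cases hP : P
  · rw [ind_true hP, ind_true (h hP)]
  · rw [ind_false hP]; exact ind_nonneg _

lemma ind_or_le (P Q : Prop) : ind (P ∨ Q) ≤ ind P + ind Q := by
  by_cases hP : P
  · rw [ind_true (Or.inl hP), ind_true hP]; linarith [ind_nonneg Q]
  · rw [ind_false hP, zero_add]; exact ind_mono (fun h => h.resolve_left hP)

lemma ind_and (P Q : Prop) : ind (P ∧ Q) = ind P * ind Q := by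
  by_cases hP : P <;> by_cases hQ : Q <;> simp [ind, hP, hQ]

lemma ind_exists_le {ι : Type*} (s : Finset ι) (Q : ι → Prop) :
    ind (∃ i ∈ s, Q i) ≤ ∑ i ∈ s, ind (Q i) := by
  by_cases h : ∃ i ∈ s, Q i
  · obtain ⟨i, hi, hQ⟩ := h
    calc ind (∃ i ∈ s, Q i) ≤ ind (Q i) := by rw [ind_true hQ]; exact ind_le_one _
      _ ≤ _ := Finset.single_le_sum (f := fun i => ind (Q i)) (fun _ _ => ind_nonneg _) hi
  · rw [ind_false h]; exact Finset.sum_nonneg fun _ _ => ind_nonneg _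

@[simp] lemma bern_empty (p : ℝ) (f : Finset α → ℝ) : bern ∅ p f = f ∅ := by
  simp [bern]

lemma bern_congr {Ω : Finset α} {p : ℝ} {f g : Finset α → ℝ} (h : ∀ S ⊆ Ω, f S = g S) :
    bern Ω p f = bern Ω p g :=
  Finset.sum_congr rfl fun S hS => by rw [h S (Finset.mem_powerset.1 hS)]

lemma bern_mono {Ω : Finset α} {p : ℝ} (h0 : 0 ≤ p) (h1 : p ≤ 1) {f g : Finset α → ℝ}
    (h : ∀ S ⊆ Ω, f S ≤ g S) : bern Ω p f ≤ bern Ω p g := by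
  refine Finset.sum_le_sum fun S hS => mul_le_mul_of_nonneg_left (h S (Finset.mem_powerset.1 hS)) ?_
  have : 0 ≤ 1 - p := by linarith
  positivity

lemma bern_add (Ω : Finset α) (p : ℝ) (f g : Finset α → ℝ) :
    bern Ω p (fun S => f S + g S) = bern Ω p f + bern Ω p g := by
  simp only [bern, mul_add, Finset.sum_add_distrib]

lemma bern_mul_left (Ω : Finset α) (p : ℝ) (a : ℝ) (f : Finset α → ℝ) :
    bern Ω p (fun S => a * f S) = a * bern Ω p f := by
  simp only [bern, Finset.mul_sum]
  exact Finset.sum_congr rfl fun S _ => by ring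

lemma bern_sum {ι : Type*} (s : Finset ι) (Ω : Finset α) (p : ℝ) (f : ι → Finset α → ℝ) :
    bern Ω p (fun S => ∑ i ∈ s, f i S) = ∑ i ∈ s, bern Ω p (f i) := by
  simp only [bern, Finset.mul_sum]
  rw [Finset.sum_comm]

variable [DecidableEq α]

lemma bern_insert {Ω : Finset α} {e : α} (he : e ∉ Ω) (p : ℝ) (f : Finset α → ℝ) :
    bern (insert e Ω) p f = p * bern Ω p (fun S => f (insert e S)) + (1 - p) * bern Ω p f := by
  unfold bern
  rw [Finset.sum_powerset_insert he, add_comm, Finset.mul_sum, Finset.mul_sum]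
  congr 1
  · refine Finset.sum_congr rfl fun S hS => ?_
    have hS' := Finset.mem_powerset.1 hS
    rw [Finset.card_insert_of_notMem he, Finset.card_insert_of_notMem (fun h => he (hS' h)),
      Nat.add_sub_add_right, pow_succ]
    ring
  · refine Finset.sum_congr rfl fun S hS => ?_
    have hS' := Finset.card_le_card (Finset.mem_powerset.1 hS)
    rw [Finset.card_insert_of_notMem he, Nat.succ_sub hS', pow_succ]
    ring

lemma bern_const (Ω : Finset α) (p : ℝ) (a : ℝ) : bern Ω p (fun _ => a) = a := by
  induction Ω using Finset.induction_on with
  | empty => simp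
  | insert e Ω he ih => rw [bern_insert he, ih]; ring

lemma bern_nonneg {Ω : Finset α} {p : ℝ} (h0 : 0 ≤ p) (h1 : p ≤ 1) {f : Finset α → ℝ}
    (h : ∀ S ⊆ Ω, 0 ≤ f S) : 0 ≤ bern Ω p f := by
  have := bern_mono h0 h1 h
  rwa [bern_const] at this

lemma bern_le_const {Ω : Finset α} {p : ℝ} (h0 : 0 ≤ p) (h1 : p ≤ 1) {f : Finset α → ℝ} {a : ℝ}
    (h : ∀ S ⊆ Ω, f S ≤ a) : bern Ω p f ≤ a := by
  have := bern_mono h0 h1 h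
  rwa [bern_const] at this

lemma bern_disjUnion {Ω₁ Ω₂ : Finset α} (h : Disjoint Ω₁ Ω₂) (p : ℝ) (f : Finset α → ℝ) :
    bern (Ω₁ ∪ Ω₂) p f = bern Ω₁ p (fun S => bern Ω₂ p (fun T => f (S ∪ T))) := by
  induction Ω₁ using Finset.induction_on generalizing f with
  | empty => simp
  | insert e Ω he ih =>
    rw [Finset.disjoint_insert_left] at h
    rw [Finset.insert_union, bern_insert (by simp [he, h.1]), bern_insert he, ih h.2, ih h.2]
    simp only [Finset.insert_union]

/-- The union of two independent random subsets is a random subset. -/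
lemma bern_union (Ω : Finset α) (p₁ p₂ : ℝ) (f : Finset α → ℝ) :
    bern Ω p₁ (fun S => bern Ω p₂ (fun T => f (S ∪ T))) =
      bern Ω (1 - (1 - p₁) * (1 - p₂)) f := by
  induction Ω using Finset.induction_on generalizing f with
  | empty => simp
  | insert e Ω he ih =>
    rw [bern_insert he, bern_insert he]
    simp only [bern_insert he, Finset.insert_union, Finset.union_insert, Finset.insert_idem]
    simp only [bern_add, bern_mul_left]
    rw [ih (fun S => f (insert e S)), ih f]
    ring

/-- A random subset contains `A` and avoids `B` with probability `p ^ |A| * (1 - p) ^ |B|`. -/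
lemma bern_contains_avoids {Ω A B : Finset α} (hA : A ⊆ Ω) (hB : B ⊆ Ω) (hAB : Disjoint A B)
    (p : ℝ) : bern Ω p (fun S => ind (A ⊆ S ∧ Disjoint B S)) = p ^ A.card * (1 - p) ^ B.card := by
  induction Ω using Finset.induction_on generalizing A B with
  | empty =>
    rw [Finset.subset_empty] at hA hB
    subst hA hB
    simp [ind]
  | insert e Ω he ih =>
    rw [bern_insert he]
    by_cases heA : e ∈ A
    · have heB : e ∉ B := Finset.disjoint_left.1 hAB heA
      have hB' : B ⊆ Ω := (Finset.subset_insert_iff_of_notMem heB).1 hB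
      have h2 : bern Ω p (fun S => ind (A ⊆ S ∧ Disjoint B S)) = 0 := by
        rw [← bern_const Ω p 0]
        refine bern_congr fun S hS => ind_false fun h => he (hS (h.1 heA))
      have h1 : bern Ω p (fun S => ind (A ⊆ insert e S ∧ Disjoint B (insert e S))) =
          bern Ω p (fun S => ind (A.erase e ⊆ S ∧ Disjoint B S)) := by
        refine bern_congr fun S hS => ?_
        rw [Finset.subset_insert_iff, Finset.disjoint_insert_right]
        simp [heB]
      rw [h1, h2, ih (by rwa [← Finset.subset_insert_iff]) hB'
        (hAB.mono_left (Finset.erase_subset _ _)), ← Finset.card_erase_add_one heA, pow_succ]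
      ring
    · have hA' : A ⊆ Ω := (Finset.subset_insert_iff_of_notMem heA).1 hA
      have h1 : bern Ω p (fun S => ind (A ⊆ insert e S ∧ Disjoint B (insert e S))) =
          if e ∈ B then 0 else bern Ω p (fun S => ind (A ⊆ S ∧ Disjoint B S)) := by
        split_ifs with heB
        · rw [← bern_const Ω p 0]
          refine bern_congr fun S hS => ind_false fun h => ?_
          exact (Finset.disjoint_insert_right.1 h.2).1 heB
        · refine bern_congr fun S hS => ?_
          rw [Finset.subset_insert_iff_of_notMem heA, Finset.disjoint_insert_right]
          simp [heB]
      rw [h1]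
      split_ifs with heB
      · have h2 : bern Ω p (fun S => ind (A ⊆ S ∧ Disjoint B S)) =
            bern Ω p (fun S => ind (A ⊆ S ∧ Disjoint (B.erase e) S)) := by
          refine bern_congr fun S hS => ?_
          have heS : e ∉ S := fun h => he (hS h)
          congr 2
          rw [Finset.disjoint_erase_comm, Finset.erase_eq_of_notMem heS]
        rw [h2, ih hA' (by rwa [← Finset.subset_insert_iff])
          (hAB.mono_right (Finset.erase_subset _ _)), ← Finset.card_erase_add_one heB, pow_succ]
        ring
      · rw [ih hA' ((Finset.subset_insert_iff_of_notMem heB).1 hB) hAB]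
        ring

lemma bern_contains {Ω A : Finset α} (hA : A ⊆ Ω) (p : ℝ) :
    bern Ω p (fun S => ind (A ⊆ S)) = p ^ A.card := by
  have := bern_contains_avoids hA (Finset.empty_subset Ω) (Finset.disjoint_empty_right A) p
  simpa using this

lemma bern_avoids {Ω B : Finset α} (hB : B ⊆ Ω) (p : ℝ) :
    bern Ω p (fun S => ind (Disjoint B S)) = (1 - p) ^ B.card := by
  have := bern_contains_avoids (Finset.empty_subset Ω) hB (Finset.disjoint_empty_left B) p
  simpa using this

/-- It is unlikely that a random set contains many pairwise disjoint members of a family. -/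
lemma bern_many_disjoint {ι : Type*} {Ω : Finset α} {p z : ℝ} (h0 : 0 ≤ p) (h1 : p ≤ 1)
    (hz : 1 ≤ z) (I : Finset ι) (A : ι → Finset α) (k : ℕ) :
    bern Ω p (fun S => ind (∃ J ⊆ I, J.card = k ∧ (J : Set ι).PairwiseDisjoint A ∧
      ∀ i ∈ J, A i ⊆ S ∧ A i ⊆ Ω)) ≤ z⁻¹ ^ k * Real.exp (z * ∑ i ∈ I, p ^ (A i).card) := by
  classical
  have hz0 : 0 < z := by linarith
  have step : ∀ S ⊆ Ω, ind (∃ J ⊆ I, J.card = k ∧ (J : Set ι).PairwiseDisjoint A ∧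
      ∀ i ∈ J, A i ⊆ S ∧ A i ⊆ Ω) ≤ z⁻¹ ^ k * ∑ J ∈ I.powerset, z ^ J.card *
        ind ((J : Set ι).PairwiseDisjoint A ∧ ∀ i ∈ J, A i ⊆ S ∧ A i ⊆ Ω) := by
    intro S _
    by_cases h : ∃ J ⊆ I, J.card = k ∧ (J : Set ι).PairwiseDisjoint A ∧
      ∀ i ∈ J, A i ⊆ S ∧ A i ⊆ Ω
    · rw [ind_true h]
      obtain ⟨J, hJI, hJk, hJ⟩ := h
      have := Finset.single_le_sum (f := fun J : Finset ι => z ^ J.card *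
        ind ((J : Set ι).PairwiseDisjoint A ∧ ∀ i ∈ J, A i ⊆ S ∧ A i ⊆ Ω))
        (fun J _ => mul_nonneg (by positivity) (ind_nonneg _)) (Finset.mem_powerset.2 hJI)
      simp only [ind_true hJ, hJk, mul_one] at this
      calc (1 : ℝ) = z⁻¹ ^ k * z ^ k := by rw [← mul_pow, inv_mul_cancel₀ hz0.ne', one_pow]
        _ ≤ _ := mul_le_mul_of_nonneg_left this (by positivity)
    · rw [ind_false h]
      exact mul_nonneg (by positivity) (Finset.sum_nonneg fun J _ =>
        mul_nonneg (by positivity) (ind_nonneg _))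
  refine (bern_mono h0 h1 step).trans ?_
  rw [bern_mul_left, bern_sum]
  refine mul_le_mul_of_nonneg_left ?_ (by positivity)
  calc ∑ J ∈ I.powerset, bern Ω p (fun S => z ^ J.card *
        ind ((J : Set ι).PairwiseDisjoint A ∧ ∀ i ∈ J, A i ⊆ S ∧ A i ⊆ Ω))
      ≤ ∑ J ∈ I.powerset, ∏ i ∈ J, (z * p ^ (A i).card) := by
        refine Finset.sum_le_sum fun J _ => ?_
        rw [bern_mul_left, Finset.prod_mul_distrib, Finset.prod_const]
        refine mul_le_mul_of_nonneg_left ?_ (by positivity)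
        by_cases hJ : (J : Set ι).PairwiseDisjoint A ∧ ∀ i ∈ J, A i ⊆ Ω
        · rw [Finset.prod_pow_eq_pow_sum, ← Finset.card_biUnion hJ.1,
            ← bern_contains (Finset.biUnion_subset.2 hJ.2) p]
          refine bern_mono h0 h1 fun S _ => ind_mono fun h => ?_
          exact Finset.biUnion_subset.2 fun i hi => (h.2 i hi).1
        · refine (bern_le_const h0 h1 fun S _ => (ind_false fun h => hJ ⟨h.1, fun i hi =>
            (h.2 i hi).2⟩).le).trans ?_
          exact Finset.prod_nonneg fun _ _ => by positivity
    _ = ∏ i ∈ I, (1 + z * p ^ (A i).card) := (Finset.prod_one_add _).symm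
    _ ≤ ∏ i ∈ I, Real.exp (z * p ^ (A i).card) := by
        refine Finset.prod_le_prod (fun i _ => by positivity) fun i _ => ?_
        rw [add_comm]; exact Real.add_one_le_exp _
    _ = _ := by rw [← Real.exp_sum, Finset.mul_sum]

/-- A sprinkling estimate: if every set of positive score has at least `b` boosters, then the score
is unlikely to remain positive. -/
lemma bern_sprinkle {Ω : Finset α} {p θ : ℝ} (h0 : 0 ≤ p) (h1 : p ≤ 1) (hθ : 0 < θ)
    (hθ1 : θ ≤ 1) (score : Finset α → ℕ) (hanti : ∀ S T, S ⊆ T → score T ≤ score S) (b : ℕ)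
    (hboost : ∀ S ⊆ Ω, 0 < score S → b ≤ (Ω.filter fun e => score (insert e S) < score S).card) :
    bern Ω p (fun S => ind (0 < score S)) ≤ θ⁻¹ ^ score ∅ * (1 - p * (1 - θ)) ^ b := by
  have hX : 0 ≤ 1 - p * (1 - θ) := by nlinarith
  have h1p : 0 ≤ 1 - p := by linarith
  have main : ∀ (d : ℕ) (K Z : Finset α), K ⊆ Ω → Z ⊆ Ω → Disjoint K Z → Z.card + d ≤ b →
      bern Ω p (fun S => ind ((K ⊆ S ∧ Disjoint Z S) ∧ 0 < score S)) ≤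
        p ^ K.card * (1 - p) ^ Z.card * (θ⁻¹ ^ score K * (1 - p * (1 - θ)) ^ d) := by
    intro d
    induction d with
    | zero =>
      intro K Z hK hZ hKZ _
      rw [pow_zero, mul_one, ← bern_contains_avoids hK hZ hKZ]
      refine (bern_mono h0 h1 fun S _ => ind_mono fun h => h.1).trans ?_
      refine le_mul_of_one_le_right (bern_nonneg h0 h1 fun _ _ => ind_nonneg _) ?_
      exact one_le_pow₀ ((one_le_inv₀ hθ).2 hθ1)
    | succ d ih =>
      intro K Z hK hZ hKZ hb
      rcases Nat.eq_zero_or_pos (score K) with hs | hs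
      · refine (bern_le_const h0 h1 fun S _ => (ind_false fun h => ?_).le).trans (by positivity)
        have := hanti K S h.1.1
        omega
      · have hlt : Z.card < (Ω.filter fun e => score (insert e K) < score K).card :=
          lt_of_lt_of_le (by omega) (hboost K hK hs)
        obtain ⟨e, he, heZ⟩ := Finset.exists_mem_notMem_of_card_lt_card hlt
        rw [Finset.mem_filter] at he
        have heK : e ∉ K := fun h => by
          have := he.2
          rw [Finset.insert_eq_of_mem h] at this
          exact lt_irrefl _ this
        have hI := ih (insert e K) Z (Finset.insert_subset he.1 hK) hZ
          (Finset.disjoint_insert_left.2 ⟨heZ, hKZ⟩) (by omega)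
        have hO := ih K (insert e Z) hK (Finset.insert_subset he.1 hZ)
          (Finset.disjoint_insert_right.2 ⟨heK, hKZ⟩)
          (by rw [Finset.card_insert_of_notMem heZ]; omega)
        have hsplit : bern Ω p (fun S => ind ((K ⊆ S ∧ Disjoint Z S) ∧ 0 < score S)) ≤
            bern Ω p (fun S => ind ((insert e K ⊆ S ∧ Disjoint Z S) ∧ 0 < score S)) +
            bern Ω p (fun S => ind ((K ⊆ S ∧ Disjoint (insert e Z) S) ∧ 0 < score S)) := by
          rw [← bern_add]
          refine bern_mono h0 h1 fun S _ => (ind_mono fun h => ?_).trans (ind_or_le _ _)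
          by_cases heS : e ∈ S
          · exact Or.inl ⟨⟨Finset.insert_subset heS h.1.1, h.1.2⟩, h.2⟩
          · exact Or.inr ⟨⟨h.1.1, Finset.disjoint_insert_left.2 ⟨heS, h.1.2⟩⟩, h.2⟩
        refine hsplit.trans ((add_le_add hI hO).trans ?_)
        rw [Finset.card_insert_of_notMem heK, Finset.card_insert_of_notMem heZ]
        have hθ' : θ⁻¹ ^ score (insert e K) ≤ θ * θ⁻¹ ^ score K := by
          have h2 : θ⁻¹ ^ (score (insert e K) + 1) ≤ θ⁻¹ ^ score K :=
            pow_le_pow_right₀ ((one_le_inv₀ hθ).2 hθ1) he.2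
          calc θ⁻¹ ^ score (insert e K) = θ * θ⁻¹ ^ (score (insert e K) + 1) := by
                rw [pow_succ]; field_simp
            _ ≤ _ := mul_le_mul_of_nonneg_left h2 hθ.le
        calc p ^ (K.card + 1) * (1 - p) ^ Z.card *
              (θ⁻¹ ^ score (insert e K) * (1 - p * (1 - θ)) ^ d) +
            p ^ K.card * (1 - p) ^ (Z.card + 1) * (θ⁻¹ ^ score K * (1 - p * (1 - θ)) ^ d)
            ≤ p ^ (K.card + 1) * (1 - p) ^ Z.card *
              (θ * θ⁻¹ ^ score K * (1 - p * (1 - θ)) ^ d) +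
            p ^ K.card * (1 - p) ^ (Z.card + 1) * (θ⁻¹ ^ score K * (1 - p * (1 - θ)) ^ d) := by
              gcongr
          _ = _ := by ring
  have := main b ∅ ∅ (Finset.empty_subset _) (Finset.empty_subset _)
    (Finset.disjoint_empty_left _) (by simp)
  simpa using this

end BernoulliSubsets

section Expansion

variable {V : Type*} [Fintype V]

open Classical in
/-- The set of vertices with a neighbour in `S`. -/
noncomputable def nbS (G : SimpleGraph V) (S : Finset V) : Finset V :=
  Finset.univ.filter fun v => ∃ s ∈ S, G.Adj s v

@[simp] lemma mem_nbS {G : SimpleGraph V} {S : Finset V} {v : V} :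
    v ∈ nbS G S ↔ ∃ s ∈ S, G.Adj s v := by
  simp [nbS]

lemma nbS_mono {G H : SimpleGraph V} (h : G ≤ H) {S T : Finset V} (hST : S ⊆ T) :
    nbS G S ⊆ nbS H T := by
  intro v hv
  obtain ⟨s, hs, hsv⟩ := mem_nbS.1 hv
  exact mem_nbS.2 ⟨s, hST hs, h hsv⟩

open Classical in
/-- The edges of `G` inside `Y` that meet `X`. -/
noncomputable def touching (G : SimpleGraph V) (X Y : Finset V) : Finset (Sym2 V) :=
  Finset.univ.filter fun e => e ∈ G.edgeSet ∧ (∀ v ∈ e, v ∈ Y) ∧ ∃ v ∈ e, v ∈ X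

lemma mem_touching {G : SimpleGraph V} {X Y : Finset V} {u v : V} :
    s(u, v) ∈ touching G X Y ↔ G.Adj u v ∧ (u ∈ Y ∧ v ∈ Y) ∧ (u ∈ X ∨ v ∈ X) := by
  simp [touching]

lemma touching_mono {G : SimpleGraph V} {X X' Y Y' : Finset V} (hX : X ⊆ X') (hY : Y ⊆ Y') :
    touching G X Y ⊆ touching G X' Y' := by
  intro e he
  induction e with
  | _ u v =>
    rw [mem_touching] at he ⊢
    exact ⟨he.1, ⟨hY he.2.1.1, hY he.2.1.2⟩, he.2.2.imp (fun h => hX h) (fun h => hX h)⟩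

open Classical in
/-- The vertices that have at least one neighbour in `B`, or lie in `B`. -/
noncomputable def closedNb (G : SimpleGraph V) (B : Finset V) : Finset V :=
  Finset.univ.filter fun v => v ∈ B ∨ ∃ u ∈ B, G.Adj v u

@[simp] lemma mem_closedNb {G : SimpleGraph V} {B : Finset V} {v : V} :
    v ∈ closedNb G B ↔ v ∈ B ∨ ∃ u ∈ B, G.Adj v u := by
  simp [closedNb]

open Classical in
/-- The strong `4`-core, as a finset. -/
noncomputable def coreF (G : SimpleGraph V) : Finset V :=
  Finset.univ.filter fun v => v ∈ strongCore G 4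

@[simp] lemma mem_coreF {G : SimpleGraph V} {v : V} : v ∈ coreF G ↔ v ∈ strongCore G 4 := by
  simp [coreF]

variable [DecidableEq V]

lemma card_nbS_singleton_inter {G : SimpleGraph V} (v : V) (S : Finset V) :
    (nbS G {v} ∩ S).card = {u | u ∈ (S : Set V) ∧ G.Adj v u}.ncard := by
  rw [← Set.ncard_coe_finset]
  congr 1
  ext u
  simp [and_comm]

lemma isStrongSet_iff {G : SimpleGraph V} (S : Finset V) :
    IsStrongSet G 4 (S : Set V) ↔ ∀ v ∈ closedNb G S, 4 ≤ (nbS G {v} ∩ S).card := by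
  simp only [IsStrongSet, card_nbS_singleton_inter, mem_closedNb]
  rfl

lemma coreF_strong (G : SimpleGraph V) :
    ∀ v ∈ closedNb G (coreF G), 4 ≤ (nbS G {v} ∩ coreF G).card := by
  intro v hv
  have : ∃ S : Set V, IsStrongSet G 4 S ∧ (v ∈ S ∨ ∃ u ∈ S, G.Adj v u) := by
    rcases mem_closedNb.1 hv with h | ⟨u, hu, h⟩
    · obtain ⟨S, hS, hvS⟩ := mem_coreF.1 h
      exact ⟨S, hS, Or.inl hvS⟩
    · obtain ⟨S, hS, huS⟩ := mem_coreF.1 hu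
      exact ⟨S, hS, Or.inr ⟨u, huS, h⟩⟩
  obtain ⟨S, hS, hvS⟩ := this
  refine (hS v hvS).trans ?_
  rw [card_nbS_singleton_inter]
  refine Set.ncard_le_ncard (fun u hu => ⟨?_, hu.2⟩) (Set.toFinite _)
  exact mem_coreF.2 ⟨S, hS, hu.1⟩

lemma subset_coreF {G : SimpleGraph V} {S : Finset V}
    (h : ∀ v ∈ closedNb G S, 4 ≤ (nbS G {v} ∩ S).card) : S ⊆ coreF G := by
  intro v hv
  exact mem_coreF.2 ⟨S, (isStrongSet_iff S).2 h, hv⟩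

/-- A set `R` away from the closed neighbourhood of `B` whose closed neighbourhood, with at most
four vertices charged to each element of `R`, is the complement of `B`. -/
structure RedSet (G : SimpleGraph V) (B R : Finset V) (ch : V → V) : Prop where
  disj : ∀ r ∈ R, r ∉ closedNb G B
  mem : ∀ z ∉ B, ch z ∈ R
  adj : ∀ z ∉ B, ch z = z ∨ G.Adj (ch z) z
  fiber : ∀ r, ((Finset.univ \ B).filter fun z => ch z = r).card ≤ 4
  sub : ∀ k ≤ R.card, ∃ R' ⊆ R, R'.card = k ∧ (R' ∪ nbS G R').card ≤ 4 * k

lemma exists_redSet (G : SimpleGraph V) : ∃ R ch, RedSet G (coreF G) R ch := by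
  classical
  set B := coreF G with hB
  let P : Finset V → Prop := fun R => (∀ r ∈ R, r ∉ closedNb G B) ∧
    (∃ ch : V → V, (∀ z ∈ R ∪ nbS G R, ch z ∈ R ∧ (ch z = z ∨ G.Adj (ch z) z)) ∧
      ∀ r, ((R ∪ nbS G R).filter fun z => ch z = r).card ≤ 4) ∧
    ∀ k ≤ R.card, ∃ R' ⊆ R, R'.card = k ∧ (R' ∪ nbS G R').card ≤ 4 * k
  have hne : (Finset.univ.powerset.filter P).Nonempty := by
    refine ⟨∅, Finset.mem_filter.2 ⟨Finset.empty_mem_powerset _, by simp, ⟨id, by simp, ?_⟩, ?_⟩⟩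
    · intro r; simp [nbS]
    · intro k hk
      have : k = 0 := by simpa using hk
      subst this
      exact ⟨∅, Finset.Subset.refl _, rfl, by simp [nbS]⟩
  obtain ⟨R, hR, hmax⟩ := Finset.exists_max_image _ Finset.card hne
  obtain ⟨hd, ⟨ch, hch, hfib⟩, hsub⟩ := (Finset.mem_filter.1 hR).2
  set Z := R ∪ nbS G R with hZ
  have hZB : Disjoint Z B := by
    rw [Finset.disjoint_left]
    intro z hz hzB
    rcases Finset.mem_union.1 hz with h | h
    · exact hd z h (mem_closedNb.2 (Or.inl hzB))
    · obtain ⟨r, hr, hrz⟩ := mem_nbS.1 h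
      exact hd r hr (mem_closedNb.2 (Or.inr ⟨z, hzB, hrz⟩))
  by_cases hstrong : ∀ v ∈ closedNb G (Finset.univ \ Z),
      4 ≤ (nbS G {v} ∩ (Finset.univ \ Z)).card
  · have hsubB : Finset.univ \ Z ⊆ B := subset_coreF hstrong
    have hZeq : ∀ z, z ∉ B ↔ z ∈ Z := fun z =>
      ⟨fun h => by
        by_contra hz
        exact h (hsubB (by simp [hz])), fun h => Finset.disjoint_left.1 hZB h⟩
    refine ⟨R, ch, hd, fun z hz => (hch z ((hZeq z).1 hz)).1,
      fun z hz => (hch z ((hZeq z).1 hz)).2, fun r => ?_, hsub⟩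
    refine (Finset.card_le_card fun z hz => ?_).trans (hfib r)
    simp only [Finset.mem_filter, Finset.mem_sdiff, Finset.mem_univ, true_and] at hz ⊢
    exact ⟨(hZeq z).1 hz.1, hz.2⟩
  · exfalso
    push Not at hstrong
    obtain ⟨v, hv, hlt⟩ := hstrong
    have hvR : v ∉ R := by
      intro hvR
      rcases mem_closedNb.1 hv with h | ⟨u, hu, h⟩
      · exact (Finset.mem_sdiff.1 h).2 (Finset.mem_union_left _ hvR)
      · exact (Finset.mem_sdiff.1 hu).2 (Finset.mem_union_right _ (mem_nbS.2 ⟨v, hvR, h⟩))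
    have hvB : v ∉ closedNb G B := by
      intro h
      have h4 := coreF_strong G v h
      have : nbS G {v} ∩ coreF G ⊆ nbS G {v} ∩ (Finset.univ \ Z) := by
        refine Finset.inter_subset_inter_left fun x hx => ?_
        simpa using fun h' => Finset.disjoint_left.1 hZB h' hx
      have := Finset.card_le_card this
      omega
    have hnew : (({v} ∪ nbS G {v}) \ Z).card ≤ 4 := by
      have : ({v} ∪ nbS G {v}) \ Z ⊆ {v} ∪ (nbS G {v} ∩ (Finset.univ \ Z)) := by
        intro x hx
        simp only [Finset.mem_sdiff, Finset.mem_union, Finset.mem_inter, Finset.mem_univ,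
          true_and] at hx ⊢
        tauto
      have h2 := Finset.card_union_le {v} (nbS G {v} ∩ (Finset.univ \ Z))
      have := Finset.card_le_card this
      rw [Finset.card_singleton] at h2
      omega
    have hcl : insert v R ∪ nbS G (insert v R) = Z ∪ (({v} ∪ nbS G {v}) \ Z) := by
      ext x
      simp only [Finset.mem_union, Finset.mem_insert, mem_nbS, exists_eq_or_imp, hZ,
        Finset.mem_sdiff, Finset.mem_singleton, exists_eq_left]
      by_cases h1 : x ∈ R <;> by_cases h2 : ∃ a ∈ R, G.Adj a x <;> simp [h1, h2]
    have hPn : P (insert v R) := by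
      refine ⟨?_, ⟨fun z => if z ∈ Z then ch z else v, ?_, ?_⟩, ?_⟩
      · intro r hr
        rcases Finset.mem_insert.1 hr with rfl | hr
        · exact hvB
        · exact hd r hr
      · intro z hz
        rw [hcl] at hz
        by_cases hzZ : z ∈ Z
        · simp only [hzZ, if_true]
          exact ⟨Finset.mem_insert_of_mem (hch z hzZ).1, (hch z hzZ).2⟩
        · simp only [hzZ, if_false]
          refine ⟨Finset.mem_insert_self _ _, ?_⟩
          have := (Finset.mem_union.1 hz).resolve_left hzZ
          simp only [Finset.mem_sdiff, Finset.mem_union, Finset.mem_singleton, mem_nbS,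
            exists_eq_left] at this
          exact this.1.imp Eq.symm id
      · intro r
        rw [hcl]
        by_cases hr : r = v
        · subst hr
          refine (Finset.card_le_card fun z hz => ?_).trans hnew
          simp only [Finset.mem_filter] at hz
          by_cases hzZ : z ∈ Z
          · have h2 := hz.2
            rw [if_pos hzZ] at h2
            exact absurd (h2 ▸ (hch z hzZ).1) hvR
          · exact (Finset.mem_union.1 hz.1).resolve_left hzZ
        · refine (Finset.card_le_card fun z hz => ?_).trans (hfib r)
          simp only [Finset.mem_filter] at hz ⊢
          by_cases hzZ : z ∈ Z
          · rw [if_pos hzZ] at hz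
            exact ⟨hzZ, hz.2⟩
          · rw [if_neg hzZ] at hz
            exact absurd hz.2.symm hr
      · intro k hk
        rcases Nat.lt_or_ge R.card k with h | h
        · rw [Finset.card_insert_of_notMem hvR] at hk
          have hk' : k = R.card + 1 := by omega
          refine ⟨insert v R, Finset.Subset.refl _, by
            rw [Finset.card_insert_of_notMem hvR, hk'], ?_⟩
          rw [hcl]
          obtain ⟨R', hR', hc, h4⟩ := hsub R.card le_rfl
          rw [Finset.eq_of_subset_of_card_le hR' hc.ge, ← hZ] at h4
          have := Finset.card_union_le Z (({v} ∪ nbS G {v}) \ Z)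
          omega
        · obtain ⟨R', hR', hc, h4⟩ := hsub k h
          exact ⟨R', hR'.trans (Finset.subset_insert _ _), hc, h4⟩
    have := hmax (insert v R) (Finset.mem_filter.2 ⟨by simp, hPn⟩)
    rw [Finset.card_insert_of_notMem hvR] at this
    omega

lemma RedSet.card_le {G : SimpleGraph V} {B R : Finset V} {ch : V → V} (h : RedSet G B R ch) :
    (Finset.univ \ B).card ≤ 4 * R.card := by
  refine Finset.card_le_mul_card_image_of_maps_to (f := ch) (fun z hz => h.mem z ?_) 4
    fun r _ => h.fiber r
  simpa using hz

/-- Adding to `H` the edges of `G` that meet a vertex with fewer than four `H`-neighbours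
in `B`. -/
def augment (G H : SimpleGraph V) (B : Finset V) : SimpleGraph V where
  Adj u v := H.Adj u v ∨ G.Adj u v ∧ ((nbS H {u} ∩ B).card < 4 ∨ (nbS H {v} ∩ B).card < 4)
  symm := ⟨fun _ _ h => h.imp SimpleGraph.Adj.symm fun h => ⟨h.1.symm, h.2.symm⟩⟩
  loopless := ⟨fun _ h => h.elim (fun h => h.ne rfl) fun h => h.1.ne rfl⟩

lemma le_augment (G H : SimpleGraph V) (B : Finset V) : H ≤ augment G H B := fun _ _ h => Or.inl h

lemma augment_le {G H : SimpleGraph V} (h : H ≤ G) (B : Finset V) : augment G H B ≤ G :=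
  fun _ _ h' => h'.elim (fun h' => h h') fun h' => h'.1

lemma four_le_augment {G H : SimpleGraph V} {B : Finset V} {v : V}
    (h : 4 ≤ (nbS G {v} ∩ B).card) : 4 ≤ (nbS (augment G H B) {v} ∩ B).card := by
  rcases Nat.lt_or_ge (nbS H {v} ∩ B).card 4 with hl | hl
  · refine h.trans (Finset.card_le_card (Finset.inter_subset_inter_right fun u hu => ?_))
    simp only [mem_nbS, Finset.mem_singleton, exists_eq_left] at hu ⊢
    exact Or.inr ⟨hu, Or.inl hl⟩
  · exact hl.trans (Finset.card_le_card (Finset.inter_subset_inter_right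
      (nbS_mono (le_augment G H B) (Finset.Subset.refl _))))

/-- If each vertex of `S` has at least four neighbours in `B` but `S` has fewer than `2|S|`
neighbours there, then many edges are spanned. -/
lemma many_edges_of_few_neighbours {K : SimpleGraph V} {B S : Finset V}
    (h4 : ∀ v ∈ S, 4 ≤ (nbS K {v} ∩ B).card) (hS : S.Nonempty)
    (hlt : (nbS K S ∩ B).card < 2 * S.card) :
    (S ∪ (nbS K S ∩ B)).card + 2 ≤ (touching K S (S ∪ (nbS K S ∩ B))).card := by
  classical
  set W := nbS K S ∩ B with hW
  let P : Finset (V × V) := Finset.univ.filter fun x => x.1 ∈ S ∧ K.Adj x.1 x.2 ∧ x.2 ∈ B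
  have hPW : ∀ x ∈ P, x.2 ∈ W := by
    intro x hx
    have := (Finset.mem_filter.1 hx).2
    exact Finset.mem_inter.2 ⟨mem_nbS.2 ⟨_, this.1, this.2.1⟩, this.2.2⟩
  let Q : Finset (V × V) := P.image Prod.swap
  have hQ : ∀ x, x ∈ Q ↔ x.swap ∈ P := fun x =>
    ⟨fun h => by
      obtain ⟨y, hy, rfl⟩ := Finset.mem_image.1 h
      simpa using hy, fun h => Finset.mem_image.2 ⟨_, h, Prod.swap_swap x⟩⟩
  have hfibP : ∀ (T : Finset V), T ⊆ S → 4 * T.card ≤ (P.filter fun x => x.1 ∈ T).card := by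
    intro T hT
    refine Finset.mul_card_image_le_card_of_maps_to (f := Prod.fst)
      (fun x hx => (Finset.mem_filter.1 hx).2) 4 fun u hu => ?_
    refine (h4 u (hT hu)).trans ?_
    refine Finset.card_le_card_of_injOn (fun w => (u, w)) (fun w hw => ?_)
      (fun a _ b _ h => (Prod.mk.inj h).2)
    have hw' := Finset.mem_inter.1 (Finset.mem_coe.1 hw)
    simp only [mem_nbS, Finset.mem_singleton, exists_eq_left] at hw'
    simp [P, hT hu, hu, hw'.1, hw'.2]
  have hPQ : P ∪ Q ⊆ Finset.univ.filter fun x : V × V =>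
      Sym2.mk x.1 x.2 ∈ touching K S (S ∪ W) := by
    intro x hx
    have key : ∀ y ∈ P, Sym2.mk y.1 y.2 ∈ touching K S (S ∪ W) := by
      intro y hy
      have h1 := (Finset.mem_filter.1 hy).2
      rw [mem_touching]
      exact ⟨h1.2.1, ⟨Finset.mem_union_left _ h1.1, Finset.mem_union_right _ (hPW y hy)⟩,
        Or.inl h1.1⟩
    refine Finset.mem_filter.2 ⟨Finset.mem_univ _, ?_⟩
    rcases Finset.mem_union.1 hx with h | h
    · exact key x h
    · have := key _ ((hQ x).1 h)
      rwa [Prod.fst_swap, Prod.snd_swap, Sym2.eq_swap] at this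
  have h2E : (P ∪ Q).card ≤ 2 * (touching K S (S ∪ W)).card := by
    refine Finset.card_le_mul_card_image_of_maps_to (f := fun x : V × V => Sym2.mk x.1 x.2)
      (fun x hx => (Finset.mem_filter.1 (hPQ hx)).2) 2 fun e _ => ?_
    induction e with
    | _ a b =>
      refine (Finset.card_le_card (t := {(a, b), (b, a)}) fun x hx => ?_).trans
        Finset.card_le_two
      have := (Finset.mem_filter.1 hx).2
      rw [Sym2.eq_iff] at this
      simp only [Finset.mem_insert, Finset.mem_singleton, Prod.ext_iff]
      exact this
  set y := (S ∩ W).card with hy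
  have hunion : (S ∪ W).card + y = S.card + W.card := Finset.card_union_add_card_inter S W
  have hP4 : 4 * S.card ≤ P.card := (hfibP S (Finset.Subset.refl _)).trans
    (Finset.card_filter_le _ _)
  have hsd : (P ∪ Q).card = P.card + (Q \ P).card := by
    rw [← Finset.card_union_of_disjoint Finset.disjoint_sdiff, Finset.union_sdiff_self_eq_union]
  have hyS : (S \ W).card + y = S.card := Finset.card_sdiff_add_card_inter S W
  rcases Nat.lt_or_ge y S.card with hlt' | hge
  · have : 4 * (S \ W).card ≤ (Q \ P).card := by
      refine (hfibP (S \ W) Finset.sdiff_subset).trans ?_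
      refine Finset.card_le_card_of_injOn Prod.swap (fun x hx => ?_)
        (fun a _ b _ h => Prod.swap_injective h)
      have hx' := Finset.mem_filter.1 (Finset.mem_coe.1 hx)
      refine Finset.mem_coe.2 (Finset.mem_sdiff.2 ⟨(hQ _).2 (by simpa using hx'.1), fun h => ?_⟩)
      exact (Finset.mem_sdiff.1 hx'.2).2 (hPW _ h)
    omega
  · have hSW : S ⊆ W := by
      have : S \ W = ∅ := Finset.card_eq_zero.1 (by omega)
      exact Finset.sdiff_eq_empty_iff_subset.1 this
    have hWS : (W \ S).card + S.card = W.card := by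
      rw [Finset.card_sdiff_add_card_eq_card hSW]
    have h1 : (W \ S).card ≤ (Q \ P).card := by
      have : ∀ w ∈ W \ S, ∃ x ∈ Q \ P, x.1 = w := by
        intro w hw
        have hw' := Finset.mem_sdiff.1 hw
        have hwW := Finset.mem_inter.1 hw'.1
        obtain ⟨s, hs, hsw⟩ := mem_nbS.1 hwW.1
        refine ⟨(w, s), Finset.mem_sdiff.2 ⟨(hQ _).2 ?_, fun h => hw'.2 ?_⟩, rfl⟩
        · exact Finset.mem_filter.2 ⟨Finset.mem_univ _, hs, hsw, hwW.2⟩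
        · exact (Finset.mem_filter.1 h).2.1
      choose! f hf hf' using this
      refine Finset.card_le_card_of_injOn f (fun w hw => hf w hw) fun a ha b hb h => ?_
      rw [← hf' a ha, ← hf' b hb, h]
    have h5 : 5 ≤ W.card := by
      obtain ⟨s, hs⟩ := hS
      have hsub : insert s (nbS K {s} ∩ B) ⊆ W := by
        refine Finset.insert_subset (hSW hs) fun w hw => ?_
        have hw' := Finset.mem_inter.1 hw
        simp only [mem_nbS, Finset.mem_singleton, exists_eq_left] at hw'
        exact Finset.mem_inter.2 ⟨mem_nbS.2 ⟨s, hs, hw'.1⟩, hw'.2⟩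
      have h1 := Finset.card_le_card hsub
      rw [Finset.card_insert_of_notMem (by simp)] at h1
      have := h4 s hs
      omega
    omega

/-- No small set `X` has its closed `H`-neighbourhood inside a set `Y` of size at most `4|X|` such
that at least `|Y|+2` edges of `G` inside `Y` meet `X`. -/
def NoDense (G H : SimpleGraph V) (x₀ : ℕ) : Prop :=
  ∀ X Y : Finset V, X.Nonempty → X ⊆ Y → X.card ≤ x₀ → Y.card ≤ 4 * X.card → nbS H X ⊆ Y →
    (touching G X Y).card ≤ Y.card + 1

lemma two_mul_card_le_of_noDense {G H : SimpleGraph V} (hHG : H ≤ G) {x₀ : ℕ}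
    (hd : NoDense G H x₀) {R : Finset V} {ch : V → V} (hR : RedSet G (coreF G) R ch)
    {S : Finset V} (hS : S ⊆ closedNb G (coreF G)) (hcard : S.card + R.card ≤ x₀) :
    2 * S.card ≤ (nbS (augment G H (coreF G)) S ∩ coreF G).card := by
  classical
  set B := coreF G with hB
  set K := augment G H B with hK
  by_contra! hlt
  have hSne : S.Nonempty := by
    rw [Finset.nonempty_iff_ne_empty]
    rintro rfl
    simp at hlt
  have h4 : ∀ v ∈ S, 4 ≤ (nbS K {v} ∩ B).card := fun v hv =>
    four_le_augment (coreF_strong G v (hS hv))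
  set W := nbS K S ∩ B with hW
  have hbase := many_edges_of_few_neighbours h4 hSne hlt
  rw [← hW] at hbase
  have hKG : K ≤ G := augment_le hHG B
  have hbase' : (S ∪ W).card + 2 ≤ (touching G (S ∪ (R ∩ (S ∪ W))) (S ∪ W)).card := by
    refine hbase.trans (Finset.card_le_card fun e he => ?_)
    induction e with
    | _ u v =>
      rw [mem_touching] at he ⊢
      exact ⟨hKG he.1, he.2.1, he.2.2.imp (Finset.mem_union_left _) (Finset.mem_union_left _)⟩
  let good : Finset V → Prop := fun Y => S ∪ W ⊆ Y ∧ Y ⊆ (S ∪ W) ∪ (Finset.univ \ B) ∧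
    Y.card + 2 ≤ (touching G (S ∪ (R ∩ Y)) Y).card
  have hne : (Finset.univ.powerset.filter good).Nonempty :=
    ⟨S ∪ W, Finset.mem_filter.2 ⟨by simp, Finset.Subset.refl _, Finset.subset_union_left, hbase'⟩⟩
  obtain ⟨Y, hY, hmax⟩ := Finset.exists_max_image _ Finset.card hne
  obtain ⟨hY1, hY2, hY3⟩ := (Finset.mem_filter.1 hY).2
  have hclose : ∀ u v, G.Adj u v → u ∈ Y → (v ∉ B) → (u ∈ S ∪ (R ∩ Y) ∨ v ∈ R) → v ∈ Y := by
    intro u v huv hu hv hor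
    by_contra hvY
    have hg : good (insert v Y) := by
      refine ⟨hY1.trans (Finset.subset_insert _ _), Finset.insert_subset ?_ hY2, ?_⟩
      · exact Finset.mem_union_right _ (by simpa using hv)
      · rw [Finset.card_insert_of_notMem hvY]
        have hsub : insert s(u, v) (touching G (S ∪ (R ∩ Y)) Y) ⊆
            touching G (S ∪ (R ∩ insert v Y)) (insert v Y) := by
          refine Finset.insert_subset ?_ (touching_mono ?_ (Finset.subset_insert _ _))
          · rw [mem_touching]
            refine ⟨huv, ⟨Finset.mem_insert_of_mem hu, Finset.mem_insert_self _ _⟩, ?_⟩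
            rcases hor with h | h
            · left
              rcases Finset.mem_union.1 h with h | h
              · exact Finset.mem_union_left _ h
              · exact Finset.mem_union_right _ (Finset.mem_inter.2
                  ⟨(Finset.mem_inter.1 h).1, Finset.mem_insert_of_mem hu⟩)
            · right
              exact Finset.mem_union_right _ (Finset.mem_inter.2 ⟨h, Finset.mem_insert_self _ _⟩)
          · exact Finset.union_subset_union_right (Finset.inter_subset_inter_left
              (Finset.subset_insert _ _))
        have h1 := Finset.card_le_card hsub
        rw [Finset.card_insert_of_notMem] at h1
        · omega
        · rw [mem_touching]
          exact fun h => hvY h.2.1.2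
    have := hmax _ (Finset.mem_filter.2 ⟨by simp, hg⟩)
    rw [Finset.card_insert_of_notMem hvY] at this
    omega
  have hSR : Disjoint S (R ∩ Y) := by
    rw [Finset.disjoint_left]
    exact fun v hv hv' => hR.disj v (Finset.mem_inter.1 hv').1 (hS hv)
  set X := S ∪ (R ∩ Y) with hX
  have hXc : X.card = S.card + (R ∩ Y).card := Finset.card_union_of_disjoint hSR
  have hYB : (Y \ B).card ≤ 4 * (R ∩ Y).card := by
    refine Finset.card_le_mul_card_image_of_maps_to (f := ch) (fun z hz => ?_) 4 fun r _ => ?_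
    · obtain ⟨hzY, hzB⟩ := Finset.mem_sdiff.1 hz
      refine Finset.mem_inter.2 ⟨hR.mem z hzB, ?_⟩
      rcases hR.adj z hzB with h | h
      · rwa [h]
      · refine hclose z (ch z) h.symm hzY (fun hc => ?_) (Or.inr (hR.mem z hzB))
        exact hR.disj _ (hR.mem z hzB) (mem_closedNb.2 (Or.inl hc))
    · refine (Finset.card_le_card fun z hz => ?_).trans (hR.fiber r)
      simp only [Finset.mem_filter, Finset.mem_sdiff, Finset.mem_univ, true_and] at hz ⊢
      exact ⟨hz.1.2, hz.2⟩
  have hYc : Y.card ≤ 4 * X.card := by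
    have h1 : (Y \ B).card + (Y ∩ B).card = Y.card := Finset.card_sdiff_add_card_inter Y B
    have h2 : Y ∩ B ⊆ S ∪ W := by
      intro v hv
      obtain ⟨hv1, hv2⟩ := Finset.mem_inter.1 hv
      rcases Finset.mem_union.1 (hY2 hv1) with h | h
      · exact h
      · exact absurd hv2 (by simpa using h)
    have h3 := Finset.card_le_card h2
    have h4 := Finset.card_union_le S W
    omega
  have hXY : X ⊆ Y := Finset.union_subset (Finset.subset_union_left.trans hY1)
    Finset.inter_subset_right
  have hnb : nbS H X ⊆ Y := by
    intro v hv
    obtain ⟨x, hx, hxv⟩ := mem_nbS.1 hv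
    by_cases hvB : v ∈ B
    · rcases Finset.mem_union.1 hx with h | h
      · refine hY1 (Finset.mem_union_right _ (Finset.mem_inter.2 ⟨mem_nbS.2 ⟨x, h, ?_⟩, hvB⟩))
        exact le_augment G H B hxv
      · exact absurd (mem_closedNb.2 (Or.inr ⟨v, hvB, hHG hxv⟩))
          (hR.disj x (Finset.mem_inter.1 h).1)
    · exact hclose x v (hHG hxv) (hXY hx) hvB (Or.inl hx)
  have hXne : X.Nonempty := hSne.mono Finset.subset_union_left
  have hRc : (R ∩ Y).card ≤ R.card := Finset.card_le_card Finset.inter_subset_left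
  have := hd X Y hXne hXY (by omega) hYc hnb
  omega

end Expansion

section PathSystems

variable {V : Type*}

/-- A family of pairwise disjoint paths of `K`. -/
structure Linear (K : SimpleGraph V) (F : Finset (List V)) : Prop where
  nodup : ∀ l ∈ F, l.Nodup
  chain : ∀ l ∈ F, l.IsChain K.Adj
  disj : ∀ l ∈ F, ∀ l' ∈ F, ∀ x ∈ l, x ∈ l' → l = l'

lemma isChain_join {K : SimpleGraph V} {l₁ l₂ c : List V} {a b : V} (h₁ : l₁.IsChain K.Adj)
    (h₂ : l₂.IsChain K.Adj) (ha : l₁.head? = some a) (hb : l₂.head? = some b)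
    (hc : (a :: c ++ [b]).IsChain K.Adj) : (l₁.reverse ++ c ++ l₂).IsChain K.Adj := by
  obtain ⟨t₁, rfl⟩ : ∃ t, l₁ = a :: t := by
    cases l₁ with
    | nil => simp at ha
    | cons x t => simp only [List.head?_cons, Option.some.injEq] at ha; exact ⟨t, by rw [ha]⟩
  obtain ⟨t₂, rfl⟩ : ∃ t, l₂ = b :: t := by
    cases l₂ with
    | nil => simp at hb
    | cons x t => simp only [List.head?_cons, Option.some.injEq] at hb; exact ⟨t, by rw [hb]⟩
  rw [List.isChain_split]
  refine ⟨?_, h₂⟩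
  have : (a :: t₁).reverse ++ c ++ [b] = t₁.reverse ++ a :: (c ++ [b]) := by simp
  rw [this, List.isChain_split]
  refine ⟨?_, by simpa using hc⟩
  have h3 : t₁.reverse ++ [a] = (a :: t₁).reverse := by simp
  rw [h3, List.isChain_reverse]
  exact h₁.imp fun _ _ h => h.symm

lemma nodup_join {l₁ l₂ c : List V} (h₁ : l₁.Nodup) (h₂ : l₂.Nodup) (hc : c.Nodup)
    (h₁₂ : ∀ x ∈ l₁, x ∉ l₂) (hc₁ : ∀ x ∈ c, x ∉ l₁) (hc₂ : ∀ x ∈ c, x ∉ l₂) :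
    (l₁.reverse ++ c ++ l₂).Nodup := by
  refine List.Nodup.append (List.Nodup.append (List.nodup_reverse.2 h₁) hc ?_) h₂ ?_
  · intro x hx hx'
    exact hc₁ x hx' (List.mem_reverse.1 hx)
  · intro x hx hx'
    rcases List.mem_append.1 hx with hx | hx
    · exact h₁₂ x (List.mem_reverse.1 hx) hx'
    · exact hc₂ x hx hx'

private lemma exists_periodic {S : Finset V} (hS : S.Nonempty) {f : V → V} (hf : ∀ s ∈ S, f s ∈ S) :
    ∃ s ∈ S, 0 < f.minimalPeriod s := by
  obtain ⟨s₀, hs₀⟩ := hS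
  have hmem : ∀ i, f^[i] s₀ ∈ S := by
    intro i
    induction i with
    | zero => exact hs₀
    | succ i ih => rw [Function.iterate_succ_apply']; exact hf _ ih
  obtain ⟨i, j, hij, h⟩ := Finite.exists_ne_map_eq_of_infinite fun i : ℕ => (⟨f^[i] s₀, hmem i⟩ : S)
  have h' : f^[i] s₀ = f^[j] s₀ := congrArg Subtype.val h
  wlog hlt : i < j generalizing i j
  · exact this j i hij.symm h.symm h'.symm (by omega)
  refine ⟨f^[i] s₀, hmem i, Function.IsPeriodicPt.minimalPeriod_pos (n := j - i) (by omega) ?_⟩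
  rw [Function.IsPeriodicPt, Function.IsFixedPt, ← Function.iterate_add_apply,
    Nat.sub_add_cancel hlt.le, h']

variable [DecidableEq V]

lemma Linear.insert {K : SimpleGraph V} {F : Finset (List V)} (h : Linear K F)
    {F' : Finset (List V)} (hF : F' ⊆ F) {l : List V} (hn : l.Nodup) (hc : l.IsChain K.Adj)
    (hd : ∀ l' ∈ F', ∀ x ∈ l, x ∉ l') : Linear K (insert l F') := by
  refine ⟨fun m hm => ?_, fun m hm => ?_, fun m hm m' hm' x hx hx' => ?_⟩
  · rcases Finset.mem_insert.1 hm with rfl | hm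
    exacts [hn, h.nodup m (hF hm)]
  · rcases Finset.mem_insert.1 hm with rfl | hm
    exacts [hc, h.chain m (hF hm)]
  · rcases Finset.mem_insert.1 hm with h1 | h1 <;> rcases Finset.mem_insert.1 hm' with h2 | h2
    · rw [h1, h2]
    · exact absurd hx' (hd _ h2 x (h1 ▸ hx))
    · exact absurd hx (hd _ h1 x (h2 ▸ hx'))
    · exact h.disj m (hF h1) m' (hF h2) x hx hx'

/-- A path system that covers `S`, starts at each vertex of `Q`, and otherwise has its ends
outside `S`, where each vertex of `S` has two private children. -/
structure ChildCover (K : SimpleGraph V) (p : V → Fin 2 → V) (S Q : Finset V)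
    (F : Finset (List V)) : Prop where
  lin : Linear K F
  ends : ∀ l ∈ F, ∃ a t, l.head? = some a ∧ l.getLast? = some t ∧ t ∉ S ∧ (a ∈ Q ∨ a ∉ S)
  len : ∀ l ∈ F, 2 ≤ l.length
  start : ∀ q ∈ Q, ∃ l ∈ F, l.head? = some q
  head : ∀ l ∈ F, ∀ q ∈ Q, q ∈ l → l.head? = some q
  cover : ∀ s ∈ S, ∃ l ∈ F, s ∈ l
  sub : ∀ l ∈ F, ∀ x ∈ l, x ∈ S ∨ ∃ s ∈ S, ∃ i, x = p s i
  card : F.card ≤ S.card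

/-- Either a list of `F` that starts at `o`, or the singleton list of `o`. -/
lemma ChildCover.exists_from {K : SimpleGraph V} {p : V → Fin 2 → V} {S Q : Finset V}
    {F : Finset (List V)} (h : ChildCover K p S Q F) {o : V} (ho : o ∈ Q ∨ o ∉ S)
    (ht : ∀ s ∈ S, ∀ i, p s i ≠ o) :
    ∃ l : List V, l.Nodup ∧ l.IsChain K.Adj ∧ l.head? = some o ∧
      (∃ t, l.getLast? = some t ∧ t ∉ S) ∧ (∀ l' ∈ F, l' ≠ l → ∀ x ∈ l, x ∉ l') ∧
      (l ∈ F ∨ l = [o]) := by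
  by_cases hoQ : o ∈ Q
  · obtain ⟨l, hl, hlo⟩ := h.start o hoQ
    obtain ⟨a, t, _, ht, htS, _⟩ := h.ends l hl
    exact ⟨l, h.lin.nodup l hl, h.lin.chain l hl, hlo, ⟨t, ht, htS⟩, fun l' hl' hne x hx hx' =>
      hne (h.lin.disj l' hl' l hl x hx' hx), Or.inl hl⟩
  · have hoS := ho.resolve_left hoQ
    refine ⟨[o], List.nodup_singleton _, List.isChain_singleton _, rfl, ⟨o, rfl, hoS⟩, ?_,
      Or.inr rfl⟩
    intro l' hl' _ x hx hx'
    rw [List.mem_singleton] at hx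
    subst hx
    rcases h.sub l' hl' x hx' with h1 | ⟨s, hs, i, h1⟩
    · exact hoS h1
    · exact ht s hs i h1.symm

/-- Adding a path through `c` to a path system on the remaining vertices. -/
lemma ChildCover.add_path {K : SimpleGraph V} {p : V → Fin 2 → V} {S Q : Finset V} {c : List V}
    {o₁ o₂ u₁ u₂ : V} {i₁ i₂ : Fin 2} (hinj : ∀ s ∈ S, ∀ s' ∈ S, ∀ i i', p s i = p s' i' →
      s = s' ∧ i = i') (hcS : ∀ x ∈ c, x ∈ S)
    (hcQ : ∀ x ∈ c, x ∉ Q) (hc : c.Nodup) (hu₁ : u₁ ∈ c) (hu₂ : u₂ ∈ c) (ho₁ : o₁ = p u₁ i₁)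
    (ho₂ : o₂ = p u₂ i₂) (ho : o₁ ≠ o₂) (ho₁c : o₁ ∉ c) (ho₂c : o₂ ∉ c) (ho₁Q : o₁ ∉ Q)
    (ho₂Q : o₂ ∉ Q) (hchain : (o₁ :: c ++ [o₂]).IsChain K.Adj)
    (hct : ∀ x ∈ c, ∀ s ∈ S \ c.toFinset, ∀ i, p s i ≠ x) {F : Finset (List V)}
    (hF : ChildCover K p (S \ c.toFinset) (Q ∪ ({o₁, o₂} ∩ (S \ c.toFinset))) F) :
    ∃ F', ChildCover K p S Q F' := by
  set S' := S \ c.toFinset with hS'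
  have hSS' : ∀ x, x ∈ S ↔ x ∈ S' ∨ x ∈ c := by
    intro x
    simp only [hS', Finset.mem_sdiff, List.mem_toFinset]
    constructor
    · intro h; by_cases hx : x ∈ c <;> simp [h, hx]
    · rintro (h | h)
      exacts [h.1, hcS x h]
  have ht₁ : ∀ s ∈ S', ∀ i, p s i ≠ o₁ := by
    intro s hs i h
    have := (hinj s ((hSS' s).2 (Or.inl hs)) u₁ (hcS _ hu₁) _ _ (h.trans ho₁)).1
    subst this
    simp [hS', hu₁] at hs
  have ht₂ : ∀ s ∈ S', ∀ i, p s i ≠ o₂ := by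
    intro s hs i h
    have := (hinj s ((hSS' s).2 (Or.inl hs)) u₂ (hcS _ hu₂) _ _ (h.trans ho₂)).1
    subst this
    simp [hS', hu₂] at hs
  have hstart : ∀ o ∈ ({o₁, o₂} : Finset V), o ∈ Q ∪ ({o₁, o₂} ∩ S') ∨ o ∉ S' := by
    intro o ho
    by_cases h : o ∈ S'
    · exact Or.inl (Finset.mem_union_right _ (Finset.mem_inter.2 ⟨ho, h⟩))
    · exact Or.inr h
  obtain ⟨l₁, hn₁, hc₁, hh₁, ⟨t₁, hl₁, htS₁⟩, hd₁, hm₁⟩ :=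
    hF.exists_from (hstart o₁ (by simp)) ht₁
  obtain ⟨l₂, hn₂, hc₂, hh₂, ⟨t₂, hl₂, htS₂⟩, hd₂, hm₂⟩ :=
    hF.exists_from (hstart o₂ (by simp)) ht₂
  have hne : l₁ ≠ l₂ := by
    rintro rfl
    rw [hh₁] at hh₂
    exact ho (Option.some.inj hh₂)
  have hcF : ∀ l ∈ F, ∀ x ∈ c, x ∉ l := by
    intro l hl x hx hxl
    rcases hF.sub l hl x hxl with h | ⟨s, hs, i, h⟩
    · simp [hS', hx] at h
    · exact hct x hx s hs i h.symm
  have hcl₁ : ∀ x ∈ c, x ∉ l₁ := by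
    intro x hx
    rcases hm₁ with h | h
    · exact hcF _ h x hx
    · rw [h, List.mem_singleton]; rintro rfl; exact ho₁c hx
  have hcl₂ : ∀ x ∈ c, x ∉ l₂ := by
    intro x hx
    rcases hm₂ with h | h
    · exact hcF _ h x hx
    · rw [h, List.mem_singleton]; rintro rfl; exact ho₂c hx
  have h₁₂ : ∀ x ∈ l₁, x ∉ l₂ := by
    intro x hx hx'
    rcases hm₁ with h | h
    · exact hd₂ l₁ h hne x hx' hx
    · rcases hm₂ with h' | h'
      · exact hd₁ l₂ h' hne.symm x hx hx'
      · rw [h, List.mem_singleton] at hx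
        rw [h', List.mem_singleton] at hx'
        exact ho (hx ▸ hx')
  have hsub₁ : ∀ x ∈ l₁, x ∈ S ∨ ∃ s ∈ S, ∃ i, x = p s i := by
    intro x hx
    rcases hm₁ with h | h
    · rcases hF.sub _ h x hx with h | ⟨s, hs, i, h⟩
      · exact Or.inl ((hSS' x).2 (Or.inl h))
      · exact Or.inr ⟨s, (hSS' s).2 (Or.inl hs), i, h⟩
    · rw [h, List.mem_singleton] at hx
      exact Or.inr ⟨u₁, hcS _ hu₁, i₁, hx.trans ho₁⟩
  have hsub₂ : ∀ x ∈ l₂, x ∈ S ∨ ∃ s ∈ S, ∃ i, x = p s i := by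
    intro x hx
    rcases hm₂ with h | h
    · rcases hF.sub _ h x hx with h | ⟨s, hs, i, h⟩
      · exact Or.inl ((hSS' x).2 (Or.inl h))
      · exact Or.inr ⟨s, (hSS' s).2 (Or.inl hs), i, h⟩
    · rw [h, List.mem_singleton] at hx
      exact Or.inr ⟨u₂, hcS _ hu₂, i₂, hx.trans ho₂⟩
  have hQl₁ : ∀ q ∈ Q, q ∉ l₁ := by
    intro q hq hql
    rcases hm₁ with h | h
    · have := hF.head _ h q (Finset.mem_union_left _ hq) hql
      rw [hh₁] at this
      exact ho₁Q (Option.some.inj this ▸ hq)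
    · rw [h, List.mem_singleton] at hql
      exact ho₁Q (hql ▸ hq)
  have hQl₂ : ∀ q ∈ Q, q ∉ l₂ := by
    intro q hq hql
    rcases hm₂ with h | h
    · have := hF.head _ h q (Finset.mem_union_left _ hq) hql
      rw [hh₂] at this
      exact ho₂Q (Option.some.inj this ▸ hq)
    · rw [h, List.mem_singleton] at hql
      exact ho₂Q (hql ▸ hq)
  set l := l₁.reverse ++ c ++ l₂ with hl
  have hmeml : ∀ x, x ∈ l ↔ x ∈ l₁ ∨ x ∈ c ∨ x ∈ l₂ := by
    intro x; simp [hl]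
  set F' := (F.erase l₁).erase l₂ with hF'
  have hmemF' : ∀ m, m ∈ F' ↔ m ∈ F ∧ m ≠ l₁ ∧ m ≠ l₂ := by
    intro m; simp only [hF', Finset.mem_erase]; tauto
  have hne₁ : l₁ ≠ [] := by rintro rfl; simp at hh₁
  have hne₂ : l₂ ≠ [] := by rintro rfl; simp at hh₂
  have hcne : c ≠ [] := List.ne_nil_of_mem hu₁
  have hlast₁ : t₁ ∈ l₁ := List.mem_of_getLast? hl₁
  have hlast₂ : t₂ ∈ l₂ := List.mem_of_getLast? hl₂
  refine ⟨insert l F', ?_, ?_, ?_, ?_, ?_, ?_, ?_, ?_⟩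
  · refine hF.lin.insert (fun m hm => ((hmemF' m).1 hm).1)
      (nodup_join hn₁ hn₂ hc h₁₂ hcl₁ hcl₂) (isChain_join hc₁ hc₂ hh₁ hh₂ hchain) ?_
    intro m hm x hx
    obtain ⟨hmF, hm1, hm2⟩ := (hmemF' m).1 hm
    rcases (hmeml x).1 hx with h | h | h
    · exact hd₁ m hmF hm1 x h
    · exact hcF m hmF x h
    · exact hd₂ m hmF hm2 x h
  · intro m hm
    rcases Finset.mem_insert.1 hm with rfl | hm
    · refine ⟨t₁, t₂, ?_, ?_, ?_, Or.inr ?_⟩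
      · rw [hl, List.append_assoc, List.head?_append_of_ne_nil _ (by simpa using hne₁),
          List.head?_reverse, hl₁]
      · rw [hl, List.getLast?_append_of_ne_nil _ hne₂, hl₂]
      · rw [hSS']; exact not_or.2 ⟨htS₂, fun h => hcl₂ _ h hlast₂⟩
      · rw [hSS']; exact not_or.2 ⟨htS₁, fun h => hcl₁ _ h hlast₁⟩
    · obtain ⟨hmF, hm1, hm2⟩ := (hmemF' m).1 hm
      obtain ⟨a, t, ha, ht, htS, haS⟩ := hF.ends m hmF
      have ham : a ∈ m := List.mem_of_head? ha
      have htm : t ∈ m := List.mem_of_getLast? ht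
      refine ⟨a, t, ha, ht, ?_, ?_⟩
      · rw [hSS']; exact not_or.2 ⟨htS, fun h => hcF m hmF _ h htm⟩
      · rcases haS with h | h
        · rcases Finset.mem_union.1 h with h | h
          · exact Or.inl h
          · exfalso
            have h' := (Finset.mem_inter.1 h).1
            simp only [Finset.mem_insert, Finset.mem_singleton] at h'
            rcases h' with rfl | rfl
            · exact hd₁ m hmF hm1 a (List.mem_of_head? hh₁) ham
            · exact hd₂ m hmF hm2 a (List.mem_of_head? hh₂) ham
        · right
          rw [hSS']; exact not_or.2 ⟨h, fun h => hcF m hmF _ h ham⟩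
  · intro m hm
    rcases Finset.mem_insert.1 hm with rfl | hm
    · have e1 := List.length_pos_iff.2 hne₁
      have e2 := List.length_pos_iff.2 hne₂
      simp only [hl, List.length_append, List.length_reverse]
      omega
    · exact hF.len m ((hmemF' m).1 hm).1
  · intro q hq
    obtain ⟨m, hm, hmq⟩ := hF.start q (Finset.mem_union_left _ hq)
    have hqm : q ∈ m := List.mem_of_head? hmq
    refine ⟨m, Finset.mem_insert_of_mem ((hmemF' m).2 ⟨hm, ?_, ?_⟩), hmq⟩
    · rintro rfl; exact hQl₁ q hq hqm
    · rintro rfl; exact hQl₂ q hq hqm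
  · intro m hm q hq hqm
    rcases Finset.mem_insert.1 hm with rfl | hm
    · rcases (hmeml q).1 hqm with h | h | h
      exacts [absurd h (hQl₁ q hq), absurd hq (hcQ q h), absurd h (hQl₂ q hq)]
    · exact hF.head m ((hmemF' m).1 hm).1 q (Finset.mem_union_left _ hq) hqm
  · intro s hs
    rcases (hSS' s).1 hs with h | h
    · obtain ⟨m, hm, hsm⟩ := hF.cover s h
      by_cases h1 : m = l₁
      · exact ⟨l, Finset.mem_insert_self _ _, (hmeml s).2 (Or.inl (h1 ▸ hsm))⟩
      · by_cases h2 : m = l₂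
        · exact ⟨l, Finset.mem_insert_self _ _, (hmeml s).2 (Or.inr (Or.inr (h2 ▸ hsm)))⟩
        · exact ⟨m, Finset.mem_insert_of_mem ((hmemF' m).2 ⟨hm, h1, h2⟩), hsm⟩
    · exact ⟨l, Finset.mem_insert_self _ _, (hmeml s).2 (Or.inr (Or.inl h))⟩
  · intro m hm x hx
    rcases Finset.mem_insert.1 hm with rfl | hm
    · rcases (hmeml x).1 hx with h | h | h
      exacts [hsub₁ x h, Or.inl (hcS x h), hsub₂ x h]
    · rcases hF.sub m ((hmemF' m).1 hm).1 x hx with h | ⟨s, hs, i, h⟩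
      · exact Or.inl ((hSS' x).2 (Or.inl h))
      · exact Or.inr ⟨s, (hSS' s).2 (Or.inl hs), i, h⟩
  · have h1 : F'.card ≤ F.card := Finset.card_le_card fun m hm => ((hmemF' m).1 hm).1
    have h2 := Finset.card_insert_le l F'
    have h3 : S'.card + 1 ≤ S.card := by
      refine Finset.card_lt_card (Finset.ssubset_iff_subset_ne.2 ⟨Finset.sdiff_subset, fun h => ?_⟩)
      have := hcS u₁ hu₁
      rw [← h] at this
      exact (Finset.mem_sdiff.1 this).2 (List.mem_toFinset.2 hu₁)
    have := hF.card
    omega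

lemma exists_childCover {K : SimpleGraph V} {p : V → Fin 2 → V} (m : ℕ) : ∀ S Q : Finset V,
    S.card = m → (∀ s ∈ S, ∀ i, K.Adj s (p s i)) →
    (∀ s ∈ S, ∀ s' ∈ S, ∀ i i', p s i = p s' i' → s = s' ∧ i = i') →
    Q ⊆ S → (∀ s ∈ S, ∀ i, p s i ∉ Q) → ∃ F, ChildCover K p S Q F := by
  induction m using Nat.strong_induction_on with
  | _ m ih =>
  intro S Q hm hadj hinj hQ ht
  have ih' : ∀ S' Q' : Finset V, S' ⊂ S → Q' ⊆ S' → (∀ s ∈ S', ∀ i, p s i ∉ Q') →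
      ∃ F, ChildCover K p S' Q' F := fun S' Q' hS' hQ' ht' =>
    ih _ (hm ▸ Finset.card_lt_card hS') S' Q' rfl (fun s hs => hadj s (hS'.1 hs))
      (fun s hs s' hs' => hinj s (hS'.1 hs) s' (hS'.1 hs')) hQ' ht'
  have hdrop : ∀ x ∈ S, ∀ c : List V, x ∈ c → S \ c.toFinset ⊂ S := by
    intro x hx c hxc
    refine Finset.ssubset_iff_subset_ne.2 ⟨Finset.sdiff_subset, fun h => ?_⟩
    rw [← h] at hx
    exact (Finset.mem_sdiff.1 hx).2 (List.mem_toFinset.2 hxc)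
  rcases S.eq_empty_or_nonempty with rfl | hne
  · obtain rfl : Q = ∅ := Finset.subset_empty.1 hQ
    exact ⟨∅, ⟨by simp, by simp, by simp⟩, by simp, by simp, by simp, by simp, by simp, by simp,
      by simp⟩
  by_cases hroot : ∃ s ∈ S, s ∉ Q ∧ ∀ s' ∈ S, ∀ i, p s' i ≠ s
  · obtain ⟨s, hs, hsQ, hst⟩ := hroot
    have hsub : Q ∪ ({p s 0, p s 1} ∩ (S \ [s].toFinset)) ⊆ S \ [s].toFinset := by
      refine Finset.union_subset (fun q hq => ?_) Finset.inter_subset_right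
      simp only [List.toFinset_cons, List.toFinset_nil, Finset.mem_sdiff, hQ hq, true_and]
      simp only [insert_empty_eq, Finset.mem_singleton]
      rintro rfl; exact hsQ hq
    obtain ⟨F, hF⟩ := ih' (S \ [s].toFinset) (Q ∪ ({p s 0, p s 1} ∩ (S \ [s].toFinset)))
      (hdrop s hs _ (by simp)) hsub (by
        intro s' hs' i hmem
        have hs'S := (Finset.mem_sdiff.1 hs').1
        have hne : s' ≠ s := by
          rintro rfl; simp at hs'
        rcases Finset.mem_union.1 hmem with h | h
        · exact ht s' hs'S i h
        · have := (Finset.mem_inter.1 h).1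
          simp only [Finset.mem_insert, Finset.mem_singleton] at this
          rcases this with h | h <;> exact hne (hinj _ hs'S _ hs _ _ h).1)
    refine ChildCover.add_path (u₁ := s) (u₂ := s) (i₁ := 0) (i₂ := 1) hinj (by simpa using hs)
      (by simpa using hsQ) (by simp) (by simp) (by simp) rfl rfl ?_ ?_ ?_ (ht s hs 0) (ht s hs 1)
      ?_ ?_ hF
    · intro h; simpa using (hinj s hs s hs _ _ h).2
    · simpa using hst s hs 0
    · simpa using hst s hs 1
    · simpa using ⟨(hadj s hs 0).symm, hadj s hs 1⟩
    · intro x hx s' hs' i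
      rw [List.mem_singleton] at hx
      subst hx
      exact hst s' (Finset.mem_sdiff.1 hs').1 i
  push Not at hroot
  rcases Q.eq_empty_or_nonempty with rfl | ⟨s, hsQ⟩
  · have hpar : ∀ s, ∃ t : V × Fin 2, s ∈ S → t.1 ∈ S ∧ p t.1 t.2 = s := by
      intro s
      by_cases hs : s ∈ S
      · obtain ⟨s', hs', i, h⟩ := hroot s hs (by simp)
        exact ⟨(s', i), fun _ => ⟨hs', h⟩⟩
      · exact ⟨(s, 0), fun h => absurd h hs⟩
    choose f hf using hpar
    obtain ⟨s, hs, hk⟩ := exists_periodic hne (f := fun s => (f s).1) fun s hs => (hf s hs).1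
    set par : V → V := fun s => (f s).1 with hpar
    set k := par.minimalPeriod s with hkdef
    have hmem : ∀ i, par^[i] s ∈ S := by
      intro i
      induction i with
      | zero => exact hs
      | succ i ih => rw [Function.iterate_succ_apply']; exact (hf _ ih).1
    have hper : par^[k] s = s := Function.isPeriodicPt_minimalPeriod par s
    have hpadj : ∀ x ∈ S, K.Adj (par x) x := by
      intro x hx
      have := hadj _ (hf x hx).1 (f x).2
      rwa [(hf x hx).2] at this
    have hinjk : ∀ i < k, ∀ j < k, par^[i] s = par^[j] s → i = j := fun i hi j hj h =>
      Function.iterate_injOn_Iio_minimalPeriod hi hj h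
    have hk2 : 2 ≤ k := by
      by_contra h
      have h1 : k = 1 := by omega
      rw [h1] at hper
      exact (hpadj s hs).ne hper
    obtain ⟨e, he⟩ : ∃ e, k = e + 2 := ⟨k - 2, by omega⟩
    rw [he] at hper hinjk
    have hother : ∀ i : Fin 2, ∃ j, j ≠ i := fun i => ⟨i + 1, by fin_cases i <;> simp⟩
    obtain ⟨i₁, hi₁⟩ := hother (f (par^[e + 1] s)).2
    obtain ⟨i₂, hi₂⟩ := hother (f (par^[e] s)).2
    set c := (List.range (e + 2)).map fun i => par^[i] s with hc
    have hmemc : ∀ x, x ∈ c ↔ ∃ i < e + 2, par^[i] s = x := by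
      intro x; simp only [hc, List.mem_map, List.mem_range]
    have hlast : par (par^[e + 1] s) = s := by
      rw [← Function.iterate_succ_apply' par]; exact hper
    have hparc : ∀ x ∈ c, par x ∈ c := by
      intro x hx
      obtain ⟨i, hi, rfl⟩ := (hmemc x).1 hx
      rcases Nat.lt_or_ge (i + 1) (e + 2) with h | h
      · exact (hmemc _).2 ⟨i + 1, h, Function.iterate_succ_apply' par i s⟩
      · obtain rfl : i = e + 1 := by omega
        exact (hmemc _).2 ⟨0, by omega, hlast.symm⟩
    have hcS : ∀ x ∈ c, x ∈ S := by
      intro x hx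
      obtain ⟨i, hi, rfl⟩ := (hmemc x).1 hx
      exact hmem i
    have hs_c : s ∈ c := (hmemc s).2 ⟨0, by omega, rfl⟩
    have ht_c : par^[e + 1] s ∈ c := (hmemc _).2 ⟨e + 1, by omega, rfl⟩
    have ho₁c : p s i₁ ∉ c := by
      intro h
      obtain ⟨i, hi, hix⟩ := (hmemc _).1 h
      have h1 := (hf _ (hmem i)).2
      obtain ⟨h2, h3⟩ := hinj _ (hf _ (hmem i)).1 s hs _ _ (h1.trans hix)
      have h4 : par^[i + 1] s = s := by rw [Function.iterate_succ_apply']; exact h2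
      rcases Nat.lt_or_ge (i + 1) (e + 2) with h5 | h5
      · exact absurd (hinjk (i + 1) h5 0 (by omega) h4) (by omega)
      · obtain rfl : i = e + 1 := by omega
        exact hi₁ h3.symm
    have ho₂c : p (par^[e + 1] s) i₂ ∉ c := by
      intro h
      obtain ⟨i, hi, hix⟩ := (hmemc _).1 h
      have h1 := (hf _ (hmem i)).2
      obtain ⟨h2, h3⟩ := hinj _ (hf _ (hmem i)).1 _ (hmem (e + 1)) _ _ (h1.trans hix)
      have h4 : par^[i + 1] s = par^[e + 1] s := by rw [Function.iterate_succ_apply']; exact h2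
      rcases Nat.lt_or_ge (i + 1) (e + 2) with h5 | h5
      · have := hinjk (i + 1) h5 (e + 1) (by omega) h4
        obtain rfl : i = e := by omega
        exact hi₂ h3.symm
      · obtain rfl : i = e + 1 := by omega
        have h6 : par^[e + 1 + 1] s = par^[0] s := hper
        exact absurd (hinjk 0 (by omega) (e + 1) (by omega) (h6.symm.trans h4)) (by omega)
    have hne12 : p s i₁ ≠ p (par^[e + 1] s) i₂ := by
      intro h
      have := (hinj _ hs _ (hmem _) _ _ h).1
      exact absurd (hinjk 0 (by omega) (e + 1) (by omega) this) (by omega)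
    have hct : ∀ x ∈ c, ∀ s' ∈ S \ c.toFinset, ∀ i, p s' i ≠ x := by
      intro x hx s' hs' i h
      have h1 := (hinj _ (Finset.mem_sdiff.1 hs').1 _ (hf x (hcS x hx)).1 _ _
        (h.trans (hf x (hcS x hx)).2.symm)).1
      exact (Finset.mem_sdiff.1 hs').2 (List.mem_toFinset.2 (h1 ▸ hparc x hx))
    obtain ⟨F, hF⟩ := ih' (S \ c.toFinset)
      (∅ ∪ ({p s i₁, p (par^[e + 1] s) i₂} ∩ (S \ c.toFinset))) (hdrop s hs _ hs_c)
      (by rw [Finset.empty_union]; exact Finset.inter_subset_right) (by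
        intro s' hs' i hm'
        have hs'S := (Finset.mem_sdiff.1 hs').1
        have hs'c : s' ∉ c := fun h => (Finset.mem_sdiff.1 hs').2 (List.mem_toFinset.2 h)
        rw [Finset.empty_union] at hm'
        have := (Finset.mem_inter.1 hm').1
        simp only [Finset.mem_insert, Finset.mem_singleton] at this
        rcases this with h | h
        · exact hs'c ((hinj _ hs'S _ hs _ _ h).1 ▸ hs_c)
        · exact hs'c ((hinj _ hs'S _ (hmem _) _ _ h).1 ▸ ht_c))
    refine ChildCover.add_path hinj hcS (by simp) ?_ hs_c ht_c rfl rfl hne12 ho₁c ho₂c (by simp)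
      (by simp) ?_ hct hF
    · refine List.Nodup.map_on (fun i hi j hj h => ?_) List.nodup_range
      exact hinjk i (List.mem_range.1 hi) j (List.mem_range.1 hj) h
    · have h1 : c = s :: (List.range (e + 1)).map fun i => par^[i + 1] s := by
        rw [hc, List.range_succ_eq_map]; simp [Function.comp_def]
      have h2 : c = (List.range (e + 1)).map (fun i => par^[i] s) ++ [par^[e + 1] s] := by
        rw [hc, List.range_succ]; simp
      have h3 : c.IsChain K.Adj := by
        rw [List.isChain_iff_getElem]
        intro i hi
        simp only [hc, List.getElem_map, List.getElem_range]
        rw [Function.iterate_succ_apply']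
        exact (hpadj _ (hmem i)).symm
      have h4 : (p s i₁ :: c).IsChain K.Adj := by
        rw [h1] at h3 ⊢
        exact List.isChain_cons_cons.2 ⟨(hadj s hs i₁).symm, h3⟩
      rw [h2] at h4 ⊢
      have h5 : p s i₁ :: ((List.range (e + 1)).map (fun i => par^[i] s) ++ [par^[e + 1] s]) ++
          [p (par^[e + 1] s) i₂] = (p s i₁ :: (List.range (e + 1)).map (fun i => par^[i] s)) ++
          par^[e + 1] s :: [p (par^[e + 1] s) i₂] := by simp
      rw [h5, List.isChain_split]
      exact ⟨by simpa using h4, List.isChain_pair.2 (hadj _ (hmem _) i₂)⟩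
  · have hs := hQ hsQ
    set o := p s 0 with ho
    have hos : o ≠ s := (hadj s hs 0).ne'
    set S' := S \ [s].toFinset with hS'
    have hS'mem : ∀ x, x ∈ S' ↔ x ∈ S ∧ x ≠ s := by intro x; simp [hS']
    obtain ⟨F, hF⟩ := ih' S' (Q.erase s ∪ ({o} ∩ S')) (hdrop s hs _ (by simp))
      (Finset.union_subset (fun q hq => (hS'mem q).2 ⟨hQ (Finset.mem_of_mem_erase hq),
        Finset.ne_of_mem_erase hq⟩) Finset.inter_subset_right) (by
        intro s' hs' i hmem
        obtain ⟨h1, h2⟩ := (hS'mem s').1 hs'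
        rcases Finset.mem_union.1 hmem with h | h
        · exact ht s' h1 i (Finset.mem_of_mem_erase h)
        · exact h2 (hinj _ h1 _ hs _ _ (Finset.mem_singleton.1 (Finset.mem_inter.1 h).1)).1)
    have hoQ : o ∉ Q := ht s hs 0
    have hnt : ∀ s' ∈ S', ∀ i, p s' i ≠ o := fun s' hs' i h =>
      ((hS'mem s').1 hs').2 (hinj _ ((hS'mem s').1 hs').1 _ hs _ _ h).1
    obtain ⟨l, hn, hc, hh, ⟨t, hl, htS⟩, hd, hm'⟩ := hF.exists_from (o := o) (by
      by_cases h : o ∈ S'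
      · exact Or.inl (Finset.mem_union_right _ (by simp [h]))
      · exact Or.inr h) hnt
    have hsF : ∀ l ∈ F, s ∉ l := by
      intro l hl hsl
      rcases hF.sub l hl s hsl with h | ⟨s', hs', i, h⟩
      · exact ((hS'mem s).1 h).2 rfl
      · exact ht s' ((hS'mem s').1 hs').1 i (h ▸ hsQ)
    have hsl : s ∉ l := by
      rcases hm' with h | h
      · exact hsF l h
      · rw [h, List.mem_singleton]; exact hos.symm
    have hlast : t ∈ l := List.mem_of_getLast? hl
    have hQl : ∀ q ∈ Q, q ∉ l := by
      intro q hq hql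
      rcases hm' with h | h
      · by_cases hqs : q = s
        · exact hsF l h (hqs ▸ hql)
        · have := hF.head _ h q (Finset.mem_union_left _ (Finset.mem_erase.2 ⟨hqs, hq⟩)) hql
          rw [hh] at this
          exact hoQ (Option.some.inj this ▸ hq)
      · rw [h, List.mem_singleton] at hql
        exact hoQ (hql ▸ hq)
    have hlne : l ≠ [] := by rintro rfl; simp at hh
    refine ⟨insert (s :: l) (F.erase l), ?_, ?_, ?_, ?_, ?_, ?_, ?_, ?_⟩
    · refine hF.lin.insert (Finset.erase_subset _ _) (List.nodup_cons.2 ⟨hsl, hn⟩) ?_ ?_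
      · cases l with
        | nil => exact absurd rfl hlne
        | cons x t =>
          simp only [List.head?_cons, Option.some.injEq] at hh
          exact List.isChain_cons_cons.2 ⟨hh ▸ hadj s hs 0, hc⟩
      · intro m hm x hx
        obtain ⟨h1, h2⟩ := Finset.mem_erase.1 hm
        rcases List.mem_cons.1 hx with rfl | hx
        · exact hsF m h2
        · exact hd m h2 h1 x hx
    · intro m hm
      rcases Finset.mem_insert.1 hm with rfl | hm
      · refine ⟨s, t, rfl, ?_, ?_, Or.inl hsQ⟩
        · rw [← List.singleton_append, List.getLast?_append_of_ne_nil _ hlne, hl]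
        · exact fun h => htS ((hS'mem t).2 ⟨h, by rintro rfl; exact hsl hlast⟩)
      · obtain ⟨h1, h2⟩ := Finset.mem_erase.1 hm
        obtain ⟨a, u, ha, hu, huS, haS⟩ := hF.ends m h2
        have ham : a ∈ m := List.mem_of_head? ha
        have hum : u ∈ m := List.mem_of_getLast? hu
        refine ⟨a, u, ha, hu, ?_, ?_⟩
        · exact fun h => huS ((hS'mem u).2 ⟨h, by rintro rfl; exact hsF m h2 hum⟩)
        · rcases haS with h | h
          · rcases Finset.mem_union.1 h with h | h
            · exact Or.inl (Finset.mem_of_mem_erase h)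
            · obtain rfl := Finset.mem_singleton.1 (Finset.mem_inter.1 h).1
              exact absurd ham (hd m h2 h1 o (List.mem_of_head? hh))
          · exact Or.inr fun h' => h ((hS'mem a).2 ⟨h', by rintro rfl; exact hsF m h2 ham⟩)
    · intro m hm
      rcases Finset.mem_insert.1 hm with rfl | hm
      · have := List.length_pos_iff.2 hlne
        rw [List.length_cons]; omega
      · exact hF.len m (Finset.mem_of_mem_erase hm)
    · intro q hq
      by_cases hqs : q = s
      · exact ⟨s :: l, Finset.mem_insert_self _ _, by rw [hqs]; rfl⟩
      · obtain ⟨m, hm, hmq⟩ := hF.start q (Finset.mem_union_left _ (Finset.mem_erase.2 ⟨hqs, hq⟩))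
        refine ⟨m, Finset.mem_insert_of_mem (Finset.mem_erase.2 ⟨?_, hm⟩), hmq⟩
        rintro rfl
        exact hQl q hq (List.mem_of_head? hmq)
    · intro m hm q hq hqm
      rcases Finset.mem_insert.1 hm with rfl | hm
      · rcases List.mem_cons.1 hqm with rfl | h
        exacts [rfl, absurd h (hQl q hq)]
      · have h2 := Finset.mem_of_mem_erase hm
        exact hF.head m h2 q (Finset.mem_union_left _ (Finset.mem_erase.2
          ⟨by rintro rfl; exact hsF m h2 hqm, hq⟩)) hqm
    · intro x hx
      by_cases hxs : x = s
      · exact ⟨s :: l, Finset.mem_insert_self _ _, by simp [hxs]⟩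
      · obtain ⟨m, hm, hxm⟩ := hF.cover x ((hS'mem x).2 ⟨hx, hxs⟩)
        by_cases h1 : m = l
        · exact ⟨s :: l, Finset.mem_insert_self _ _, List.mem_cons_of_mem _ (h1 ▸ hxm)⟩
        · exact ⟨m, Finset.mem_insert_of_mem (Finset.mem_erase.2 ⟨h1, hm⟩), hxm⟩
    · have hsub : ∀ m ∈ F, ∀ x ∈ m, x ∈ S ∨ ∃ s ∈ S, ∃ i, x = p s i := by
        intro m hm x hx
        rcases hF.sub m hm x hx with h | ⟨s', hs', i, h⟩
        · exact Or.inl ((hS'mem x).1 h).1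
        · exact Or.inr ⟨s', ((hS'mem s').1 hs').1, i, h⟩
      intro m hm x hx
      rcases Finset.mem_insert.1 hm with rfl | hm
      · rcases List.mem_cons.1 hx with rfl | h
        · exact Or.inl hs
        · rcases hm' with h' | h'
          · exact hsub _ h' x h
          · rw [h', List.mem_singleton] at h
            exact Or.inr ⟨s, hs, 0, h⟩
      · exact hsub m (Finset.mem_of_mem_erase hm) x hx
    · have h2 := Finset.card_insert_le (s :: l) (F.erase l)
      have h4 := Finset.card_le_card (Finset.erase_subset l F)
      have h3 : S'.card < S.card := Finset.card_lt_card (hdrop s hs [s] (by simp))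
      have := hF.card
      omega

end PathSystems

section Sparse

variable {V : Type*} [Fintype V] [DecidableEq V]

/-- The closed neighbourhood of a set. -/
noncomputable def cl (K : SimpleGraph V) (S : Finset V) : Finset V := S ∪ nbS K S

lemma mem_cl {K : SimpleGraph V} {S : Finset V} {v : V} :
    v ∈ cl K S ↔ ∃ s ∈ S, v = s ∨ K.Adj s v := by
  simp only [cl, Finset.mem_union, mem_nbS]
  constructor
  · rintro (h | ⟨s, hs, h⟩)
    exacts [⟨v, h, Or.inl rfl⟩, ⟨s, hs, Or.inr h⟩]
  · rintro ⟨s, hs, rfl | h⟩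
    exacts [Or.inl hs, Or.inr ⟨s, hs, h⟩]

lemma cl_mono {K K' : SimpleGraph V} (h : K ≤ K') {S T : Finset V} (hST : S ⊆ T) :
    cl K S ⊆ cl K' T :=
  Finset.union_subset_union hST (nbS_mono h hST)

lemma cl_union (K : SimpleGraph V) (S T : Finset V) : cl K (S ∪ T) = cl K S ∪ cl K T := by
  ext v
  simp only [mem_cl, Finset.mem_union]
  constructor
  · rintro ⟨s, hs | hs, h⟩
    exacts [Or.inl ⟨s, hs, h⟩, Or.inr ⟨s, hs, h⟩]
  · rintro (⟨s, hs, h⟩ | ⟨s, hs, h⟩)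
    exacts [⟨s, Or.inl hs, h⟩, ⟨s, Or.inr hs, h⟩]

@[simp] lemma cl_empty (K : SimpleGraph V) : cl K ∅ = ∅ := by
  ext v; simp [mem_cl]

lemma subset_cl (K : SimpleGraph V) (S : Finset V) : S ⊆ cl K S := Finset.subset_union_left

omit [Fintype V] in
/-- Hall's theorem with `r` private representatives for each element. -/
lemma exists_privates {S : Finset V} (r : ℕ) {N : V → Finset V}
    (h : ∀ T ⊆ S, r * T.card ≤ (T.biUnion N).card) :
    ∃ p : V → Fin r → V, (∀ s ∈ S, ∀ i, p s i ∈ N s) ∧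
      ∀ s ∈ S, ∀ s' ∈ S, ∀ i i', p s i = p s' i' → s = s' ∧ i = i' := by
  classical
  have hall : ∀ W : Finset (S × Fin r), W.card ≤ (W.biUnion fun w => N w.1).card := by
    intro W
    set T : Finset V := W.image fun w => (w.1 : V) with hT
    have hTS : T ⊆ S := by
      intro x hx
      obtain ⟨w, _, rfl⟩ := Finset.mem_image.1 hx
      exact w.1.2
    have h1 : (W.biUnion fun w => N w.1) = T.biUnion N := by
      ext v
      simp only [Finset.mem_biUnion, hT, Finset.mem_image]
      constructor
      · rintro ⟨w, hw, hv⟩; exact ⟨_, ⟨w, hw, rfl⟩, hv⟩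
      · rintro ⟨_, ⟨w, hw, rfl⟩, hv⟩; exact ⟨w, hw, hv⟩
    rw [h1]
    refine le_trans ?_ (h T hTS)
    have h2 : (W.image fun w => ((w.1 : V), w.2)) ⊆ T ×ˢ (Finset.univ : Finset (Fin r)) := by
      intro x hx
      obtain ⟨w, hw, rfl⟩ := Finset.mem_image.1 hx
      exact Finset.mem_product.2 ⟨Finset.mem_image_of_mem _ hw, Finset.mem_univ _⟩
    have h3 := Finset.card_le_card h2
    rw [Finset.card_image_of_injective _ (by
      rintro ⟨⟨a, ha⟩, i⟩ ⟨⟨b, hb⟩, j⟩ h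
      simp only [Prod.mk.injEq] at h
      obtain ⟨rfl, rfl⟩ := h
      rfl), Finset.card_product, Finset.card_univ, Fintype.card_fin] at h3
    linarith [Nat.mul_comm T.card r]
  obtain ⟨f, hf, hfN⟩ := (Finset.all_card_le_biUnion_card_iff_exists_injective
    (fun w : S × Fin r => N w.1)).1 hall
  refine ⟨fun s i => if hs : s ∈ S then f (⟨s, hs⟩, i) else s, fun s hs i => ?_,
    fun s hs s' hs' i i' h => ?_⟩
  · simpa only [dif_pos hs] using hfN (⟨s, hs⟩, i)
  · simp only [dif_pos hs, dif_pos hs'] at h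
    simpa using hf h

/-- A maximal set whose closed neighbourhood is small on `C` leaves a large neighbourhood for all
sets that avoid it. -/
lemma exists_maximal_sparse (K : SimpleGraph V) (A C : Finset V) (a cap : ℕ) :
    ∃ S ⊆ A, S.card ≤ cap ∧ (cl K S ∩ C).card ≤ a * S.card ∧
      ∀ T ⊆ A, Disjoint T S → T.Nonempty → T.card + S.card ≤ cap →
        a * T.card < ((cl K T ∩ C) \ cl K S).card := by
  have hne : (A.powerset.filter fun S => S.card ≤ cap ∧
      (cl K S ∩ C).card ≤ a * S.card).Nonempty :=
    ⟨∅, by simp⟩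
  obtain ⟨S, hS, hmax⟩ := Finset.exists_max_image _ Finset.card hne
  simp only [Finset.mem_filter, Finset.mem_powerset] at hS hmax
  refine ⟨S, hS.1, hS.2.1, hS.2.2, fun T hT hTS hTne hcard => ?_⟩
  by_contra hlt
  push Not at hlt
  have hc : (S ∪ T).card = S.card + T.card := Finset.card_union_of_disjoint hTS.symm
  have := hmax (S ∪ T) ⟨Finset.union_subset hS.1 hT, by omega, by
    rw [hc, mul_add]
    have : cl K (S ∪ T) ∩ C ⊆ (cl K S ∩ C) ∪ ((cl K T ∩ C) \ cl K S) := by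
      rw [cl_union]
      intro x hx
      simp only [Finset.mem_union, Finset.mem_inter, Finset.mem_sdiff] at hx ⊢
      tauto
    exact (Finset.card_le_card this).trans ((Finset.card_union_le _ _).trans (by omega))⟩
  have := hTne.card_pos
  omega

end Sparse

section Merge

variable {V : Type*} [DecidableEq V]

/-- The edge `e` joins two consecutive vertices of `l`. -/
def HasEdge (l : List V) (e : Sym2 V) : Prop := ∃ a b, e = s(a, b) ∧ [a, b] <:+: l

omit [DecidableEq V] in
lemma HasEdge.mono {l l' : List V} {e : Sym2 V} (h : HasEdge l e) (hl : l <:+: l') :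
    HasEdge l' e := by
  obtain ⟨a, b, rfl, h⟩ := h
  exact ⟨a, b, rfl, h.trans hl⟩

omit [DecidableEq V] in
lemma HasEdge.reverse {l : List V} {e : Sym2 V} (h : HasEdge l e) : HasEdge l.reverse e := by
  obtain ⟨a, b, rfl, h⟩ := h
  exact ⟨b, a, Sym2.eq_swap, by simpa using List.reverse_infix.2 h⟩

omit [DecidableEq V] in
lemma HasEdge.join {l₁ l₂ c : List V} {e : Sym2 V} (h : HasEdge l₁ e ∨ HasEdge l₂ e) :
    HasEdge (l₁.reverse ++ c ++ l₂) e := by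
  rcases h with h | h
  · exact h.reverse.mono ⟨[], c ++ l₂, by simp⟩
  · exact h.mono ⟨l₁.reverse ++ c, [], by simp⟩

/-- A path system through part `D` of a matching `M`, covering `S`, whose remaining paths start at
the endpoints in `S` of the remaining edges of `M`. -/
structure MergeState (K : SimpleGraph V) (M : Finset (Sym2 V)) (p : V → Fin 2 → V) (S : Finset V)
    (D : Finset (Sym2 V)) (F : Finset (List V)) : Prop where
  lin : Linear (K ⊔ SimpleGraph.fromEdgeSet ↑M) F
  ends : ∀ l ∈ F, ∃ a t, l.head? = some a ∧ l.getLast? = some t ∧ t ∉ S ∧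
    (a ∈ S → ∃ e ∈ M, e ∉ D ∧ a ∈ e)
  len : ∀ l ∈ F, 2 ≤ l.length
  start : ∀ e ∈ M, e ∉ D → ∀ v ∈ e, v ∈ S → ∃ l ∈ F, l.head? = some v
  out : ∀ e ∈ M, e ∉ D → ∀ v ∈ e, v ∉ S → ∀ l ∈ F, v ∉ l
  cover : ∀ s ∈ S, ∃ l ∈ F, s ∈ l
  sub : ∀ l ∈ F, ∀ x ∈ l, x ∈ S ∨ (∃ e ∈ M, x ∈ e) ∨ ∃ s ∈ S, ∃ i, x = p s i
  edge : ∀ e ∈ D, ∃ l ∈ F, HasEdge l e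
  card : F.card ≤ S.card + D.card

lemma MergeState.exists_from {K : SimpleGraph V} {M : Finset (Sym2 V)} {p : V → Fin 2 → V}
    {S : Finset V} {D : Finset (Sym2 V)} {F : Finset (List V)} (h : MergeState K M p S D F)
    {e : Sym2 V} (he : e ∈ M) (heD : e ∉ D) {o : V} (ho : o ∈ e) :
    ∃ l : List V, l.Nodup ∧ l.IsChain (K ⊔ SimpleGraph.fromEdgeSet ↑M).Adj ∧ l.head? = some o ∧
      (∃ t, l.getLast? = some t ∧ t ∉ S) ∧ (∀ l' ∈ F, l' ≠ l → ∀ x ∈ l, x ∉ l') ∧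
      (l ∈ F ∨ l = [o]) := by
  by_cases hoS : o ∈ S
  · obtain ⟨l, hl, hlo⟩ := h.start e he heD o ho hoS
    obtain ⟨a, t, _, ht, htS, _⟩ := h.ends l hl
    exact ⟨l, h.lin.nodup l hl, h.lin.chain l hl, hlo, ⟨t, ht, htS⟩, fun l' hl' hne x hx hx' =>
      hne (h.lin.disj l' hl' l hl x hx' hx), Or.inl hl⟩
  · refine ⟨[o], List.nodup_singleton _, List.isChain_singleton _, rfl, ⟨o, rfl, hoS⟩, ?_,
      Or.inr rfl⟩
    intro l' hl' _ x hx
    rw [List.mem_singleton] at hx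
    subst hx
    exact h.out e he heD _ ho hoS l' hl'

lemma ChildCover.exists_mergeState {K : SimpleGraph V} {M : Finset (Sym2 V)}
    (hdiag : ∀ e ∈ M, ¬ e.IsDiag) (hM : ∀ e ∈ M, ∀ f ∈ M, e ≠ f → ∀ v, v ∈ e → v ∉ f)
    {p : V → Fin 2 → V} {S Q : Finset V} (hQ : ∀ v, v ∈ Q ↔ v ∈ S ∧ ∃ e ∈ M, v ∈ e)
    (hp : ∀ s ∈ S, ∀ i, ∀ e ∈ M, p s i ∉ e) {F₀ : Finset (List V)} (h₀ : ChildCover K p S Q F₀)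
    (D : Finset (Sym2 V)) (hD : D ⊆ M) : ∃ F, MergeState K M p S D F := by
  induction D using Finset.induction_on with
  | empty =>
    refine ⟨F₀, ⟨h₀.lin.nodup, fun l hl => (h₀.lin.chain l hl).imp fun _ _ h => Or.inl h,
      h₀.lin.disj⟩, fun l hl => ?_, h₀.len, ?_, ?_, h₀.cover, fun l hl x hx => ?_, by simp,
      by simpa using h₀.card⟩
    · obtain ⟨a, t, ha, ht, htS, haS⟩ := h₀.ends l hl
      refine ⟨a, t, ha, ht, htS, fun h => ?_⟩
      obtain ⟨e, he, hae⟩ := ((hQ a).1 (haS.resolve_right (by simpa using h))).2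
      exact ⟨e, he, by simp, hae⟩
    · intro e he _ v hv hvS
      exact h₀.start v ((hQ v).2 ⟨hvS, e, he, hv⟩)
    · intro e he _ v hv hvS l hl hvl
      rcases h₀.sub l hl v hvl with h | ⟨s, hs, i, rfl⟩
      exacts [hvS h, hp s hs i e he hv]
    · rcases h₀.sub l hl x hx with h | h
      exacts [Or.inl h, Or.inr (Or.inr h)]
  | insert e₀ D he₀ ih =>
    obtain ⟨F, hF⟩ := ih fun e he => hD (Finset.mem_insert_of_mem he)
    have he₀M := hD (Finset.mem_insert_self e₀ D)
    obtain ⟨a, b, rfl⟩ : ∃ a b, e₀ = s(a, b) := by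
      induction e₀ with | _ a b => exact ⟨a, b, rfl⟩
    have hab : a ≠ b := fun h => hdiag _ he₀M (by simpa using h)
    obtain ⟨l₁, hn₁, hc₁, hh₁, ⟨t₁, hl₁, htS₁⟩, hd₁, hm₁⟩ :=
      hF.exists_from he₀M he₀ (Sym2.mem_mk_left a b)
    obtain ⟨l₂, hn₂, hc₂, hh₂, ⟨t₂, hl₂, htS₂⟩, hd₂, hm₂⟩ :=
      hF.exists_from he₀M he₀ (Sym2.mem_mk_right a b)
    have ha₁ : a ∈ l₁ := List.mem_of_head? hh₁
    have hb₂ : b ∈ l₂ := List.mem_of_head? hh₂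
    have hne : l₁ ≠ l₂ := by
      rintro rfl
      rw [hh₁] at hh₂
      exact hab (Option.some.inj hh₂)
    have h₁₂ : ∀ x ∈ l₁, x ∉ l₂ := by
      intro x hx hx'
      rcases hm₁ with h | h
      · exact hd₂ l₁ h hne x hx' hx
      · rcases hm₂ with h' | h'
        · exact hd₁ l₂ h' hne.symm x hx hx'
        · rw [h, List.mem_singleton] at hx
          rw [h', List.mem_singleton] at hx'
          exact hab (hx ▸ hx')
    have hne₁ : l₁ ≠ [] := List.ne_nil_of_mem ha₁
    have hne₂ : l₂ ≠ [] := List.ne_nil_of_mem hb₂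
    set l := l₁.reverse ++ [] ++ l₂ with hl
    have hmeml : ∀ x, x ∈ l ↔ x ∈ l₁ ∨ x ∈ l₂ := by
      intro x; simp [hl]
    set F' := (F.erase l₁).erase l₂ with hF'
    have hmemF' : ∀ m, m ∈ F' ↔ m ∈ F ∧ m ≠ l₁ ∧ m ≠ l₂ := by
      intro m; simp only [hF', Finset.mem_erase]; tauto
    have hrest : ∀ e ∈ M, e ∉ insert s(a, b) D → e ∉ D ∧ ∀ v ∈ e, v ≠ a ∧ v ≠ b := by
      intro e he heD
      rw [Finset.mem_insert, not_or] at heD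
      refine ⟨heD.2, fun v hv => ?_⟩
      have := hM e he _ he₀M heD.1 v hv
      rw [Sym2.mem_iff, not_or] at this
      exact this
    have hinf : [a, b] <:+: l := by
      obtain ⟨x₁, rfl⟩ : ∃ t, l₁ = a :: t := by
        cases l₁ with
        | nil => simp at hh₁
        | cons x t => simp only [List.head?_cons, Option.some.injEq] at hh₁; exact ⟨t, by rw [hh₁]⟩
      obtain ⟨x₂, rfl⟩ : ∃ t, l₂ = b :: t := by
        cases l₂ with
        | nil => simp at hh₂
        | cons x t => simp only [List.head?_cons, Option.some.injEq] at hh₂; exact ⟨t, by rw [hh₂]⟩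
      exact ⟨x₁.reverse, x₂, by simp [hl]⟩
    refine ⟨insert l F', ?_, ?_, ?_, ?_, ?_, ?_, ?_, ?_, ?_⟩
    · refine hF.lin.insert (fun m hm => ((hmemF' m).1 hm).1)
        (nodup_join hn₁ hn₂ List.nodup_nil h₁₂ (by simp) (by simp))
        (isChain_join hc₁ hc₂ hh₁ hh₂ ?_) ?_
      · simp only [List.cons_append, List.nil_append, List.isChain_pair]
        exact Or.inr ((SimpleGraph.fromEdgeSet_adj _).2 ⟨he₀M, hab⟩)
      · intro m hm x hx
        obtain ⟨hmF, hm1, hm2⟩ := (hmemF' m).1 hm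
        rcases (hmeml x).1 hx with h | h
        · exact hd₁ m hmF hm1 x h
        · exact hd₂ m hmF hm2 x h
    · intro m hm
      rcases Finset.mem_insert.1 hm with rfl | hm
      · refine ⟨t₁, t₂, ?_, ?_, htS₂, fun h => absurd h htS₁⟩
        · rw [hl, List.append_nil, List.head?_append_of_ne_nil _ (by simpa using hne₁),
            List.head?_reverse, hl₁]
        · rw [hl, List.getLast?_append_of_ne_nil _ hne₂, hl₂]
      · obtain ⟨hmF, hm1, hm2⟩ := (hmemF' m).1 hm
        obtain ⟨x, t, hx, ht, htS, hxS⟩ := hF.ends m hmF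
        have hxm : x ∈ m := List.mem_of_head? hx
        refine ⟨x, t, hx, ht, htS, fun h => ?_⟩
        obtain ⟨e, he, heD, hxe⟩ := hxS h
        refine ⟨e, he, fun h' => ?_, hxe⟩
        rcases Finset.mem_insert.1 h' with rfl | h'
        · rcases Sym2.mem_iff.1 hxe with rfl | rfl
          · exact hd₁ m hmF hm1 _ ha₁ hxm
          · exact hd₂ m hmF hm2 _ hb₂ hxm
        · exact heD h'
    · intro m hm
      rcases Finset.mem_insert.1 hm with rfl | hm
      · have e1 := List.length_pos_iff.2 hne₁
        have e2 := List.length_pos_iff.2 hne₂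
        simp only [hl, List.length_append, List.length_reverse]
        omega
      · exact hF.len m ((hmemF' m).1 hm).1
    · intro e he heD v hv hvS
      obtain ⟨h1, h2⟩ := hrest e he heD
      obtain ⟨m, hm, hmv⟩ := hF.start e he h1 v hv hvS
      refine ⟨m, Finset.mem_insert_of_mem ((hmemF' m).2 ⟨hm, ?_, ?_⟩), hmv⟩
      · rintro rfl
        exact (h2 v hv).1 (Option.some.inj (hmv.symm.trans hh₁))
      · rintro rfl
        exact (h2 v hv).2 (Option.some.inj (hmv.symm.trans hh₂))
    · intro e he heD v hv hvS m hm hvm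
      obtain ⟨h1, h2⟩ := hrest e he heD
      have h3 := hF.out e he h1 v hv hvS
      rcases Finset.mem_insert.1 hm with rfl | hm
      · rcases (hmeml v).1 hvm with h | h
        · rcases hm₁ with h' | h'
          · exact h3 _ h' h
          · rw [h', List.mem_singleton] at h; exact (h2 v hv).1 h
        · rcases hm₂ with h' | h'
          · exact h3 _ h' h
          · rw [h', List.mem_singleton] at h; exact (h2 v hv).2 h
      · exact h3 m ((hmemF' m).1 hm).1 hvm
    · intro s hs
      obtain ⟨m, hm, hsm⟩ := hF.cover s hs
      by_cases h1 : m = l₁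
      · exact ⟨l, Finset.mem_insert_self _ _, (hmeml s).2 (Or.inl (h1 ▸ hsm))⟩
      · by_cases h2 : m = l₂
        · exact ⟨l, Finset.mem_insert_self _ _, (hmeml s).2 (Or.inr (h2 ▸ hsm))⟩
        · exact ⟨m, Finset.mem_insert_of_mem ((hmemF' m).2 ⟨hm, h1, h2⟩), hsm⟩
    · intro m hm x hx
      rcases Finset.mem_insert.1 hm with rfl | hm
      · rcases (hmeml x).1 hx with h | h
        · rcases hm₁ with h' | h'
          · exact hF.sub _ h' x h
          · rw [h', List.mem_singleton] at h
            exact Or.inr (Or.inl ⟨_, he₀M, h ▸ Sym2.mem_mk_left a b⟩)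
        · rcases hm₂ with h' | h'
          · exact hF.sub _ h' x h
          · rw [h', List.mem_singleton] at h
            exact Or.inr (Or.inl ⟨_, he₀M, h ▸ Sym2.mem_mk_right a b⟩)
      · exact hF.sub m ((hmemF' m).1 hm).1 x hx
    · intro e he
      rcases Finset.mem_insert.1 he with rfl | he
      · exact ⟨l, Finset.mem_insert_self _ _, a, b, rfl, hinf⟩
      · obtain ⟨m, hm, hme⟩ := hF.edge e he
        by_cases h1 : m = l₁
        · exact ⟨l, Finset.mem_insert_self _ _, HasEdge.join (Or.inl (h1 ▸ hme))⟩
        · by_cases h2 : m = l₂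
          · exact ⟨l, Finset.mem_insert_self _ _, HasEdge.join (Or.inr (h2 ▸ hme))⟩
          · exact ⟨m, Finset.mem_insert_of_mem ((hmemF' m).2 ⟨hm, h1, h2⟩), hme⟩
    · have h1 : F'.card ≤ F.card := Finset.card_le_card fun m hm => ((hmemF' m).1 hm).1
      have h2 := Finset.card_insert_le l F'
      have h3 := Finset.card_insert_of_notMem he₀
      have := hF.card
      omega

end Merge

section Links

variable {V : Type*}

lemma exists_shorter_chain {r : V → V → Prop} : ∀ {L : List V}, L.IsChain r → ¬ L.Nodup →
    ∃ L' : List V, L'.IsChain r ∧ L'.head? = L.head? ∧ L'.getLast? = L.getLast? ∧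
      L'.length < L.length
  | [], _, h => absurd List.nodup_nil h
  | x :: t, hc, h => by
    by_cases hx : x ∈ t
    · obtain ⟨α, β, rfl⟩ := List.append_of_mem hx
      refine ⟨x :: β, hc.suffix ⟨x :: α, by simp⟩, rfl, ?_, by simp⟩
      rw [← List.cons_append, List.getLast?_append_of_ne_nil _ (by simp)]
    · have ht : ¬ t.Nodup := fun ht => h (List.nodup_cons.2 ⟨hx, ht⟩)
      have hct : t.IsChain r := hc.suffix ⟨[x], by simp⟩
      obtain ⟨t', h1, h2, h3, h4⟩ := exists_shorter_chain hct ht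
      cases t with
      | nil => exact absurd List.nodup_nil ht
      | cons y t =>
        cases t' with
        | nil => simp at h2
        | cons y' t' =>
          simp only [List.head?_cons, Option.some.injEq] at h2
          subst h2
          refine ⟨x :: y' :: t', List.isChain_cons_cons.2 ⟨(List.isChain_cons_cons.1 hc).1, h1⟩,
            rfl, by simpa [List.getLast?_cons_cons] using h3, by simpa using h4⟩

/-- Two chains that end at adjacent vertices contain a path between their starting sets. -/
lemma exists_link {K : SimpleGraph V} {st : V → V → Prop} {X Y C : Set V} (hXY : Disjoint X Y)
    (hYC : Disjoint Y C) (hst : ∀ u v, st u v → v ∈ C ∧ K.Adj u v)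
    {L₁ L₂ : List V} (h₁ : L₁.IsChain st) (h₂ : L₂.IsChain st) {x y x' y' : V}
    (hx : L₁.head? = some x) (hxX : x ∈ X) (hy : L₂.head? = some y) (hyY : y ∈ Y)
    (hx' : L₁.getLast? = some x') (hy' : L₂.getLast? = some y') (hadj : K.Adj x' y') :
    ∃ a ∈ X, ∃ b ∈ Y, ∃ m : List V, m.Nodup ∧ (∀ v ∈ m, v ∈ C) ∧ (a :: m ++ [b]).IsChain K.Adj ∧
      m.length + 2 ≤ L₁.length + L₂.length ∧ ∀ v ∈ m, ∃ u, (u ∈ m ∨ u = a ∨ u = b) ∧ st u v := by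
  classical
  let P : ℕ → Prop := fun n => ∃ L₁ L₂ : List V, L₁.IsChain st ∧ L₂.IsChain st ∧
    (∃ x, L₁.head? = some x ∧ x ∈ X) ∧ (∃ y, L₂.head? = some y ∧ y ∈ Y) ∧
    (∃ x' y', L₁.getLast? = some x' ∧ L₂.getLast? = some y' ∧ K.Adj x' y') ∧
    L₁.length + L₂.length = n
  have hP : ∃ n, P n := ⟨_, L₁, L₂, h₁, h₂, ⟨x, hx, hxX⟩, ⟨y, hy, hyY⟩, ⟨x', y', hx', hy', hadj⟩,
    rfl⟩
  have hle : Nat.find hP ≤ L₁.length + L₂.length := Nat.find_min' hP ⟨L₁, L₂, h₁, h₂, ⟨x, hx, hxX⟩,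
    ⟨y, hy, hyY⟩, ⟨x', y', hx', hy', hadj⟩, rfl⟩
  have hmin : ∀ k < Nat.find hP, ¬ P k := fun k hk => Nat.find_min hP hk
  obtain ⟨M₁, M₂, c₁, c₂, ⟨a, ha, haX⟩, ⟨b, hb, hbY⟩, ⟨u, v, hu, hv, huv⟩, hn⟩ := Nat.find_spec hP
  rw [← hn] at hle hmin
  have n₁ : M₁.Nodup := by
    by_contra h
    obtain ⟨L, d1, d2, d3, d4⟩ := exists_shorter_chain c₁ h
    exact hmin _ (by omega) ⟨L, M₂, d1, c₂, ⟨a, d2.trans ha, haX⟩, ⟨b, hb, hbY⟩,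
      ⟨u, v, d3.trans hu, hv, huv⟩, rfl⟩
  have n₂ : M₂.Nodup := by
    by_contra h
    obtain ⟨L, d1, d2, d3, d4⟩ := exists_shorter_chain c₂ h
    exact hmin _ (by omega) ⟨M₁, L, c₁, d1, ⟨a, ha, haX⟩, ⟨b, d2.trans hb, hbY⟩,
      ⟨u, v, hu, d3.trans hv, huv⟩, rfl⟩
  have htail : ∀ {c : V} {m : List V}, (c :: m).IsChain st → ∀ z ∈ m,
      ∃ w, (w ∈ m ∨ w = c) ∧ st w z := by
    intro c m hc z hz
    obtain ⟨α, β, rfl⟩ := List.append_of_mem hz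
    rcases List.eq_nil_or_concat α with rfl | ⟨α, w, rfl⟩
    · exact ⟨c, Or.inr rfl, (List.isChain_cons_cons.1 hc).1⟩
    · refine ⟨w, Or.inl (by simp), ?_⟩
      have : (c :: α ++ w :: z :: β).IsChain st := by simpa using hc
      exact (List.isChain_append_cons_cons.1 this).2.1
  obtain ⟨m₁, rfl⟩ : ∃ m, M₁ = a :: m := by
    cases M₁ with
    | nil => simp at ha
    | cons x t => simp only [List.head?_cons, Option.some.injEq] at ha; exact ⟨t, by rw [ha]⟩
  obtain ⟨m₂, rfl⟩ : ∃ m, M₂ = b :: m := by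
    cases M₂ with
    | nil => simp at hb
    | cons x t => simp only [List.head?_cons, Option.some.injEq] at hb; exact ⟨t, by rw [hb]⟩
  have hC₁ : ∀ z ∈ m₁, z ∈ C := fun z hz => by
    obtain ⟨w, _, h⟩ := htail c₁ z hz; exact (hst w z h).1
  have hC₂ : ∀ z ∈ m₂, z ∈ C := fun z hz => by
    obtain ⟨w, _, h⟩ := htail c₂ z hz; exact (hst w z h).1
  have n₁₂ : ∀ z ∈ a :: m₁, z ∉ b :: m₂ := by
    intro z hz₁ hz₂
    obtain ⟨α, α', h3⟩ := List.append_of_mem hz₁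
    obtain ⟨β, β', h4⟩ := List.append_of_mem hz₂
    rcases List.eq_nil_or_concat β with rfl | ⟨β, w, rfl⟩
    · simp only [List.nil_append, List.cons.injEq] at h4
      obtain ⟨rfl, -⟩ := h4
      rcases List.mem_cons.1 hz₁ with rfl | h
      · exact Set.disjoint_left.1 hXY haX hbY
      · exact Set.disjoint_left.1 hYC hbY (hC₁ _ h)
    · rw [List.concat_eq_append, List.append_assoc] at h4
      have hwz : st w z := by
        rw [h4] at c₂
        exact (List.isChain_append_cons_cons.1 c₂).2.1
      refine hmin ((α ++ [z]).length + (β ++ [w]).length) ?_ ⟨α ++ [z], β ++ [w], c₁.prefix ?_,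
        c₂.prefix ?_, ⟨a, ?_, haX⟩, ⟨b, ?_, hbY⟩, ⟨z, w, by simp, by simp, (hst w z hwz).2.symm⟩,
        rfl⟩
      · rw [h3, h4]; simp; omega
      · rw [h3]; exact ⟨α', by simp⟩
      · rw [h4]; exact ⟨z :: β', by simp⟩
      · rw [← ha, h3]; cases α <;> simp
      · rw [← hb, h4]; cases β <;> simp
  refine ⟨a, haX, b, hbY, m₁ ++ m₂.reverse, ?_, ?_, ?_, ?_, ?_⟩
  · refine List.Nodup.append (List.nodup_cons.1 n₁).2
      (List.nodup_reverse.2 (List.nodup_cons.1 n₂).2) fun z h h' => ?_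
    exact n₁₂ z (List.mem_cons_of_mem _ h) (List.mem_cons_of_mem _ (List.mem_reverse.1 h'))
  · intro z hz
    rcases List.mem_append.1 hz with h | h
    exacts [hC₁ z h, hC₂ z (List.mem_reverse.1 h)]
  · have : a :: (m₁ ++ m₂.reverse) ++ [b] = (a :: m₁) ++ (b :: m₂).reverse := by simp
    rw [this, List.isChain_append]
    refine ⟨c₁.imp fun _ _ h => (hst _ _ h).2, ?_, ?_⟩
    · rw [List.isChain_reverse]
      exact c₂.imp fun _ _ h => (hst _ _ h).2.symm
    · intro p hp q hq
      rw [List.head?_reverse] at hq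
      rw [hu] at hp
      rw [hv] at hq
      simp only [Option.mem_def, Option.some.injEq] at hp hq
      exact hp ▸ hq ▸ huv
  · simp only [List.length_append, List.length_reverse, List.length_cons] at hle ⊢
    omega
  · intro z hz
    rcases List.mem_append.1 hz with h | h
    · obtain ⟨w, hw, hwz⟩ := htail c₁ z h
      exact ⟨w, by rcases hw with hw | hw <;> simp [hw], hwz⟩
    · obtain ⟨w, hw, hwz⟩ := htail c₂ z (List.mem_reverse.1 h)
      exact ⟨w, by rcases hw with hw | hw <;> simp [hw], hwz⟩

/-- Every closed path of `K` of length between three and `ℓ` meets `X`. -/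
def ShortCyclesMeet (K : SimpleGraph V) (ℓ : ℕ) (X : Finset V) : Prop :=
  ∀ l : List V, l.Nodup → 3 ≤ l.length → l.length ≤ ℓ → l.IsChain K.Adj →
    (∀ a b, l.head? = some a → l.getLast? = some b → K.Adj b a) → ∃ x ∈ l, x ∈ X

/-- A vertex has at most one neighbour on a short path that avoids the short cycles. -/
lemma neighbour_on_path_unique {K : SimpleGraph V} {ℓ : ℕ} {X : Finset V}
    (h : ShortCyclesMeet K ℓ X) {m : List V} (hn : m.Nodup) (hc : m.IsChain K.Adj)
    (hℓ : m.length + 1 ≤ ℓ) (hm : ∀ v ∈ m, v ∉ X) {s : V} (hs : s ∉ m) (hsX : s ∉ X) {x y : V}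
    (hx : x ∈ m) (hy : y ∈ m) (hsx : K.Adj s x) (hsy : K.Adj s y) : x = y := by
  by_contra hxy
  have key : ∀ x y, K.Adj s x → K.Adj s y → ∀ α β γ, m = α ++ x :: (β ++ y :: γ) → False := by
    intro x y hsx hsy α β γ hm'
    have hinf : x :: (β ++ [y]) <:+: m := ⟨α, γ, by rw [hm']; simp⟩
    have hsub := hinf.subset
    have hlen := hinf.length_le
    obtain ⟨z, hz, hzX⟩ := h (s :: x :: (β ++ [y]))
      (List.nodup_cons.2 ⟨fun h => hs (hsub h), hinf.sublist.nodup hn⟩) (by simp)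
      (by simp only [List.length_cons] at hlen ⊢; omega)
      (List.isChain_cons_cons.2 ⟨hsx, hc.infix hinf⟩) (by
        intro a b ha hb
        have h1 : s = a := by simpa using ha
        have h2 : s :: x :: (β ++ [y]) = (s :: x :: β) ++ [y] := by simp
        rw [h2, List.getLast?_append_of_ne_nil _ (by simp)] at hb
        have h3 : y = b := by simpa using hb
        rw [← h1, ← h3]
        exact hsy.symm)
    rcases List.mem_cons.1 hz with rfl | hz
    exacts [hsX hzX, hm z (hsub hz) hzX]
  obtain ⟨α, β, rfl⟩ := List.append_of_mem hx
  rcases List.mem_append.1 hy with h1 | h1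
  · obtain ⟨γ, δ, rfl⟩ := List.append_of_mem h1
    exact key y x hsy hsx γ δ β (by simp)
  · rcases List.mem_cons.1 h1 with h1 | h1
    · exact hxy h1.symm
    · obtain ⟨γ, δ, rfl⟩ := List.append_of_mem h1
      exact key x y hsx hsy α γ δ rfl

end Links

section LinkStep

variable {V : Type*} [DecidableEq V]

/-- The vertices on the paths of a family. -/
def cov (F : Finset (List V)) : Finset V := F.biUnion List.toFinset

lemma mem_cov {F : Finset (List V)} {v : V} : v ∈ cov F ↔ ∃ l ∈ F, v ∈ l := by
  simp [cov]

open Classical in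
/-- The ends of the paths of a family. -/
noncomputable def pathEnds (F : Finset (List V)) : Finset V :=
  (cov F).filter fun v => ∃ l ∈ F, l.head? = some v ∨ l.getLast? = some v

lemma mem_pathEnds {F : Finset (List V)} {v : V} :
    v ∈ pathEnds F ↔ ∃ l ∈ F, l.head? = some v ∨ l.getLast? = some v := by
  simp only [pathEnds, Finset.mem_filter, mem_cov, and_iff_right_iff_imp]
  rintro ⟨l, hl, h | h⟩
  exacts [⟨l, hl, List.mem_of_head? h⟩, ⟨l, hl, List.mem_of_getLast? h⟩]

lemma pathEnds_subset (F : Finset (List V)) : pathEnds F ⊆ cov F := Finset.filter_subset _ _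

/-- The vertices of `A` that are not interior to a path of `F`. -/
noncomputable def live (A : Finset V) (F : Finset (List V)) : Finset V := (A \ cov F) ∪ pathEnds F

variable [Fintype V]

/-- A system of paths through a matching `M` outside of which `K` has good expansion. -/
structure LinkState (K : SimpleGraph V) (M : Finset (Sym2 V)) (A C : Finset V) (μ : ℕ)
    (F : Finset (List V)) : Prop where
  lin : Linear (K ⊔ SimpleGraph.fromEdgeSet ↑M) F
  len : ∀ l ∈ F, 2 ≤ l.length
  edge : ∀ e ∈ M, ∃ l ∈ F, HasEdge l e
  sub : cov F ⊆ A
  inv : ∀ S ⊆ live A F, S.card < μ → 3 * S.card ≤ (cl K S ∩ (C \ cov F)).card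

lemma MergeState.linkState {K : SimpleGraph V} {M : Finset (Sym2 V)} {p : V → Fin 2 → V}
    {S A C : Finset V} {F : Finset (List V)} {μ cap : ℕ} (h : MergeState K M p S M F)
    (hSA : S ⊆ A) (hMA : ∀ e ∈ M, ∀ v ∈ e, v ∈ A) (hpA : ∀ s ∈ S, ∀ i, p s i ∈ A)
    (hMC : ∀ e ∈ M, ∀ v ∈ e, v ∉ C) (hp : ∀ s ∈ S, ∀ i, K.Adj s (p s i))
    (hcap : S.card + μ ≤ cap)
    (hS : ∀ T ⊆ A, Disjoint T S → T.Nonempty → T.card + S.card ≤ cap →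
      3 * T.card < ((cl K T ∩ C) \ cl K S).card) :
    LinkState K M A C μ F ∧ C ∩ cov F ⊆ cl K S := by
  have hcov : C ∩ cov F ⊆ cl K S := by
    intro v hv
    obtain ⟨hvC, hv⟩ := Finset.mem_inter.1 hv
    obtain ⟨l, hl, hvl⟩ := mem_cov.1 hv
    rcases h.sub l hl v hvl with h1 | ⟨e, he, h1⟩ | ⟨s, hs, i, rfl⟩
    · exact subset_cl _ _ h1
    · exact absurd hvC (hMC e he v h1)
    · exact mem_cl.2 ⟨s, hs, Or.inr (hp s hs i)⟩
  have hsub : cov F ⊆ A := by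
    intro v hv
    obtain ⟨l, hl, hvl⟩ := mem_cov.1 hv
    rcases h.sub l hl v hvl with h1 | ⟨e, he, h1⟩ | ⟨s, hs, i, rfl⟩
    exacts [hSA h1, hMA e he v h1, hpA s hs i]
  refine ⟨⟨h.lin, h.len, h.edge, hsub, fun T hT hTμ => ?_⟩, hcov⟩
  rcases T.eq_empty_or_nonempty with rfl | hne
  · simp
  have hTS : Disjoint T S := by
    rw [Finset.disjoint_left]
    intro v hv hvS
    rcases Finset.mem_union.1 (hT hv) with h1 | h1
    · exact (Finset.mem_sdiff.1 h1).2 (mem_cov.2 (h.cover v hvS))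
    · obtain ⟨l, hl, h2⟩ := mem_pathEnds.1 h1
      obtain ⟨a, t, ha, ht, htS, haS⟩ := h.ends l hl
      rcases h2 with h2 | h2
      · obtain rfl := Option.some.inj (ha.symm.trans h2)
        obtain ⟨e, he, he', _⟩ := haS hvS
        exact he' he
      · obtain rfl := Option.some.inj (ht.symm.trans h2)
        exact htS hvS
  have hTA : T ⊆ A := fun v hv => by
    rcases Finset.mem_union.1 (hT hv) with h1 | h1
    exacts [(Finset.mem_sdiff.1 h1).1, hsub (pathEnds_subset _ h1)]
  refine (hS T hTA hTS hne (by omega)).le.trans (Finset.card_le_card fun v hv => ?_)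
  simp only [Finset.mem_sdiff, Finset.mem_inter] at hv ⊢
  exact ⟨hv.1.1, hv.1.2, fun h' => hv.2 (hcov (Finset.mem_inter.2 ⟨hv.1.2, h'⟩))⟩

/-- The vertices reached from `X` in exactly `i` steps. -/
noncomputable def levels (img : Finset V → Finset V) (X : Finset V) : ℕ → Finset V
  | 0 => X
  | i + 1 => img (levels img X i)

open Classical in
/-- The image of a set under a relation. -/
noncomputable def relImg (st : V → V → Prop) (X : Finset V) : Finset V :=
  Finset.univ.filter fun v => ∃ u ∈ X, st u v

omit [DecidableEq V] in
lemma mem_relImg {st : V → V → Prop} {X : Finset V} {v : V} :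
    v ∈ relImg st X ↔ ∃ u ∈ X, st u v := by
  simp [relImg]

lemma exists_chain_of_mem_levels {st : V → V → Prop} {X : Finset V} {i : ℕ} : ∀ {v : V},
    v ∈ levels (relImg st) X i → ∃ L : List V, L.IsChain (fun a b => st a b ∧ a ≠ b) ∧
      (∃ x ∈ X, L.head? = some x) ∧ L.getLast? = some v ∧ L.length ≤ i + 1 := by
  induction i with
  | zero => exact fun {v} hv => ⟨[v], List.isChain_singleton _, ⟨v, hv, rfl⟩, rfl, le_rfl⟩
  | succ i ih =>
    intro v hv
    obtain ⟨u, hu, huv⟩ := mem_relImg.1 hv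
    obtain ⟨L, h1, ⟨x, hx, h2⟩, h3, h4⟩ := ih hu
    by_cases huv' : u = v
    · subst huv'
      exact ⟨L, h1, ⟨x, hx, h2⟩, h3, by omega⟩
    · refine ⟨L ++ [v], ?_, ⟨x, hx, ?_⟩, by simp, by simp; omega⟩
      · rw [List.isChain_append]
        refine ⟨h1, List.isChain_singleton _, fun a ha b hb => ?_⟩
        rw [h3] at ha
        simp only [Option.mem_def, Option.some.injEq, List.head?_cons] at ha hb
        exact ha ▸ hb ▸ ⟨huv, huv'⟩
      · rw [List.head?_append_of_ne_nil _ (by rintro rfl; simp at h2), h2]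

omit [DecidableEq V] in
lemma card_levels {st : V → V → Prop} {A X : Finset V} {cap N : ℕ} (hX : X ⊆ A)
    (hst : ∀ u v, st u v → v ∈ A)
    (hgrow : ∀ Y ⊆ A, Y.card ≤ cap → 3 * Y.card ≤ (relImg st Y).card) (hcap : N / 12 + 1 ≤ cap)
    (i : ℕ) : levels (relImg st) X i ⊆ A ∧ (3 ^ i * X.card ≤ (levels (relImg st) X i).card ∨
      N ≤ 4 * (levels (relImg st) X i).card) := by
  induction i with
  | zero => exact ⟨hX, Or.inl (by simp [levels])⟩
  | succ i ih =>
    obtain ⟨h1, h2⟩ := ih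
    set R := levels (relImg st) X i with hR
    change relImg st R ⊆ A ∧ (_ ≤ (relImg st R).card ∨ N ≤ 4 * (relImg st R).card)
    refine ⟨fun v hv => ?_, ?_⟩
    · obtain ⟨u, _, huv⟩ := mem_relImg.1 hv
      exact hst u v huv
    · by_cases hbig : N / 12 + 1 ≤ R.card
      · right
        obtain ⟨Y, hYR, hY⟩ := Finset.exists_subset_card_eq hbig
        have h3 := hgrow Y (hYR.trans h1) (by omega)
        have h4 : relImg st Y ⊆ relImg st R := fun v hv => by
          obtain ⟨u, hu, huv⟩ := mem_relImg.1 hv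
          exact mem_relImg.2 ⟨u, hYR hu, huv⟩
        have h5 := Finset.card_le_card h4
        omega
      · have h3 := hgrow R h1 (by omega)
        rcases h2 with h2 | h2
        · left
          rw [pow_succ]
          nlinarith
        · right
          omega

/-- Two large sets meet or are joined by an edge. -/
lemma exists_meet {K : SimpleGraph V} {cap w : ℕ} (hcap : 4 * cap + 4 ≤ Fintype.card V) (hw : 4 ≤ w)
    (hlarge : ∀ X : Finset V, cap ≤ X.card → 4 * X.card ≤ Fintype.card V →
      3 * X.card + w ≤ (cl K X).card) {X Y : Finset V} (hX : Fintype.card V ≤ 4 * X.card)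
    (hY : Fintype.card V ≤ 4 * Y.card) : ∃ x ∈ X, ∃ y ∈ Y, x = y ∨ K.Adj x y := by
  by_contra hno
  push Not at hno
  obtain ⟨X', hX'X, hX'⟩ := Finset.exists_subset_card_eq (show Fintype.card V / 4 ≤ X.card by omega)
  have h1 := hlarge X' (by omega) (by omega)
  have hdisj : Disjoint (cl K X') Y := by
    rw [Finset.disjoint_left]
    intro y hy hyY
    obtain ⟨x, hx, h | h⟩ := mem_cl.1 hy
    · exact (hno x (hX'X hx) y hyY).1 h.symm
    · exact (hno x (hX'X hx) y hyY).2 h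
  have h2 := Finset.card_union_of_disjoint hdisj
  have h3 := Finset.card_le_univ (cl K X' ∪ Y)
  omega

lemma card_cl_inter_path_le {K : SimpleGraph V} {ℓ : ℕ} {X C S : Finset V}
    (hcyc : ShortCyclesMeet K ℓ X) (hXC : Disjoint (cl K X) C) {m : List V} (hn : m.Nodup)
    (hc : m.IsChain K.Adj) (hℓ : m.length + 1 ≤ ℓ) (hmC : ∀ v ∈ m, v ∈ C) (hS : ∀ s ∈ S, s ∉ m) :
    (cl K S ∩ m.toFinset).card ≤ S.card := by
  have hch : ∀ v, ∃ s, v ∈ cl K S ∩ m.toFinset → s ∈ S ∧ K.Adj s v := by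
    intro v
    by_cases hv : v ∈ cl K S ∩ m.toFinset
    · obtain ⟨h1, h2⟩ := Finset.mem_inter.1 hv
      obtain ⟨s, hs, rfl | h⟩ := mem_cl.1 h1
      · exact absurd (List.mem_toFinset.1 h2) (hS _ hs)
      · exact ⟨s, fun _ => ⟨hs, h⟩⟩
    · exact ⟨v, fun h => absurd h hv⟩
  choose f hf using hch
  have hmX : ∀ v ∈ m, v ∉ X := fun v hv hvX =>
    Finset.disjoint_left.1 hXC (subset_cl K X hvX) (hmC v hv)
  refine Finset.card_le_card_of_injOn f (fun v hv => (hf v hv).1) fun u hu v hv huv => ?_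
  have hu' := hf u hu
  have hv' := hf v hv
  rw [← huv] at hv'
  have hum := List.mem_toFinset.1 (Finset.mem_inter.1 hu).2
  exact neighbour_on_path_unique hcyc hn hc hℓ hmX (hS _ hu'.1)
    (fun h => Finset.disjoint_left.1 hXC (mem_cl.2 ⟨_, h, Or.inr hu'.2⟩) (hmC u hum)) hum
    (List.mem_toFinset.1 (Finset.mem_inter.1 hv).2) hu'.2 hv'.2

/-- The geometric hypotheses for linking paths by short connections. -/
structure LinkHyp (K : SimpleGraph V) (C X : Finset V) (μ cap w ℓ : ℕ) : Prop where
  mid : ∀ Y : Finset V, μ ≤ Y.card → Y.card ≤ cap → 4 * Y.card + w < (cl K Y).card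
  large : ∀ Y : Finset V, cap ≤ Y.card → 4 * Y.card ≤ Fintype.card V →
    3 * Y.card + w ≤ (cl K Y).card
  four_le : 4 ≤ w
  cap_le : 4 * cap + 4 ≤ Fintype.card V
  le_cap : Fintype.card V / 12 + 1 + μ ≤ cap
  two_le : 2 * μ ≤ cap
  cyc : ShortCyclesMeet K ℓ X
  disj : Disjoint (cl K X) C

lemma LinkState.exists_step {K : SimpleGraph V} {M : Finset (Sym2 V)} {A C X : Finset V}
    {μ cap w ℓ t : ℕ} {F : Finset (List V)} (h : LinkState K M A C μ F)
    (hyp : LinkHyp K C X μ cap w ℓ) (hCA : C ⊆ A) (hℓ : 2 * t + 1 ≤ ℓ)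
    (hw : (Finset.univ \ (C \ cov F)).card ≤ w) (ht : Fintype.card V ≤ 4 * (3 ^ t * (F.card / 2))) :
    ∃ F', LinkState K M A C μ F' ∧ F'.card + 1 = F.card ∧ (cov F' \ cov F).card ≤ 2 * t := by
  classical
  set C' := C \ cov F with hC'
  obtain ⟨Sm, hSmA, hSmcap, hSm, hmax⟩ := exists_maximal_sparse K (live A F) C' 4 cap
  have hSmμ : Sm.card < μ := by
    by_contra hlt
    have h1 := hyp.mid Sm (by omega) hSmcap
    have h2 : cl K Sm ⊆ (cl K Sm ∩ C') ∪ (Finset.univ \ C') := by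
      intro x hx; by_cases hxC : x ∈ C' <;> simp [hx, hxC]
    have h3 := (Finset.card_le_card h2).trans (Finset.card_union_le _ _)
    omega
  have hC'live : C' ⊆ live A F := fun v hv => by
    obtain ⟨h1, h2⟩ := Finset.mem_sdiff.1 hv
    exact Finset.mem_union_left _ (Finset.mem_sdiff.2 ⟨hCA h1, h2⟩)
  obtain ⟨p, hpN, hpinj⟩ := exists_privates (S := Sm) 3 (N := fun s => cl K {s} ∩ C') (by
    intro T hT
    refine (h.inv T (hT.trans hSmA) ((Finset.card_le_card hT).trans_lt hSmμ)).trans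
      (Finset.card_le_card fun v hv => ?_)
    obtain ⟨h1, h2⟩ := Finset.mem_inter.1 hv
    obtain ⟨s, hs, h3⟩ := mem_cl.1 h1
    exact Finset.mem_biUnion.2 ⟨s, hs, Finset.mem_inter.2 ⟨mem_cl.2 ⟨s, by simp, h3⟩, h2⟩⟩)
  have hpC : ∀ s ∈ Sm, ∀ i, p s i ∈ C' := fun s hs i => (Finset.mem_inter.1 (hpN s hs i)).2
  have hpcl : ∀ s ∈ Sm, ∀ i, p s i = s ∨ K.Adj s (p s i) := fun s hs i => by
    obtain ⟨s', hs', h3⟩ := mem_cl.1 (Finset.mem_inter.1 (hpN s hs i)).1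
    rw [Finset.mem_singleton] at hs'
    subst hs'
    exact h3
  have hpclS : ∀ s ∈ Sm, ∀ i, p s i ∈ cl K Sm := fun s hs i => mem_cl.2 ⟨s, hs, hpcl s hs i⟩
  have hpcard : ∀ T ⊆ Sm, ((T ×ˢ (Finset.univ : Finset (Fin 3))).image fun x => p x.1 x.2).card =
      3 * T.card := by
    intro T hT
    rw [Finset.card_image_of_injOn, Finset.card_product, Finset.card_univ, Fintype.card_fin,
      mul_comm]
    rintro ⟨s, i⟩ hs ⟨s', i'⟩ hs' heq
    have h1 := (Finset.mem_product.1 hs).1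
    have h2 := (Finset.mem_product.1 hs').1
    obtain ⟨rfl, rfl⟩ := hpinj s (hT h1) s' (hT h2) i i' heq
    rfl
  set st : V → V → Prop := fun u v => (u ∈ Sm ∧ ∃ i, v = p u i) ∨
    (u ∉ Sm ∧ v ∈ C' ∧ v ∉ cl K Sm ∧ (v = u ∨ K.Adj u v)) with hst
  have hstC : ∀ u v, st u v → v ∈ C' := by
    rintro u v (⟨hu, i, rfl⟩ | ⟨_, h, _⟩)
    exacts [hpC u hu i, h]
  have hstK : ∀ u v, st u v ∧ u ≠ v → v ∈ (C' : Set V) ∧ K.Adj u v := by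
    rintro u v ⟨huv, hne⟩
    refine ⟨hstC u v huv, ?_⟩
    rcases huv with ⟨hu, i, rfl⟩ | ⟨_, _, _, h⟩
    · exact (hpcl u hu i).resolve_left fun h => hne h.symm
    · exact h.resolve_left fun h => hne h.symm
  have hgrow : ∀ Y ⊆ live A F, Y.card ≤ cap - μ → 3 * Y.card ≤ (relImg st Y).card := by
    intro Y hY hYc
    have hsplit : (Y ∩ Sm).card + (Y \ Sm).card = Y.card := Finset.card_inter_add_card_sdiff Y Sm
    have h1 := hpcard (Y ∩ Sm) Finset.inter_subset_right
    have h2 : 4 * (Y \ Sm).card ≤ ((cl K (Y \ Sm) ∩ C') \ cl K Sm).card := by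
      rcases (Y \ Sm).eq_empty_or_nonempty with h0 | hne
      · simp [h0]
      · exact (hmax _ (Finset.sdiff_subset.trans hY) Finset.sdiff_disjoint hne (by omega)).le
    have h3 : Disjoint (((Y ∩ Sm) ×ˢ (Finset.univ : Finset (Fin 3))).image fun x => p x.1 x.2)
        ((cl K (Y \ Sm) ∩ C') \ cl K Sm) := by
      rw [Finset.disjoint_left]
      intro v hv hv'
      obtain ⟨⟨s, i⟩, hs, rfl⟩ := Finset.mem_image.1 hv
      exact (Finset.mem_sdiff.1 hv').2
        (hpclS s (Finset.mem_inter.1 (Finset.mem_product.1 hs).1).2 i)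
    have h4 : (((Y ∩ Sm) ×ˢ (Finset.univ : Finset (Fin 3))).image fun x => p x.1 x.2) ∪
        ((cl K (Y \ Sm) ∩ C') \ cl K Sm) ⊆ relImg st Y := by
      intro v hv
      rcases Finset.mem_union.1 hv with hv | hv
      · obtain ⟨⟨s, i⟩, hs, rfl⟩ := Finset.mem_image.1 hv
        obtain ⟨hsY, hsS⟩ := Finset.mem_inter.1 (Finset.mem_product.1 hs).1
        exact mem_relImg.2 ⟨s, hsY, Or.inl ⟨hsS, i, rfl⟩⟩
      · obtain ⟨hv, hvS⟩ := Finset.mem_sdiff.1 hv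
        obtain ⟨hv, hvC⟩ := Finset.mem_inter.1 hv
        obtain ⟨s, hs, hsv⟩ := mem_cl.1 hv
        obtain ⟨hsY, hsS⟩ := Finset.mem_sdiff.1 hs
        exact mem_relImg.2 ⟨s, hsY, Or.inr ⟨hsS, hvC, hvS, hsv⟩⟩
    have h5 := Finset.card_le_card h4
    rw [Finset.card_union_of_disjoint h3] at h5
    omega
  obtain ⟨I, hIF, hI⟩ := Finset.exists_subset_card_eq (show F.card / 2 ≤ F.card by omega)
  obtain ⟨J, hJF, hJ⟩ := Finset.exists_subset_card_eq (show F.card / 2 ≤ (F \ I).card by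
    rw [Finset.card_sdiff_of_subset hIF]; omega)
  let hds : Finset (List V) → Finset V := fun I =>
    (cov F).filter fun v => ∃ l ∈ I, l.head? = some v
  have hmemhds : ∀ {I : Finset (List V)}, I ⊆ F → ∀ v, v ∈ hds I ↔ ∃ l ∈ I, l.head? = some v := by
    intro I hI v
    simp only [hds, Finset.mem_filter, mem_cov, and_iff_right_iff_imp]
    rintro ⟨l, hl, hv⟩
    exact ⟨l, hI hl, List.mem_of_head? hv⟩
  have hdscard : ∀ I ⊆ F, I.card ≤ (hds I).card := by
    intro I hI
    refine Finset.card_le_card_of_forall_subsingleton (fun l v => l.head? = some v)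
      (fun l hl => ?_) fun v _ l hl l' hl' => ?_
    · have := h.len l (hI hl)
      cases l with
      | nil => simp at this
      | cons x t => exact ⟨x, (hmemhds hI x).2 ⟨_, hl, rfl⟩, rfl⟩
    · exact h.lin.disj l (hI hl.1) l' (hI hl'.1) v (List.mem_of_head? hl.2)
        (List.mem_of_head? hl'.2)
  replace hJF : J ⊆ F ∧ Disjoint I J :=
    ⟨hJF.trans Finset.sdiff_subset, Finset.disjoint_of_subset_right hJF Finset.disjoint_sdiff⟩
  obtain ⟨hJF, hIJ⟩ := hJF
  have hdscov : ∀ {I}, I ⊆ F → hds I ⊆ cov F := fun _ => Finset.filter_subset _ _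
  have hdslive : ∀ {I}, I ⊆ F → hds I ⊆ live A F := fun hI v hv => by
    obtain ⟨l, hl, hv⟩ := (hmemhds hI v).1 hv
    exact Finset.mem_union_right _ (mem_pathEnds.2 ⟨l, hI hl, Or.inl hv⟩)
  have hreach : ∀ I ⊆ F, I.card = F.card / 2 →
      Fintype.card V ≤ 4 * (levels (relImg st) (hds I) t).card := by
    intro I hI hIc
    rcases (card_levels (N := Fintype.card V) (hdslive hI) (fun u v huv => hC'live (hstC u v huv))
      hgrow (by have := hyp.le_cap; omega) t).2 with h1 | h1
    · have h2 := hdscard I hI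
      rw [hIc] at h2
      have := Nat.mul_le_mul_left (3 ^ t) h2
      omega
    · exact h1
  have hdisjXY : Disjoint (hds I) (hds J) := by
    rw [Finset.disjoint_left]
    intro v hv hv'
    obtain ⟨l, hl, h1⟩ := (hmemhds hIF v).1 hv
    obtain ⟨l', hl', h2⟩ := (hmemhds hJF v).1 hv'
    have := h.lin.disj l (hIF hl) l' (hJF hl') v (List.mem_of_head? h1) (List.mem_of_head? h2)
    exact Finset.disjoint_left.1 hIJ hl (this ▸ hl')
  have hC'cov : ∀ v ∈ C', v ∉ cov F := fun v hv => (Finset.mem_sdiff.1 hv).2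
  obtain ⟨x, hx, y, hy, hxy⟩ := exists_meet hyp.cap_le hyp.four_le hyp.large
    (hreach I hIF hI) (hreach J hJF hJ)
  obtain ⟨L₁, c₁, ⟨x₀, hx₀, e₁⟩, g₁, n₁⟩ := exists_chain_of_mem_levels hx
  obtain ⟨L₂, c₂, ⟨y₀, hy₀, e₂⟩, g₂, n₂⟩ := exists_chain_of_mem_levels hy
  have hL₂ : ∃ L : List V, L.IsChain (fun a b => st a b ∧ a ≠ b) ∧ L.head? = some y₀ ∧
      (∃ y', L.getLast? = some y' ∧ K.Adj x y') ∧ L.length ≤ t + 1 := by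
    rcases hxy with rfl | hxy
    · rcases List.eq_nil_or_concat L₂ with rfl | ⟨L, z, rfl⟩
      · simp at g₂
      rw [List.concat_eq_append] at *
      obtain rfl : z = x := by simpa using g₂
      rcases L.eq_nil_or_concat with rfl | ⟨L', w, rfl⟩
      · obtain rfl : z = y₀ := by simpa using e₂
        exfalso
        rcases List.eq_nil_or_concat L₁ with rfl | ⟨L, z', rfl⟩
        · simp at g₁
        rw [List.concat_eq_append] at *
        obtain rfl : z' = z := by simpa using g₁
        rcases L.eq_nil_or_concat with rfl | ⟨L', w, rfl⟩
        · obtain rfl : z' = x₀ := by simpa using e₁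
          exact Finset.disjoint_left.1 hdisjXY hx₀ hy₀
        · rw [List.concat_eq_append, List.append_assoc] at c₁
          have h1 := (List.isChain_append.1 c₁).2.1
          simp only [List.cons_append, List.nil_append, List.isChain_pair] at h1
          exact hC'cov _ (hstC _ _ h1.1) (hdscov hJF hy₀)
      · rw [List.concat_eq_append] at *
        have h1 := c₂
        rw [List.append_assoc] at h1
        have h1 := (List.isChain_append.1 h1).2.1
        simp only [List.cons_append, List.nil_append, List.isChain_pair] at h1
        refine ⟨L' ++ [w], (List.isChain_append.1 c₂).1, ?_, ⟨w, by simp, (hstK _ _ h1).2.symm⟩, ?_⟩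
        · rwa [List.head?_append_of_ne_nil _ (by simp)] at e₂
        · simp only [List.length_append, List.length_cons, List.length_nil] at n₂ ⊢
          omega
    · exact ⟨L₂, c₂, e₂, ⟨y, g₂, hxy⟩, n₂⟩
  obtain ⟨L₃, c₃, e₃, ⟨y', g₃, hadj⟩, n₃⟩ := hL₂
  obtain ⟨a, ha, b, hb, m, hmn, hmC, hmc, hml, hmp⟩ := exists_link (X := (hds I : Set V))
    (Y := (hds J : Set V)) (C := (C' : Set V)) (by exact_mod_cast hdisjXY)
    (Set.disjoint_left.2 fun v hv hv' => hC'cov v hv' (hdscov hJF hv)) hstK c₁ c₃ e₁ hx₀ e₃ hy₀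
    g₁ g₃ hadj
  obtain ⟨la, hla, hlaa⟩ := (hmemhds hIF a).1 ha
  obtain ⟨lb, hlb, hlbb⟩ := (hmemhds hJF b).1 hb
  have hne : la ≠ lb := fun heq => Finset.disjoint_left.1 hIJ hla (heq ▸ hlb)
  have hlaF := hIF hla
  have hlbF := hJF hlb
  set F₀ := (F.erase la).erase lb with hF₀
  have hF₀F : F₀ ⊆ F := (Finset.erase_subset _ _).trans (Finset.erase_subset _ _)
  have hmF₀ : ∀ l, l ∈ F₀ ↔ l ∈ F ∧ l ≠ la ∧ l ≠ lb := fun l => by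
    simp only [hF₀, Finset.mem_erase]; tauto
  set l := la.reverse ++ m ++ lb with hl
  have hmcov : ∀ v ∈ m, v ∉ cov F := fun v hv => hC'cov v (hmC v hv)
  have hmnot : ∀ v ∈ m, ∀ l' ∈ F, v ∉ l' := fun v hv l' hl' hvl => hmcov v hv
    (mem_cov.2 ⟨l', hl', hvl⟩)
  have hlmem : ∀ v, v ∈ l ↔ v ∈ la ∨ v ∈ m ∨ v ∈ lb := fun v => by
    simp [hl]
  have hln : l.Nodup := nodup_join (h.lin.nodup la hlaF) (h.lin.nodup lb hlbF) hmn
    (fun v hv hv' => hne (h.lin.disj la hlaF lb hlbF v hv hv'))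
    (fun v hv => hmnot v hv la hlaF) (fun v hv => hmnot v hv lb hlbF)
  have hlF₀ : ∀ l' ∈ F₀, ∀ v ∈ l, v ∉ l' := by
    intro l' hl' v hv hvl'
    obtain ⟨h1, h2, h3⟩ := (hmF₀ l').1 hl'
    rcases (hlmem v).1 hv with hv | hv | hv
    · exact h2 (h.lin.disj _ h1 _ hlaF v hvl' hv)
    · exact hmnot v hv l' h1 hvl'
    · exact h3 (h.lin.disj _ h1 _ hlbF v hvl' hv)
  have hlen_a := h.len la hlaF
  have hlen_b := h.len lb hlbF
  have hlnot : l ∉ F₀ := fun hmem => by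
    cases hlal : la with
    | nil => simp [hlal] at hlen_a
    | cons z r => exact hlF₀ l hmem z ((hlmem z).2 (Or.inl (by simp [hlal])))
                    ((hlmem z).2 (Or.inl (by simp [hlal])))
  have hcov' : ∀ v, v ∈ cov (insert l F₀) ↔ v ∈ cov F ∨ v ∈ m := by
    intro v
    simp only [mem_cov, Finset.mem_insert]
    constructor
    · rintro ⟨l', rfl | hl', hv⟩
      · rcases (hlmem v).1 hv with hv | hv | hv
        exacts [Or.inl ⟨la, hlaF, hv⟩, Or.inr hv, Or.inl ⟨lb, hlbF, hv⟩]
      · exact Or.inl ⟨l', hF₀F hl', hv⟩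
    · rintro (⟨l', hl', hv⟩ | hv)
      · by_cases h1 : l' = la
        · exact ⟨l, Or.inl rfl, (hlmem v).2 (Or.inl (h1 ▸ hv))⟩
        · by_cases h2 : l' = lb
          · exact ⟨l, Or.inl rfl, (hlmem v).2 (Or.inr (Or.inr (h2 ▸ hv)))⟩
          · exact ⟨l', Or.inr ((hmF₀ l').2 ⟨hl', h1, h2⟩), hv⟩
      · exact ⟨l, Or.inl rfl, (hlmem v).2 (Or.inr (Or.inl hv))⟩
  have hmℓ : m.length ≤ 2 * t := by omega
  have hcard' : (cov (insert l F₀) \ cov F).card ≤ 2 * t := by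
    refine le_trans (Finset.card_le_card (t := m.toFinset) fun v hv => ?_)
      ((List.toFinset_card_le m).trans hmℓ)
    obtain ⟨h1, h2⟩ := Finset.mem_sdiff.1 hv
    exact List.mem_toFinset.2 (((hcov' v).1 h1).resolve_left h2)
  have hlhead : l.head? = la.getLast? := by
    rw [hl, List.append_assoc, List.head?_append_of_ne_nil _ (by
      intro h0; rw [List.reverse_eq_nil_iff] at h0; simp [h0] at hlen_a), List.head?_reverse]
  have hllast : l.getLast? = lb.getLast? := by
    rw [hl, List.getLast?_append_of_ne_nil _ (by intro h0; simp [h0] at hlen_b)]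
  have hends : ∀ v ∈ pathEnds (insert l F₀), v ∈ pathEnds F ∧ v ≠ a ∧ v ≠ b := by
    have key : ∀ {r : List V} {z : V}, r.Nodup → 2 ≤ r.length → r.head? = some z →
        r.getLast? ≠ some z := by
      intro r z hr hrl hz hz'
      match r, hrl with
      | c :: d :: r, _ =>
        obtain rfl : c = z := by simpa using hz
        rw [List.getLast?_cons_cons] at hz'
        exact (List.nodup_cons.1 hr).1 (List.mem_of_getLast? hz')
    have haL := List.mem_of_head? hlaa
    have hbL := List.mem_of_head? hlbb
    intro v hv
    obtain ⟨l', hl', hv⟩ := mem_pathEnds.1 hv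
    rcases Finset.mem_insert.1 hl' with rfl | hl'
    · rw [hlhead, hllast] at hv
      rcases hv with hv | hv
      · refine ⟨mem_pathEnds.2 ⟨la, hlaF, Or.inr hv⟩, ?_, ?_⟩
        · rintro rfl
          exact key (h.lin.nodup la hlaF) hlen_a hlaa hv
        · rintro rfl
          exact hne (h.lin.disj la hlaF lb hlbF v (List.mem_of_getLast? hv) hbL)
      · refine ⟨mem_pathEnds.2 ⟨lb, hlbF, Or.inr hv⟩, ?_, ?_⟩
        · rintro rfl
          exact hne (h.lin.disj la hlaF lb hlbF v haL (List.mem_of_getLast? hv))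
        · rintro rfl
          exact key (h.lin.nodup lb hlbF) hlen_b hlbb hv
    · obtain ⟨h1, h2, h3⟩ := (hmF₀ l').1 hl'
      have hvl' : v ∈ l' := hv.elim List.mem_of_head? List.mem_of_getLast?
      refine ⟨mem_pathEnds.2 ⟨l', h1, hv⟩, ?_, ?_⟩
      · rintro rfl
        exact h2 (h.lin.disj l' h1 la hlaF v hvl' haL)
      · rintro rfl
        exact h3 (h.lin.disj l' h1 lb hlbF v hvl' hbL)
  have hlive : ∀ v ∈ live A (insert l F₀), v ∈ live A F ∧ v ∉ m ∧ v ≠ a ∧ v ≠ b := by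
    have hac : a ∈ cov F := hdscov hIF ha
    have hbc : b ∈ cov F := hdscov hJF hb
    intro v hv
    rcases Finset.mem_union.1 hv with hv | hv
    · obtain ⟨h1, h2⟩ := Finset.mem_sdiff.1 hv
      rw [hcov'] at h2
      push Not at h2
      refine ⟨Finset.mem_union_left _ (Finset.mem_sdiff.2 ⟨h1, h2.1⟩), h2.2, ?_, ?_⟩
      · rintro rfl; exact h2.1 hac
      · rintro rfl; exact h2.1 hbc
    · obtain ⟨h1, h2, h3⟩ := hends v hv
      exact ⟨Finset.mem_union_right _ h1, fun hvm => hmcov v hvm (pathEnds_subset F h1), h2, h3⟩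
  have hKM : K ≤ K ⊔ SimpleGraph.fromEdgeSet ↑M := le_sup_left
  refine ⟨insert l F₀, ⟨?_, ?_, ?_, ?_, ?_⟩, ?_, hcard'⟩
  · refine h.lin.insert hF₀F hln ?_ hlF₀
    exact isChain_join (h.lin.chain la hlaF) (h.lin.chain lb hlbF) hlaa hlbb
      (hmc.imp fun _ _ huv => hKM huv)
  · intro l' hl'
    rcases Finset.mem_insert.1 hl' with rfl | hl'
    · simp only [hl, List.length_append, List.length_reverse]
      omega
    · exact h.len l' (hF₀F hl')
  · intro e he
    obtain ⟨l', hl', hel⟩ := h.edge e he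
    by_cases h1 : l' = la
    · exact ⟨l, Finset.mem_insert_self _ _, HasEdge.join (Or.inl (h1 ▸ hel))⟩
    · by_cases h2 : l' = lb
      · exact ⟨l, Finset.mem_insert_self _ _, HasEdge.join (Or.inr (h2 ▸ hel))⟩
      · exact ⟨l', Finset.mem_insert_of_mem ((hmF₀ l').2 ⟨hl', h1, h2⟩), hel⟩
  · intro v hv
    rcases (hcov' v).1 hv with hv | hv
    · exact h.sub hv
    · exact hCA (Finset.mem_sdiff.1 (hmC v hv)).1
  · intro S hS hSc
    have hSS : S ⊆ live A F := fun v hv => (hlive v (hS hv)).1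
    have h1 := hpcard (S ∩ Sm) Finset.inter_subset_right
    have h2 : 4 * (S \ Sm).card ≤ ((cl K (S \ Sm) ∩ C') \ cl K Sm).card := by
      rcases (S \ Sm).eq_empty_or_nonempty with h0 | hne
      · simp [h0]
      · refine (hmax _ (Finset.sdiff_subset.trans hSS) Finset.sdiff_disjoint hne ?_).le
        have := hyp.two_le
        have := Finset.card_le_card (Finset.sdiff_subset (s := S) (t := Sm))
        omega
    have h3 : (cl K (S \ Sm) ∩ m.toFinset).card ≤ (S \ Sm).card :=
      card_cl_inter_path_le hyp.cyc hyp.disj hmn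
        ((List.isChain_append.1 (List.isChain_cons.1 hmc).2).1) (by omega)
        (fun v hv => (Finset.mem_sdiff.1 (hmC v hv)).1)
        fun s hs => (hlive s (hS (Finset.mem_sdiff.1 hs).1)).2.1
    set P := ((S ∩ Sm) ×ˢ (Finset.univ : Finset (Fin 3))).image fun x => p x.1 x.2 with hP
    set Q := ((cl K (S \ Sm) ∩ C') \ cl K Sm) \ (cl K (S \ Sm) ∩ m.toFinset) with hQ
    have hQc : 3 * (S \ Sm).card ≤ Q.card := by
      have := Finset.le_card_sdiff (cl K (S \ Sm) ∩ m.toFinset) ((cl K (S \ Sm) ∩ C') \ cl K Sm)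
      rw [← hQ] at this
      omega
    have hPmem : ∀ v ∈ P, v ∈ cl K S ∧ v ∈ C' ∧ v ∉ m ∧ v ∈ cl K Sm := by
      intro v hv
      obtain ⟨⟨s, i⟩, hs, rfl⟩ := Finset.mem_image.1 hv
      obtain ⟨hsS, hsm⟩ := Finset.mem_inter.1 (Finset.mem_product.1 hs).1
      refine ⟨mem_cl.2 ⟨s, hsS, hpcl s hsm i⟩, hpC s hsm i, fun hvm => ?_, hpclS s hsm i⟩
      obtain ⟨u, hu, huv, -⟩ := hmp _ hvm
      obtain ⟨-, hsm', hsa, hsb⟩ := hlive s (hS hsS)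
      rcases huv with ⟨huS, i', heq⟩ | ⟨_, _, hn, _⟩
      · obtain ⟨rfl, -⟩ := hpinj s hsm u huS i i' heq
        rcases hu with hu | hu | hu
        exacts [hsm' hu, hsa hu, hsb hu]
      · exact hn (hpclS s hsm i)
    have hQmem : ∀ v ∈ Q, v ∈ cl K S ∧ v ∈ C' ∧ v ∉ m ∧ v ∉ cl K Sm := by
      intro v hv
      simp only [hQ, Finset.mem_sdiff, Finset.mem_inter, List.mem_toFinset] at hv
      exact ⟨cl_mono le_rfl Finset.sdiff_subset hv.1.1.1, hv.1.1.2,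
        fun hvm => hv.2 ⟨hv.1.1.1, hvm⟩, hv.1.2⟩
    have hdisj : Disjoint P Q := Finset.disjoint_left.2 fun v hv hv' =>
      (hQmem v hv').2.2.2 (hPmem v hv).2.2.2
    have hsub : P ∪ Q ⊆ cl K S ∩ (C \ cov (insert l F₀)) := by
      have : ∀ v, v ∈ cl K S ∧ v ∈ C' ∧ v ∉ m → v ∈ cl K S ∩ (C \ cov (insert l F₀)) := by
        rintro v ⟨h1, h2, h3⟩
        refine Finset.mem_inter.2 ⟨h1, Finset.mem_sdiff.2 ⟨(Finset.mem_sdiff.1 h2).1, ?_⟩⟩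
        rw [hcov']
        exact not_or.2 ⟨hC'cov v h2, h3⟩
      intro v hv
      rcases Finset.mem_union.1 hv with hv | hv
      · obtain ⟨h1, h2, h3, -⟩ := hPmem v hv
        exact this v ⟨h1, h2, h3⟩
      · obtain ⟨h1, h2, h3, -⟩ := hQmem v hv
        exact this v ⟨h1, h2, h3⟩
    have h4 := Finset.card_le_card hsub
    rw [Finset.card_union_of_disjoint hdisj, h1] at h4
    have h5 : (S ∩ Sm).card + (S \ Sm).card = S.card := Finset.card_inter_add_card_sdiff S Sm
    omega
  · rw [Finset.card_insert_of_notMem hlnot, hF₀, Finset.card_erase_of_mem, Finset.card_erase_of_mem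
      hlaF]
    · have h1 : 2 ≤ F.card := by
        rw [← Finset.card_pair hne]
        exact Finset.card_le_card (by intro z hz; simp at hz; rcases hz with rfl | rfl <;> assumption)
      omega
    · exact Finset.mem_erase.2 ⟨fun h => hne h.symm, hlbF⟩

end LinkStep

section LinkIterate

variable {V : Type*} [DecidableEq V] [Fintype V]

lemma LinkState.exists_few {K : SimpleGraph V} {M : Finset (Sym2 V)} {A C X : Finset V}
    {μ cap w ℓ m : ℕ} {t : ℕ → ℕ} (hyp : LinkHyp K C X μ cap w ℓ) (hCA : C ⊆ A) :
    ∀ {F : Finset (List V)}, LinkState K M A C μ F →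
    (∀ k ∈ Finset.Ioc m F.card,
      2 * t k + 1 ≤ ℓ ∧ Fintype.card V ≤ 4 * (3 ^ t k * (k / 2))) →
    (Finset.univ \ (C \ cov F)).card + ∑ k ∈ Finset.Ioc m F.card, 2 * t k ≤ w →
    ∃ F', LinkState K M A C μ F' ∧ F'.card ≤ m ∧ (Finset.univ \ (C \ cov F')).card ≤ w := by
  suffices H : ∀ n, ∀ F : Finset (List V), F.card = n → LinkState K M A C μ F →
      (∀ k ∈ Finset.Ioc m F.card,
        2 * t k + 1 ≤ ℓ ∧ Fintype.card V ≤ 4 * (3 ^ t k * (k / 2))) →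
      (Finset.univ \ (C \ cov F)).card + ∑ k ∈ Finset.Ioc m F.card, 2 * t k ≤ w →
      ∃ F', LinkState K M A C μ F' ∧ F'.card ≤ m ∧ (Finset.univ \ (C \ cov F')).card ≤ w from
    fun {F} => H _ F rfl
  intro n
  induction n with
  | zero => exact fun F hF h _ hw => ⟨F, h, by omega, by omega⟩
  | succ n ih =>
    intro F hF h ht hw
    by_cases hm : F.card ≤ m
    · exact ⟨F, h, hm, by omega⟩
    obtain ⟨h1, h2⟩ := ht F.card (Finset.mem_Ioc.2 ⟨by omega, le_rfl⟩)
    obtain ⟨F', hF', hc, hd⟩ := h.exists_step hyp hCA h1 (by omega) h2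
    have hcard : F'.card = n := by omega
    have hins : Finset.Ioc m F.card = insert F.card (Finset.Ioc m F'.card) := by
      ext k
      simp only [Finset.mem_Ioc, Finset.mem_insert]
      omega
    rw [hins, Finset.sum_insert (by simp only [Finset.mem_Ioc]; omega)] at hw
    refine ih F' hcard hF' (fun k hk => ht k ?_) ?_
    · rw [hins]
      exact Finset.mem_insert_of_mem hk
    · have h3 : Finset.univ \ (C \ cov F') ⊆ (Finset.univ \ (C \ cov F)) ∪ (cov F' \ cov F) := by
        intro v
        simp only [Finset.mem_sdiff, Finset.mem_union, Finset.mem_univ, true_and]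
        tauto
      have h4 := (Finset.card_le_card h3).trans (Finset.card_union_le _ _)
      omega

end LinkIterate

section Posa

variable {V : Type*}

lemma infix_append_iff {l₁ l₃ : List V} {w z a b : V} (hz : l₃.head? = some z) :
    [a, b] <:+: l₁ ++ w :: l₃ ↔
      [a, b] <:+: l₁ ++ [w] ∨ (a = w ∧ b = z) ∨ [a, b] <:+: l₃ := by
  obtain ⟨t, rfl⟩ : ∃ t, l₃ = z :: t := by
    cases l₃ with
    | nil => simp at hz
    | cons c t => exact ⟨t, by simp at hz; rw [hz]⟩
  clear hz
  induction l₁ with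
  | nil => simp [List.infix_cons_iff (l₂ := z :: t), List.infix_cons_iff (l₂ := ([] : List V)),
      List.prefix_cons_iff]
  | cons c l₁ ih =>
    rw [List.cons_append, List.infix_cons_iff, ih, List.cons_append,
      List.infix_cons_iff (l₂ := l₁ ++ [w])]
    have : [a, b] <+: c :: (l₁ ++ w :: z :: t) ↔ [a, b] <+: c :: (l₁ ++ [w]) := by
      cases l₁ <;> simp [List.prefix_cons_iff]
    rw [this]
    tauto

lemma hasEdge_append_iff {l₁ l₃ : List V} {w z : V} {e : Sym2 V} (hz : l₃.head? = some z) :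
    HasEdge (l₁ ++ w :: l₃) e ↔ HasEdge (l₁ ++ [w]) e ∨ e = s(w, z) ∨ HasEdge l₃ e := by
  constructor
  · rintro ⟨a, b, rfl, h⟩
    rcases (infix_append_iff hz).1 h with h | ⟨rfl, rfl⟩ | h
    exacts [Or.inl ⟨a, b, rfl, h⟩, Or.inr (Or.inl rfl), Or.inr (Or.inr ⟨a, b, rfl, h⟩)]
  · rintro (⟨a, b, rfl, h⟩ | rfl | ⟨a, b, rfl, h⟩)
    exacts [⟨a, b, rfl, (infix_append_iff hz).2 (Or.inl h)⟩,
      ⟨w, z, rfl, (infix_append_iff hz).2 (Or.inr (Or.inl ⟨rfl, rfl⟩))⟩,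
      ⟨a, b, rfl, (infix_append_iff hz).2 (Or.inr (Or.inr h))⟩]

lemma hasEdge_reverse_iff {l : List V} {e : Sym2 V} : HasEdge l.reverse e ↔ HasEdge l e :=
  ⟨fun h => by simpa using h.reverse, fun h => h.reverse⟩

/-- The list `l` is a path on `T` in `Γ ⊔ Mg` that traverses each edge of `Mg`. -/
structure HamPath (Γ Mg : SimpleGraph V) (T : Finset V) (l : List V) : Prop where
  nodup : l.Nodup
  mem : ∀ v, v ∈ l ↔ v ∈ T
  chain : l.IsChain (Γ ⊔ Mg).Adj
  edge : ∀ a b, Mg.Adj a b → HasEdge l s(a, b)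

lemma HamPath.reverse {Γ Mg : SimpleGraph V} {T : Finset V} {l : List V} (h : HamPath Γ Mg T l) :
    HamPath Γ Mg T l.reverse where
  nodup := List.nodup_reverse.2 h.nodup
  mem v := by rw [List.mem_reverse]; exact h.mem v
  chain := List.isChain_reverse.2 (h.chain.imp fun _ _ h => h.symm)
  edge a b hab := (h.edge a b hab).reverse

lemma HamPath.mono {Γ Γ' Mg : SimpleGraph V} {T : Finset V} {l : List V} (h : HamPath Γ Mg T l)
    (hΓ : Γ ≤ Γ') : HamPath Γ' Mg T l :=
  ⟨h.nodup, h.mem, h.chain.imp fun _ _ hab => sup_le_sup_right hΓ Mg hab, h.edge⟩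

/-- There is a cycle on `T` in `Γ ⊔ Mg` that traverses each edge of `Mg` and some edge of `Γ`. -/
def HasHamCycle (Γ Mg : SimpleGraph V) (T : Finset V) : Prop :=
  ∃ l a b, HamPath Γ Mg T l ∧ l.head? = some a ∧ l.getLast? = some b ∧ Γ.Adj b a

lemma HasHamCycle.mono {Γ Γ' Mg : SimpleGraph V} {T : Finset V} (h : HasHamCycle Γ Mg T)
    (hΓ : Γ ≤ Γ') : HasHamCycle Γ' Mg T := by
  obtain ⟨l, a, b, h1, h2, h3, h4⟩ := h
  exact ⟨l, a, b, h1.mono hΓ, h2, h3, hΓ h4⟩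

/-- The lists obtained from `l` by rotations that fix the first vertex. -/
inductive Rotated (Γ Mg : SimpleGraph V) (l : List V) : List V → Prop
  | refl : Rotated Γ Mg l l
  | step {l₁ l₃ : List V} {w z x : V} (h : Rotated Γ Mg l (l₁ ++ w :: l₃))
      (hz : l₃.head? = some z) (hx : l₃.getLast? = some x) (hadj : Γ.Adj x w)
      (hM : ¬ Mg.Adj w z) : Rotated Γ Mg l (l₁ ++ w :: l₃.reverse)

lemma Rotated.hamPath {Γ Mg : SimpleGraph V} {T : Finset V} {l l' : List V}
    (h : Rotated Γ Mg l l') (hl : HamPath Γ Mg T l) :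
    HamPath Γ Mg T l' ∧ l'.head? = l.head? := by
  induction h with
  | refl => exact ⟨hl, rfl⟩
  | @step l₁ l₃ w z x h hz hx hadj hM ih =>
    obtain ⟨ih, hh⟩ := ih
    have hp : (l₁ ++ w :: l₃.reverse).Perm (l₁ ++ w :: l₃) :=
      List.Perm.append_left _ (List.Perm.cons _ (List.reverse_perm l₃))
    have hx' : l₃.reverse.head? = some x := by rw [List.head?_reverse, hx]
    refine ⟨⟨hp.nodup_iff.2 ih.nodup, fun v => ?_, ?_, fun a b hab => ?_⟩, ?_⟩
    · rw [hp.mem_iff]; exact ih.mem v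
    · have h1 := ih.chain
      rw [List.isChain_append] at h1 ⊢
      obtain ⟨c1, c2, c3⟩ := h1
      refine ⟨c1, ?_, ?_⟩
      · rw [List.isChain_cons] at c2 ⊢
        refine ⟨fun y hy => ?_, List.isChain_reverse.2 (c2.2.imp fun _ _ h => h.symm)⟩
        rw [hx'] at hy
        obtain rfl : x = y := by simpa using hy
        exact Or.inl hadj.symm
      · simpa using c3
    · rcases (hasEdge_append_iff hz).1 (ih.edge a b hab) with h | h | h
      · exact (hasEdge_append_iff hx').2 (Or.inl h)
      · exfalso
        apply hM
        rw [Sym2.eq_iff] at h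
        rcases h with ⟨rfl, rfl⟩ | ⟨rfl, rfl⟩
        exacts [hab, hab.symm]
      · exact (hasEdge_append_iff hx').2 (Or.inr (Or.inr h.reverse))
    · rw [← hh]
      cases l₁ <;> simp

/-- The last vertices of the lists obtained from `l` by rotations. -/
def rotEnds (Γ Mg : SimpleGraph V) (l : List V) : Set V :=
  {x | ∃ l', Rotated Γ Mg l l' ∧ l'.getLast? = some x}

/-- Rotations do not alter the path around vertices away from the ends. -/
lemma Rotated.hasEdge_iff {Γ Mg : SimpleGraph V} {l l' : List V} {y u : V}
    (h : Rotated Γ Mg l l') (hy : y ∉ rotEnds Γ Mg l)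
    (hyn : ∀ x ∈ rotEnds Γ Mg l, ¬ HasEdge l s(y, x)) :
    HasEdge l' s(y, u) ↔ HasEdge l s(y, u) := by
  induction h generalizing u with
  | refl => rfl
  | @step l₁ l₃ w z x h hz hx hadj hM ih =>
    have hxE : x ∈ rotEnds Γ Mg l :=
      ⟨_, h, by rw [List.getLast?_append_of_ne_nil _ (by simp), List.getLast?_cons, hx]; rfl⟩
    have hzE : z ∈ rotEnds Γ Mg l := by
      refine ⟨_, Rotated.step h hz hx hadj hM, ?_⟩
      rw [List.getLast?_append_of_ne_nil _ (by simp), List.getLast?_cons, List.getLast?_reverse, hz]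
      rfl
    have hx' : l₃.reverse.head? = some x := by rw [List.head?_reverse, hx]
    have hyw : y ≠ w := by
      rintro rfl
      exact hyn z hzE (ih.1 ((hasEdge_append_iff hz).2 (Or.inr (Or.inl rfl))))
    rw [← ih, hasEdge_append_iff hz, hasEdge_append_iff hx', hasEdge_reverse_iff]
    have h1 : s(y, u) ≠ s(w, x) := by
      rw [Ne, Sym2.eq_iff]
      rintro (⟨h, -⟩ | ⟨h, -⟩)
      exacts [hyw h, hy (h ▸ hxE)]
    have h2 : s(y, u) ≠ s(w, z) := by
      rw [Ne, Sym2.eq_iff]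
      rintro (⟨h, -⟩ | ⟨h, -⟩)
      exacts [hyw h, hy (h ▸ hzE)]
    tauto

lemma infix_pair_unique_right {l : List V} (hn : l.Nodup) {a b b' : V} (h : [a, b] <:+: l)
    (h' : [a, b'] <:+: l) : b = b' := by
  induction l with
  | nil => simp at h
  | cons c l ih =>
    rw [List.nodup_cons] at hn
    rw [List.infix_cons_iff] at h h'
    have key : ∀ {b b' : V}, [a, b] <+: c :: l → [a, b'] <:+: l → False := by
      clear h h'
      intro b b' h h'
      rw [List.prefix_cons_iff] at h
      simp only [reduceCtorEq, List.cons.injEq, false_or] at h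
      obtain ⟨t, ⟨rfl, -⟩, -⟩ := h
      exact hn.1 (h'.subset (by simp))
    rcases h with h | h <;> rcases h' with h' | h'
    · rw [List.prefix_cons_iff] at h h'
      simp only [reduceCtorEq, List.cons.injEq, false_or] at h h'
      obtain ⟨t, ⟨rfl, rfl⟩, h⟩ := h
      obtain ⟨t', ⟨-, rfl⟩, h'⟩ := h'
      cases l with
      | nil => simp at h
      | cons d l =>
        rw [List.cons_prefix_cons] at h h'
        exact h.1.trans h'.1.symm
    · exact (key h h').elim
    · exact (key h' h).elim
    · exact ih hn.2 h h'

lemma infix_pair_unique_left {l : List V} (hn : l.Nodup) {a a' b : V} (h : [a, b] <:+: l)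
    (h' : [a', b] <:+: l) : a = a' :=
  infix_pair_unique_right (List.nodup_reverse.2 hn) (by simpa using List.reverse_infix.2 h)
    (by simpa using List.reverse_infix.2 h')

lemma not_infix_of_getLast? {l : List V} (hn : l.Nodup) {a b : V} (ha : l.getLast? = some a) :
    ¬ [a, b] <:+: l := by
  rintro ⟨p, q, rfl⟩
  rw [List.append_assoc, List.getLast?_append_of_ne_nil _ (by simp)] at ha
  have h1 : a ∈ b :: q := List.mem_of_getLast? (by simpa using ha)
  have h2 := (List.nodup_append.1 (by simpa using hn : (p ++ a :: b :: q).Nodup)).2.1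
  exact (List.nodup_cons.1 h2).1 h1

variable [Fintype V] [DecidableEq V]

omit [Fintype V] in
lemma card_path_neighbours {l : List V} (hn : l.Nodup) {E : Finset V} {x : V}
    (hx : l.getLast? = some x) (hxE : x ∈ E) {Y : Finset V}
    (hY : ∀ y ∈ Y, ∃ u ∈ E, HasEdge l s(y, u)) : Y.card + 1 ≤ 2 * E.card := by
  classical
  have h1 : (Y.filter fun y => ∃ u ∈ E, [u, y] <:+: l).card ≤ (E.erase x).card := by
    refine Finset.card_le_card_of_forall_subsingleton (fun y u => [u, y] <:+: l) (fun y hy => ?_)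
      fun u _ y hy y' hy' => infix_pair_unique_right hn hy.2 hy'.2
    obtain ⟨u, hu, h⟩ := (Finset.mem_filter.1 hy).2
    exact ⟨u, Finset.mem_erase.2 ⟨fun hux => not_infix_of_getLast? hn hx (hux ▸ h), hu⟩, h⟩
  have h2 : (Y.filter fun y => ∃ u ∈ E, [y, u] <:+: l).card ≤ E.card := by
    refine Finset.card_le_card_of_forall_subsingleton (fun y u => [y, u] <:+: l) (fun y hy => ?_)
      fun u _ y hy y' hy' => infix_pair_unique_left hn hy.2 hy'.2
    exact (Finset.mem_filter.1 hy).2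
  have h3 : Y ⊆ (Y.filter fun y => ∃ u ∈ E, [u, y] <:+: l) ∪
      (Y.filter fun y => ∃ u ∈ E, [y, u] <:+: l) := by
    intro y hy
    obtain ⟨u, hu, a, b, hab, h⟩ := hY y hy
    rw [Sym2.eq_iff] at hab
    rcases hab with ⟨rfl, rfl⟩ | ⟨rfl, rfl⟩
    · exact Finset.mem_union_right _ (Finset.mem_filter.2 ⟨hy, u, hu, h⟩)
    · exact Finset.mem_union_left _ (Finset.mem_filter.2 ⟨hy, u, hu, h⟩)
  have h4 := (Finset.card_le_card h3).trans (Finset.card_union_le _ _)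
  rw [Finset.card_erase_of_mem hxE] at h1
  have := Finset.card_pos.2 ⟨x, hxE⟩
  omega

/-- Sets of at most `k` vertices of `T` have at least twice as many outer neighbours in `T'`. -/
def Expands (Γ : SimpleGraph V) (T T' : Finset V) (k : ℕ) : Prop :=
  ∀ S ⊆ T, S.card ≤ k → 2 * S.card ≤ ((nbS Γ S ∩ T') \ S).card

lemma Expands.mono {Γ Γ' : SimpleGraph V} {T T' : Finset V} {k : ℕ} (h : Expands Γ T T' k)
    (hΓ : Γ ≤ Γ') : Expands Γ' T T' k := fun S hS hc => (h S hS hc).trans <|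
  Finset.card_le_card <| Finset.sdiff_subset_sdiff
    (Finset.inter_subset_inter_right (nbS_mono hΓ (Finset.Subset.refl S))) (Finset.Subset.refl S)

/-- **Pósa's lemma**, for paths traversing a given matching. -/
lemma HamPath.many_ends {Γ Mg : SimpleGraph V} {T T' : Finset V} {l : List V} {k : ℕ}
    (h : HamPath Γ Mg T l) (hl : l ≠ []) (hT' : T' ⊆ T) (hM : ∀ y ∈ T', ∀ z, ¬ Mg.Adj y z)
    (hexp : Expands Γ T T' k) :
    ∃ E : Finset V, k < E.card ∧ E ⊆ T ∧ ∀ x ∈ E, ∃ l', HamPath Γ Mg T l' ∧ l'.head? = l.head? ∧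
      l'.getLast? = some x := by
  classical
  set E := Finset.univ.filter fun x => x ∈ rotEnds Γ Mg l with hE
  have hmem : ∀ x, x ∈ E ↔ x ∈ rotEnds Γ Mg l := fun x => by simp [hE]
  have hlast : ∀ x ∈ E, ∃ l', HamPath Γ Mg T l' ∧ l'.head? = l.head? ∧ l'.getLast? = some x := by
    intro x hx
    obtain ⟨l', hr, hx⟩ := (hmem x).1 hx
    exact ⟨l', (hr.hamPath h).1, (hr.hamPath h).2, hx⟩
  have hET : E ⊆ T := fun x hx => by
    obtain ⟨l', hl', -, hx⟩ := hlast x hx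
    exact (hl'.mem x).1 (List.mem_of_getLast? hx)
  refine ⟨E, ?_, hET, hlast⟩
  by_contra! hk
  have h1 := hexp E hET hk
  obtain ⟨x₀, hx₀⟩ : ∃ x, l.getLast? = some x := ⟨_, List.getLast?_eq_getLast_of_ne_nil hl⟩
  have h2 := card_path_neighbours h.nodup hx₀ ((hmem x₀).2 ⟨l, Rotated.refl, hx₀⟩)
    (Y := (nbS Γ E ∩ T') \ E) (by
      intro y hy
      obtain ⟨hy, hyE⟩ := Finset.mem_sdiff.1 hy
      obtain ⟨hy, hyT⟩ := Finset.mem_inter.1 hy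
      obtain ⟨x, hx, hxy⟩ := mem_nbS.1 hy
      by_contra! hno
      obtain ⟨l', hr, hlx⟩ := (hmem x).1 hx
      have hl' := (hr.hamPath h).1
      obtain ⟨l₁, l₃, rfl⟩ := List.append_of_mem ((hl'.mem y).2 (hT' hyT))
      cases l₃ with
      | nil =>
        rw [List.getLast?_append_of_ne_nil _ (by simp)] at hlx
        obtain rfl : y = x := by simpa using hlx
        exact hyE hx
      | cons z l₃ =>
        rw [List.getLast?_append_of_ne_nil _ (by simp), List.getLast?_cons_cons] at hlx
        have hz : z ∈ rotEnds Γ Mg l := by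
          refine ⟨_, Rotated.step (z := z) hr (by simp) hlx hxy (hM y hyT z), ?_⟩
          rw [List.getLast?_append_of_ne_nil _ (by simp), List.getLast?_cons, List.getLast?_reverse]
          rfl
        refine hno z ((hmem z).2 hz) ((hr.hasEdge_iff (fun hy' => hyE ((hmem y).2 hy'))
          fun u hu => hno u ((hmem u).2 hu)).1 ⟨y, z, rfl, l₁, l₃, by simp⟩))
  omega

end Posa

section Defect

variable {V : Type*}

lemma isChain_iff_infix {R : V → V → Prop} {l : List V} :
    l.IsChain R ↔ ∀ a b, [a, b] <:+: l → R a b := by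
  constructor
  · intro h a b hab
    simpa using h.infix hab
  · intro h
    induction l with
    | nil => exact List.isChain_nil
    | cons c l ih =>
      refine List.isChain_cons.2 ⟨fun y hy => h c y ?_, ih fun a b hab => h a b ?_⟩
      · cases l with
        | nil => simp at hy
        | cons d l =>
          obtain rfl : d = y := by simpa using hy
          exact ⟨[], l, by simp⟩
      · exact hab.trans (List.suffix_cons c l).isInfix

lemma HasEdge.append_right {l₁ l₂ : List V} {e : Sym2 V} (h : HasEdge l₁ e) :
    HasEdge (l₁ ++ l₂) e := h.mono (List.prefix_append l₁ l₂).isInfix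

lemma HasEdge.append_left {l₁ l₂ : List V} {e : Sym2 V} (h : HasEdge l₂ e) :
    HasEdge (l₁ ++ l₂) e := h.mono (List.suffix_append l₁ l₂).isInfix

/-- A Hamilton cycle may be cut open at any edge outside of `Mg`. -/
lemma HamPath.cut {Γ Mg : SimpleGraph V} {T : Finset V} {p q : List V} {x y a b : V}
    (h : HamPath Γ Mg T (p ++ x :: y :: q)) (ha : (p ++ x :: y :: q).head? = some a)
    (hb : (p ++ x :: y :: q).getLast? = some b) (hba : Γ.Adj b a) (hxy : ¬ Mg.Adj x y) :
    HamPath Γ Mg T (y :: q ++ (p ++ [x])) := by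
  have hp : (y :: q ++ (p ++ [x])).Perm (p ++ x :: y :: q) := by
    refine List.perm_append_comm.trans ?_
    simp
  have hb' : (y :: q).getLast? = some b := by
    rwa [List.getLast?_append_of_ne_nil _ (by simp), List.getLast?_cons_cons] at hb
  have ha' : (p ++ [x]).head? = some a := by
    cases p <;> simpa using ha
  have hc : (p ++ [x] ++ y :: q).IsChain (Γ ⊔ Mg).Adj := by simpa using h.chain
  rw [List.isChain_append] at hc
  refine ⟨hp.nodup_iff.2 h.nodup, fun v => by rw [hp.mem_iff, h.mem], ?_, fun c d hcd => ?_⟩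
  · rw [List.isChain_append]
    refine ⟨hc.2.1, hc.1, fun u hu v hv => ?_⟩
    rw [hb'] at hu
    rw [ha'] at hv
    obtain rfl : b = u := by simpa using hu
    obtain rfl : a = v := by simpa using hv
    exact Or.inl hba
  · rcases (hasEdge_append_iff (z := y) (by simp)).1 (h.edge c d hcd) with h | h | h
    · exact h.append_left
    · exfalso
      apply hxy
      rw [Sym2.eq_iff] at h
      rcases h with ⟨rfl, rfl⟩ | ⟨rfl, rfl⟩
      exacts [hcd, hcd.symm]
    · exact h.append_right

variable [Fintype V] [DecidableEq V]

/-- The number of edges that have to be added to make `Γ` Hamiltonian. -/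
noncomputable def hamDefect (Γ Mg : SimpleGraph V) (T : Finset V) : ℕ :=
  sInf {k | ∃ W : Finset (Sym2 V), W.card = k ∧
    HasHamCycle (Γ ⊔ SimpleGraph.fromEdgeSet ↑W) Mg T}

variable {Γ Γ' Mg : SimpleGraph V} {T : Finset V}

omit [Fintype V] [DecidableEq V] in
lemma hamDefect_le {W : Finset (Sym2 V)}
    (h : HasHamCycle (Γ ⊔ SimpleGraph.fromEdgeSet ↑W) Mg T) : hamDefect Γ Mg T ≤ W.card :=
  Nat.sInf_le ⟨W, rfl, h⟩

omit [DecidableEq V] in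
lemma exists_hamDefect (h : HasHamCycle ⊤ Mg T) (Γ : SimpleGraph V) :
    ∃ W : Finset (Sym2 V), W.card = hamDefect Γ Mg T ∧
      HasHamCycle (Γ ⊔ SimpleGraph.fromEdgeSet ↑W) Mg T :=
  Nat.sInf_mem (s := {k | ∃ W : Finset (Sym2 V), W.card = k ∧
    HasHamCycle (Γ ⊔ SimpleGraph.fromEdgeSet ↑W) Mg T})
    ⟨_, Finset.univ, rfl, h.mono fun a b hab => Or.inr (by simpa using hab)⟩

omit [DecidableEq V] in
lemma hamDefect_anti (h : HasHamCycle ⊤ Mg T) (hΓ : Γ ≤ Γ') :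
    hamDefect Γ' Mg T ≤ hamDefect Γ Mg T := by
  obtain ⟨W, hW, hc⟩ := exists_hamDefect h Γ
  rw [← hW]
  exact hamDefect_le (hc.mono (sup_le_sup_right hΓ _))

omit [DecidableEq V] in
lemma hasHamCycle_of_hamDefect (h : HasHamCycle ⊤ Mg T) (h0 : hamDefect Γ Mg T = 0) :
    HasHamCycle Γ Mg T := by
  obtain ⟨W, hW, hc⟩ := exists_hamDefect h Γ
  rw [h0, Finset.card_eq_zero] at hW
  subst hW
  exact hc.mono (by simp)

omit [Fintype V] in
lemma exists_hamPath_of_closing {W : Finset (Sym2 V)} {l : List V} {a b : V}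
    (h : HamPath (Γ ⊔ SimpleGraph.fromEdgeSet ↑W) Mg T l) (hl : 3 ≤ l.length)
    (ha : l.head? = some a) (hb : l.getLast? = some b)
    (hab : (Γ ⊔ SimpleGraph.fromEdgeSet ↑W).Adj b a) (hn : ¬ Γ.Adj b a) :
    s(b, a) ∈ W ∧ HamPath (Γ ⊔ SimpleGraph.fromEdgeSet ↑(W.erase s(b, a))) Mg T l := by
  refine ⟨?_, h.nodup, h.mem, isChain_iff_infix.2 fun x y hxy => ?_, h.edge⟩
  · have := hab.resolve_left hn
    simp only [SimpleGraph.fromEdgeSet_adj] at this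
    exact this.1
  · have hne : s(x, y) ≠ s(b, a) := by
      rw [Ne, Sym2.eq_iff]
      rintro (⟨rfl, -⟩ | ⟨rfl, rfl⟩)
      · exact not_infix_of_getLast? h.nodup hb hxy
      · obtain ⟨p, q, rfl⟩ := hxy
        cases p with
        | nil =>
          cases q with
          | nil => simp at hl
          | cons c q =>
            rw [List.getLast?_append_of_ne_nil _ (by simp)] at hb
            have h1 := h.nodup
            simp only [List.nil_append, List.cons_append, List.nodup_cons] at h1
            exact h1.2.1 (List.mem_of_getLast? hb)
        | cons c p =>
          obtain rfl : c = x := by simpa using ha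
          have h1 := h.nodup
          simp at h1
    rcases isChain_iff_infix.1 h.chain x y hxy with (h1 | h1) | h1
    · exact Or.inl (Or.inl h1)
    · refine Or.inl (Or.inr ?_)
      simp only [SimpleGraph.fromEdgeSet_adj, Finset.coe_erase, Set.mem_sdiff,
        Set.mem_singleton_iff] at h1 ⊢
      exact ⟨⟨h1.1, hne⟩, h1.2⟩
    · exact Or.inr h1

lemma exists_hamPath_of_hamDefect_pos (h : HasHamCycle ⊤ Mg T) (hT : 3 ≤ T.card)
    (h0 : 0 < hamDefect Γ Mg T) : ∃ W : Finset (Sym2 V), W.card < hamDefect Γ Mg T ∧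
      ∃ l, HamPath (Γ ⊔ SimpleGraph.fromEdgeSet ↑W) Mg T l ∧ l ≠ [] := by
  obtain ⟨W, hW, l, a, b, hl, ha, hb, hba⟩ := exists_hamDefect h Γ
  have hlen : ∀ {l}, HamPath (Γ ⊔ SimpleGraph.fromEdgeSet ↑W) Mg T l → 3 ≤ l.length := by
    intro l hl
    have : l.toFinset = T := by ext v; rw [List.mem_toFinset, hl.mem]
    rwa [← List.toFinset_card_of_nodup hl.nodup, this]
  suffices H : ∃ l a b, HamPath (Γ ⊔ SimpleGraph.fromEdgeSet ↑W) Mg T l ∧ l.head? = some a ∧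
      l.getLast? = some b ∧ (Γ ⊔ SimpleGraph.fromEdgeSet ↑W).Adj b a ∧ ¬ Γ.Adj b a by
    obtain ⟨l, a, b, hl, ha, hb, hba, hn⟩ := H
    obtain ⟨h1, h2⟩ := exists_hamPath_of_closing hl (hlen hl) ha hb hba hn
    refine ⟨_, ?_, l, h2, ?_⟩
    · rw [← hW]; exact Finset.card_erase_lt_of_mem h1
    · rintro rfl; simp at ha
  by_cases hn : Γ.Adj b a
  · have hnc : ¬ l.IsChain (Γ ⊔ Mg).Adj := by
      intro hc
      have : HasHamCycle (Γ ⊔ SimpleGraph.fromEdgeSet ↑(∅ : Finset (Sym2 V))) Mg T :=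
        HasHamCycle.mono ⟨l, a, b, ⟨hl.nodup, hl.mem, hc, hl.edge⟩, ha, hb, hn⟩ le_sup_left
      have := hamDefect_le this
      rw [Finset.card_empty] at this
      omega
    rw [isChain_iff_infix] at hnc
    push Not at hnc
    obtain ⟨x, y, hxy, hnxy⟩ := hnc
    have hadj := isChain_iff_infix.1 hl.chain x y hxy
    obtain ⟨p, q, rfl⟩ := hxy
    rw [show p ++ [x, y] ++ q = p ++ x :: y :: q by simp] at *
    refine ⟨_, y, x, hl.cut ha hb hba fun hM => hnxy (Or.inr hM), by simp, ?_, ?_,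
      fun h => hnxy (Or.inl h)⟩
    · rw [← List.append_assoc, List.getLast?_append_of_ne_nil _ (by simp)]; rfl
    · rcases hadj with h1 | h1
      exacts [h1, (hnxy (Or.inr h1)).elim]
  · exact ⟨l, a, b, hl, ha, hb, hba, hn⟩

lemma card_boosters {T' L : Finset V} {k : ℕ} {Ω : Finset (Sym2 V)} (h : HasHamCycle ⊤ Mg T)
    (hT : 3 ≤ T.card) (hT' : T' ⊆ T) (hM : ∀ y ∈ T', ∀ z, ¬ Mg.Adj y z)
    (hexp : Expands Γ T T' k) (hΩ : ∀ a b, a ≠ b → a ∉ L → b ∉ L → s(a, b) ∈ Ω)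
    (h0 : 0 < hamDefect Γ Mg T) {D : Sym2 V → Prop} [DecidablePred D]
    (hD : ∀ e, hamDefect (Γ ⊔ SimpleGraph.fromEdgeSet {e}) Mg T < hamDefect Γ Mg T → D e) :
    (k - L.card) * (k - L.card) ≤ 2 * (Ω.filter D).card := by
  classical
  obtain ⟨W, hW, l, hl, hne⟩ := exists_hamPath_of_hamDefect_pos h hT h0
  set Γ₁ := Γ ⊔ SimpleGraph.fromEdgeSet (↑W : Set (Sym2 V)) with hΓ₁
  have hexp₁ : Expands Γ₁ T T' k := hexp.mono le_sup_left
  obtain ⟨E, hEk, hET, hE⟩ := hl.many_ends hne hT' hM hexp₁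
  have hsecond : ∀ t ∈ E, ∃ E' : Finset V, k < E'.card ∧ ∀ u ∈ E', u ≠ t ∧
      hamDefect (Γ ⊔ SimpleGraph.fromEdgeSet {s(t, u)}) Mg T < hamDefect Γ Mg T := by
    intro t ht
    obtain ⟨l', hl', -, hlast⟩ := hE t ht
    have hne' : l'.reverse ≠ [] := by
      intro h0
      rw [List.reverse_eq_nil_iff] at h0
      simp [h0] at hlast
    obtain ⟨E', hEk', -, hE'⟩ := hl'.reverse.many_ends hne' hT' hM hexp₁
    refine ⟨E', hEk', fun u hu => ?_⟩
    obtain ⟨l'', hl'', hhead, hlast'⟩ := hE' u hu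
    rw [List.head?_reverse, hlast] at hhead
    have hut : u ≠ t := by
      rintro rfl
      have h1 : l''.toFinset = T := by ext v; rw [List.mem_toFinset, hl''.mem]
      have h2 := List.toFinset_card_of_nodup hl''.nodup
      rw [h1] at h2
      match l'', hhead, hlast', hl''.nodup, h2 with
      | [c], _, _, _, h2 => simp at h2; omega
      | c :: d :: r, hh, hl, hn, _ =>
        obtain rfl : c = u := by simpa using hh
        rw [List.getLast?_cons_cons] at hl
        exact (List.nodup_cons.1 hn).1 (List.mem_of_getLast? hl)
    refine ⟨hut, lt_of_le_of_lt (hamDefect_le (W := W) ⟨l'', t, u, hl''.mono ?_, hhead, hlast', ?_⟩)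
      hW⟩
    · exact sup_le_sup_right le_sup_left _
    · refine Or.inl (Or.inr ?_)
      simp [hut, Sym2.eq_swap]
  choose! E' hE'k hE' using hsecond
  set P := (E \ L).sigma fun t => E' t \ L with hP
  have hcard : (k - L.card) * (k - L.card) ≤ P.card := by
    rw [hP, Finset.card_sigma]
    calc (k - L.card) * (k - L.card) ≤ (E \ L).card * (k - L.card) := by
          have := Finset.le_card_sdiff L E
          exact Nat.mul_le_mul_right _ (by omega)
      _ = ∑ t ∈ E \ L, (k - L.card) := by rw [Finset.sum_const, smul_eq_mul]
      _ ≤ _ := Finset.sum_le_sum fun t ht => by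
          have := Finset.le_card_sdiff L (E' t)
          have := hE'k t (Finset.mem_sdiff.1 ht).1
          omega
  have hmaps : ∀ x ∈ P, s(x.1, x.2) ∈ Ω.filter D := by
    rintro ⟨t, u⟩ hx
    obtain ⟨ht, hu⟩ := Finset.mem_sigma.1 hx
    obtain ⟨ht, htL⟩ := Finset.mem_sdiff.1 ht
    obtain ⟨hu, huL⟩ := Finset.mem_sdiff.1 hu
    obtain ⟨h1, h2⟩ := hE' t ht u hu
    exact Finset.mem_filter.2 ⟨hΩ _ _ h1.symm htL huL, hD _ h2⟩
  refine hcard.trans (Finset.card_le_mul_card_image_of_maps_to hmaps 2 fun e _ => ?_)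
  induction e with
  | _ a b =>
    refine le_trans (Finset.card_le_card (t := {⟨a, b⟩, ⟨b, a⟩}) ?_) Finset.card_le_two
    rintro ⟨t, u⟩ hx
    have := (Finset.mem_filter.1 hx).2
    simp only [Sym2.eq_iff] at this
    rcases this with ⟨rfl, rfl⟩ | ⟨rfl, rfl⟩ <;> simp

end Defect

section PathCover

variable {V : Type*}

/-- The last vertex of `l` is followed by its first one. -/
def ClosedUp (R : V → V → Prop) (l : List V) : Prop :=
  ∃ a b, l.head? = some a ∧ l.getLast? = some b ∧ R b a

variable [DecidableEq V]

open Classical in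
lemma exists_matching_of_deficiency {ar : V → V → Prop} {T : Finset V} {D : ℕ}
    (hall : ∀ A ⊆ T, A.card ≤ (T.filter fun v => ∃ u ∈ A, ar u v).card + D) :
    ∃ g : T → V ⊕ Fin D, Function.Injective g ∧ ∀ u v, g u = Sum.inl v → v ∈ T ∧ ar u v := by
  set N : T → Finset (V ⊕ Fin D) := fun u =>
    (T.filter fun v => ar u v).disjSum Finset.univ with hN
  have key : ∀ s : Finset T, s.card ≤ (s.biUnion N).card := by
    intro s
    rcases s.eq_empty_or_nonempty with rfl | ⟨u₀, hu₀⟩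
    · simp
    have h1 : (s.map (Function.Embedding.subtype _)).card = s.card := Finset.card_map _
    have h2 : s.map (Function.Embedding.subtype _) ⊆ T := by
      intro v hv
      obtain ⟨u, _, rfl⟩ := Finset.mem_map.1 hv
      exact u.2
    refine (h1 ▸ hall _ h2).trans ((?_ : _ = _).trans_le
      (Finset.card_le_card (s := (T.filter fun v => ∃ u ∈ s.map (Function.Embedding.subtype _),
        ar u v).disjSum Finset.univ) fun x hx => ?_))
    · rw [Finset.card_disjSum, Finset.card_univ, Fintype.card_fin]
    rcases x with v | i
    · rw [Finset.inl_mem_disjSum, Finset.mem_filter] at hx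
      obtain ⟨hv, u, hu, huv⟩ := hx
      obtain ⟨u', hu', rfl⟩ := Finset.mem_map.1 hu
      exact Finset.mem_biUnion.2 ⟨u', hu',
        Finset.inl_mem_disjSum.2 (Finset.mem_filter.2 ⟨hv, huv⟩)⟩
    · exact Finset.mem_biUnion.2 ⟨u₀, hu₀, Finset.inr_mem_disjSum.2 (Finset.mem_univ i)⟩
  obtain ⟨g, hg, hgN⟩ := (Finset.all_card_le_biUnion_card_iff_exists_injective N).1 key
  refine ⟨g, hg, fun u v huv => ?_⟩
  have := hgN u
  rw [huv, hN, Finset.inl_mem_disjSum, Finset.mem_filter] at this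
  exact this

/-- A family of disjoint paths of a relation that partition `T`. -/
structure PathPartition (R : V → V → Prop) (T : Finset V) (F : Finset (List V)) : Prop where
  ne : ∀ l ∈ F, l ≠ []
  nodup : ∀ l ∈ F, l.Nodup
  chain : ∀ l ∈ F, l.IsChain R
  disj : ∀ l ∈ F, ∀ l' ∈ F, ∀ x ∈ l, x ∈ l' → l = l'
  mem : ∀ v, v ∈ T ↔ ∃ l ∈ F, v ∈ l

omit [DecidableEq V] in
lemma PathPartition.mono {R R' : V → V → Prop} {T : Finset V} {F : Finset (List V)}
    (h : PathPartition R T F) (hR : ∀ a b, R a b → R' a b) : PathPartition R' T F :=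
  ⟨h.ne, h.nodup, fun l hl => (h.chain l hl).imp hR, h.disj, h.mem⟩

lemma PathPartition.exists_join {R : V → V → Prop} {T : Finset V} {F : Finset (List V)}
    (h : PathPartition R T F) {l l' : List V} (hl : l ∈ F) (hl' : l' ∈ F) (hne : l ≠ l') {a b : V}
    (ha : l.getLast? = some a) (hb : l'.head? = some b) (hab : R a b) :
    PathPartition R T (insert (l ++ l') ((F.erase l).erase l')) ∧
      (insert (l ++ l') ((F.erase l).erase l')).card + 1 = F.card := by
  have hd : ∀ m ∈ (F.erase l).erase l', ∀ x ∈ l ++ l', x ∉ m := by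
    intro m hm x hx hxm
    simp only [Finset.mem_erase] at hm
    rcases List.mem_append.1 hx with hx | hx
    · exact hm.2.1 (h.disj m hm.2.2 l hl x hxm hx)
    · exact hm.1 (h.disj m hm.2.2 l' hl' x hxm hx)
  have hnn : l ++ l' ≠ [] := by simp [h.ne l hl]
  have hnot : l ++ l' ∉ (F.erase l).erase l' := fun hm => by
    obtain ⟨x, hx⟩ := List.exists_mem_of_ne_nil _ hnn
    exact hd _ hm x hx hx
  constructor
  · refine ⟨fun m hm => ?_, fun m hm => ?_, fun m hm => ?_, fun m hm m' hm' x hx hx' => ?_,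
      fun v => ?_⟩
    · rcases Finset.mem_insert.1 hm with rfl | hm
      exacts [hnn, h.ne m (by simp_all)]
    · rcases Finset.mem_insert.1 hm with rfl | hm
      · exact List.Nodup.append (h.nodup l hl) (h.nodup l' hl')
          fun x hx hx' => hne (h.disj l hl l' hl' x hx hx')
      · exact h.nodup m (by simp_all)
    · rcases Finset.mem_insert.1 hm with rfl | hm
      · refine List.isChain_append.2 ⟨h.chain l hl, h.chain l' hl', fun x hx y hy => ?_⟩
        have hx : l.getLast? = some x := hx
        have hy : l'.head? = some y := hy
        rw [ha] at hx
        rw [hb] at hy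
        cases hx
        cases hy
        exact hab
      · exact h.chain m (by simp_all)
    · rcases Finset.mem_insert.1 hm with h1 | h1 <;> rcases Finset.mem_insert.1 hm' with h2 | h2
      · rw [h1, h2]
      · exact absurd hx' (hd _ h2 x (h1 ▸ hx))
      · exact absurd hx (hd _ h1 x (h2 ▸ hx'))
      · exact h.disj m (by simp_all) m' (by simp_all) x hx hx'
    · rw [h.mem]
      constructor
      · rintro ⟨m, hm, hv⟩
        by_cases h1 : m = l
        · exact ⟨_, Finset.mem_insert_self _ _, List.mem_append.2 (Or.inl (h1 ▸ hv))⟩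
        by_cases h2 : m = l'
        · exact ⟨_, Finset.mem_insert_self _ _, List.mem_append.2 (Or.inr (h2 ▸ hv))⟩
        exact ⟨m, by simp [h1, h2, hm], hv⟩
      · rintro ⟨m, hm, hv⟩
        rcases Finset.mem_insert.1 hm with rfl | hm
        · rcases List.mem_append.1 hv with hv | hv
          exacts [⟨l, hl, hv⟩, ⟨l', hl', hv⟩]
        · exact ⟨m, by simp_all, hv⟩
  · rw [Finset.card_insert_of_notMem hnot, Finset.card_erase_of_mem (by simp [hl', hne.symm]),
      Finset.card_erase_of_mem hl]
    have : 1 < F.card := Finset.one_lt_card.2 ⟨l, hl, l', hl', hne⟩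
    omega

open Classical in
lemma exists_pathPartition {ar : V → V → Prop} {T : Finset V} {D : ℕ}
    (hall : ∀ A ⊆ T, A.card ≤ (T.filter fun v => ∃ u ∈ A, ar u v).card + D) :
    ∃ F, PathPartition ar T F ∧ F.card ≤ D + (F.filter (ClosedUp ar)).card := by
  obtain ⟨g, hg, hgT⟩ := exists_matching_of_deficiency hall
  set st : V → V → Prop := fun u v => ∃ h : u ∈ T, g ⟨u, h⟩ = Sum.inl v with hst
  have hst_ar : ∀ u v, st u v → ar u v := fun u v ⟨h, huv⟩ => (hgT _ _ huv).2
  have hinj : ∀ u u' v, st u v → st u' v → u = u' := by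
    rintro u u' v ⟨h, h1⟩ ⟨h', h2⟩
    exact congrArg Subtype.val (hg (h1.trans h2.symm))
  have hex : ∃ k, ∃ F, PathPartition st T F ∧ F.card = k := by
    refine ⟨_, T.image fun v => [v], ⟨?_, ?_, ?_, ?_, ?_⟩, rfl⟩
    · intro l hl; obtain ⟨v, _, rfl⟩ := Finset.mem_image.1 hl; simp
    · intro l hl; obtain ⟨v, _, rfl⟩ := Finset.mem_image.1 hl; simp
    · intro l hl; obtain ⟨v, _, rfl⟩ := Finset.mem_image.1 hl; simp
    · intro l hl l' hl' x hx hx'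
      obtain ⟨v, _, rfl⟩ := Finset.mem_image.1 hl
      obtain ⟨v', _, rfl⟩ := Finset.mem_image.1 hl'
      simp only [List.mem_singleton] at hx hx'
      rw [← hx, ← hx']
    · intro v
      constructor
      · exact fun hv => ⟨_, Finset.mem_image_of_mem _ hv, by simp⟩
      · rintro ⟨l, hl, hv⟩
        obtain ⟨v', h', rfl⟩ := Finset.mem_image.1 hl
        rw [List.mem_singleton.1 hv]; exact h'
  obtain ⟨F, hF, hFk⟩ := Nat.find_spec hex
  refine ⟨F, hF.mono hst_ar, ?_⟩
  have hlast : ∀ l ∈ F, ¬ ClosedUp ar l → ∃ i : Fin D, ∃ (u : V) (hu : u ∈ T),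
      l.getLast? = some u ∧ g ⟨u, hu⟩ = Sum.inr i := by
    intro l hl hlc
    obtain ⟨u, hu⟩ : ∃ u, l.getLast? = some u :=
      ⟨_, List.getLast?_eq_some_getLast (hF.ne l hl)⟩
    have hul : u ∈ l := List.mem_of_getLast? hu
    have huT : u ∈ T := (hF.mem u).2 ⟨l, hl, hul⟩
    rcases hgu : g ⟨u, huT⟩ with v | i
    · exfalso
      have hvT := (hgT _ _ hgu).1
      have huv : st u v := ⟨huT, hgu⟩
      obtain ⟨l', hl', hvl'⟩ := (hF.mem v).1 hvT
      by_cases hhead : l'.head? = some v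
      · by_cases hll : l = l'
        · subst hll
          exact hlc ⟨v, u, hhead, hu, hst_ar _ _ huv⟩
        · obtain ⟨h1, h2⟩ := hF.exists_join hl hl' hll hu hhead huv
          have := Nat.find_min' hex ⟨_, h1, rfl⟩
          omega
      · obtain ⟨p, q, hpq⟩ := List.append_of_mem hvl'
        rcases p.eq_nil_or_concat with rfl | ⟨p', w, rfl⟩
        · exact hhead (by simp [hpq])
        · rw [List.concat_eq_append] at hpq
          have hin : [w, v] <:+: l' := ⟨p', q, by simp [hpq]⟩
          have hwv : st w v := isChain_iff_infix.1 (hF.chain l' hl') w v hin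
          obtain rfl := hinj _ _ _ hwv huv
          have : l = l' := hF.disj l hl l' hl' w hul (by simp [hpq])
          subst this
          exact not_infix_of_getLast? (hF.nodup l hl) hu hin
    · exact ⟨i, u, huT, hu, hgu⟩
  have hcard : (F.filter fun l => ¬ ClosedUp ar l).card ≤ D := by
    rw [← Fintype.card_fin D, ← Finset.card_univ]
    refine Finset.card_le_card_of_forall_subsingleton
      (fun l i => ∃ (u : V) (hu : u ∈ T), l.getLast? = some u ∧ g ⟨u, hu⟩ = Sum.inr i)
      (fun l hl => ?_) fun i _ l hl l' hl' => ?_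
    · obtain ⟨hl, hlc⟩ := Finset.mem_filter.1 hl
      obtain ⟨i, h⟩ := hlast l hl hlc
      exact ⟨i, Finset.mem_univ _, h⟩
    · obtain ⟨hl, u, hu, h1, h2⟩ := hl
      obtain ⟨hl', u', hu', h1', h2'⟩ := hl'
      have : u = u' := congrArg Subtype.val (hg (h2.trans h2'.symm))
      subst this
      exact hF.disj l (Finset.mem_filter.1 hl).1 l' (Finset.mem_filter.1 hl').1 u
        (List.mem_of_getLast? h1) (List.mem_of_getLast? h1')
  have := Finset.card_filter_add_card_filter_not (s := F) (ClosedUp ar)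
  omega

end PathCover

section JoinPaths

variable {V : Type*} [DecidableEq V]

lemma PathPartition.exists_hamPath {Mg : SimpleGraph V} {T : Finset V} (k : ℕ) :
    ∀ (Γ : SimpleGraph V) (F : Finset (List V)), F.card = k + 1 →
    PathPartition (Γ ⊔ Mg).Adj T F → (∀ a b, Mg.Adj a b → ∃ l ∈ F, HasEdge l s(a, b)) →
    ∃ W : Finset (Sym2 V), W.card ≤ k ∧
      ∃ l, HamPath (Γ ⊔ SimpleGraph.fromEdgeSet ↑W) Mg T l := by
  induction k with
  | zero =>
    intro Γ F hF h hM
    obtain ⟨l, rfl⟩ := Finset.card_eq_one.1 hF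
    refine ⟨∅, by simp, l, h.nodup l (by simp), fun v => ?_, ?_, fun a b hab => ?_⟩
    · rw [h.mem]; simp
    · exact (h.chain l (by simp)).imp fun a b hab => by simpa using hab
    · obtain ⟨l', hl', h'⟩ := hM a b hab
      rwa [Finset.mem_singleton.1 hl'] at h'
  | succ k ih =>
    intro Γ F hF h hM
    obtain ⟨l, hl, l', hl', hne⟩ := Finset.one_lt_card.1 (by omega : 1 < F.card)
    set a := l.getLast (h.ne l hl) with ha
    set b := l'.head (h.ne l' hl') with hb
    have ha' : l.getLast? = some a := List.getLast?_eq_some_getLast _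
    have hb' : l'.head? = some b := List.head?_eq_some_head _
    have hab : a ≠ b := fun hab => hne (h.disj l hl l' hl' a (List.mem_of_getLast? ha')
      (hab ▸ List.mem_of_head? hb'))
    set Γ' := Γ ⊔ SimpleGraph.fromEdgeSet {s(a, b)} with hΓ'
    have hle : Γ ⊔ Mg ≤ Γ' ⊔ Mg := sup_le_sup_right le_sup_left _
    obtain ⟨h1, h2⟩ := (h.mono fun _ _ h => hle h : PathPartition (Γ' ⊔ Mg).Adj T F).exists_join
      hl hl' hne ha' hb' (Or.inl (Or.inr (by simp [hab])))
    obtain ⟨W, hW, m, hm⟩ := ih Γ' _ (by omega) h1 fun c d hcd => by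
      obtain ⟨l₁, hl₁, he⟩ := hM c d hcd
      by_cases e1 : l₁ = l
      · exact ⟨_, Finset.mem_insert_self _ _, (e1 ▸ he).append_right⟩
      by_cases e2 : l₁ = l'
      · exact ⟨_, Finset.mem_insert_self _ _, (e2 ▸ he).append_left⟩
      exact ⟨l₁, by simp [e1, e2, hl₁], he⟩
    refine ⟨insert s(a, b) W, (Finset.card_insert_le _ _).trans (by omega), m, hm.mono ?_⟩
    rw [hΓ', sup_assoc, Finset.coe_insert, Set.insert_eq, SimpleGraph.fromEdgeSet_union]

lemma PathPartition.exists_hamCycle {Γ Mg : SimpleGraph V} {T : Finset V} {F : Finset (List V)}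
    (h : PathPartition (Γ ⊔ Mg).Adj T F) (hM : ∀ a b, Mg.Adj a b → ∃ l ∈ F, HasEdge l s(a, b))
    (hT : 2 ≤ T.card) :
    ∃ W : Finset (Sym2 V), W.card ≤ F.card ∧
      HasHamCycle (Γ ⊔ SimpleGraph.fromEdgeSet ↑W) Mg T := by
  obtain ⟨v, hv⟩ := Finset.card_pos.1 (by omega : 0 < T.card)
  obtain ⟨l₀, hl₀, _⟩ := (h.mem v).1 hv
  have hF : 0 < F.card := Finset.card_pos.2 ⟨l₀, hl₀⟩
  obtain ⟨W, hW, l, hl⟩ := PathPartition.exists_hamPath (F.card - 1) Γ F (by omega) h hM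
  have hcard : l.length = T.card := by
    rw [← List.toFinset_card_of_nodup hl.nodup]
    congr 1
    ext x
    rw [List.mem_toFinset, hl.mem]
  have hne : l ≠ [] := by rintro rfl; simp at hcard; omega
  obtain ⟨b, hb⟩ : ∃ b, l.getLast? = some b := ⟨_, List.getLast?_eq_some_getLast hne⟩
  cases l with
  | nil => exact absurd rfl hne
  | cons a t =>
    have hab : b ≠ a := by
      rintro rfl
      cases t with
      | nil => simp at hcard; omega
      | cons c t =>
        rw [List.getLast?_cons_cons] at hb
        exact (List.nodup_cons.1 hl.nodup).1 (List.mem_of_getLast? hb)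
    refine ⟨insert s(b, a) W, (Finset.card_insert_le _ _).trans (by omega), a :: t, a, b,
      hl.mono (sup_le_sup_left (SimpleGraph.fromEdgeSet_mono (by simp)) _), rfl, hb,
      Or.inr (by simp [hab])⟩

end JoinPaths

section Expand

variable {V : Type*}

/-- `e` joins the two ends of `d`. -/
def IsEnds (d : List V) (e : Sym2 V) : Prop :=
  ∃ a b, d.head? = some a ∧ d.getLast? = some b ∧ e = s(a, b)

lemma IsEnds.unique {d : List V} {e e' : Sym2 V} (h : IsEnds d e) (h' : IsEnds d e') : e = e' := by
  obtain ⟨a, b, h1, h2, rfl⟩ := h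
  obtain ⟨a', b', h1', h2', rfl⟩ := h'
  rw [h1] at h1'
  rw [h2] at h2'
  cases h1'
  cases h2'
  rfl

lemma IsEnds.mem {d : List V} {e : Sym2 V} (h : IsEnds d e) {v : V} (hv : v ∈ e) : v ∈ d := by
  obtain ⟨a, b, h1, h2, rfl⟩ := h
  rcases Sym2.mem_iff.1 hv with rfl | rfl
  exacts [List.mem_of_head? h1, List.mem_of_getLast? h2]

lemma HasEdge.mem {l : List V} {e : Sym2 V} (h : HasEdge l e) {v : V} (hv : v ∈ e) : v ∈ l := by
  obtain ⟨a, b, rfl, h⟩ := h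
  refine h.subset ?_
  simpa using hv

lemma exists_isEnds {d : List V} (hd : 2 ≤ d.length) : ∃ e, IsEnds d e := by
  have : d ≠ [] := by rintro rfl; simp at hd
  exact ⟨_, _, _, List.head?_eq_some_head this, List.getLast?_eq_some_getLast this, rfl⟩

lemma IsEnds.not_isDiag {d : List V} {e : Sym2 V} (h : IsEnds d e) (hd : 2 ≤ d.length)
    (hn : d.Nodup) : ¬ e.IsDiag := by
  obtain ⟨a, b, h1, h2, rfl⟩ := h
  rw [Sym2.mk_isDiag_iff]
  rintro rfl
  match d, hd with
  | x :: y :: t, _ =>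
    obtain rfl : x = a := by simpa using h1
    rw [List.getLast?_cons_cons] at h2
    exact (List.nodup_cons.1 hn).1 (List.mem_of_getLast? h2)

/-- A path from `x` to `y` starts at `x` and stops at `y`. -/
lemma IsEnds.exists_eq {d : List V} {x y : V} (h : IsEnds d s(x, y)) (hxy : x ≠ y) :
    ∃ m, d = x :: (m ++ [y]) ∨ d.reverse = x :: (m ++ [y]) := by
  obtain ⟨a, b, h1, h2, h3⟩ := h
  have key : ∀ d : List V, d.head? = some x → d.getLast? = some y → ∃ m, d = x :: (m ++ [y]) := by
    intro d h1 h2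
    cases d with
    | nil => simp at h1
    | cons c d =>
      obtain rfl : c = x := by simpa using h1
      rcases d.eq_nil_or_concat with rfl | ⟨m, w, rfl⟩
      · exact absurd (by simpa using h2) hxy
      · rw [List.concat_eq_append] at h2 ⊢
        rw [← List.cons_append, List.getLast?_append_of_ne_nil _ (by simp)] at h2
        obtain rfl : w = y := by simpa using h2
        exact ⟨m, rfl⟩
  rw [Sym2.eq_iff] at h3
  rcases h3 with ⟨rfl, rfl⟩ | ⟨rfl, rfl⟩
  · obtain ⟨m, hm⟩ := key d h1 h2
    exact ⟨m, Or.inl hm⟩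
  · obtain ⟨m, hm⟩ := key d.reverse (by simpa using h2) (by simpa using h1)
    exact ⟨m, Or.inr hm⟩

private lemma mem_splice {p m q : List V} {x y v : V} :
    v ∈ p ++ x :: (m ++ y :: q) ↔ v ∈ p ++ x :: y :: q ∨ v ∈ x :: (m ++ [y]) := by
  simp only [List.mem_append, List.mem_cons, List.not_mem_nil]
  tauto

variable [DecidableEq V] [Fintype V]

open Classical in
/-- The pairs of ends of the paths of a family. -/
noncomputable def endPairs (F : Finset (List V)) : Finset (Sym2 V) :=
  Finset.univ.filter fun e => ∃ d ∈ F, IsEnds d e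

omit [DecidableEq V] in
lemma mem_endPairs {F : Finset (List V)} {e : Sym2 V} :
    e ∈ endPairs F ↔ ∃ d ∈ F, IsEnds d e := by
  classical
  simp [endPairs]

omit [DecidableEq V] in
lemma card_endPairs_le (F : Finset (List V)) : (endPairs F).card ≤ F.card :=
  Finset.card_le_card_of_forall_subsingleton (fun e d => IsEnds d e)
    (fun _ he => mem_endPairs.1 he) fun _ _ _ he _ he' => he.2.unique he'.2

set_option maxHeartbeats 800000 in
/-- Inserting the paths of a family into a cycle that traverses the pairs of their ends. -/
lemma expand_cycle {G' G'' Γ : SimpleGraph V} {F : Finset (List V)} {A : Finset V}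
    (h : Linear G' F) (hlen : ∀ l ∈ F, 2 ≤ l.length) (hG : G' ≤ G'') (hΓ : Γ ≤ G'')
    (hc : HasHamCycle Γ (SimpleGraph.fromEdgeSet ↑(endPairs F)) (live A F)) :
    ∃ L a b, L.Nodup ∧ (∀ x, x ∈ L ↔ x ∈ A ∪ cov F) ∧ L.IsChain G''.Adj ∧
      L.head? = some a ∧ L.getLast? = some b ∧ G''.Adj b a ∧
      ∀ d ∈ F, ∀ e, HasEdge d e → HasEdge L e := by
  classical
  obtain ⟨L₀, a, b, hL₀, ha, hb, hba⟩ := hc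
  have key : ∀ D ⊆ F, ∃ L : List V, L.Nodup ∧ (∀ x, x ∈ L ↔ x ∈ live A F ∪ cov D) ∧
      L.IsChain (fun u v => G''.Adj u v ∨ ∃ d ∈ F \ D, IsEnds d s(u, v)) ∧
      L.head? = some a ∧ L.getLast? = some b ∧
      (∀ d ∈ F \ D, ∀ e, IsEnds d e → HasEdge L e) ∧
      (∀ d ∈ D, ∀ e, HasEdge d e → HasEdge L e) := by
    intro D
    induction D using Finset.induction_on with
    | empty =>
      intro _
      refine ⟨L₀, hL₀.nodup, fun x => ?_, hL₀.chain.imp fun u v huv => ?_, ha, hb, ?_, by simp⟩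
      · rw [hL₀.mem]; simp [cov]
      · rcases huv with huv | huv
        · exact Or.inl (hΓ huv)
        · have := (SimpleGraph.fromEdgeSet_adj _).1 huv
          obtain ⟨d, hd, he⟩ := mem_endPairs.1 this.1
          exact Or.inr ⟨d, by simpa using hd, he⟩
      · intro d hd e he
        have hdF : d ∈ F := (Finset.mem_sdiff.1 hd).1
        have hdiag := he.not_isDiag (hlen d hdF) (h.nodup d hdF)
        induction e with
        | _ u v =>
          refine hL₀.edge u v ((SimpleGraph.fromEdgeSet_adj _).2 ⟨mem_endPairs.2 ⟨d, hdF, he⟩, ?_⟩)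
          simpa using hdiag
    | insert d D hdD ih =>
      intro hDF
      have hdF : d ∈ F := hDF (Finset.mem_insert_self _ _)
      obtain ⟨L, hn, hmem, hch, hha, hlb, hends, hed⟩ :=
        ih ((Finset.subset_insert _ _).trans hDF)
      obtain ⟨e, he⟩ := exists_isEnds (hlen d hdF)
      obtain ⟨x, y, rfl, p, q, hpq⟩ := hends d (by simp [hdF, hdD]) e he
      have hxy : x ≠ y := by
        have := he.not_isDiag (hlen d hdF) (h.nodup d hdF)
        simpa using this
      obtain ⟨m, hm⟩ := he.exists_eq hxy
      have hL : L = p ++ x :: y :: q := by rw [← hpq]; simp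
      clear hpq
      have hdn : (x :: (m ++ [y])).Nodup := by
        rcases hm with hm | hm
        · exact hm ▸ h.nodup d hdF
        · exact hm ▸ List.nodup_reverse.2 (h.nodup d hdF)
      have hdmem : ∀ v, v ∈ d ↔ v ∈ x :: (m ++ [y]) := by
        intro v
        rcases hm with hm | hm
        · rw [hm]
        · rw [← hm, List.mem_reverse]
      have hdch : (x :: (m ++ [y])).IsChain G''.Adj := by
        rcases hm with hm | hm
        · exact hm ▸ (h.chain d hdF).imp fun _ _ h => hG h
        · rw [← hm, List.isChain_reverse]
          exact (h.chain d hdF).imp fun _ _ h => hG h.symm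
      have hded : ∀ e, HasEdge d e → HasEdge (x :: (m ++ [y])) e := by
        intro e he
        rcases hm with hm | hm
        · exact hm ▸ he
        · exact hm ▸ he.reverse
      have hmL : ∀ v ∈ m, v ∉ L := by
        intro v hv hvL
        have hvd : v ∈ d := (hdmem v).2 (by simp [hv])
        have hvc : v ∈ cov F := mem_cov.2 ⟨d, hdF, hvd⟩
        rw [hmem] at hvL
        rcases Finset.mem_union.1 hvL with hvL | hvL
        · rcases Finset.mem_union.1 hvL with hvL | hvL
          · exact (Finset.mem_sdiff.1 hvL).2 hvc
          · obtain ⟨d', hd', h'⟩ := mem_pathEnds.1 hvL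
            have hvd' : v ∈ d' := by
              rcases h' with h' | h'
              exacts [List.mem_of_head? h', List.mem_of_getLast? h']
            obtain rfl := h.disj d hdF d' hd' v hvd hvd'
            obtain ⟨a', b', h1, h2, h3⟩ := he
            have hvxy : v = x ∨ v = y := by
              rw [← Sym2.mem_iff, h3, Sym2.mem_iff]
              rw [h1, h2, Option.some.injEq, Option.some.injEq] at h'
              exact h'.imp Eq.symm Eq.symm
            rcases hvxy with rfl | rfl
            · exact (List.nodup_cons.1 hdn).1 (by simp [hv])
            · exact (List.disjoint_of_nodup_append (List.nodup_cons.1 hdn).2) hv (by simp)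
        · obtain ⟨d', hd', h'⟩ := mem_cov.1 hvL
          obtain rfl := h.disj d hdF d' (hDF (Finset.mem_insert_of_mem hd')) v hvd h'
          exact hdD hd'
      have hedge : ∀ e, HasEdge L e → e ≠ s(x, y) → HasEdge (p ++ x :: (m ++ y :: q)) e := by
        intro e he hne
        rw [hL, hasEdge_append_iff (z := y) (by simp)] at he
        rcases he with he | he | he
        · exact he.mono ⟨[], m ++ y :: q, by simp⟩
        · exact absurd he hne
        · exact he.mono ⟨p ++ x :: m, [], by simp⟩
      refine ⟨p ++ x :: (m ++ y :: q), ?_, fun v => ?_, ?_, ?_, ?_, ?_, ?_⟩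
      · have hperm : (p ++ x :: (m ++ y :: q)).Perm (m ++ L) := by
          rw [hL]
          have e1 : p ++ x :: (m ++ y :: q) = (p ++ [x]) ++ m ++ (y :: q) := by simp
          have e2 : m ++ (p ++ x :: y :: q) = m ++ (p ++ [x]) ++ (y :: q) := by simp
          rw [e1, e2]
          exact List.perm_append_comm.append_right _
        rw [hperm.nodup_iff]
        exact List.Nodup.append
          (List.Nodup.of_append_left (List.nodup_cons.1 hdn).2) hn fun v hv hv' => hmL v hv hv'
      · have h1 : v ∈ p ++ x :: (m ++ y :: q) ↔ v ∈ L ∨ v ∈ d := by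
          rw [hdmem, hL]; exact mem_splice
        have h2 : v ∈ cov (insert d D) ↔ v ∈ cov D ∨ v ∈ d := by
          simp only [cov, Finset.biUnion_insert, Finset.mem_union, List.mem_toFinset]
          exact or_comm
        rw [h1, hmem, Finset.mem_union, Finset.mem_union, h2, or_assoc]
      · have hch' : ∀ u v, [u, v] <:+: L → s(u, v) ≠ s(x, y) →
            G''.Adj u v ∨ ∃ d' ∈ F \ insert d D, IsEnds d' s(u, v) := by
          intro u v huv hne
          rcases isChain_iff_infix.1 hch u v huv with h1 | ⟨d', hd', h1⟩
          · exact Or.inl h1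
          · refine Or.inr ⟨d', ?_, h1⟩
            simp only [Finset.mem_sdiff, Finset.mem_insert, not_or] at hd' ⊢
            refine ⟨hd'.1, ?_, hd'.2⟩
            rintro rfl
            exact hne (h1.unique he)
        rw [hL] at hn
        have hyp : y ∉ p ++ [x] := by
          intro hy
          have : (p ++ [x] ++ y :: q).Nodup := by simpa using hn
          exact List.disjoint_of_nodup_append this hy (by simp)
        have hxq : x ∉ y :: q := (List.nodup_cons.1 (List.nodup_append.1 hn).2.1).1
        rw [List.isChain_split]
        constructor
        · refine isChain_iff_infix.2 fun u v huv => hch' u v ?_ fun hs => hyp ?_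
          · rw [hL]; exact huv.trans ⟨[], y :: q, by simp⟩
          · have : HasEdge (p ++ [x]) s(u, v) := ⟨u, v, rfl, huv⟩
            exact this.mem (hs ▸ Sym2.mem_mk_right x y)
        · rw [← List.cons_append, List.isChain_split]
          constructor
          · exact (by simpa using hdch : (x :: m ++ [y]).IsChain G''.Adj).imp fun _ _ h => Or.inl h
          · refine isChain_iff_infix.2 fun u v huv => hch' u v ?_ fun hs => hxq ?_
            · rw [hL]; exact huv.trans ⟨p ++ [x], [], by simp⟩
            · have : HasEdge (y :: q) s(u, v) := ⟨u, v, rfl, huv⟩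
              exact this.mem (hs ▸ Sym2.mem_mk_left x y)
      · rw [← hha, hL]; cases p <;> simp
      · rw [← hlb, hL]
        have e1 : p ++ x :: (m ++ y :: q) = (p ++ x :: m) ++ (y :: q) := by simp
        have e2 : p ++ x :: y :: q = (p ++ [x]) ++ (y :: q) := by simp
        rw [e1, e2, List.getLast?_append_of_ne_nil _ (by simp),
          List.getLast?_append_of_ne_nil _ (by simp)]
      · intro d' hd' e' he'
        simp only [Finset.mem_sdiff, Finset.mem_insert, not_or] at hd'
        refine hedge e' (hends d' (by simp [hd'.1, hd'.2.2]) e' he') ?_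
        rintro rfl
        exact hd'.2.1 (h.disj d' hd'.1 d hdF x (he'.mem (by simp)) (he.mem (by simp)))
      · intro d' hd' e' he'
        rcases Finset.mem_insert.1 hd' with rfl | hd'
        · exact (hded e' he').mono ⟨p, q, by simp⟩
        · refine hedge e' (hed d' hd' e' he') ?_
          rintro rfl
          have := h.disj d' (hDF (Finset.mem_insert_of_mem hd')) d hdF x (he'.mem (by simp))
            (he.mem (by simp))
          exact hdD (this ▸ hd')
  obtain ⟨L, hn, hmem, hch, hha, hlb, -, hed⟩ := key F subset_rfl
  refine ⟨L, a, b, hn, fun x => ?_, hch.imp fun u v huv => ?_, hha, hlb, hΓ hba, hed⟩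
  · rw [hmem, live]
    have := pathEnds_subset F (V := V)
    constructor
    · intro hx
      rcases Finset.mem_union.1 hx with hx | hx
      · rcases Finset.mem_union.1 hx with hx | hx
        · exact Finset.mem_union_left _ (Finset.mem_sdiff.1 hx).1
        · exact Finset.mem_union_right _ (this hx)
      · exact Finset.mem_union_right _ hx
    · intro hx
      by_cases hxc : x ∈ cov F
      · exact Finset.mem_union_right _ hxc
      · exact Finset.mem_union_left _ (Finset.mem_union_left _
          (Finset.mem_sdiff.2 ⟨(Finset.mem_union.1 hx).resolve_right hxc, hxc⟩))
  · simpa using huv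

end Expand

section ListWalk

variable {V : Type*}

lemma SimpleGraph.Walk.mem_edges_iff_hasEdge {G : SimpleGraph V} {u v : V} (p : G.Walk u v)
    (e : Sym2 V) : e ∈ p.edges ↔ HasEdge p.support e := by
  induction p with
  | nil =>
    simp only [edges_nil, List.not_mem_nil, support_nil, false_iff]
    rintro ⟨a, b, -, h⟩
    simpa using h.length_le
  | @cons u v w h p ih =>
    have hs : p.support.head? = some v := by cases p <;> simp
    rw [edges_cons, List.mem_cons, support_cons, ih]
    have := hasEdge_append_iff (l₁ := []) (w := u) (e := e) hs
    simp only [List.nil_append] at this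
    rw [this]
    refine ⟨Or.inr, fun h => h.resolve_left ?_⟩
    rintro ⟨a, b, -, h⟩
    simpa using h.length_le

lemma not_hasEdge_ends {L : List V} {a b : V} (hn : L.Nodup) (hlen : 3 ≤ L.length)
    (ha : L.head? = some a) (hb : L.getLast? = some b) : ¬ HasEdge L s(b, a) := by
  rintro ⟨x, y, hxy, hin⟩
  rw [Sym2.eq_iff] at hxy
  rcases hxy with ⟨h1, h2⟩ | ⟨h1, h2⟩
  · exact not_infix_of_getLast? hn hb (h1 ▸ hin)
  · rw [← h1, ← h2] at hin
    obtain ⟨p, r, rfl⟩ := hin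
    have hp : p = [] := by
      rcases p with _ | ⟨c, p⟩
      · rfl
      · exfalso
        have hc : c = a := by simpa using ha
        have hnd' : (c :: (p ++ [a, b] ++ r)).Nodup := by simpa using hn
        exact (List.nodup_cons.1 hnd').1 (by rw [hc]; simp)
    have hr : r = [] := by
      rcases r.eq_nil_or_concat with rfl | ⟨r', w, rfl⟩
      · rfl
      · exfalso
        rw [List.concat_eq_append] at hn hb
        rw [List.getLast?_append_of_ne_nil _ (by simp),
          List.getLast?_append_of_ne_nil _ (by simp)] at hb
        have hw : w = b := by simpa using hb
        rw [hw] at hn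
        have := List.disjoint_of_nodup_append hn (a := b) (by simp)
        simp at this
    simp [hp, hr] at hlen

lemma exists_cycle_of_list {G : SimpleGraph V} {L : List V} {a b : V} (hn : L.Nodup)
    (hlen : 3 ≤ L.length) (hch : L.IsChain G.Adj) (ha : L.head? = some a)
    (hb : L.getLast? = some b) (hba : G.Adj b a) :
    ∃ p : G.Walk b b, p.IsCycle ∧ (∀ x, x ∈ p.support ↔ x ∈ L) ∧
      ∀ e, HasEdge L e → e ∈ p.edges := by
  have hne : L ≠ [] := by rintro rfl; simp at hlen
  have hnot := not_hasEdge_ends hn hlen ha hb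
  have ha' : L.head hne = a := by
    rw [List.head?_eq_some_head hne] at ha; exact Option.some.inj ha
  have hb' : L.getLast hne = b := by
    rw [List.getLast?_eq_some_getLast hne] at hb; exact Option.some.inj hb
  subst ha' hb'
  set q := SimpleGraph.Walk.ofSupport L hne hch with hq
  have hqs : q.support = L := SimpleGraph.Walk.support_ofSupport ..
  refine ⟨SimpleGraph.Walk.cons hba q, ?_, fun x => ?_, fun e he => ?_⟩
  · rw [SimpleGraph.Walk.cons_isCycle_iff, SimpleGraph.Walk.isPath_def, hqs,
      SimpleGraph.Walk.mem_edges_iff_hasEdge, hqs]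
    exact ⟨hn, hnot⟩
  · rw [SimpleGraph.Walk.support_cons, hqs, List.mem_cons]
    exact ⟨fun h => h.elim (fun h => h ▸ List.getLast_mem hne) id, Or.inr⟩
  · rw [SimpleGraph.Walk.edges_cons, List.mem_cons, SimpleGraph.Walk.mem_edges_iff_hasEdge, hqs]
    exact Or.inr he

end ListWalk

section Assembly

variable {V : Type*} [Fintype V] [DecidableEq V]

/-- Numerical constraints for linking the edges of a matching in a graph on `N` vertices. -/
structure LinkNumbers (N x₀ μ cap w r₀ η ℓ m k₀ : ℕ) (t : ℕ → ℕ) : Prop where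
  four_le : 4 ≤ w
  cap_le : 4 * cap + 4 ≤ N
  le_cap : N / 12 + 1 + μ ≤ cap
  two_le : 2 * μ ≤ cap
  r_le : r₀ ≤ x₀
  k_le : 2 * x₀ + r₀ ≤ 2 * k₀
  w_le : w + 3 ≤ N
  sum_le : 4 * r₀ + η + 3 * x₀ + ∑ k ∈ Finset.Ioc m k₀, 2 * t k ≤ w
  step : ∀ k ∈ Finset.Ioc m k₀, 2 * t k + 1 ≤ ℓ ∧ N ≤ 4 * (3 ^ t k * (k / 2))

/-- The expansion properties of a pair of sparse random graphs. -/
structure Expanding (G H : SimpleGraph V) (x₀ μ cap w r₀ η ℓ : ℕ) (X : Finset V) : Prop where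
  le : H ≤ G
  dense : NoDense G H x₀
  red : ∀ S : Finset V, S.card = r₀ → 4 * r₀ < (cl G S).card
  small : ∀ S : Finset V, x₀ ≤ S.card → S.card ≤ μ + r₀ → 4 * S.card + η < (cl H S).card
  mid : ∀ S : Finset V, μ ≤ S.card → S.card ≤ cap → 4 * S.card + w < (cl H S).card
  large : ∀ S : Finset V, cap ≤ S.card → 4 * S.card ≤ Fintype.card V →
    3 * S.card + w ≤ (cl H S).card
  cyc : ShortCyclesMeet G ℓ X
  card_cl : (cl G X).card ≤ η

omit [DecidableEq V] [Fintype V] in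
lemma ShortCyclesMeet.anti {G K : SimpleGraph V} {ℓ : ℕ} {X : Finset V}
    (h : ShortCyclesMeet G ℓ X) (hK : K ≤ G) : ShortCyclesMeet K ℓ X :=
  fun l h1 h2 h3 h4 h5 => h l h1 h2 h3 (h4.imp fun _ _ h => hK h) fun a b ha hb => hK (h5 a b ha hb)

/-- The vertices with fewer than four `H`-neighbours in `B`. -/
noncomputable def lowSet (H : SimpleGraph V) (B : Finset V) : Finset V :=
  Finset.univ.filter fun v => (nbS H {v} ∩ B).card < 4

variable {G H : SimpleGraph V} {x₀ μ cap w r₀ η ℓ m k₀ : ℕ} {t : ℕ → ℕ} {X : Finset V}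

lemma Expanding.card_red (h : Expanding G H x₀ μ cap w r₀ η ℓ X) {R : Finset V} {ch : V → V}
    (hR : RedSet G (coreF G) R ch) : R.card < r₀ := by
  by_contra! hle
  obtain ⟨R', -, hR', hc⟩ := hR.sub r₀ hle
  have h1 := h.red R' hR'
  have : cl G R' = R' ∪ nbS G R' := rfl
  rw [this] at h1
  omega

lemma RedSet.cl_disjoint {B R : Finset V} {ch : V → V} (hR : RedSet G B R ch) :
    Disjoint (cl G R) B := by
  rw [Finset.disjoint_left]
  intro v hv hvB
  obtain ⟨s, hs, h⟩ := mem_cl.1 hv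
  refine hR.disj s hs (mem_closedNb.2 ?_)
  rcases h with h | h
  · exact Or.inl (h ▸ hvB)
  · exact Or.inr ⟨v, hvB, h⟩

lemma Expanding.card_lowSet_lt (h : Expanding G H x₀ μ cap w r₀ η ℓ X)
    (hn : LinkNumbers (Fintype.card V) x₀ μ cap w r₀ η ℓ m k₀ t) (hx : x₀ ≤ μ) :
    (lowSet H (coreF G)).card < x₀ := by
  classical
  by_contra! hle
  obtain ⟨R, ch, hR⟩ := exists_redSet G
  have hRr := h.card_red hR
  have hRL : R ⊆ lowSet H (coreF G) := by
    intro v hv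
    have : nbS H {v} ∩ coreF G = ∅ := by
      rw [← Finset.disjoint_iff_inter_eq_empty]
      refine hR.cl_disjoint.mono_left fun u hu => ?_
      have hu := mem_nbS.1 hu
      simp only [Finset.mem_singleton, exists_eq_left] at hu
      exact mem_cl.2 ⟨v, hv, Or.inr (h.le hu)⟩
    simp [lowSet, this]
  obtain ⟨L, hRL', hLL, hLc⟩ := Finset.exists_subsuperset_card_eq hRL
    (hRr.le.trans hn.r_le) hle
  have h1 := h.small L hLc.ge (by omega)
  have h2 : cl H L ⊆ (Finset.univ \ coreF G) ∪
      (L \ R).biUnion fun v => {v} ∪ (nbS H {v} ∩ coreF G) := by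
    intro v hv
    by_cases hvB : v ∈ coreF G
    · obtain ⟨s, hs, hsv⟩ := mem_cl.1 hv
      have hsR : s ∉ R := fun hsR => Finset.disjoint_left.1 hR.cl_disjoint
        (mem_cl.2 ⟨s, hsR, hsv.imp id fun h' => h.le h'⟩) hvB
      refine Finset.mem_union_right _ (Finset.mem_biUnion.2 ⟨s, Finset.mem_sdiff.2 ⟨hs, hsR⟩, ?_⟩)
      rcases hsv with rfl | hsv
      · simp
      · exact Finset.mem_union_right _ (Finset.mem_inter.2 ⟨by simpa using hsv, hvB⟩)
    · exact Finset.mem_union_left _ (by simpa using hvB)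
  have h3 : ((L \ R).biUnion fun v => {v} ∪ (nbS H {v} ∩ coreF G)).card ≤ (L \ R).card * 4 := by
    refine Finset.card_biUnion_le_card_mul _ _ _ fun v hv => ?_
    refine (Finset.card_union_le _ _).trans ?_
    have := (Finset.mem_filter.1 (hLL (Finset.mem_sdiff.1 hv).1)).2
    rw [Finset.card_singleton]
    omega
  have h4 := (Finset.card_le_card h2).trans (Finset.card_union_le _ _)
  have h5 := hR.card_le
  have h6 := Finset.card_sdiff_of_subset hRL'
  have h7 := Finset.card_le_card hRL'
  omega

/-- The vertices of the edges of `M`. -/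
def vertsOf (M : Finset (Sym2 V)) : Finset V := Finset.univ.filter fun v => ∃ e ∈ M, v ∈ e

lemma mem_vertsOf {M : Finset (Sym2 V)} {v : V} : v ∈ vertsOf M ↔ ∃ e ∈ M, v ∈ e := by
  simp [vertsOf]

lemma two_mul_card_le_card_vertsOf {M : Finset (Sym2 V)} (hdiag : ∀ e ∈ M, ¬ e.IsDiag)
    (hM : ∀ e ∈ M, ∀ f ∈ M, e ≠ f → ∀ v, v ∈ e → v ∉ f) : 2 * M.card ≤ (vertsOf M).card := by
  classical
  have h1 : vertsOf M = M.biUnion fun e => Finset.univ.filter fun v => v ∈ e := by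
    ext v; simp [mem_vertsOf]
  rw [h1, Finset.card_biUnion, mul_comm]
  · refine le_of_eq_of_le (b := ∑ e ∈ M, 2) (by simp) (Finset.sum_le_sum fun e he => ?_)
    induction e with
    | _ a b =>
      have hab : a ≠ b := by simpa using hdiag _ he
      refine (Finset.card_pair hab).symm.le.trans (Finset.card_le_card ?_)
      intro v; simp
  · intro e he f hf hef
    rw [Function.onFun, Finset.disjoint_left]
    intro v hv hv'
    exact hM e he f hf hef v (by simpa using hv) (by simpa using hv')

/-- Linking the edges of a matching on the neighbourhood of the core into few paths. -/
lemma Expanding.exists_linkState (h : Expanding G H x₀ μ cap w r₀ η ℓ X)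
    (hn : LinkNumbers (Fintype.card V) x₀ μ cap w r₀ η ℓ m k₀ t)
    {A : Finset V} (hBA : coreF G ⊆ A) (hA : A ⊆ closedNb G (coreF G))
    {M : Finset (Sym2 V)} (hdiag : ∀ e ∈ M, ¬ e.IsDiag)
    (hM : ∀ e ∈ M, ∀ f ∈ M, e ≠ f → ∀ v, v ∈ e → v ∉ f)
    (hMA : ∀ e ∈ M, ∀ v ∈ e, v ∈ A ∧ v ∉ coreF G) :
    (Finset.univ \ coreF G).card ≤ 4 * r₀ ∧
    ∃ C ⊆ A, ∃ F, LinkState (augment G H (coreF G)) M A C μ F ∧ F.card ≤ m ∧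
      (Finset.univ \ (C \ cov F)).card ≤ w ∧
      LinkHyp (augment G H (coreF G)) C X μ cap w ℓ := by
  classical
  obtain ⟨R, ch, hR⟩ := exists_redSet G
  have hRr := h.card_red hR
  have hBc := hR.card_le
  set B := coreF G with hB
  set K := augment G H B with hK
  have hHK : H ≤ K := le_augment G H B
  have hKG : K ≤ G := augment_le h.le B
  refine ⟨by omega, ?_⟩
  set C := (A \ vertsOf M) \ cl G X with hC
  have hCA : C ⊆ A := Finset.sdiff_subset.trans Finset.sdiff_subset
  have hCc : Finset.univ \ C ⊆ (Finset.univ \ B) ∪ cl G X := by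
    intro v hv
    by_cases hvB : v ∈ B
    · refine Finset.mem_union_right _ ?_
      by_contra hvX
      have hvM : v ∉ vertsOf M := fun hvM => by
        obtain ⟨e, he, hve⟩ := mem_vertsOf.1 hvM
        exact (hMA e he v hve).2 hvB
      exact (Finset.mem_sdiff.1 hv).2
        (Finset.mem_sdiff.2 ⟨Finset.mem_sdiff.2 ⟨hBA hvB, hvM⟩, hvX⟩)
    · exact Finset.mem_union_left _ (by simpa using hvB)
  have hCcard := (Finset.card_le_card hCc).trans (Finset.card_union_le _ _)
  have hX := h.card_cl
  have hsum := hn.sum_le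
  have hyp : LinkHyp K C X μ cap w ℓ :=
    { mid := fun Y h1 h2 => (h.mid Y h1 h2).trans_le
        (Finset.card_le_card (cl_mono hHK (Finset.Subset.refl _)))
      large := fun Y h1 h2 => (h.large Y h1 h2).trans
        (Finset.card_le_card (cl_mono hHK (Finset.Subset.refl _)))
      four_le := hn.four_le
      cap_le := hn.cap_le
      le_cap := hn.le_cap
      two_le := hn.two_le
      cyc := h.cyc.anti hKG
      disj := by
        rw [Finset.disjoint_left]
        intro v hv hvC
        exact (Finset.mem_sdiff.1 hvC).2 (cl_mono hKG (Finset.Subset.refl _) hv) }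
  obtain ⟨S, hSA, hScap, hSC, hmax⟩ := exists_maximal_sparse K A C 3 cap
  have hclS : ∀ Y : Finset V, Y.card ≤ (Y ∩ C).card + (Finset.univ \ C).card := fun Y => by
    have h1 : Y ⊆ (Y ∩ C) ∪ (Finset.univ \ C) := fun v hv => by
      by_cases hvC : v ∈ C
      · exact Finset.mem_union_left _ (Finset.mem_inter.2 ⟨hv, hvC⟩)
      · exact Finset.mem_union_right _ (by simpa using hvC)
    exact (Finset.card_le_card h1).trans (Finset.card_union_le _ _)
  have hSμ : S.card < μ := by
    by_contra! hle
    have h1 := hyp.mid S hle hScap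
    have h2 := hclS (cl K S)
    omega
  have hSR : S.card + R.card < x₀ := by
    by_contra! hle
    have hd : Disjoint S R := by
      rw [Finset.disjoint_left]
      exact fun v hv hvR => hR.disj v hvR (hA (hSA hv))
    have hc := Finset.card_union_of_disjoint hd
    have h1 := h.small (S ∪ R) (by omega) (by omega)
    have h2 : cl H (S ∪ R) ⊆ (cl K S ∩ C) ∪ ((Finset.univ \ B) ∪ cl G X) := by
      rw [cl_union]
      intro v hv
      by_cases hvC : v ∈ C
      · rcases Finset.mem_union.1 hv with hv | hv
        · exact Finset.mem_union_left _ (Finset.mem_inter.2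
            ⟨cl_mono hHK (Finset.Subset.refl _) hv, hvC⟩)
        · have := Finset.disjoint_left.1 hR.cl_disjoint (cl_mono h.le (Finset.Subset.refl _) hv)
          exact Finset.mem_union_right _ (Finset.mem_union_left _ (by simpa using this))
      · exact Finset.mem_union_right _ (hCc (by simpa using hvC))
    have h3 := (Finset.card_le_card h2).trans (Finset.card_union_le _ _)
    have h4 := Finset.card_union_le (Finset.univ \ B) (cl G X)
    omega
  obtain ⟨p, hpN, hpinj⟩ := exists_privates (S := S) 2 (N := fun s => nbS K {s} ∩ B)
    fun T hT => by
      have h1 := two_mul_card_le_of_noDense h.le h.dense hR (S := T) ((hT.trans hSA).trans hA)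
        (by have := Finset.card_le_card hT; omega)
      refine h1.trans (Finset.card_le_card fun v hv => ?_)
      obtain ⟨hv, hvB⟩ := Finset.mem_inter.1 hv
      obtain ⟨s, hs, hsv⟩ := mem_nbS.1 hv
      exact Finset.mem_biUnion.2 ⟨s, hs, Finset.mem_inter.2 ⟨by simpa using hsv, hvB⟩⟩
  have hpB : ∀ s ∈ S, ∀ i, p s i ∈ B := fun s hs i => (Finset.mem_inter.1 (hpN s hs i)).2
  have hpK : ∀ s ∈ S, ∀ i, K.Adj s (p s i) := fun s hs i => by
    simpa using (Finset.mem_inter.1 (hpN s hs i)).1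
  have hpM : ∀ s ∈ S, ∀ i, ∀ e ∈ M, p s i ∉ e := fun s hs i e he hpe =>
    (hMA e he _ hpe).2 (hpB s hs i)
  obtain ⟨F₀, hF₀⟩ := exists_childCover S.card S (S ∩ vertsOf M) rfl hpK hpinj
    Finset.inter_subset_left fun s hs i hi => by
      obtain ⟨e, he, hpe⟩ := mem_vertsOf.1 (Finset.mem_inter.1 hi).2
      exact hpM s hs i e he hpe
  obtain ⟨F, hF⟩ := hF₀.exists_mergeState hdiag hM
    (fun v => by rw [Finset.mem_inter, mem_vertsOf]) hpM M (Finset.Subset.refl _)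
  obtain ⟨hL, hcovF⟩ := hF.linkState (A := A) (C := C) (μ := μ) (cap := cap) hSA
    (fun e he v hv => (hMA e he v hv).1) (fun s hs i => hBA (hpB s hs i))
    (fun e he v hv hvC => (Finset.mem_sdiff.1 (Finset.mem_sdiff.1 hvC).1).2
      (mem_vertsOf.2 ⟨e, he, hv⟩)) hpK (by have := hn.two_le; omega) hmax
  have hMcard : 2 * M.card + R.card ≤ (Finset.univ \ B).card := by
    have h1 := two_mul_card_le_card_vertsOf hdiag hM
    have hd : Disjoint (vertsOf M) R := by
      rw [Finset.disjoint_left]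
      intro v hv hvR
      obtain ⟨e, he, hve⟩ := mem_vertsOf.1 hv
      exact hR.disj v hvR (hA (hMA e he v hve).1)
    have h2 : vertsOf M ∪ R ⊆ Finset.univ \ B := by
      intro v hv
      rw [Finset.mem_sdiff]
      refine ⟨Finset.mem_univ _, fun hvB => ?_⟩
      rcases Finset.mem_union.1 hv with hv | hv
      · obtain ⟨e, he, hve⟩ := mem_vertsOf.1 hv
        exact (hMA e he v hve).2 hvB
      · exact hR.disj v hv (mem_closedNb.2 (Or.inl hvB))
    have h3 := Finset.card_le_card h2
    rw [Finset.card_union_of_disjoint hd] at h3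
    omega
  have hFk : F.card ≤ k₀ := by
    have h1 := hF.card
    have h2 := hn.k_le
    omega
  have hFc : (Finset.univ \ (C \ cov F)).card ≤ 4 * r₀ + η + 3 * x₀ := by
    have h1 : Finset.univ \ (C \ cov F) ⊆ (Finset.univ \ C) ∪ (cl K S ∩ C) := by
      intro v hv
      by_cases hvC : v ∈ C
      · have hvF : v ∈ cov F := by
          by_contra hvF
          exact (Finset.mem_sdiff.1 hv).2 (Finset.mem_sdiff.2 ⟨hvC, hvF⟩)
        exact Finset.mem_union_right _
          (Finset.mem_inter.2 ⟨hcovF (Finset.mem_inter.2 ⟨hvC, hvF⟩), hvC⟩)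
      · exact Finset.mem_union_left _ (by simpa using hvC)
    have h2 := (Finset.card_le_card h1).trans (Finset.card_union_le _ _)
    omega
  have hIoc : Finset.Ioc m F.card ⊆ Finset.Ioc m k₀ := Finset.Ioc_subset_Ioc_right hFk
  obtain ⟨F', hF', hFm, hFw⟩ := hL.exists_few (t := t) hyp hCA
    (fun k hk => hn.step k (hIoc hk)) (by
      have := Finset.sum_le_sum_of_subset (f := fun k => 2 * t k) hIoc
      omega)
  exact ⟨C, hCA, F', hF', hFm, hFw, hyp⟩

lemma LinkState.expands {K : SimpleGraph V} {M : Finset (Sym2 V)} {A C : Finset V}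
    {F : Finset (List V)} (h : LinkState K M A C μ F) (hyp : LinkHyp K C X μ cap w ℓ) (hCA : C ⊆ A)
    (hw : (Finset.univ \ (C \ cov F)).card ≤ w) {k : ℕ} (hk : 4 * k ≤ Fintype.card V) :
    Expands K (live A F) (A \ cov F) k := by
  intro S hS hSk
  have h1 : 3 * S.card ≤ (cl K S ∩ (C \ cov F)).card := by
    rcases Nat.lt_or_ge S.card μ with hμ | hμ
    · exact h.inv S hS hμ
    have h2 : (cl K S).card ≤ (cl K S ∩ (C \ cov F)).card + (Finset.univ \ (C \ cov F)).card := by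
      have h1 : cl K S ⊆ (cl K S ∩ (C \ cov F)) ∪ (Finset.univ \ (C \ cov F)) := fun v hv => by
        by_cases hvC : v ∈ C \ cov F
        · exact Finset.mem_union_left _ (Finset.mem_inter.2 ⟨hv, hvC⟩)
        · exact Finset.mem_union_right _ (Finset.mem_sdiff.2 ⟨Finset.mem_univ _, hvC⟩)
      exact (Finset.card_le_card h1).trans (Finset.card_union_le _ _)
    rcases Nat.le_total S.card cap with hc | hc
    · have := hyp.mid S hμ hc
      omega
    · have := hyp.large S hc (by omega)
      omega
  have h2 : cl K S ∩ (C \ cov F) ⊆ ((nbS K S ∩ (A \ cov F)) \ S) ∪ S := by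
    intro v hv
    obtain ⟨hv, hvC⟩ := Finset.mem_inter.1 hv
    by_cases hvS : v ∈ S
    · exact Finset.mem_union_right _ hvS
    · refine Finset.mem_union_left _ (Finset.mem_sdiff.2 ⟨Finset.mem_inter.2 ⟨?_, ?_⟩, hvS⟩)
      · exact (Finset.mem_union.1 hv).resolve_left hvS
      · exact Finset.sdiff_subset_sdiff hCA (Finset.Subset.refl _) hvC
  have h3 := (Finset.card_le_card h2).trans (Finset.card_union_le _ _)
  omega

end Assembly

section Finish

variable {V : Type*} [Fintype V] [DecidableEq V]

/-- The properties of the arcs `ar` and the short cycles of `G` that give a path cover. -/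
structure ArcCover (G H : SimpleGraph V) (ar : V → V → Prop) (ℓ δ s : ℕ) : Prop where
  arc : ∀ u v, ar u v → H.Adj u v
  hall : ∀ A Y : Finset V, (∀ a ∈ A, ∀ y ∈ Y, ¬ ar a y) → A.card + Y.card ≤ Fintype.card V + δ
  double : ∀ E : Finset (Sym2 V), (∀ e ∈ E, ∃ u v, e = s(u, v) ∧ ar u v ∧ ar v u) → E.card ≤ s
  cycles : ∀ F : Finset (List V), (∀ l ∈ F, l.Nodup ∧ 3 ≤ l.length ∧ l.length ≤ ℓ ∧
    l.IsChain G.Adj ∧ ClosedUp G.Adj l) → (∀ l ∈ F, ∀ l' ∈ F, ∀ x ∈ l, x ∈ l' → l = l') → F.card ≤ s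

variable {G H : SimpleGraph V} {ar : V → V → Prop} {ℓ δ s : ℕ}

lemma card_mul_le_of_disjoint_lists {F : Finset (List V)} (hn : ∀ l ∈ F, l.Nodup)
    (hd : ∀ l ∈ F, ∀ l' ∈ F, ∀ x ∈ l, x ∈ l' → l = l') {k : ℕ} (hk : ∀ l ∈ F, k ≤ l.length) :
    F.card * k ≤ Fintype.card V := by
  have h1 : (cov F).card = ∑ l ∈ F, l.toFinset.card := by
    refine Finset.card_biUnion fun l hl l' hl' hne => Finset.disjoint_left.2 fun x hx hx' => hne ?_
    exact hd l hl l' hl' x (by simpa using hx) (by simpa using hx')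
  refine le_trans ?_ (Finset.card_le_univ (cov F))
  rw [h1, ← smul_eq_mul]
  refine Finset.card_nsmul_le_sum _ _ _ fun l hl => ?_
  rw [List.toFinset_card_of_nodup (hn l hl)]
  exact hk l hl

open Classical in
lemma ArcCover.card_closed_le (h : ArcCover G H ar ℓ δ s) (hHG : H ≤ G) (hℓ : 0 < ℓ)
    {T : Finset V} {F : Finset (List V)} (hF : PathPartition ar T F) :
    (F.filter (ClosedUp ar)).card ≤ 2 * s + Fintype.card V / ℓ := by
  have harG : ∀ u v, ar u v → G.Adj u v := fun u v huv => hHG (h.arc u v huv)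
  set Cs := F.filter (ClosedUp ar) with hCs
  have hCF : Cs ⊆ F := Finset.filter_subset _ _
  have h1 : Cs ⊆ (Cs.filter fun l => l.length ≤ 2) ∪
      ((Cs.filter fun l => 3 ≤ l.length ∧ l.length ≤ ℓ) ∪ Cs.filter fun l => ℓ ≤ l.length) := by
    intro l hl
    simp only [Finset.mem_union, Finset.mem_filter, hl, true_and]
    omega
  have h2 : (Cs.filter fun l => l.length ≤ 2).card ≤ s := by
    set D := Cs.filter fun l => l.length ≤ 2
    have hD : ∀ l ∈ D, ∃ u v, l = [u, v] ∧ ar u v ∧ ar v u := by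
      intro l hl
      obtain ⟨hlC, hlen⟩ := Finset.mem_filter.1 hl
      obtain ⟨hlF, a, b, ha, hb, hba⟩ := Finset.mem_filter.1 hlC
      match l, hlen with
      | [], _ => simp at ha
      | [u], _ =>
        simp only [List.head?_cons, Option.some.injEq, List.getLast?_singleton] at ha hb
        subst ha hb
        exact ((h.arc _ _ hba).ne rfl).elim
      | [u, v], _ =>
        simp only [List.head?_cons, Option.some.injEq, List.getLast?_cons_cons,
          List.getLast?_singleton] at ha hb
        subst ha hb
        have := hF.chain _ hlF
        exact ⟨u, v, rfl, by simpa using this, hba⟩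
    have hinj : D.card ≤ (endPairs D).card := by
      refine Finset.card_le_card_of_forall_subsingleton (fun d e => IsEnds d e) (fun d hd => ?_) ?_
      · obtain ⟨u, v, rfl, -⟩ := hD d hd
        have : IsEnds [u, v] s(u, v) := ⟨u, v, rfl, rfl, rfl⟩
        exact ⟨_, mem_endPairs.2 ⟨_, hd, this⟩, this⟩
      · intro e he d hd d' hd'
        obtain ⟨a, b, ha, hb, rfl⟩ := hd.2
        have hmem : ∀ d ∈ D, d ∈ F := fun d hd => hCF (Finset.mem_filter.1 hd).1
        exact hF.disj d (hmem d hd.1) d' (hmem d' hd'.1) a (List.mem_of_head? ha)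
          (hd'.2.mem (by simp))
    refine hinj.trans (h.double _ fun e he => ?_)
    obtain ⟨d, hd, hde⟩ := mem_endPairs.1 he
    obtain ⟨u, v, rfl, huv⟩ := hD d hd
    exact ⟨u, v, hde.unique ⟨u, v, rfl, rfl, rfl⟩, huv⟩
  have h3 : (Cs.filter fun l => 3 ≤ l.length ∧ l.length ≤ ℓ).card ≤ s := by
    refine h.cycles _ (fun l hl => ?_) fun l hl l' hl' => hF.disj l ?_ l' ?_
    · obtain ⟨hlC, h3, hℓ'⟩ := Finset.mem_filter.1 hl
      obtain ⟨hlF, a, b, ha, hb, hba⟩ := Finset.mem_filter.1 hlC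
      exact ⟨hF.nodup l hlF, h3, hℓ', (hF.chain l hlF).imp harG, a, b, ha, hb, harG _ _ hba⟩
    · exact hCF (Finset.mem_filter.1 hl).1
    · exact hCF (Finset.mem_filter.1 hl').1
  have h4 : (Cs.filter fun l => ℓ ≤ l.length).card ≤ Fintype.card V / ℓ := by
    rw [Nat.le_div_iff_mul_le hℓ]
    have hsub : (Cs.filter fun l => ℓ ≤ l.length) ⊆ F := (Finset.filter_subset _ _).trans hCF
    exact card_mul_le_of_disjoint_lists (fun l hl => hF.nodup l (hsub hl))
      (fun l hl l' hl' => hF.disj l (hsub hl) l' (hsub hl')) fun l hl => (Finset.mem_filter.1 hl).2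
  have h5 := (Finset.card_le_card h1).trans (Finset.card_union_le _ _)
  have h6 := Finset.card_union_le (Cs.filter fun l => 3 ≤ l.length ∧ l.length ≤ ℓ)
    (Cs.filter fun l => ℓ ≤ l.length)
  omega

open Classical in
lemma ArcCover.exists_pathPartition (h : ArcCover G H ar ℓ δ s) (hHG : H ≤ G) (hℓ : 0 < ℓ)
    {T : Finset V} {w : ℕ} (hT : (Finset.univ \ T).card ≤ w) :
    ∃ F, PathPartition ar T F ∧ F.card ≤ δ + w + (2 * s + Fintype.card V / ℓ) := by
  obtain ⟨F, hF, hc⟩ := _root_.exists_pathPartition (ar := ar) (T := T) (D := δ + w) (by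
    intro A hA
    have h1 := h.hall A (T.filter fun v => ¬ ∃ u ∈ A, ar u v) fun a ha y hy hay =>
      (Finset.mem_filter.1 hy).2 ⟨a, ha, hay⟩
    have h2 := Finset.card_filter_add_card_filter_not (s := T) (fun v => ∃ u ∈ A, ar u v)
    have h3 := Finset.card_sdiff_add_card_inter (Finset.univ : Finset V) T
    rw [Finset.univ_inter, Finset.card_univ] at h3
    omega)
  exact ⟨F, hF, hc.trans (Nat.add_le_add_left (h.card_closed_le hHG hℓ hF) _)⟩

lemma ArcCover.exists_shortCyclesMeet (h : ArcCover G H ar ℓ δ s) {Δ : ℕ}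
    (hΔ : ∀ v, (nbS G {v}).card ≤ Δ) :
    ∃ X, ShortCyclesMeet G ℓ X ∧ (cl G X).card ≤ s * ℓ * (Δ + 1) := by
  classical
  set P : Finset (List V) → Prop := fun F => (∀ l ∈ F, l.Nodup ∧ 3 ≤ l.length ∧ l.length ≤ ℓ ∧
    l.IsChain G.Adj ∧ ClosedUp G.Adj l) ∧ (∀ l ∈ F, ∀ l' ∈ F, ∀ x ∈ l, x ∈ l' → l = l') with hP
  obtain ⟨k, ⟨F, hF, hFk⟩, hmax⟩ : ∃ k, (∃ F, P F ∧ F.card = k) ∧ ∀ F, P F → F.card ≤ k := by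
    have hbdd : ∀ F, P F → F.card ≤ s := fun F hF => h.cycles F hF.1 hF.2
    have h0 : ∃ k, ∃ F, P F ∧ F.card = k := ⟨0, ∅, by simp [hP], rfl⟩
    have hbd : ∀ k, (∃ F, P F ∧ F.card = k) → k ≤ s := by rintro _ ⟨F, hF, rfl⟩; exact hbdd F hF
    obtain ⟨k, hk⟩ := h0
    have := Nat.findGreatest_spec (P := fun k => ∃ F, P F ∧ F.card = k) (hbd k hk) hk
    exact ⟨_, this, fun F hF => Nat.le_findGreatest (hbdd F hF) ⟨F, hF, rfl⟩⟩
  refine ⟨cov F, ?_, ?_⟩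
  · intro l hn h3 hℓ hch hcl
    by_contra! hnot
    have hlne : l ≠ [] := by rintro rfl; simp at h3
    have hlF : l ∉ F := fun hlF => hnot _ (List.head_mem hlne) (mem_cov.2 ⟨l, hlF, List.head_mem hlne⟩)
    have hd : ∀ l' ∈ F, ∀ x ∈ l, x ∉ l' := fun l' hl' x hx hx' => hnot x hx (mem_cov.2 ⟨l', hl', hx'⟩)
    have := hmax (insert l F) ⟨fun l' hl' => ?_, fun l₁ h₁ l₂ h₂ x hx hx' => ?_⟩
    · rw [Finset.card_insert_of_notMem hlF] at this
      omega
    · rcases Finset.mem_insert.1 hl' with rfl | hl'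
      · exact ⟨hn, h3, hℓ, hch, _, _, List.head?_eq_some_head hlne, List.getLast?_eq_some_getLast hlne,
          hcl _ _ (List.head?_eq_some_head hlne) (List.getLast?_eq_some_getLast hlne)⟩
      · exact hF.1 l' hl'
    · rcases Finset.mem_insert.1 h₁ with h₁ | h₁ <;> rcases Finset.mem_insert.1 h₂ with h₂ | h₂
      · rw [h₁, h₂]
      · exact (hd _ h₂ x (h₁ ▸ hx) hx').elim
      · exact (hd _ h₁ x (h₂ ▸ hx') hx).elim
      · exact hF.2 _ h₁ _ h₂ x hx hx'
  · have h1 : (cov F).card ≤ F.card * ℓ := Finset.card_biUnion_le_card_mul _ _ _ fun l hl =>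
      (List.toFinset_card_le l).trans (hF.1 l hl).2.2.1
    have h2 : cl G (cov F) ⊆ (cov F).biUnion fun v => {v} ∪ nbS G {v} := by
      intro v hv
      obtain ⟨u, hu, huv⟩ := mem_cl.1 hv
      refine Finset.mem_biUnion.2 ⟨u, hu, ?_⟩
      rcases huv with rfl | huv
      · simp
      · simp [huv]
    have h3 := Finset.card_biUnion_le_card_mul (cov F) (fun v => {v} ∪ nbS G {v}) (Δ + 1) fun v _ => by
      have := Finset.card_union_le {v} (nbS G {v})
      have := hΔ v
      rw [Finset.card_singleton] at *
      omega
    exact (Finset.card_le_card h2).trans (h3.trans (Nat.mul_le_mul_right _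
      (h1.trans (Nat.mul_le_mul_right _ (h.cycles F hF.1 hF.2)))))

variable {x₀ μ cap w r₀ η m k₀ : ℕ} {t : ℕ → ℕ} {X : Finset V}

omit [Fintype V] [DecidableEq V] in
lemma exists_ends {d : List V} (hd : 2 ≤ d.length) (hn : d.Nodup) :
    ∃ a b, a ≠ b ∧ d.head? = some a ∧ d.getLast? = some b := by
  have hne : d ≠ [] := by rintro rfl; simp at hd
  refine ⟨_, _, ?_, List.head?_eq_some_head hne, List.getLast?_eq_some_getLast hne⟩
  obtain ⟨a, l, rfl⟩ := List.exists_cons_of_ne_nil hne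
  have hl : l ≠ [] := by rintro rfl; simp at hd
  rw [List.getLast_cons hl, List.head_cons]
  rintro h
  exact (List.nodup_cons.1 hn).1 (h ▸ List.getLast_mem hl)

/-- A path cover of the vertices outside `F` gives a bound on the number of missing edges. -/
lemma hamDefect_live_le {K G' : SimpleGraph V} {A : Finset V} {F L : Finset (List V)}
    (hlin : Linear G' F) (hlen : ∀ l ∈ F, 2 ≤ l.length) (hL : PathPartition ar (A \ cov F) L)
    (harK : ∀ u v, ar u v → K.Adj u v) (hT : 2 ≤ (live A F).card) :
    hamDefect K (SimpleGraph.fromEdgeSet ↑(endPairs F)) (live A F) ≤ L.card + F.card ∧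
    HasHamCycle ⊤ (SimpleGraph.fromEdgeSet ↑(endPairs F)) (live A F) := by
  classical
  set E : List V → List V := fun d => d.head?.toList ++ d.getLast?.toList with hE
  have hEeq : ∀ {d : List V} {a b : V}, d.head? = some a → d.getLast? = some b → E d = [a, b] := by
    intro d a b ha hb
    simp [hE, ha, hb]
  have hEmem : ∀ d x, x ∈ E d → x ∈ d := by
    intro d x hx
    simp only [hE, List.mem_append, Option.mem_toList] at hx
    exact hx.elim List.mem_of_head? List.mem_of_getLast?
  set Mg := SimpleGraph.fromEdgeSet (↑(endPairs F) : Set (Sym2 V)) with hMg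
  have hLmem : ∀ l ∈ L, ∀ x ∈ l, x ∉ cov F := fun l hl x hx =>
    (Finset.mem_sdiff.1 ((hL.mem x).2 ⟨l, hl, hx⟩)).2
  have hpp : PathPartition (K ⊔ Mg).Adj (live A F) (L ∪ F.image E) := by
    refine ⟨?_, ?_, ?_, ?_, ?_⟩
    · intro l hl
      rcases Finset.mem_union.1 hl with hl | hl
      · exact hL.ne l hl
      · obtain ⟨d, hd, rfl⟩ := Finset.mem_image.1 hl
        obtain ⟨a, b, -, ha, hb⟩ := exists_ends (hlen d hd) (hlin.nodup d hd)
        simp [hEeq ha hb]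
    · intro l hl
      rcases Finset.mem_union.1 hl with hl | hl
      · exact hL.nodup l hl
      · obtain ⟨d, hd, rfl⟩ := Finset.mem_image.1 hl
        obtain ⟨a, b, hab, ha, hb⟩ := exists_ends (hlen d hd) (hlin.nodup d hd)
        simp [hEeq ha hb, hab]
    · intro l hl
      rcases Finset.mem_union.1 hl with hl | hl
      · exact (hL.chain l hl).imp fun u v huv => Or.inl (harK u v huv)
      · obtain ⟨d, hd, rfl⟩ := Finset.mem_image.1 hl
        obtain ⟨a, b, hab, ha, hb⟩ := exists_ends (hlen d hd) (hlin.nodup d hd)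
        rw [hEeq ha hb]
        have : Mg.Adj a b := by
          rw [hMg, SimpleGraph.fromEdgeSet_adj]
          exact ⟨mem_endPairs.2 ⟨d, hd, a, b, ha, hb, rfl⟩, hab⟩
        simp [this]
    · intro l hl l' hl' x hx hx'
      rcases Finset.mem_union.1 hl with h1 | h1 <;> rcases Finset.mem_union.1 hl' with h2 | h2
      · exact hL.disj l h1 l' h2 x hx hx'
      · obtain ⟨d, hd, rfl⟩ := Finset.mem_image.1 h2
        exact (hLmem l h1 x hx (mem_cov.2 ⟨d, hd, hEmem d x hx'⟩)).elim
      · obtain ⟨d, hd, rfl⟩ := Finset.mem_image.1 h1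
        exact (hLmem l' h2 x hx' (mem_cov.2 ⟨d, hd, hEmem d x hx⟩)).elim
      · obtain ⟨d, hd, rfl⟩ := Finset.mem_image.1 h1
        obtain ⟨d', hd', rfl⟩ := Finset.mem_image.1 h2
        rw [hlin.disj d hd d' hd' x (hEmem d x hx) (hEmem d' x hx')]
    · intro v
      rw [live, Finset.mem_union, hL.mem v, mem_pathEnds]
      constructor
      · rintro (⟨l, hl, hv⟩ | ⟨d, hd, hv⟩)
        · exact ⟨l, Finset.mem_union_left _ hl, hv⟩
        · refine ⟨E d, Finset.mem_union_right _ (Finset.mem_image_of_mem _ hd), ?_⟩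
          simpa [hE] using hv
      · rintro ⟨l, hl, hv⟩
        rcases Finset.mem_union.1 hl with hl | hl
        · exact Or.inl ⟨l, hl, hv⟩
        · obtain ⟨d, hd, rfl⟩ := Finset.mem_image.1 hl
          exact Or.inr ⟨d, hd, by simpa [hE] using hv⟩
  obtain ⟨W, hW, hc⟩ := hpp.exists_hamCycle (fun a b hab => by
    rw [hMg, SimpleGraph.fromEdgeSet_adj] at hab
    obtain ⟨d, hd, x, y, hx, hy, he⟩ := mem_endPairs.1 hab.1
    refine ⟨E d, Finset.mem_union_right _ (Finset.mem_image_of_mem _ hd), ?_⟩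
    rw [hEeq hx hy]
    exact ⟨x, y, he, List.infix_refl _⟩) hT
  refine ⟨(hamDefect_le hc).trans (hW.trans ((Finset.card_union_le _ _).trans
    (Nat.add_le_add_left Finset.card_image_le _))), hc.mono le_top⟩

/-- The vertices of `T` that do not lie on an edge of `Mp`. -/
def offVerts (T : Finset V) (Mp : Finset (Sym2 V)) : Finset V := T.filter fun v => ∀ e ∈ Mp, v ∉ e

lemma offVerts_live {A : Finset V} {F : Finset (List V)} (hlen : ∀ l ∈ F, 2 ≤ l.length) :
    offVerts (live A F) (endPairs F) = A \ cov F := by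
  ext v
  simp only [offVerts, Finset.mem_filter, live, Finset.mem_union, mem_pathEnds]
  constructor
  · rintro ⟨h1 | ⟨l, hl, h1⟩, h2⟩
    · exact h1
    · obtain ⟨e, he⟩ := exists_isEnds (hlen l hl)
      obtain ⟨a, b, ha, hb, rfl⟩ := id he
      refine (h2 _ (mem_endPairs.2 ⟨l, hl, he⟩) ?_).elim
      rcases h1 with h1 | h1
      · rw [ha, Option.some.injEq] at h1; simp [h1]
      · rw [hb, Option.some.injEq] at h1; simp [h1]
  · refine fun hv => ⟨Or.inl hv, fun e he hve => ?_⟩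
    obtain ⟨d, hd, hde⟩ := mem_endPairs.1 he
    exact (Finset.mem_sdiff.1 hv).2 (mem_cov.2 ⟨d, hd, hde.mem hve⟩)

/-- Hamiltonicity of all the sets of vertices and pairs of ends that may be left by the linking. -/
def Closes (G H : SimpleGraph V) (x₀ w m j : ℕ) : Prop :=
  ∀ T : Finset V, ∀ Mp : Finset (Sym2 V), (Finset.univ \ T).card ≤ w → Mp.card ≤ m → 3 ≤ T.card →
    HasHamCycle ⊤ (SimpleGraph.fromEdgeSet ↑Mp) T →
    ∀ B : Finset V, (Finset.univ \ B).card ≤ x₀ → (lowSet H B).card ≤ x₀ →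
    Expands (augment G H B) T (offVerts T Mp) (Fintype.card V / 4) →
    hamDefect (augment G H B) (SimpleGraph.fromEdgeSet ↑Mp) T ≤ j →
    hamDefect G (SimpleGraph.fromEdgeSet ↑Mp) T = 0

lemma robust_of_closes {n : ℕ} {G H : SimpleGraph (Fin n)} {ar : Fin n → Fin n → Prop}
    {X : Finset (Fin n)} {j : ℕ} (h : Expanding G H x₀ μ cap w r₀ η ℓ X)
    (hn : LinkNumbers n x₀ μ cap w r₀ η ℓ m k₀ t) (hx : x₀ ≤ μ) (hr : 4 * r₀ ≤ x₀)
    (ha : ArcCover G H ar ℓ δ s) (hℓ : 0 < ℓ) (hj : δ + w + (2 * s + n / ℓ) + m ≤ j)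
    (hc : Closes G H x₀ w m j) : RobustHam n G := by
  classical
  have hN : Fintype.card (Fin n) = n := Fintype.card_fin n
  rw [← hN] at hn
  intro U hU M hdiag hMU hM
  set A := (closedNb G (coreF G)).filter fun v => v ∉ U with hA
  have hmemA : ∀ x, x ∈ A ↔ x ∈ (strongCore G 4 ∪ strongBlue G 4) \ U := by
    intro x
    simp only [hA, Finset.mem_filter, mem_closedNb, mem_coreF, strongBlue, Set.mem_sdiff,
      Set.mem_union, Set.mem_ofPred_eq]
    by_cases hx : x ∈ strongCore G 4 <;> simp [hx]
  have hBA : coreF G ⊆ A := by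
    intro v hv
    refine Finset.mem_filter.2 ⟨mem_closedNb.2 (Or.inl hv), fun hvU => ?_⟩
    exact (hU hvU).1 (mem_coreF.1 hv)
  obtain ⟨hBc, C, hCA, F, hst, hFm, hw, hyp⟩ := h.exists_linkState hn hBA (Finset.filter_subset _ _)
    hdiag hM fun e he v hv => by
      obtain ⟨h1, h2⟩ := hMU e he v hv
      exact ⟨(hmemA v).2 ⟨Or.inr h1, h2⟩, fun h3 => h1.1 (mem_coreF.1 h3)⟩
  have hw' : (Finset.univ \ (A \ cov F)).card ≤ w := (Finset.card_le_card
    (Finset.sdiff_subset_sdiff (Finset.Subset.refl _)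
      (Finset.sdiff_subset_sdiff hCA (Finset.Subset.refl _)))).trans hw
  obtain ⟨L, hL, hLc⟩ := ha.exists_pathPartition h.le hℓ hw'
  have hTc : (Finset.univ \ live A F).card ≤ w := (Finset.card_le_card
    (Finset.sdiff_subset_sdiff (Finset.Subset.refl _) Finset.subset_union_left)).trans hw'
  have hT3 : 3 ≤ (live A F).card := by
    have h1 := Finset.card_sdiff_add_card_inter (Finset.univ : Finset (Fin n)) (live A F)
    rw [Finset.univ_inter, Finset.card_univ] at h1
    have := hn.w_le
    omega
  have hHK := le_augment G H (coreF G)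
  obtain ⟨hd, htop⟩ := hamDefect_live_le (K := augment G H (coreF G)) hst.lin hst.len hL
    (fun u v huv => hHK (ha.arc u v huv)) (by omega)
  have h0 := hc (live A F) (endPairs F) hTc ((card_endPairs_le F).trans hFm) hT3 htop (coreF G)
    (hBc.trans hr) (h.card_lowSet_lt hn hx).le (by
      rw [offVerts_live hst.len]
      exact hst.expands hyp hCA hw (Nat.mul_div_le _ _)) (by rw [hN] at hLc; omega)
  have hKG : augment G H (coreF G) ≤ G := augment_le h.le _
  obtain ⟨L, a, b, hLn, hLm, hLch, hLa, hLb, hba, hLe⟩ := expand_cycle (G'' := G ⊔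
    SimpleGraph.fromEdgeSet ↑M) hst.lin hst.len (sup_le_sup_right hKG _) le_sup_left
    (hasHamCycle_of_hamDefect htop h0)
  have hLA : ∀ x, x ∈ L ↔ x ∈ A := fun x => by
    rw [hLm, Finset.union_eq_left.2 hst.sub]
  obtain ⟨p, hp, hps, hpe⟩ := exists_cycle_of_list hLn (by
    rw [← List.toFinset_card_of_nodup hLn]
    refine hT3.trans (Finset.card_le_card fun v hv => ?_)
    rw [List.mem_toFinset, hLA]
    rcases Finset.mem_union.1 hv with hv | hv
    · exact (Finset.mem_sdiff.1 hv).1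
    · obtain ⟨l, hl, hv⟩ := mem_pathEnds.1 hv
      exact hst.sub (mem_cov.2 ⟨l, hl, hv.elim List.mem_of_head? List.mem_of_getLast?⟩))
    hLch hLa hLb hba
  refine ⟨b, p, hp, fun x => ?_, fun e he => ?_⟩
  · rw [hps, hLA, hmemA]
  · obtain ⟨l, hl, hle⟩ := hst.edge e he
    exact hpe e (hLe l hl e hle)

end Finish

section SprinkleEdges

/-- The graph with a given finite set of edges. -/
abbrev gr {V : Type*} (S : Finset (Sym2 V)) : SimpleGraph V := SimpleGraph.fromEdgeSet ↑S

lemma mem_allEdges {n : ℕ} {e : Sym2 (Fin n)} : e ∈ allEdges n ↔ ¬ e.IsDiag := by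
  simp [allEdges]

lemma gr_union {V : Type*} [DecidableEq V] (S T : Finset (Sym2 V)) : gr (S ∪ T) = gr S ⊔ gr T := by
  rw [gr, Finset.coe_union, SimpleGraph.fromEdgeSet_union]

variable {n : ℕ} {H : SimpleGraph (Fin n)} {T B : Finset (Fin n)} {Mp : Finset (Sym2 (Fin n))}
  {p θ : ℝ} {x₀ k b j w m : ℕ}

lemma bern_sprinkle_defect (h0 : 0 ≤ p) (h1 : p ≤ 1) (hθ : 0 < θ) (hθ1 : θ ≤ 1)
    (hlow : (lowSet H B).card ≤ x₀) (hT : 3 ≤ T.card) (htop : HasHamCycle ⊤ (gr Mp) T)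
    (hb : 2 * b ≤ (k - x₀) * (k - x₀)) :
    bern (allEdges n) p (fun R => ind (Expands (augment (H ⊔ gr R) H B) T (offVerts T Mp) k ∧
      hamDefect (augment (H ⊔ gr R) H B) (gr Mp) T ≤ j ∧ hamDefect (H ⊔ gr R) (gr Mp) T ≠ 0)) ≤
    θ⁻¹ ^ j * (1 - p * (1 - θ)) ^ b := by
  classical
  set Ω₁ := (allEdges n).filter fun e => ∃ v ∈ e, v ∈ lowSet H B with hΩ₁
  set Ω₂ := (allEdges n).filter fun e => ¬ ∃ v ∈ e, v ∈ lowSet H B with hΩ₂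
  have hX : 0 ≤ (1 - p * (1 - θ)) ^ b := pow_nonneg (by nlinarith) _
  have hθi : 1 ≤ θ⁻¹ := (one_le_inv₀ hθ).2 hθ1
  have hun : Ω₁ ∪ Ω₂ = allEdges n := Finset.filter_union_filter_not_eq _ _
  rw [← hun, bern_disjUnion (Finset.disjoint_filter_filter_not _ _ _)]
  refine bern_le_const h0 h1 fun R₁ hR₁ => ?_
  set K := augment (H ⊔ gr R₁) H B with hK
  have hlowiff : ∀ v, v ∈ lowSet H B ↔ (nbS H {v} ∩ B).card < 4 := by simp [lowSet]
  have haug : ∀ R₂ ⊆ Ω₂, augment (H ⊔ gr (R₁ ∪ R₂)) H B = K := by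
    intro R₂ hR₂
    ext u v
    simp only [hK, augment, ← hlowiff, SimpleGraph.sup_adj, SimpleGraph.fromEdgeSet_adj,
      Finset.coe_union, Set.mem_union, Finset.mem_coe]
    constructor
    · rintro (h | ⟨h | ⟨h | h, hne⟩, hl⟩)
      · exact Or.inl h
      · exact Or.inl h
      · exact Or.inr ⟨Or.inr ⟨h, hne⟩, hl⟩
      · exact ((Finset.mem_filter.1 (hR₂ h)).2
          (hl.elim (fun hl => ⟨u, by simp, hl⟩) fun hl => ⟨v, by simp, hl⟩)).elim
    · rintro (h | ⟨h | ⟨h, hne⟩, hl⟩)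
      · exact Or.inl h
      · exact Or.inl h
      · exact Or.inr ⟨Or.inr ⟨Or.inl h, hne⟩, hl⟩
  have hfull : ∀ R₂, H ⊔ gr (R₁ ∪ R₂) = K ⊔ gr R₂ := by
    intro R₂
    rw [gr_union, ← sup_assoc]
    congr 1
    refine le_antisymm (sup_le (le_augment _ _ _) fun u v huv => ?_) (augment_le le_sup_left _)
    have huv' := (SimpleGraph.fromEdgeSet_adj _).1 huv
    obtain ⟨x, hx, hxl⟩ := (Finset.mem_filter.1 (hR₁ huv'.1)).2
    refine Or.inr ⟨Or.inr huv, ?_⟩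
    rw [← hlowiff, ← hlowiff]
    rcases Sym2.mem_iff.1 hx with rfl | rfl
    exacts [Or.inl hxl, Or.inr hxl]
  by_cases hgood : Expands K T (offVerts T Mp) k ∧ hamDefect K (gr Mp) T ≤ j
  swap
  · rw [bern_congr (g := fun _ => 0) fun R₂ hR₂ => ind_false fun h => hgood (by
      rw [haug R₂ hR₂] at h; exact ⟨h.1, h.2.1⟩), bern_const]
    positivity
  set score : Finset (Sym2 (Fin n)) → ℕ := fun S => hamDefect (K ⊔ gr S) (gr Mp) T with hscore
  have hs0 : score ∅ ≤ j := by
    refine le_trans (le_of_eq ?_) hgood.2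
    simp [hscore, gr]
  refine (bern_mono h0 h1 (g := fun S => ind (0 < score S)) fun R₂ hR₂ => ?_).trans
    ((bern_sprinkle h0 h1 hθ hθ1 score (fun S S' hS => ?_) b fun S hS hpos => ?_).trans ?_)
  · refine ind_mono fun h => Nat.pos_of_ne_zero ?_
    have := h.2.2
    rwa [hfull] at this
  · refine hamDefect_anti htop (sup_le_sup_left ?_ _)
    exact SimpleGraph.fromEdgeSet_mono (by exact_mod_cast hS)
  · have := card_boosters (Γ := K ⊔ gr S) (Ω := Ω₂) (L := lowSet H B)
      (D := fun e => score (insert e S) < score S) htop hT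
      (T' := offVerts T Mp) (Finset.filter_subset _ _) (fun y hy z hyz => by
        rw [SimpleGraph.fromEdgeSet_adj] at hyz
        exact (Finset.mem_filter.1 hy).2 _ hyz.1 (by simp)) (hgood.1.mono le_sup_left)
      (fun a b hab ha hb => by
        simp only [hΩ₂, Finset.mem_filter, mem_allEdges, Sym2.mem_iff]
        refine ⟨by simpa using hab, ?_⟩
        rintro ⟨v, rfl | rfl, hv⟩
        exacts [ha hv, hb hv]) hpos (fun e he => by
        have h3 : K ⊔ gr (insert e S) = K ⊔ gr S ⊔ SimpleGraph.fromEdgeSet {e} := by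
          rw [Finset.insert_eq, Finset.union_comm, gr_union, sup_assoc]
          simp [gr]
        simp only [hscore]
        rw [h3]
        exact he)
    have h2 : (k - x₀) * (k - x₀) ≤ (k - (lowSet H B).card) * (k - (lowSet H B).card) :=
      Nat.mul_le_mul (by omega) (by omega)
    have h3 : b ≤ (Ω₂.filter fun e => score (insert e S) < score S).card := by omega
    convert h3
  · exact mul_le_mul_of_nonneg_right (pow_le_pow_right₀ hθi hs0) hX

open Classical in
/-- The subsets with at most `k` elements. -/
noncomputable def setsUpToCard (α : Type*) [Fintype α] (k : ℕ) : Finset (Finset α) :=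
  Finset.univ.filter fun S => S.card ≤ k

lemma mem_setsUpToCard {α : Type*} [Fintype α] {k : ℕ} {S : Finset α} :
    S ∈ setsUpToCard α k ↔ S.card ≤ k := by
  simp [setsUpToCard]

lemma bern_not_closes_le (h0 : 0 ≤ p) (h1 : p ≤ 1) (hθ : 0 < θ) (hθ1 : θ ≤ 1)
    (hb : 2 * b ≤ (n / 4 - x₀) * (n / 4 - x₀)) :
    bern (allEdges n) p (fun R => ind (¬ Closes (H ⊔ gr R) H x₀ w m j)) ≤
    (setsUpToCard (Fin n) w).card * (setsUpToCard (Sym2 (Fin n)) m).card * (setsUpToCard (Fin n) x₀).card *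
      (θ⁻¹ ^ j * (1 - p * (1 - θ)) ^ b) := by
  classical
  set I := setsUpToCard (Fin n) w ×ˢ setsUpToCard (Sym2 (Fin n)) m ×ˢ setsUpToCard (Fin n) x₀ with hI
  have hX : 0 ≤ θ⁻¹ ^ j * (1 - p * (1 - θ)) ^ b := by
    have : 0 ≤ 1 - p * (1 - θ) := by nlinarith
    positivity
  set Q : Finset (Fin n) × Finset (Sym2 (Fin n)) × Finset (Fin n) → Finset (Sym2 (Fin n)) → Prop :=
    fun i R => 3 ≤ (i.1ᶜ).card ∧ HasHamCycle ⊤ (gr i.2.1) i.1ᶜ ∧ (lowSet H i.2.2ᶜ).card ≤ x₀ ∧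
      (Expands (augment (H ⊔ gr R) H i.2.2ᶜ) i.1ᶜ (offVerts i.1ᶜ i.2.1) (n / 4) ∧
      hamDefect (augment (H ⊔ gr R) H i.2.2ᶜ) (gr i.2.1) i.1ᶜ ≤ j ∧
      hamDefect (H ⊔ gr R) (gr i.2.1) i.1ᶜ ≠ 0) with hQ
  have h2 : ∀ R, ind (¬ Closes (H ⊔ gr R) H x₀ w m j) ≤ ∑ i ∈ I, ind (Q i R) := by
    intro R
    refine (ind_mono fun h => ?_).trans (ind_exists_le I fun i => Q i R)
    unfold Closes at h
    push Not at h
    obtain ⟨T, Mp, hT, hMp, hT3, htop, B, hB, hlow, hexp, hj, hne⟩ := h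
    rw [← Finset.compl_eq_univ_sdiff] at hT hB
    refine ⟨(Tᶜ, Mp, Bᶜ), ?_, ?_⟩
    · simp [hI, mem_setsUpToCard, hT, hMp, hB]
    · rw [Fintype.card_fin] at hexp
      simp only [hQ, compl_compl]
      exact ⟨hT3, htop, hlow, hexp, hj, hne⟩
  refine (bern_mono h0 h1 fun R _ => h2 R).trans ?_
  rw [bern_sum]
  refine (Finset.sum_le_card_nsmul _ _ (θ⁻¹ ^ j * (1 - p * (1 - θ)) ^ b) fun i _ => ?_).trans
    (le_of_eq ?_)
  · by_cases hi : 3 ≤ (i.1ᶜ).card ∧ HasHamCycle ⊤ (gr i.2.1) i.1ᶜ ∧ (lowSet H i.2.2ᶜ).card ≤ x₀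
    · refine (bern_mono h0 h1 fun R _ => ind_mono fun h => h.2.2.2).trans ?_
      exact bern_sprinkle_defect h0 h1 hθ hθ1 hi.2.2 hi.1 hi.2.1 hb
    · rw [bern_congr (g := fun _ => 0) fun R _ => ind_false fun h => hi ⟨h.1, h.2.1, h.2.2.1⟩,
        bern_const]
      exact hX
  · rw [hI, Finset.card_product, Finset.card_product, nsmul_eq_mul]
    push_cast
    simp only [mul_assoc]

end SprinkleEdges

section Counting

lemma pow_div_factorial_le {y t : ℝ} (hy : 0 ≤ y) (ht : 0 < t) (u : ℕ) :
    y ^ u / u.factorial ≤ Real.exp (t * y - u * Real.log t) := by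
  have h1 := Real.pow_div_factorial_le_exp (t * y) (by positivity) u
  rw [Real.exp_sub, Real.exp_nat_mul, Real.exp_log ht, le_div_iff₀ (by positivity)]
  calc y ^ u / u.factorial * t ^ u = (t * y) ^ u / u.factorial := by rw [mul_pow]; ring
    _ ≤ _ := h1

lemma choose_mul_pow_le {a t : ℝ} (ha : 0 ≤ a) (ht : 0 < t) (n u : ℕ) :
    (n.choose u : ℝ) * a ^ u ≤ Real.exp (t * (n * a) - u * Real.log t) := by
  refine le_trans ?_ (pow_div_factorial_le (y := n * a) (by positivity) ht u)
  rw [mul_pow, mul_div_right_comm]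
  exact mul_le_mul_of_nonneg_right (Nat.choose_le_pow_div u n) (by positivity)

lemma choose_le_exp {t : ℝ} (ht : 0 < t) (n u : ℕ) :
    (n.choose u : ℝ) ≤ Real.exp (t * n - u * Real.log t) := by
  simpa using choose_mul_pow_le zero_le_one ht n u

lemma card_setsUpToCard_le {α : Type*} [Fintype α] {t : ℝ} (ht : 0 < t) (ht1 : t ≤ 1) (k : ℕ) :
    ((setsUpToCard α k).card : ℝ) ≤ Real.exp (t * Fintype.card α - k * Real.log t) := by
  classical
  have h1 : (setsUpToCard α k).card = ∑ u ∈ Finset.range (k + 1), (Fintype.card α).choose u := by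
    have : setsUpToCard α k = (Finset.range (k + 1)).biUnion fun u =>
        Finset.powersetCard u (Finset.univ : Finset α) := by
      ext S; simp [mem_setsUpToCard, Order.lt_add_one_iff]
    rw [this, Finset.card_biUnion]
    · simp
    · exact fun u _ v _ huv => Finset.pairwise_disjoint_powersetCard _ huv
  rw [h1]
  push_cast
  have h2 : ∀ u ∈ Finset.range (k + 1), ((Fintype.card α).choose u : ℝ) ≤
      (t * Fintype.card α) ^ u / u.factorial * t⁻¹ ^ k := by
    intro u hu
    have hu : u ≤ k := Nat.lt_succ_iff.1 (Finset.mem_range.1 hu)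
    calc ((Fintype.card α).choose u : ℝ) ≤ (Fintype.card α : ℝ) ^ u / u.factorial :=
        Nat.choose_le_pow_div u _
      _ = (t * Fintype.card α) ^ u / u.factorial * t⁻¹ ^ u := by
        rw [mul_pow, inv_pow]; field_simp
      _ ≤ _ := by
        refine mul_le_mul_of_nonneg_left (pow_le_pow_right₀ ((one_le_inv₀ ht).2 ht1) hu) ?_
        positivity
  refine (Finset.sum_le_sum h2).trans ?_
  rw [← Finset.sum_mul, Real.exp_sub, Real.exp_nat_mul, Real.exp_log ht, div_eq_mul_inv, inv_pow]
  exact mul_le_mul_of_nonneg_right (Real.sum_le_exp_of_nonneg (by positivity) _) (by positivity)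

lemma one_sub_pow_le {p : ℝ} (h1 : p ≤ 1) (k : ℕ) : (1 - p) ^ k ≤ Real.exp (-(p * k)) := by
  calc (1 - p) ^ k ≤ Real.exp (-p) ^ k :=
      pow_le_pow_left₀ (by linarith) (by linarith [Real.add_one_le_exp (-p)]) k
    _ = _ := by rw [← Real.exp_nat_mul]; ring_nf

end Counting

section AvoidRectangles

variable {n : ℕ} {p : ℝ}

/-- The pairs with one vertex in each of two sets. -/
def rect (S Z : Finset (Fin n)) : Finset (Sym2 (Fin n)) := (S ×ˢ Z).image fun q => s(q.1, q.2)

lemma mem_rect {S Z : Finset (Fin n)} {e : Sym2 (Fin n)} :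
    e ∈ rect S Z ↔ ∃ s ∈ S, ∃ z ∈ Z, s(s, z) = e := by
  simp only [rect, Finset.mem_image, Finset.mem_product, Prod.exists]
  exact ⟨fun ⟨a, b, ⟨h1, h2⟩, h⟩ => ⟨a, h1, b, h2, h⟩, fun ⟨a, h1, b, h2, h⟩ => ⟨a, b, ⟨h1, h2⟩, h⟩⟩

lemma card_rect {S Z : Finset (Fin n)} (h : Disjoint S Z) : (rect S Z).card = S.card * Z.card := by
  rw [rect, Finset.card_image_of_injOn, Finset.card_product]
  rintro ⟨a, b⟩ hab ⟨a', b'⟩ hab' heq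
  simp only [Finset.coe_product, Set.mem_prod, Finset.mem_coe] at hab hab'
  simp only [Sym2.eq_iff] at heq
  rcases heq with ⟨rfl, rfl⟩ | ⟨rfl, rfl⟩
  · rfl
  · exact (Finset.disjoint_left.1 h hab.1 hab'.2).elim

lemma rect_subset {S Z : Finset (Fin n)} (h : Disjoint S Z) : rect S Z ⊆ allEdges n := by
  intro e he
  obtain ⟨s, hs, z, hz, rfl⟩ := mem_rect.1 he
  rw [mem_allEdges, Sym2.mk_isDiag_iff]
  rintro rfl
  exact Finset.disjoint_left.1 h hs hz

lemma disjoint_rect_of_cl {T : Finset (Sym2 (Fin n))} {S Y : Finset (Fin n)}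
    (h : cl (gr T) S ⊆ Y) : Disjoint (rect S Yᶜ) T := by
  rw [Finset.disjoint_left]
  intro e he heT
  obtain ⟨s, hs, z, hz, rfl⟩ := mem_rect.1 he
  refine Finset.mem_compl.1 hz (h (mem_cl.2 ⟨s, hs, ?_⟩))
  by_cases hsz : s = z
  · exact Or.inl hsz.symm
  · exact Or.inr ((SimpleGraph.fromEdgeSet_adj _).2 ⟨heT, hsz⟩)

/-- The random graph has `U` inside and `Z` outside the neighbourhood of `S`. -/
lemma bern_attach_le (h0 : 0 ≤ p) (h1 : p ≤ 1) {S U Z : Finset (Fin n)} (hSU : Disjoint S U)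
    (hSZ : Disjoint S Z) (hUZ : Disjoint U Z) :
    bern (allEdges n) p (fun T => ind ((∀ v ∈ U, ∃ s ∈ S, s(s, v) ∈ T) ∧ Disjoint (rect S Z) T)) ≤
      (S.card * p) ^ U.card * (1 - p) ^ (S.card * Z.card) := by
  classical
  set A : (U → Fin n) → Finset (Sym2 (Fin n)) := fun φ =>
    Finset.univ.image fun v : U => s(φ v, v.1) with hA
  set I := Fintype.piFinset fun _ : U => S with hI
  have hstep : ∀ T, ind ((∀ v ∈ U, ∃ s ∈ S, s(s, v) ∈ T) ∧ Disjoint (rect S Z) T) ≤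
      ∑ φ ∈ I, ind (A φ ⊆ T ∧ Disjoint (rect S Z) T) := by
    intro T
    refine (ind_mono fun h => ?_).trans (ind_exists_le I _)
    choose! φ hφ hφT using h.1
    refine ⟨fun v => φ v, ?_, ?_, h.2⟩
    · simp only [hI, Fintype.mem_piFinset]
      exact fun v => hφ v v.2
    · intro e he
      obtain ⟨v, -, rfl⟩ := Finset.mem_image.1 he
      exact hφT v v.2
  refine (bern_mono h0 h1 fun T _ => hstep T).trans ?_
  rw [bern_sum]
  have hterm : ∀ φ ∈ I, bern (allEdges n) p (fun T => ind (A φ ⊆ T ∧ Disjoint (rect S Z) T)) =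
      p ^ U.card * (1 - p) ^ (S.card * Z.card) := by
    intro φ hφ
    have hφ : ∀ v, φ v ∈ S := by simpa [hI] using hφ
    have hAc : (A φ).card = U.card := by
      rw [hA, Finset.card_image_of_injective]
      · simp
      · intro v w hvw
        simp only [Sym2.eq_iff] at hvw
        rcases hvw with ⟨-, h⟩ | ⟨h, -⟩
        · exact Subtype.ext h
        · exact (Finset.disjoint_left.1 hSU (hφ v) (h ▸ w.2)).elim
    rw [bern_contains_avoids _ (rect_subset hSZ), hAc, card_rect hSZ]
    · rw [Finset.disjoint_left]
      intro e he he'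
      obtain ⟨v, -, rfl⟩ := Finset.mem_image.1 he
      obtain ⟨s, hs, z, hz, h⟩ := mem_rect.1 he'
      simp only [Sym2.eq_iff] at h
      rcases h with ⟨-, h⟩ | ⟨-, h⟩
      · exact Finset.disjoint_left.1 hUZ v.2 (h ▸ hz)
      · exact Finset.disjoint_left.1 hSZ (hφ v) (h ▸ hz)
    · intro e he
      obtain ⟨v, -, rfl⟩ := Finset.mem_image.1 he
      rw [mem_allEdges, Sym2.mk_isDiag_iff]
      intro h
      exact Finset.disjoint_left.1 hSU (hφ v) (h ▸ v.2)
  rw [Finset.sum_congr rfl hterm, Finset.sum_const, nsmul_eq_mul, hI, Fintype.card_piFinset,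
    Finset.prod_const, Finset.card_univ, Fintype.card_coe]
  push_cast
  rw [mul_pow, mul_assoc]

lemma bern_small_cl_le (h0 : 0 ≤ p) (h1 : p ≤ 1) {x y : ℕ} (hxy : x ≤ y) :
    bern (allEdges n) p (fun T => ind (∃ S : Finset (Fin n), S.card = x ∧ (cl (gr T) S).card ≤ y)) ≤
      ∑ u ∈ Finset.range (y - x + 1), (n.choose x : ℝ) *
        ((n.choose u : ℝ) * (x * p) ^ u * (1 - p) ^ (x * (n - x - u))) := by
  classical
  set I := (Finset.range (y - x + 1)).sigma fun u => (Finset.powersetCard x (Finset.univ : Finset (Fin n))) ×ˢ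
    (Finset.powersetCard u (Finset.univ : Finset (Fin n))) with hI
  set Q : (Σ _ : ℕ, Finset (Fin n) × Finset (Fin n)) → Finset (Sym2 (Fin n)) → Prop := fun i T =>
    Disjoint i.2.1 i.2.2 ∧ (∀ v ∈ i.2.2, ∃ s ∈ i.2.1, s(s, v) ∈ T) ∧
      Disjoint (rect i.2.1 (i.2.1 ∪ i.2.2)ᶜ) T with hQ
  have hstep : ∀ T, ind (∃ S : Finset (Fin n), S.card = x ∧ (cl (gr T) S).card ≤ y) ≤
      ∑ i ∈ I, ind (Q i T) := by
    intro T
    refine (ind_mono fun h => ?_).trans (ind_exists_le I fun i => Q i T)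
    obtain ⟨S, hS, hcl⟩ := h
    have hSc := subset_cl (gr T) S
    have hc := Finset.card_sdiff_of_subset hSc
    refine ⟨⟨(cl (gr T) S \ S).card, S, cl (gr T) S \ S⟩, ?_, ?_, ?_, ?_⟩
    · simp only [hI, Finset.mem_sigma, Finset.mem_range, Finset.mem_product,
        Finset.mem_powersetCard_univ, hS, and_true]
      omega
    · exact Finset.disjoint_sdiff
    · intro v hv
      obtain ⟨hv, hvS⟩ := Finset.mem_sdiff.1 hv
      obtain ⟨s, hs, h⟩ := mem_cl.1 hv
      refine ⟨s, hs, ?_⟩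
      rcases h with rfl | h
      · exact (hvS hs).elim
      · exact ((SimpleGraph.fromEdgeSet_adj _).1 h).1
    · refine disjoint_rect_of_cl ?_
      simp
  refine (bern_mono h0 h1 fun T _ => hstep T).trans ?_
  rw [bern_sum, hI, Finset.sum_sigma]
  refine Finset.sum_le_sum fun u hu => ?_
  refine (Finset.sum_le_card_nsmul _ _ ((x * p) ^ u * (1 - p) ^ (x * (n - x - u))) ?_).trans ?_
  · rintro ⟨S, U⟩ hi
    simp only [Finset.mem_product, Finset.mem_powersetCard_univ] at hi
    have hp : 0 ≤ 1 - p := by linarith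
    by_cases hd : Disjoint S U
    · have hc : ((S ∪ U)ᶜ).card = n - x - u := by
        rw [Finset.card_compl, Finset.card_union_of_disjoint hd, Fintype.card_fin, hi.1, hi.2]
        omega
      have := bern_attach_le h0 h1 hd (Z := (S ∪ U)ᶜ) (disjoint_compl_right.mono_left
        Finset.subset_union_left) (disjoint_compl_right.mono_left Finset.subset_union_right)
      rw [hc, hi.1, hi.2] at this
      exact (bern_mono h0 h1 fun T _ => ind_mono fun h => h.2).trans this
    · rw [bern_congr (g := fun _ => 0) fun T _ => ind_false fun h => hd h.1, bern_const]
      positivity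
  · rw [Finset.card_product, Finset.card_powersetCard, Finset.card_powersetCard, Finset.card_univ,
      Fintype.card_fin, nsmul_eq_mul]
    push_cast
    simp only [mul_assoc]
    exact le_rfl

lemma bern_small_cl_le' (h0 : 0 ≤ p) (h1 : p ≤ 1) {x y : ℕ} (hxy : x ≤ y) (hy : y ≤ n) :
    bern (allEdges n) p (fun T => ind (∃ S : Finset (Fin n), S.card = x ∧ (cl (gr T) S).card ≤ y)) ≤
      (n.choose x : ℝ) * ((n - x).choose (y - x) : ℝ) * (1 - p) ^ (x * (n - y)) := by
  classical
  set I := (Finset.powersetCard x (Finset.univ : Finset (Fin n))).sigma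
    fun S => Finset.powersetCard (y - x) Sᶜ with hI
  set Q : (Σ _ : Finset (Fin n), Finset (Fin n)) → Finset (Sym2 (Fin n)) → Prop := fun i T =>
    Disjoint (rect i.1 (i.1 ∪ i.2)ᶜ) T with hQ
  have hstep : ∀ T, ind (∃ S : Finset (Fin n), S.card = x ∧ (cl (gr T) S).card ≤ y) ≤
      ∑ i ∈ I, ind (Q i T) := by
    intro T
    refine (ind_mono fun h => ?_).trans (ind_exists_le I fun i => Q i T)
    obtain ⟨S, hS, hcl⟩ := h
    obtain ⟨Y, hY, hYc⟩ := Finset.exists_superset_card_eq hcl (by simpa using hy)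
    have hSY := (subset_cl (gr T) S).trans hY
    refine ⟨⟨S, Y \ S⟩, ?_, ?_⟩
    · simp only [hI, Finset.mem_sigma, Finset.mem_powersetCard, Finset.subset_univ, hS, true_and]
      rw [Finset.card_sdiff_of_subset hSY, hYc, hS]
      exact ⟨fun v hv => Finset.mem_compl.2 (Finset.mem_sdiff.1 hv).2, rfl⟩
    · refine disjoint_rect_of_cl ?_
      rwa [Finset.union_sdiff_of_subset hSY]
  refine (bern_mono h0 h1 fun T _ => hstep T).trans ?_
  rw [bern_sum]
  refine (Finset.sum_le_card_nsmul _ _ ((1 - p) ^ (x * (n - y))) ?_).trans ?_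
  · rintro ⟨S, U⟩ hi
    simp only [hI, Finset.mem_sigma, Finset.mem_powersetCard, Finset.subset_univ, true_and] at hi
    have hd : Disjoint S U := Finset.disjoint_left.2 fun v hv hv' =>
      Finset.mem_compl.1 (hi.2.1 hv') hv
    have hc : ((S ∪ U)ᶜ).card = n - y := by
      rw [Finset.card_compl, Finset.card_union_of_disjoint hd, Fintype.card_fin, hi.1, hi.2.2]
      omega
    have hdd : Disjoint S (S ∪ U)ᶜ := disjoint_compl_right.mono_left Finset.subset_union_left
    rw [bern_avoids (rect_subset hdd), card_rect hdd, hi.1, hc]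
  · rw [hI, Finset.card_sigma, Finset.sum_congr rfl (g := fun _ => (n - x).choose (y - x)),
      Finset.sum_const, Finset.card_powersetCard, Finset.card_univ, Fintype.card_fin]
    · simp
    · intro S hS
      rw [Finset.card_powersetCard, Finset.card_compl, Fintype.card_fin,
        (Finset.mem_powersetCard.1 hS).2]

lemma choose_mul_choose_le (n x u : ℕ) : n.choose x * (n - x).choose u ≤ 3 ^ n := by
  rcases lt_or_ge n x with h | h
  · simp [Nat.choose_eq_zero_of_lt h]
  · have h1 : (3 : ℕ) ^ n = ∑ k ∈ Finset.range (n + 1), 1 ^ k * 2 ^ (n - k) * n.choose k := by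
      have := add_pow 1 2 n
      simpa using this
    rw [h1]
    refine le_trans ?_ (Finset.single_le_sum (f := fun k => 1 ^ k * 2 ^ (n - k) * n.choose k)
      (fun _ _ => Nat.zero_le _) (Finset.mem_range.2 (Nat.lt_succ_of_le h)))
    simp only [one_pow, one_mul, mul_comm]
    exact Nat.mul_le_mul_left _ (Nat.choose_le_two_pow _ _)

lemma bern_pair_avoid_le {q : ℝ} (h0 : 0 ≤ q) (h1 : q ≤ 1) (A Y : Finset (Fin n)) :
    bern (allEdges n) q (fun S => bern (allEdges n) q fun T => ind (∀ a ∈ A, ∀ y ∈ Y,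
      (a < y → s(a, y) ∉ S) ∧ (y < a → s(a, y) ∉ T))) ≤
      (1 - q) ^ (A.card * Y.card - n) := by
  classical
  set f : Fin n × Fin n → Sym2 (Fin n) := fun z => s(z.1, z.2) with hf
  set P := (A ×ˢ Y).filter fun z => z.1 < z.2 with hP
  set Q := (A ×ˢ Y).filter fun z => z.2 < z.1 with hQ
  set D := (A ×ˢ Y).filter fun z => z.1 = z.2 with hD
  have hsub : ∀ {W : Finset (Fin n × Fin n)}, (∀ z ∈ W, z.1 ≠ z.2) → W.image f ⊆ allEdges n := by
    intro W hW e he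
    obtain ⟨z, hz, rfl⟩ := Finset.mem_image.1 he
    exact mem_allEdges.2 (hW z hz)
  have hPs : P.image f ⊆ allEdges n := hsub fun z hz => (Finset.mem_filter.1 hz).2.ne
  have hQs : Q.image f ⊆ allEdges n := hsub fun z hz => (Finset.mem_filter.1 hz).2.ne'
  have hPc : (P.image f).card = P.card := by
    refine Finset.card_image_of_injOn fun z hz z' hz' h => ?_
    have h1 := (Finset.mem_filter.1 hz).2
    have h2 := (Finset.mem_filter.1 hz').2
    rcases Sym2.eq_iff.1 h with ⟨h3, h4⟩ | ⟨h3, h4⟩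
    · exact Prod.ext h3 h4
    · rw [h3, h4] at h1; exact (lt_asymm h1 h2).elim
  have hQc : (Q.image f).card = Q.card := by
    refine Finset.card_image_of_injOn fun z hz z' hz' h => ?_
    have h1 := (Finset.mem_filter.1 hz).2
    have h2 := (Finset.mem_filter.1 hz').2
    rcases Sym2.eq_iff.1 h with ⟨h3, h4⟩ | ⟨h3, h4⟩
    · exact Prod.ext h3 h4
    · rw [h3, h4] at h1; exact (lt_asymm h1 h2).elim
  have hcard : A.card * Y.card ≤ P.card + Q.card + n := by
    have hDc : D.card ≤ n := by
      have := Finset.card_le_card_of_injOn (s := D) (t := (Finset.univ : Finset (Fin n))) Prod.fst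
        (fun _ _ => Finset.mem_coe.2 (Finset.mem_univ _)) (fun z hz z' hz' h => by
          have h1 := (Finset.mem_filter.1 hz).2
          have h2 := (Finset.mem_filter.1 hz').2
          exact Prod.ext h (by rw [← h1, ← h2, h]))
      simpa using this
    rw [← Finset.card_product]
    have : A ×ˢ Y ⊆ P ∪ Q ∪ D := by
      intro z hz
      simp only [hP, hQ, hD, Finset.mem_union, Finset.mem_filter, hz, true_and]
      rcases lt_trichotomy z.1 z.2 with h | h | h <;> simp [h]
    have h2 := (Finset.card_le_card this).trans (Finset.card_union_le _ _)
    have h3 := Finset.card_union_le P Q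
    omega
  have hi : ∀ S T, ind (∀ a ∈ A, ∀ y ∈ Y, (a < y → s(a, y) ∉ S) ∧ (y < a → s(a, y) ∉ T)) ≤
      ind (Disjoint (P.image f) S) * ind (Disjoint (Q.image f) T) := by
    intro S T
    rw [← ind_and]
    refine ind_mono fun h => ⟨?_, ?_⟩
    · rw [Finset.disjoint_left]
      intro e he
      obtain ⟨z, hz, rfl⟩ := Finset.mem_image.1 he
      obtain ⟨hz, hlt⟩ := Finset.mem_filter.1 hz
      exact (h _ (Finset.mem_product.1 hz).1 _ (Finset.mem_product.1 hz).2).1 hlt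
    · rw [Finset.disjoint_left]
      intro e he
      obtain ⟨z, hz, rfl⟩ := Finset.mem_image.1 he
      obtain ⟨hz, hlt⟩ := Finset.mem_filter.1 hz
      exact (h _ (Finset.mem_product.1 hz).1 _ (Finset.mem_product.1 hz).2).2 hlt
  calc _ ≤ bern (allEdges n) q (fun S => (1 - q) ^ Q.card * ind (Disjoint (P.image f) S)) := by
        refine bern_mono h0 h1 fun S _ => (bern_mono h0 h1 fun T _ => hi S T).trans ?_
        rw [bern_mul_left, bern_avoids hQs, hQc, mul_comm]
    _ = (1 - q) ^ (Q.card + P.card) := by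
        rw [bern_mul_left, bern_avoids hPs, hPc, pow_add]
    _ ≤ _ := pow_le_pow_of_le_one (by linarith) (by linarith) (by omega)

lemma bern_hall_le {q : ℝ} (h0 : 0 ≤ q) (h1 : q ≤ 1) {δ : ℕ} :
    bern (allEdges n) q (fun S => bern (allEdges n) q fun T => ind (∃ A Y : Finset (Fin n),
      (∀ a ∈ A, ∀ y ∈ Y, (a < y → s(a, y) ∉ S) ∧ (y < a → s(a, y) ∉ T)) ∧
        n + δ < A.card + Y.card)) ≤
      ∑ i ∈ Finset.Icc (δ + 1) n, (n.choose i : ℝ) * (n.choose (n + δ + 1 - i) : ℝ) *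
        (1 - q) ^ (i * (n + δ + 1 - i) - n) := by
  classical
  set I := (Finset.Icc (δ + 1) n).sigma fun i =>
    (Finset.powersetCard i (Finset.univ : Finset (Fin n))) ×ˢ
      (Finset.powersetCard (n + δ + 1 - i) (Finset.univ : Finset (Fin n))) with hI
  set Q : (Σ _ : ℕ, Finset (Fin n) × Finset (Fin n)) → Finset (Sym2 (Fin n)) →
      Finset (Sym2 (Fin n)) → Prop := fun i S T => ∀ a ∈ i.2.1, ∀ y ∈ i.2.2,
      (a < y → s(a, y) ∉ S) ∧ (y < a → s(a, y) ∉ T) with hQ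
  have hstep : ∀ S T, ind (∃ A Y : Finset (Fin n),
      (∀ a ∈ A, ∀ y ∈ Y, (a < y → s(a, y) ∉ S) ∧ (y < a → s(a, y) ∉ T)) ∧
        n + δ < A.card + Y.card) ≤ ∑ i ∈ I, ind (Q i S T) := by
    intro S T
    refine (ind_mono fun h => ?_).trans (ind_exists_le I fun i => Q i S T)
    obtain ⟨A, Y, h, hc⟩ := h
    have hA : A.card ≤ n := by simpa using Finset.card_le_univ A
    have hY : Y.card ≤ n := by simpa using Finset.card_le_univ Y
    obtain ⟨Y', hY', hYc⟩ := Finset.exists_subset_card_eq (show n + δ + 1 - A.card ≤ Y.card by omega)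
    refine ⟨⟨A.card, A, Y'⟩, ?_, fun a ha y hy => h a ha y (hY' hy)⟩
    simp only [hI, Finset.mem_sigma, Finset.mem_product, Finset.mem_powersetCard_univ, hYc,
      Finset.mem_Icc]
    exact ⟨⟨by omega, hA⟩, trivial, trivial⟩
  refine (bern_mono h0 h1 fun S _ => bern_mono h0 h1 fun T _ => hstep S T).trans ?_
  simp only [bern_sum]
  rw [hI, Finset.sum_sigma]
  refine Finset.sum_le_sum fun i _ => (Finset.sum_le_card_nsmul _ _ _ fun z hz => ?_).trans
    (b := ((Finset.powersetCard i (Finset.univ : Finset (Fin n))) ×ˢ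
      (Finset.powersetCard (n + δ + 1 - i) (Finset.univ : Finset (Fin n)))).card •
      (1 - q) ^ (i * (n + δ + 1 - i) - n)) ?_
  · obtain ⟨h1', h2'⟩ := Finset.mem_product.1 hz
    have := bern_pair_avoid_le h0 h1 z.1 z.2
    rwa [(Finset.mem_powersetCard.1 h1').2, (Finset.mem_powersetCard.1 h2').2] at this
  · rw [Finset.card_product, Finset.card_powersetCard, Finset.card_powersetCard, Finset.card_univ,
      Fintype.card_fin, nsmul_eq_mul]
    push_cast
    exact le_rfl

end AvoidRectangles

section FirstMoments

variable {n : ℕ} {p : ℝ}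

lemma card_allEdges_le (n : ℕ) : (allEdges n).card ≤ n ^ 2 := by
  refine (Finset.card_filter_le _ _).trans ?_
  rw [Finset.card_univ, Sym2.card, Fintype.card_fin, Nat.choose_two_right, Nat.add_sub_cancel]
  refine Nat.div_le_of_le_mul ?_
  rcases n.eq_zero_or_pos with rfl | h
  · simp
  · nlinarith

lemma bern_common_le (h0 : 0 ≤ p) (h1 : p ≤ 1) (k : ℕ) :
    bern (allEdges n) p (fun S => bern (allEdges n) p fun T => ind (∃ K : Finset (Sym2 (Fin n)),
      K.card = k ∧ K ⊆ allEdges n ∧ K ⊆ S ∧ K ⊆ T)) ≤ ((n ^ 2).choose k : ℝ) * (p * p) ^ k := by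
  classical
  set I := Finset.powersetCard k (allEdges n) with hI
  have hstep : ∀ S T, ind (∃ K : Finset (Sym2 (Fin n)),
      K.card = k ∧ K ⊆ allEdges n ∧ K ⊆ S ∧ K ⊆ T) ≤ ∑ K ∈ I, ind (K ⊆ S) * ind (K ⊆ T) := by
    intro S T
    simp only [← ind_and]
    refine (ind_mono fun h => ?_).trans (ind_exists_le I _)
    obtain ⟨K, hK, hΩ, hS, hT⟩ := h
    exact ⟨K, Finset.mem_powersetCard.2 ⟨hΩ, hK⟩, hS, hT⟩
  calc _ ≤ bern (allEdges n) p (fun S => ∑ K ∈ I, p ^ k * ind (K ⊆ S)) := by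
        refine bern_mono h0 h1 fun S _ => (bern_mono h0 h1 fun T _ => hstep S T).trans ?_
        rw [bern_sum]
        refine (Finset.sum_congr rfl fun K hK => ?_).le
        obtain ⟨hK, hc⟩ := Finset.mem_powersetCard.1 hK
        rw [bern_mul_left, bern_contains hK, hc, mul_comm]
    _ = ∑ K ∈ I, (p * p) ^ k := by
        rw [bern_sum]
        refine Finset.sum_congr rfl fun K hK => ?_
        obtain ⟨hK, hc⟩ := Finset.mem_powersetCard.1 hK
        rw [bern_mul_left, bern_contains hK, hc, mul_pow]
    _ ≤ _ := by
        rw [Finset.sum_const, hI, Finset.card_powersetCard, nsmul_eq_mul]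
        gcongr
        exact card_allEdges_le n

lemma bern_degree_le (h0 : 0 ≤ p) (h1 : p ≤ 1) (k : ℕ) :
    bern (allEdges n) p (fun S => ind (∃ v : Fin n, k ≤ (nbS (gr S) {v}).card)) ≤
      n * ((n.choose k : ℝ) * p ^ k) := by
  classical
  set I := (Finset.univ : Finset (Fin n)).sigma fun v => Finset.powersetCard k {v}ᶜ with hI
  have hstep : ∀ S, ind (∃ v : Fin n, k ≤ (nbS (gr S) {v}).card) ≤
      ∑ z ∈ I, ind (rect {z.1} z.2 ⊆ S) := by
    intro S
    refine (ind_mono fun h => ?_).trans (ind_exists_le I fun z => rect {z.1} z.2 ⊆ S)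
    obtain ⟨v, hv⟩ := h
    obtain ⟨K, hK, hc⟩ := Finset.exists_subset_card_eq hv
    have hK' : ∀ z ∈ K, (gr S).Adj v z := fun z hz => by simpa using hK hz
    refine ⟨⟨v, K⟩, ?_, ?_⟩
    · simp only [hI, Finset.mem_sigma, Finset.mem_univ, Finset.mem_powersetCard, true_and]
      refine ⟨fun z hz => ?_, hc⟩
      rw [Finset.mem_compl, Finset.mem_singleton]
      exact (hK' z hz).ne'
    · intro e he
      obtain ⟨s, hs, z, hz, rfl⟩ := mem_rect.1 he
      rw [Finset.mem_singleton.1 hs]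
      exact ((SimpleGraph.fromEdgeSet_adj _).1 (hK' z hz)).1
  refine (bern_mono h0 h1 fun S _ => hstep S).trans ?_
  rw [bern_sum]
  refine (Finset.sum_le_card_nsmul _ _ (p ^ k) fun z hz => ?_).trans ?_
  · obtain ⟨-, hz⟩ := Finset.mem_sigma.1 hz
    obtain ⟨hz, hc⟩ := Finset.mem_powersetCard.1 hz
    have hd : Disjoint {z.1} z.2 := Finset.disjoint_left.2 fun v hv hv' =>
      Finset.mem_compl.1 (hz hv') hv
    rw [bern_contains (rect_subset hd), card_rect hd, hc, Finset.card_singleton, one_mul]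
  · rw [hI, Finset.card_sigma, Finset.sum_congr rfl (g := fun _ => (n - 1).choose k),
      Finset.sum_const, Finset.card_univ, Fintype.card_fin, smul_eq_mul, nsmul_eq_mul]
    · push_cast
      rw [mul_assoc]
      gcongr
      exact Nat.sub_le n 1
    · intro v _
      rw [Finset.card_powersetCard, Finset.card_compl, Fintype.card_fin, Finset.card_singleton]

lemma bern_dense_le {r : ℝ} (h0 : 0 ≤ p) (h1 : p ≤ 1) (hr0 : 0 ≤ r) (hr1 : r ≤ 1) (x₀ : ℕ) :
    bern (allEdges n) p (fun S => bern (allEdges n) r fun R =>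
      ind (¬ NoDense (gr (S ∪ R)) (gr S) x₀)) ≤
      ∑ x ∈ Finset.Ioc 0 x₀, ∑ y ∈ Finset.Icc x (4 * x), (n.choose x : ℝ) * (n.choose (y - x) : ℝ) *
        ((x * y).choose (y + 2) * ((p + r) ^ (y + 2) * (1 - p) ^ (x * (n - y)))) := by
  classical
  set P : Finset (Fin n) → Finset (Fin n) → Finset (Sym2 (Fin n)) := fun X Z =>
    (rect X (X ∪ Z)).filter fun e => ¬ e.IsDiag with hP
  set I := (Finset.Ioc 0 x₀).sigma fun x => (Finset.Icc x (4 * x)).sigma fun y =>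
    ((Finset.powersetCard x (Finset.univ : Finset (Fin n))) ×ˢ
      (Finset.powersetCard (y - x) (Finset.univ : Finset (Fin n)))).sigma fun z =>
        if Disjoint z.1 z.2 then Finset.powersetCard (y + 2) (P z.1 z.2) else ∅ with hI
  have hstep : ∀ S R, ind (¬ NoDense (gr (S ∪ R)) (gr S) x₀) ≤ ∑ i ∈ I, ∑ F ∈ i.2.2.2.powerset,
      ind (F ⊆ S ∧ Disjoint (rect i.2.2.1.1 (i.2.2.1.1 ∪ i.2.2.1.2)ᶜ) S) *
        ind (i.2.2.2 \ F ⊆ R) := by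
    intro S R
    simp only [← ind_and]
    refine (ind_mono fun h => ?_).trans ((ind_exists_le I fun i => ∃ F ∈ i.2.2.2.powerset,
      (F ⊆ S ∧ Disjoint (rect i.2.2.1.1 (i.2.2.1.1 ∪ i.2.2.1.2)ᶜ) S) ∧ i.2.2.2 \ F ⊆ R).trans
      (Finset.sum_le_sum fun i _ => ind_exists_le _ _))
    simp only [NoDense, not_forall, not_le] at h
    obtain ⟨X, Y, hX, hXY, hx, hy, hN, hc⟩ := h
    obtain ⟨F, hF, hFc⟩ := Finset.exists_subset_card_eq (show Y.card + 2 ≤ _ from hc)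
    have hU : X ∪ Y \ X = Y := Finset.union_sdiff_of_subset hXY
    refine ⟨⟨X.card, Y.card, (X, Y \ X), F⟩, ?_, F ∩ S, ?_, ⟨Finset.inter_subset_right, ?_⟩, ?_⟩
    · simp only [hI, Finset.mem_sigma, Finset.mem_Ioc, Finset.mem_Icc, Finset.mem_product,
        Finset.card_sdiff_of_subset hXY, Finset.disjoint_sdiff, if_true, Finset.mem_powersetCard, hFc, and_true]
      refine ⟨⟨hX.card_pos, hx⟩, ⟨Finset.card_le_card hXY, hy⟩,
        ⟨Finset.subset_univ _, Finset.subset_univ _⟩, fun e he => ?_⟩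
      induction e using Sym2.ind with
      | _ u v =>
        obtain ⟨huv, ⟨hu, hv⟩, h⟩ := mem_touching.1 (hF he)
        refine Finset.mem_filter.2 ⟨?_, by simpa using huv.ne⟩
        rw [hU, mem_rect]
        rcases h with h | h
        · exact ⟨u, h, v, hv, rfl⟩
        · exact ⟨v, h, u, hu, Sym2.eq_swap⟩
    · simp
    · rw [hU]
      exact disjoint_rect_of_cl (Finset.union_subset hXY hN)
    · intro e he
      obtain ⟨he, heS⟩ := Finset.mem_sdiff.1 he
      have : e ∈ S ∪ R := by
        induction e using Sym2.ind with
        | _ u v =>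
          exact ((SimpleGraph.fromEdgeSet_adj _).1 (mem_touching.1 (hF he)).1).1
      rcases Finset.mem_union.1 this with h | h
      · exact (heS (Finset.mem_inter.2 ⟨he, h⟩)).elim
      · exact h
  have hterm : ∀ i ∈ I, bern (allEdges n) p (fun S => bern (allEdges n) r fun R =>
      ∑ F ∈ i.2.2.2.powerset, ind (F ⊆ S ∧ Disjoint (rect i.2.2.1.1 (i.2.2.1.1 ∪ i.2.2.1.2)ᶜ) S) *
        ind (i.2.2.2 \ F ⊆ R)) ≤ (p + r) ^ (i.2.1 + 2) * (1 - p) ^ (i.1 * (n - i.2.1)) := by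
    rintro ⟨x, y, ⟨X, Z⟩, F⟩ hi
    simp only [hI, Finset.mem_sigma, Finset.mem_Icc, Finset.mem_product,
      Finset.mem_powersetCard_univ] at hi
    obtain ⟨-, ⟨hxy, -⟩, ⟨hX, hZ⟩, hF⟩ := hi
    split_ifs at hF with hd
    swap
    · simp at hF
    obtain ⟨hFP, hFc⟩ := Finset.mem_powersetCard.1 hF
    have hFΩ : F ⊆ allEdges n := fun e he => mem_allEdges.2 (Finset.mem_filter.1 (hFP he)).2
    have hdd : Disjoint X (X ∪ Z)ᶜ := disjoint_compl_right.mono_left Finset.subset_union_left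
    have hD : Disjoint F (rect X (X ∪ Z)ᶜ) := by
      rw [Finset.disjoint_left]
      intro e he he'
      obtain ⟨a, ha, b, hb, rfl⟩ := mem_rect.1 (Finset.mem_filter.1 (hFP he)).1
      obtain ⟨s, hs, z, hz, h⟩ := mem_rect.1 he'
      rw [Finset.mem_compl] at hz
      rcases Sym2.eq_iff.1 h with ⟨-, rfl⟩ | ⟨-, rfl⟩
      · exact hz hb
      · exact hz (Finset.mem_union_left _ ha)
    have hDc : (rect X (X ∪ Z)ᶜ).card = x * (n - y) := by
      rw [card_rect hdd, Finset.card_compl, Finset.card_union_of_disjoint hd, Fintype.card_fin,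
        hX, hZ]
      congr 2; omega
    simp only [bern_sum]
    rw [← hFc, ← Finset.sum_pow_mul_eq_add_pow, Finset.sum_mul]
    refine Finset.sum_le_sum fun E hE => ?_
    have hE := Finset.mem_powerset.1 hE
    simp only [bern_mul_left]
    simp only [bern_contains (Finset.sdiff_subset.trans hFΩ), mul_comm _ (r ^ _), bern_mul_left]
    rw [bern_contains_avoids (hE.trans hFΩ) (rect_subset hdd) (hD.mono_left hE), hDc,
      Finset.card_sdiff_of_subset hE]
    exact le_of_eq (by ring)
  refine (bern_mono h0 h1 fun S _ => bern_mono hr0 hr1 fun R _ => hstep S R).trans ?_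
  rw [bern_congr fun S _ => bern_sum I (allEdges n) r _, bern_sum]
  refine (Finset.sum_le_sum hterm).trans ?_
  have hq : 0 ≤ 1 - p := by linarith
  rw [hI, Finset.sum_sigma]
  refine Finset.sum_le_sum fun x _ => ?_
  rw [Finset.sum_sigma]
  refine Finset.sum_le_sum fun y hy => ?_
  have hy := Finset.mem_Icc.1 hy
  rw [Finset.sum_sigma]
  refine (Finset.sum_le_card_nsmul _ _ ((x * y).choose (y + 2) *
    ((p + r) ^ (y + 2) * (1 - p) ^ (x * (n - y)))) fun z hz => ?_).trans ?_
  · obtain ⟨hz1, hz2⟩ := Finset.mem_product.1 hz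
    rw [Finset.mem_powersetCard_univ] at hz1 hz2
    dsimp only
    split_ifs with hd
    · rw [Finset.sum_const, Finset.card_powersetCard, nsmul_eq_mul]
      have hc : (P z.1 z.2).card ≤ x * y := by
        refine (Finset.card_filter_le _ _).trans (Finset.card_image_le.trans ?_)
        rw [Finset.card_product, Finset.card_union_of_disjoint hd, hz1, hz2]
        exact Nat.mul_le_mul_left _ (by omega)
      gcongr
    · rw [Finset.sum_empty]; positivity
  · rw [Finset.card_product, Finset.card_powersetCard, Finset.card_powersetCard, Finset.card_univ,
      Fintype.card_fin, nsmul_eq_mul]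
    push_cast
    exact le_rfl

/-- The edges joining cyclically consecutive entries of a list. -/
def cycleEdges (l : List (Fin n)) : List (Sym2 (Fin n)) := List.zipWith (fun a b => s(a, b)) l (l.rotate 1)

lemma mem_cycleEdges {l : List (Fin n)} {e : Sym2 (Fin n)} : e ∈ cycleEdges l ↔
    ∃ (i : ℕ) (h : i < l.length), s(l[i], l[(i + 1) % l.length]'(Nat.mod_lt _ (by omega))) = e := by
  simp only [cycleEdges, List.mem_iff_getElem, List.getElem_zipWith, List.getElem_rotate,
    List.length_zipWith, List.length_rotate, min_self]

lemma card_cycleEdges {l : List (Fin n)} (h : l.Nodup) (h3 : 3 ≤ l.length) :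
    (cycleEdges l).toFinset.card = l.length := by
  rw [List.toFinset_card_of_nodup]
  · simp [cycleEdges]
  · rw [List.nodup_iff_injective_getElem]
    rintro ⟨i, hi⟩ ⟨j, hj⟩ hij
    simp only [cycleEdges, List.getElem_zipWith, List.getElem_rotate] at hij
    simp only [cycleEdges, List.length_zipWith, List.length_rotate, min_self] at hi hj
    rw [Fin.mk.injEq]
    rcases Sym2.eq_iff.1 hij with ⟨h1, -⟩ | ⟨h1, h2⟩
    · exact h.getElem_inj_iff.1 h1
    · have h1 := h.getElem_inj_iff.1 h1
      have h2 := h.getElem_inj_iff.1 h2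
      have e1 : (i + 1) = l.length ∨ i + 1 < l.length := by omega
      have e2 : (j + 1) = l.length ∨ j + 1 < l.length := by omega
      rcases e1 with e1 | e1 <;> rcases e2 with e2 | e2 <;>
        simp only [Nat.mod_eq_of_lt, Nat.mod_self, e1, e2] at h1 h2 <;> omega

lemma bern_cycles_le (h0 : 0 ≤ p) (h1 : p ≤ 1) {z : ℝ} (hz : 1 ≤ z) (ℓ k : ℕ) :
    bern (allEdges n) p (fun S => ind (∃ F : Finset (List (Fin n)), F.card = k ∧
      (∀ l ∈ F, l.Nodup ∧ 3 ≤ l.length ∧ l.length ≤ ℓ ∧ l.IsChain (gr S).Adj ∧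
        ClosedUp (gr S).Adj l) ∧ ∀ l ∈ F, ∀ l' ∈ F, ∀ x ∈ l, x ∈ l' → l = l')) ≤
      z⁻¹ ^ k * Real.exp (z * ∑ i ∈ Finset.Icc 3 ℓ, (n * p) ^ i) := by
  classical
  set I : Finset (Σ i, List.Vector (Fin n) i) := (Finset.Icc 3 ℓ).sigma fun i =>
    (Finset.univ : Finset (List.Vector (Fin n) i)).filter fun v => v.1.Nodup with hI
  set A : (Σ i, List.Vector (Fin n) i) → Finset (Sym2 (Fin n)) := fun v =>
    (cycleEdges v.2.1).toFinset with hA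
  refine (bern_mono h0 h1 fun S _ => ind_mono ?_).trans ((bern_many_disjoint h0 h1 hz I A k).trans ?_)
  · rintro ⟨F, hc, hF, hd⟩
    have hinj : Function.Injective fun l : List (Fin n) =>
        (⟨l.length, l, rfl⟩ : Σ i, List.Vector (Fin n) i) := by
      intro l l' h
      exact congrArg (fun v : Σ i, List.Vector (Fin n) i => v.2.1) h
    refine ⟨F.image fun l => ⟨l.length, l, rfl⟩, ?_, ?_, ?_, ?_⟩
    · intro v hv
      obtain ⟨l, hl, rfl⟩ := Finset.mem_image.1 hv
      exact Finset.mem_sigma.2 ⟨Finset.mem_Icc.2 ⟨(hF l hl).2.1, (hF l hl).2.2.1⟩,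
        Finset.mem_filter.2 ⟨Finset.mem_univ _, (hF l hl).1⟩⟩
    · rw [Finset.card_image_of_injective _ hinj, hc]
    · intro v hv v' hv' hne
      obtain ⟨l, hl, rfl⟩ := Finset.mem_image.1 hv
      obtain ⟨l', hl', rfl⟩ := Finset.mem_image.1 hv'
      refine Finset.disjoint_left.2 fun e he he' => hne ?_
      obtain ⟨i, hi, rfl⟩ := mem_cycleEdges.1 (List.mem_toFinset.1 he)
      obtain ⟨j, hj, hij⟩ := mem_cycleEdges.1 (List.mem_toFinset.1 he')
      have : l = l' := by
        rcases Sym2.eq_iff.1 hij with ⟨h, -⟩ | ⟨h, -⟩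
        · exact hd l hl l' hl' l[i] (List.getElem_mem _) (h ▸ List.getElem_mem _)
        · exact hd l hl l' hl' _ (List.getElem_mem _) (h ▸ List.getElem_mem _)
      rw [this]
    · intro v hv
      obtain ⟨l, hl, rfl⟩ := Finset.mem_image.1 hv
      obtain ⟨hn, h3, -, hch, a, b, ha, hb, hab⟩ := hF l hl
      have key : ∀ e ∈ cycleEdges l, e ∈ (gr S).edgeSet := by
        intro e he
        obtain ⟨i, hi, rfl⟩ := mem_cycleEdges.1 he
        rw [SimpleGraph.mem_edgeSet]
        rcases (show i + 1 < l.length ∨ i + 1 = l.length by omega) with h | h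
        · simp only [Nat.mod_eq_of_lt h]
          exact List.isChain_iff_getElem.1 hch i h
        · simp only [h, Nat.mod_self]
          rw [List.head?_eq_getElem?, List.getElem?_eq_getElem (by omega), Option.some_inj] at ha
          rw [List.getLast?_eq_getElem?, List.getElem?_eq_getElem (by omega), Option.some_inj] at hb
          have : i = l.length - 1 := by omega
          subst this
          rw [ha, hb]
          exact hab
      constructor
      · intro e he
        have := key e (List.mem_toFinset.1 he)
        rw [SimpleGraph.edgeSet_fromEdgeSet] at this
        exact this.1
      · intro e he
        exact mem_allEdges.2 ((gr S).not_isDiag_of_mem_edgeSet (key e (List.mem_toFinset.1 he)))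
  · gcongr
    rw [hI, Finset.sum_sigma]
    refine Finset.sum_le_sum fun i hi => ?_
    refine (Finset.sum_le_card_nsmul _ _ (p ^ i) fun v hv => ?_).trans ?_
    · have := (Finset.mem_filter.1 hv).2
      rw [hA]
      dsimp only
      rw [card_cycleEdges this (by rw [v.2]; exact (Finset.mem_Icc.1 hi).1), v.2]
    · rw [nsmul_eq_mul, mul_pow]
      gcongr
      have := Finset.card_filter_le (Finset.univ : Finset (List.Vector (Fin n) i)) fun v => v.1.Nodup
      rw [Finset.card_univ, card_vector, Fintype.card_fin] at this
      exact_mod_cast this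

end FirstMoments

section Exponents

lemma log_le_div_of_pow_le {a : ℝ} {m k : ℕ} (hm : 0 < m) (ha : 0 < a)
    (h : a ^ m ≤ 2.7182818283 ^ k) : Real.log a ≤ k / m := by
  rw [le_div_iff₀ (by positivity), mul_comm, ← Real.log_pow, Real.log_le_iff_le_exp (by positivity),
    ← Real.exp_one_pow]
  exact h.trans (pow_le_pow_left₀ (by norm_num) Real.exp_one_gt_d9.le k)

lemma div_le_log_of_le_pow {a : ℝ} {m k : ℕ} (hm : 0 < m) (ha : 0 < a)
    (h : 2.7182818286 ^ k ≤ a ^ m) : k / m ≤ Real.log a := by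
  rw [div_le_iff₀ (by positivity), mul_comm, ← Real.log_pow, Real.le_log_iff_exp_le (by positivity),
    ← Real.exp_one_pow]
  exact (pow_le_pow_left₀ (Real.exp_pos 1).le Real.exp_one_lt_d9.le k).trans h

lemma sub_log_add_le_of_endpoints {A B K C a b ξ : ℝ} (hK : 0 ≤ K) (ha : 0 < a) (haξ : a ≤ ξ)
    (hξb : ξ ≤ b) (h1 : A - K * Real.log a + B * a ≤ C) (h2 : A - K * Real.log b + B * b ≤ C) :
    A - K * Real.log ξ + B * ξ ≤ C := by
  rcases haξ.eq_or_lt with rfl | haξ'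
  · exact h1
  have hab : 0 < b - a := by linarith
  set s := (b - ξ) / (b - a)
  set r := (ξ - a) / (b - a)
  have hs : 0 ≤ s := div_nonneg (by linarith) hab.le
  have hr : 0 ≤ r := div_nonneg (by linarith) hab.le
  have hsr : s + r = 1 := by simp only [s, r]; field_simp; ring
  have hξ' : s * a + r * b = ξ := by simp only [s, r]; field_simp; ring
  have hc := strictConcaveOn_log_Ioi.concaveOn.2 (Set.mem_Ioi.2 ha)
    (Set.mem_Ioi.2 (show 0 < b by linarith)) hs hr hsr
  simp only [smul_eq_mul, hξ'] at hc
  have e1 := mul_le_mul_of_nonneg_left h1 hs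
  have e2 := mul_le_mul_of_nonneg_left h2 hr
  have e3 := mul_le_mul_of_nonneg_left hc hK
  have e4 : A = s * A + r * A := by rw [← add_mul, hsr, one_mul]
  have e5 : C = s * C + r * C := by rw [← add_mul, hsr, one_mul]
  have e6 : B * ξ = B * (s * a + r * b) := by rw [hξ']
  linarith

end Exponents

section SmallClosure

variable {n x y : ℕ} {p κ l : ℝ}

lemma bern_small_cl_le_exp (h1 : p ≤ 1) (hl0 : 0 < l) (hl : l ≤ n * p) (hx : 0 < x)
    (hxy : x ≤ y) (hy : y ≤ n) (hκ : 0 < κ) (hyκ : (y : ℝ) - x ≤ κ * x)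
    (hκl : κ ≤ l * (1 - (1 + κ) * (x / n))) :
    bern (allEdges n) p (fun T => ind (∃ S : Finset (Fin n), S.card = x ∧ (cl (gr T) S).card ≤ y)) ≤
      (n + 1) * Real.exp (x * (1 - Real.log (x / n) + κ * (1 + Real.log (l / κ)) -
        l * (1 - (1 + κ) * (x / n)))) := by
  have hn : (0 : ℝ) < n := by exact_mod_cast (show 0 < n by omega)
  have hx' : (0 : ℝ) < x := by exact_mod_cast hx
  have hp : 0 < p := by
    by_contra h
    nlinarith
  set L := (n : ℝ) * p with hL
  set ξ := (x : ℝ) / n with hξ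
  have hξ0 : 0 < ξ := by positivity
  have hL0 : 0 < L := by positivity
  have hκL : κ ≤ L := by
    have : 0 ≤ l * ((1 + κ) * ξ) := by positivity
    linarith
  have hlog0 : 0 ≤ Real.log (L / κ) := Real.log_nonneg ((one_le_div hκ).2 hκL)
  have hlog : Real.log (L / κ) ≤ Real.log (l / κ) + (L / l - 1) := by
    have : L / κ = (l / κ) * (L / l) := by field_simp
    rw [this, Real.log_mul (by positivity) (by positivity)]
    linarith [Real.log_le_sub_one_of_pos (show 0 < L / l by positivity)]
  refine (bern_small_cl_le hp.le h1 hxy).trans ?_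
  refine (Finset.sum_le_card_nsmul _ _ (Real.exp (x * (1 - Real.log ξ + κ * (1 + Real.log (l / κ)) -
        l * (1 - (1 + κ) * ξ)))) fun u hu => ?_).trans ?_
  · have hu' : (u : ℝ) ≤ κ * x := by
      have : u ≤ y - x := Nat.lt_succ_iff.1 (Finset.mem_range.1 hu)
      have : (u : ℝ) ≤ (y - x : ℕ) := by exact_mod_cast this
      rw [Nat.cast_sub hxy] at this
      linarith
    have b1 : (n.choose x : ℝ) ≤ Real.exp (x * (1 - Real.log ξ)) := by
      refine (choose_le_exp hξ0 n x).trans (le_of_eq ?_)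
      rw [hξ]; field_simp
    have b2 : (n.choose u : ℝ) * (x * p) ^ u ≤ Real.exp (x * (κ * (1 + Real.log (L / κ)))) := by
      refine (choose_mul_pow_le (by positivity) (show 0 < κ / L by positivity) n u).trans ?_
      rw [Real.exp_le_exp]
      have e1 : κ / L * (n * (x * p)) = κ * x := by
        rw [hL]; field_simp
      have e2 : Real.log (κ / L) = - Real.log (L / κ) := by rw [← Real.log_inv, inv_div]
      rw [e1, e2]
      nlinarith
    have b3 : (1 - p) ^ (x * (n - x - u)) ≤ Real.exp (-(x * (L * (1 - (1 + κ) * ξ)))) := by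
      refine (one_sub_pow_le h1 _).trans ?_
      rw [Real.exp_le_exp, neg_le_neg_iff]
      push_cast
      have e1 : (n : ℝ) - x - u ≤ ((n - x - u : ℕ) : ℝ) := by
        rw [sub_le_iff_le_add, sub_le_iff_le_add]
        exact_mod_cast (show n ≤ n - x - u + u + x by omega)
      have e2 : x * (L * (1 - (1 + κ) * ξ)) = p * (x * (n - (1 + κ) * x)) := by
        rw [hL, hξ]; field_simp
      rw [e2]
      gcongr
      linarith
    have hp1 : 0 ≤ 1 - p := by linarith
    calc _ ≤ Real.exp (x * (1 - Real.log ξ)) * (Real.exp (x * (κ * (1 + Real.log (L / κ)))) *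
          Real.exp (-(x * (L * (1 - (1 + κ) * ξ))))) := by gcongr
      _ ≤ _ := by
        rw [← Real.exp_add, ← Real.exp_add, Real.exp_le_exp, ← mul_neg, ← mul_add, ← mul_add]
        refine mul_le_mul_of_nonneg_left ?_ hx'.le
        have e1 : κ * Real.log (L / κ) ≤ κ * Real.log (l / κ) + (L - l) * (κ / l) := by
          have : (L - l) * (κ / l) = κ * (L / l - 1) := by field_simp
          rw [this, ← mul_add]
          exact mul_le_mul_of_nonneg_left hlog hκ.le
        have e2 : κ / l ≤ 1 - (1 + κ) * ξ := by rw [div_le_iff₀ hl0]; linarith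
        have e3 : (L - l) * (κ / l) ≤ (L - l) * (1 - (1 + κ) * ξ) :=
          mul_le_mul_of_nonneg_left e2 (by linarith)
        linarith
  · rw [Finset.card_range, nsmul_eq_mul]
    gcongr
    exact_mod_cast (show y - x + 1 ≤ n + 1 by omega)

lemma bern_small_cl_le_exp' (h1 : p ≤ 1) (hl0 : 0 < l) (hl : l ≤ n * p) (hx : 0 < x)
    (hxy : x ≤ y) (hy : y ≤ n) (hκ : 0 < κ) (hyκ : (y : ℝ) - x ≤ κ * x) (hκx : κ * (x / n) ≤ 1) :
    bern (allEdges n) p (fun T => ind (∃ S : Finset (Fin n), S.card = x ∧ (cl (gr T) S).card ≤ y)) ≤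
      Real.exp (x * (1 - Real.log (x / n) + κ * (1 - Real.log (κ * (x / n)))) -
        l * x * (1 - y / n)) := by
  have hn : (0 : ℝ) < n := by exact_mod_cast (show 0 < n by omega)
  have hx' : (0 : ℝ) < x := by exact_mod_cast hx
  have hp : 0 < p := by
    by_contra h
    nlinarith
  have hp1 : 0 ≤ 1 - p := by linarith
  have hyn : (y : ℝ) ≤ n := by exact_mod_cast hy
  set ξ := (x : ℝ) / n with hξ
  have hξ0 : 0 < ξ := by positivity
  refine (bern_small_cl_le' hp.le h1 hxy hy).trans ?_
  have b1 : (n.choose x : ℝ) ≤ Real.exp (x * (1 - Real.log ξ)) := by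
    refine (choose_le_exp hξ0 n x).trans (le_of_eq ?_)
    rw [hξ]; field_simp
  have b2 : ((n - x).choose (y - x) : ℝ) ≤ Real.exp (x * (κ * (1 - Real.log (κ * ξ)))) := by
    have : ((n - x).choose (y - x) : ℝ) ≤ (n.choose (y - x) : ℝ) := by
      exact_mod_cast Nat.choose_le_choose _ (Nat.sub_le n x)
    refine this.trans ((choose_le_exp (show 0 < κ * ξ by positivity) n (y - x)).trans ?_)
    rw [Real.exp_le_exp, Nat.cast_sub hxy]
    have e1 : κ * ξ * n = κ * x := by rw [hξ]; field_simp
    have e2 : Real.log (κ * ξ) ≤ 0 := Real.log_nonpos (by positivity) hκx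
    rw [e1]
    nlinarith
  have b3 : (1 - p) ^ (x * (n - y)) ≤ Real.exp (-(l * x * (1 - y / n))) := by
    refine (one_sub_pow_le h1 _).trans ?_
    rw [Real.exp_le_exp, neg_le_neg_iff]
    push_cast [Nat.cast_sub hy]
    have e2 : n * p * x * (1 - y / n) = p * (x * (n - y)) := by field_simp
    rw [← e2]
    have : 0 ≤ 1 - (y : ℝ) / n := by rw [sub_nonneg, div_le_one hn]; exact hyn
    gcongr
  calc _ ≤ Real.exp (x * (1 - Real.log ξ)) * Real.exp (x * (κ * (1 - Real.log (κ * ξ)))) *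
        Real.exp (-(l * x * (1 - y / n))) := by gcongr
    _ = _ := by rw [← Real.exp_add, ← Real.exp_add]; ring_nf

lemma bern_small_cl_le_three_pow (h1 : p ≤ 1) (h0 : 0 ≤ p) (hl : l ≤ n * p) (hn : 0 < n)
    (hxy : x ≤ y) (hy : y ≤ n) :
    bern (allEdges n) p (fun T => ind (∃ S : Finset (Fin n), S.card = x ∧ (cl (gr T) S).card ≤ y)) ≤
      Real.exp (n * Real.log 3 - l * x * (1 - y / n)) := by
  have hn : (0 : ℝ) < n := by exact_mod_cast hn
  have hp1 : 0 ≤ 1 - p := by linarith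
  have hyn : (y : ℝ) ≤ n := by exact_mod_cast hy
  refine (bern_small_cl_le' h0 h1 hxy hy).trans ?_
  rw [Real.exp_sub, Real.exp_nat_mul, Real.exp_log (by norm_num), div_eq_mul_inv, ← Real.exp_neg]
  refine mul_le_mul (by exact_mod_cast choose_mul_choose_le n x (y - x))
    ((one_sub_pow_le h1 _).trans ?_) (by positivity) (by positivity)
  rw [Real.exp_le_exp, neg_le_neg_iff]
  push_cast [Nat.cast_sub hy]
  have e2 : n * p * x * (1 - y / n) = p * (x * (n - y)) := by field_simp
  rw [← e2]
  have : 0 ≤ 1 - (y : ℝ) / n := by rw [sub_nonneg, div_le_one hn]; exact hyn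
  gcongr

end SmallClosure

section ExpansionEvents

variable {n x₀ μ cap w r₀ η : ℕ} {p : ℝ}

lemma small_exponent_le {ξ : ℝ} (h1 : 0.000189 ≤ ξ) (h2 : ξ ≤ 0.0051) :
    1 - Real.log ξ + 3.006 * (1 + Real.log (18 / 3.006)) - 18 * (1 - (1 + 3.006) * ξ) ≤ -0.015 := by
  have a1 : Real.log (18 / 3.006) ≤ (179 : ℕ) / (100 : ℕ) :=
    log_le_div_of_pow_le (by norm_num) (by norm_num) (by norm_num)
  have a2 : (-223 : ℝ) / 26 ≤ Real.log 0.000189 := by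
    have : Real.log (0.000189⁻¹) ≤ (223 : ℕ) / (26 : ℕ) :=
      log_le_div_of_pow_le (by norm_num) (by norm_num) (by norm_num)
    rw [Real.log_inv] at this
    push_cast at this
    linarith
  have a3 : (-6 : ℝ) ≤ Real.log 0.0051 := by
    have : Real.log (0.0051⁻¹) ≤ (6 : ℕ) / (1 : ℕ) :=
      log_le_div_of_pow_le (by norm_num) (by norm_num) (by norm_num)
    rw [Real.log_inv] at this
    push_cast at this
    linarith
  push_cast at a1
  have := sub_log_add_le_of_endpoints (A := 1 + 3.006 * (1 + Real.log (18 / 3.006)) - 18) (K := 1)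
    (B := 18 * (1 + 3.006)) (C := -0.015) zero_le_one (by norm_num) h1 h2 (by linarith) (by linarith)
  linarith

lemma mid_exponent_le {ξ : ℝ} (h1 : 0.0049 ≤ ξ) (h2 : ξ ≤ 0.03) :
    1 - Real.log ξ + 3.94 * (1 + Real.log (18 / 3.94)) - 18 * (1 - (1 + 3.94) * ξ) ≤ -0.3 := by
  have a1 : Real.log (18 / 3.94) ≤ (16 : ℕ) / (10 : ℕ) :=
    log_le_div_of_pow_le (by norm_num) (by norm_num) (by norm_num)
  have a2 : (-54 : ℝ) / 10 ≤ Real.log 0.0049 := by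
    have : Real.log (0.0049⁻¹) ≤ (54 : ℕ) / (10 : ℕ) :=
      log_le_div_of_pow_le (by norm_num) (by norm_num) (by norm_num)
    rw [Real.log_inv] at this
    push_cast at this
    linarith
  have a3 : (-36 : ℝ) / 10 ≤ Real.log 0.03 := by
    have : Real.log (0.03⁻¹) ≤ (36 : ℕ) / (10 : ℕ) :=
      log_le_div_of_pow_le (by norm_num) (by norm_num) (by norm_num)
    rw [Real.log_inv] at this
    push_cast at this
    linarith
  push_cast at a1
  have := sub_log_add_le_of_endpoints (A := 1 + 3.94 * (1 + Real.log (18 / 3.94)) - 18) (K := 1)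
    (B := 18 * (1 + 3.94)) (C := -0.3) zero_le_one (by norm_num) h1 h2 (by linarith) (by linarith)
  linarith

lemma mid_exponent_le' {ξ : ℝ} (h1 : 0.03 ≤ ξ) (h2 : ξ ≤ 0.1) :
    1 - Real.log ξ + 3.156 * (1 - Real.log (3.156 * ξ)) - 18 * (1 - (1 + 3.156) * ξ) ≤ -0.3 := by
  have a1 : (114 : ℕ) / (100 : ℕ) ≤ Real.log 3.156 :=
    div_le_log_of_le_pow (by norm_num) (by norm_num) (by norm_num)
  have a2 : (-88 : ℝ) / 25 ≤ Real.log 0.03 := by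
    have : Real.log (0.03⁻¹) ≤ (88 : ℕ) / (25 : ℕ) :=
      log_le_div_of_pow_le (by norm_num) (by norm_num) (by norm_num)
    rw [Real.log_inv] at this
    push_cast at this
    linarith
  have a3 : (-231 : ℝ) / 100 ≤ Real.log 0.1 := by
    have : Real.log (0.1⁻¹) ≤ (231 : ℕ) / (100 : ℕ) :=
      log_le_div_of_pow_le (by norm_num) (by norm_num) (by norm_num)
    rw [Real.log_inv] at this
    push_cast at this
    linarith
  push_cast at a1
  have := sub_log_add_le_of_endpoints (A := 1 + 3.156 * (1 - Real.log 3.156) - 18) (K := 4.156)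
    (B := 18 * (1 + 3.156)) (C := -0.3) (by norm_num) (by norm_num) h1 h2 (by linarith) (by linarith)
  rw [Real.log_mul (by norm_num) (by linarith)]
  linarith

lemma red_exponent_le {ξ : ℝ} (h1 : 0.0000349 ≤ ξ) (h2 : ξ ≤ 0.000036) :
    1 - Real.log ξ + 3 * (1 + Real.log (20 / 3)) - 20 * (1 - (1 + 3) * ξ) ≤ -0.015 := by
  have a1 : Real.log (20 / 3) ≤ (19 : ℕ) / (10 : ℕ) :=
    log_le_div_of_pow_le (by norm_num) (by norm_num) (by norm_num)
  have a2 : (-154 : ℝ) / 15 ≤ Real.log 0.0000349 := by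
    have : Real.log (0.0000349⁻¹) ≤ (154 : ℕ) / (15 : ℕ) :=
      log_le_div_of_pow_le (by norm_num) (by norm_num) (by norm_num)
    rw [Real.log_inv] at this
    push_cast at this
    linarith
  have a3 : Real.log 0.0000349 ≤ Real.log ξ := Real.log_le_log (by norm_num) h1
  push_cast at a1
  linarith

lemma ind_not_forall_card_le {I : Finset ℕ} (P : ℕ → Prop) (Q : Finset (Fin n) → Prop)
    (hI : ∀ S : Finset (Fin n), P S.card → S.card ∈ I) :
    ind (¬ ∀ S : Finset (Fin n), P S.card → ¬ Q S) ≤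
      ∑ x ∈ I, ind (∃ S : Finset (Fin n), S.card = x ∧ Q S) := by
  refine (ind_mono fun h => ?_).trans (ind_exists_le I _)
  push Not at h
  obtain ⟨S, hP, hQ⟩ := h
  exact ⟨_, hI S hP, S, rfl, hQ⟩

lemma bern_small_event_le (h0 : 0 ≤ p) (h1 : p ≤ 1) (hn : 1 ≤ n) (hp : 18 ≤ n * p)
    (hx : 0.000189 * (n : ℝ) ≤ x₀) (hμ : (μ : ℝ) + r₀ ≤ 0.0051 * n) (hη : (η : ℝ) ≤ 0.006 * x₀) :
    bern (allEdges n) p (fun T => ind (¬ ∀ S : Finset (Fin n), x₀ ≤ S.card → S.card ≤ μ + r₀ →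
      4 * S.card + η < (cl (gr T) S).card)) ≤ (n + 1) ^ 2 * Real.exp (-(0.000001 * n)) := by
  have hn' : (1 : ℝ) ≤ n := by exact_mod_cast hn
  refine (bern_mono h0 h1 fun T _ => (ind_mono ?_).trans (ind_not_forall_card_le
    (I := Finset.Icc x₀ (μ + r₀)) (fun x => x₀ ≤ x ∧ x ≤ μ + r₀)
    (fun S => (cl (gr T) S).card ≤ 4 * S.card + η) fun S h => Finset.mem_Icc.2 h)).trans ?_
  · exact fun h h' => h fun S h1 h2 => not_le.1 (h' S ⟨h1, h2⟩)
  rw [bern_sum]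
  refine (Finset.sum_le_card_nsmul _ _ ((n + 1) * Real.exp (-(0.000001 * n))) fun x hx' => ?_).trans ?_
  · obtain ⟨hx1, hx2⟩ := Finset.mem_Icc.1 hx'
    have hx1' : (x₀ : ℝ) ≤ x := by exact_mod_cast hx1
    have hx2' : (x : ℝ) ≤ μ + r₀ := by exact_mod_cast hx2
    have hxn : 0.000189 * (n : ℝ) ≤ x := hx.trans hx1'
    have hxpos : 0 < x := by
      have : (0 : ℝ) < x := by linarith
      exact_mod_cast this
    have hy : 4 * x + η ≤ n := by
      have : (4 * x + η : ℝ) ≤ n := by linarith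
      exact_mod_cast this
    have hn0 : (0 : ℝ) < n := by linarith
    have hξ1 : 0.000189 ≤ (x : ℝ) / n := by rw [le_div_iff₀ hn0]; exact hxn
    have hξ2 : (x : ℝ) / n ≤ 0.0051 := by rw [div_le_iff₀ hn0]; linarith
    have := bern_small_cl_le_exp (κ := 3.006) (l := 18) h1 (by norm_num) hp hxpos
      (show x ≤ 4 * x + η by omega) hy (by norm_num) (by push_cast; linarith) (by linarith)
    refine (bern_mono h0 h1 fun T _ => ind_mono ?_).trans (this.trans ?_)
    · rintro ⟨S, hS, hc⟩
      exact ⟨S, hS, hS ▸ hc⟩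
    · refine mul_le_mul_of_nonneg_left (Real.exp_le_exp.2 ?_) (by positivity)
      nlinarith [mul_le_mul_of_nonneg_left (small_exponent_le hξ1 hξ2) (Nat.cast_nonneg (α := ℝ) x)]
  · have hc : ((Finset.Icc x₀ (μ + r₀)).card : ℝ) ≤ n + 1 := by
      rw [Nat.card_Icc]
      have h1 : (μ : ℝ) + r₀ ≤ n := by linarith
      have : μ + r₀ ≤ n := by exact_mod_cast h1
      exact_mod_cast (show μ + r₀ + 1 - x₀ ≤ n + 1 by omega)
    rw [nsmul_eq_mul, pow_two, mul_assoc]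
    gcongr

lemma bern_mid_event_le (h0 : 0 ≤ p) (h1 : p ≤ 1) (hn : 1 ≤ n) (hp : 18 ≤ n * p)
    (hμ : 0.0049 * (n : ℝ) ≤ μ) (hcap : (cap : ℝ) ≤ 0.1 * n) (hw : (w : ℝ) ≤ 0.0046 * n) :
    bern (allEdges n) p (fun T => ind (¬ ∀ S : Finset (Fin n), μ ≤ S.card → S.card ≤ cap →
      4 * S.card + w < (cl (gr T) S).card)) ≤ (n + 1) ^ 2 * Real.exp (-(0.000001 * n)) := by
  have hn' : (1 : ℝ) ≤ n := by exact_mod_cast hn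
  refine (bern_mono h0 h1 fun T _ => (ind_mono ?_).trans (ind_not_forall_card_le
    (I := Finset.Icc μ cap) (fun x => μ ≤ x ∧ x ≤ cap)
    (fun S => (cl (gr T) S).card ≤ 4 * S.card + w) fun S h => Finset.mem_Icc.2 h)).trans ?_
  · exact fun h h' => h fun S h1 h2 => not_le.1 (h' S ⟨h1, h2⟩)
  rw [bern_sum]
  refine (Finset.sum_le_card_nsmul _ _ ((n + 1) * Real.exp (-(0.000001 * n))) fun x hx' => ?_).trans ?_
  · obtain ⟨hx1, hx2⟩ := Finset.mem_Icc.1 hx'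
    have hx1' : (μ : ℝ) ≤ x := by exact_mod_cast hx1
    have hx2' : (x : ℝ) ≤ cap := by exact_mod_cast hx2
    have hxpos : 0 < x := by
      have : (0 : ℝ) < x := by linarith
      exact_mod_cast this
    have hy : 4 * x + w ≤ n := by
      have : (4 * x + w : ℝ) ≤ n := by linarith
      exact_mod_cast this
    have hn0 : (0 : ℝ) < n := by linarith
    have hξ1 : 0.0049 ≤ (x : ℝ) / n := by rw [le_div_iff₀ hn0]; linarith
    have hξ2 : (x : ℝ) / n ≤ 0.1 := by rw [div_le_iff₀ hn0]; linarith
    refine (bern_mono h0 h1 fun T _ => ind_mono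
      (Q := ∃ S : Finset (Fin n), S.card = x ∧ (cl (gr T) S).card ≤ 4 * x + w) ?_).trans ?_
    · rintro ⟨S, hS, hc⟩
      exact ⟨S, hS, hS ▸ hc⟩
    rcases le_total ((x : ℝ) / n) 0.03 with h | h
    · refine (bern_small_cl_le_exp (κ := 3.94) (l := 18) h1 (by norm_num) hp hxpos
        (show x ≤ 4 * x + w by omega) hy (by norm_num) (by push_cast; linarith) (by linarith)).trans ?_
      refine mul_le_mul_of_nonneg_left (Real.exp_le_exp.2 ?_) (by positivity)
      nlinarith [mul_le_mul_of_nonneg_left (mid_exponent_le hξ1 h) (Nat.cast_nonneg (α := ℝ) x)]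
    · have hxn : 0.03 * n ≤ (x : ℝ) := by rwa [le_div_iff₀ hn0] at h
      refine (bern_small_cl_le_exp' (κ := 3.156) (l := 18) h1 (by norm_num) hp hxpos
        (show x ≤ 4 * x + w by omega) hy (by norm_num) (by push_cast; linarith) (by linarith)).trans ?_
      have e1 : ((4 * x + w : ℕ) : ℝ) / n ≤ (1 + 3.156) * (x / n) := by
        rw [← mul_div_assoc]
        gcongr
        push_cast
        linarith
      have e2 : Real.exp (-(0.000001 * (n : ℝ))) ≤ (n + 1) * Real.exp (-(0.000001 * n)) :=
        le_mul_of_one_le_left (Real.exp_pos _).le (by linarith)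
      refine (Real.exp_le_exp.2 ?_).trans e2
      have e3 := mul_le_mul_of_nonneg_left (mid_exponent_le' h hξ2) (Nat.cast_nonneg (α := ℝ) x)
      have e4 := mul_le_mul_of_nonneg_left e1 (Nat.cast_nonneg (α := ℝ) x)
      nlinarith
  · have hc : ((Finset.Icc μ cap).card : ℝ) ≤ n + 1 := by
      rw [Nat.card_Icc]
      have h1 : (cap : ℝ) ≤ n := by linarith
      have : cap ≤ n := by exact_mod_cast h1
      exact_mod_cast (show cap + 1 - μ ≤ n + 1 by omega)
    rw [nsmul_eq_mul, pow_two, mul_assoc]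
    gcongr

lemma bern_large_event_le (h0 : 0 ≤ p) (h1 : p ≤ 1) (hn : 1 ≤ n) (hp : 18 ≤ n * p)
    (hcap : 0.0999 * (n : ℝ) ≤ cap) (hw : (w : ℝ) ≤ 0.0046 * n) :
    bern (allEdges n) p (fun T => ind (¬ ∀ S : Finset (Fin n), cap ≤ S.card → 4 * S.card ≤ n →
      3 * S.card + w ≤ (cl (gr T) S).card)) ≤ (n + 1) ^ 2 * Real.exp (-(0.000001 * n)) := by
  have hn' : (1 : ℝ) ≤ n := by exact_mod_cast hn
  refine (bern_mono h0 h1 fun T _ => (ind_mono ?_).trans (ind_not_forall_card_le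
    (I := (Finset.range (n + 1)).filter fun x => cap ≤ x ∧ 4 * x ≤ n)
    (fun x => cap ≤ x ∧ 4 * x ≤ n) (fun S => (cl (gr T) S).card < 3 * S.card + w)
    fun S h => Finset.mem_filter.2 ⟨Finset.mem_range.2 (by omega), h⟩)).trans ?_
  · exact fun h h' => h fun S h1 h2 => not_lt.1 (h' S ⟨h1, h2⟩)
  rw [bern_sum]
  refine (Finset.sum_le_card_nsmul _ _ ((n + 1) * Real.exp (-(0.000001 * n))) fun x hx' => ?_).trans ?_
  · obtain ⟨-, hx1, hx2⟩ := Finset.mem_filter.1 hx'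
    have hx1' : (cap : ℝ) ≤ x := by exact_mod_cast hx1
    have hx2' : 4 * (x : ℝ) ≤ n := by exact_mod_cast hx2
    have hy : 3 * x + w ≤ n := by
      have : (3 * x + w : ℝ) ≤ n := by linarith
      exact_mod_cast this
    have hn0 : (0 : ℝ) < n := by linarith
    refine (bern_mono h0 h1 fun T _ => ind_mono
      (Q := ∃ S : Finset (Fin n), S.card = x ∧ (cl (gr T) S).card ≤ 3 * x + w) ?_).trans ?_
    · rintro ⟨S, hS, hc⟩
      exact ⟨S, hS, by rw [← hS]; exact hc.le⟩
    refine (bern_small_cl_le_three_pow (l := 18) h1 h0 hp hn (show x ≤ 3 * x + w by omega) hy).trans ?_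
    have e2 : Real.exp (-(0.000001 * (n : ℝ))) ≤ (n + 1) * Real.exp (-(0.000001 * n)) :=
      le_mul_of_one_le_left (Real.exp_pos _).le (by linarith)
    refine (Real.exp_le_exp.2 ?_).trans e2
    have a1 : Real.log 3 ≤ (11 : ℕ) / (10 : ℕ) :=
      log_le_div_of_pow_le (by norm_num) (by norm_num) (by norm_num)
    push_cast at a1
    have hξ1 : 0.0999 ≤ (x : ℝ) / n := by rw [le_div_iff₀ hn0]; linarith
    have hξ2 : (x : ℝ) / n ≤ 0.25 := by rw [div_le_iff₀ hn0]; linarith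
    have e3 : ((3 * x + w : ℕ) : ℝ) / n ≤ 3 * (x / n) + 0.0046 := by
      rw [div_le_iff₀ hn0, add_mul, mul_assoc, div_mul_cancel₀ _ hn0.ne']
      push_cast
      linarith
    have e4 : (x : ℝ) = n * (x / n) := by field_simp
    have e5 : 1.1001 ≤ 18 * ((x : ℝ) / n) * (1 - ((3 * x + w : ℕ) : ℝ) / n) := by
      have : 18 * ((x : ℝ) / n) * (1 - (3 * (x / n) + 0.0046)) ≤
          18 * ((x : ℝ) / n) * (1 - ((3 * x + w : ℕ) : ℝ) / n) := by gcongr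
      nlinarith [mul_nonneg (sub_nonneg.2 hξ1) (sub_nonneg.2 hξ2)]
    have e6 : 18 * (x : ℝ) * (1 - ((3 * x + w : ℕ) : ℝ) / n) =
        n * (18 * ((x : ℝ) / n) * (1 - ((3 * x + w : ℕ) : ℝ) / n)) := by field_simp
    rw [e6]
    nlinarith
  · have hc : (((Finset.range (n + 1)).filter fun x => cap ≤ x ∧ 4 * x ≤ n).card : ℝ) ≤ n + 1 := by
      have := Finset.card_filter_le (Finset.range (n + 1)) fun x => cap ≤ x ∧ 4 * x ≤ n
      rw [Finset.card_range] at this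
      exact_mod_cast this
    rw [nsmul_eq_mul, pow_two, mul_assoc]
    gcongr

lemma bern_red_event_le (h0 : 0 ≤ p) (h1 : p ≤ 1) (hn : 1 ≤ n) (hp : 20 ≤ n * p)
    (hr : 0.0000349 * (n : ℝ) ≤ r₀) (hr' : (r₀ : ℝ) ≤ 0.000036 * n) :
    bern (allEdges n) p (fun T => ind (¬ ∀ S : Finset (Fin n), S.card = r₀ →
      4 * r₀ < (cl (gr T) S).card)) ≤ (n + 1) ^ 2 * Real.exp (-(0.0000001 * n)) := by
  have hn' : (1 : ℝ) ≤ n := by exact_mod_cast hn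
  have hn0 : (0 : ℝ) < n := by linarith
  have hpos : 0 < r₀ := by
    have : (0 : ℝ) < r₀ := by linarith
    exact_mod_cast this
  have hξ1 : 0.0000349 ≤ (r₀ : ℝ) / n := by rw [le_div_iff₀ hn0]; linarith
  have hξ2 : (r₀ : ℝ) / n ≤ 0.000036 := by rw [div_le_iff₀ hn0]; linarith
  have hy : 4 * r₀ ≤ n := by
    have : (4 * r₀ : ℝ) ≤ n := by linarith
    exact_mod_cast this
  refine (bern_mono h0 h1 fun T _ => ind_mono
    (Q := ∃ S : Finset (Fin n), S.card = r₀ ∧ (cl (gr T) S).card ≤ 4 * r₀) ?_).trans ?_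
  · intro h
    push Not at h
    exact h
  refine (bern_small_cl_le_exp (κ := 3) (l := 20) h1 (by norm_num) hp hpos
    (show r₀ ≤ 4 * r₀ by omega) hy (by norm_num) (by push_cast; linarith) (by linarith)).trans ?_
  have e1 : ((n : ℝ) + 1) ≤ (n + 1) ^ 2 := by nlinarith
  refine mul_le_mul e1 (Real.exp_le_exp.2 ?_) (Real.exp_pos _).le (by positivity)
  nlinarith [mul_le_mul_of_nonneg_left (red_exponent_le hξ1 hξ2) (Nat.cast_nonneg (α := ℝ) r₀)]

end ExpansionEvents

section DenseSum

variable {n : ℕ} {c p r : ℝ}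

lemma dense_exponent_le {c ξ : ℝ} (hc : 20 ≤ c) (hξ : ξ ≤ 0.000191) :
    8 - 3 * Real.log 3 + 4 * Real.log (c + 2) - (c - 2) * (1 - 4 * ξ) ≤ -0.8 := by
  have a1 : Real.log 22 ≤ (167 : ℕ) / (54 : ℕ) :=
    log_le_div_of_pow_le (by norm_num) (by norm_num) (by norm_num)
  have a2 : ((12 : ℕ) : ℝ) / (11 : ℕ) ≤ Real.log 3 :=
    div_le_log_of_le_pow (by norm_num) (by norm_num) (by norm_num)
  have a3 : Real.log (c + 2) ≤ Real.log 22 + ((c + 2) / 22 - 1) := by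
    have := Real.log_le_sub_one_of_pos (x := (c + 2) / 22) (by linarith)
    rw [Real.log_div (by linarith) (by norm_num)] at this
    linarith
  push_cast at a1 a2
  have a4 : 0 ≤ (c - 20) * (1 - 4 * ξ - 4 / 22) := mul_nonneg (by linarith) (by linarith)
  linarith

lemma dense_term_le (hc : 20 ≤ c) (h0 : 0 ≤ p) (h1 : p ≤ 1) (hr : 0 ≤ r) (hp : c - 2 ≤ n * p)
    (hs : n * (p + r) ≤ c + 2) {x y : ℕ} (hx : 0 < x) (hxn : (x : ℝ) ≤ 0.000191 * n) (hxy : x ≤ y)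
    (hy : y ≤ 4 * x) :
    (n.choose x : ℝ) * n.choose (y - x) *
      ((x * y).choose (y + 2) * ((p + r) ^ (y + 2) * (1 - p) ^ (x * (n - y)))) ≤
    (c + 2) ^ 2 / (n : ℝ) ^ 2 * ((x : ℝ) ^ 2 * Real.exp (-(0.8 * x))) := by
  have hx' : (0 : ℝ) < x := by exact_mod_cast hx
  have hn : (0 : ℝ) < n := by nlinarith
  set ξ := (x : ℝ) / n with hξ
  have hξ0 : 0 < ξ := by positivity
  have hξn : ξ * n = x := by rw [hξ]; field_simp
  have hξ1 : ξ ≤ 0.000191 := by rw [hξ, div_le_iff₀ hn]; exact hxn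
  have hy' : (y : ℝ) ≤ 4 * x := by exact_mod_cast hy
  have hyn : y ≤ n := by
    have : (y : ℝ) ≤ n := by nlinarith
    exact_mod_cast this
  set B := c + 2 with hB
  have hB0 : 0 < B := by linarith
  have hlB : Real.log (ξ * B) = Real.log ξ + Real.log B := Real.log_mul hξ0.ne' hB0.ne'
  have e1 : (n.choose x : ℝ) ≤ Real.exp (ξ * n - x * Real.log ξ) := choose_le_exp hξ0 n x
  have e2 := choose_le_exp (t := 3 * ξ) (by positivity) n (y - x)
  have e3 := choose_mul_pow_le (a := p + r) (t := (ξ * B)⁻¹) (by linarith) (by positivity) (x * y) (y + 2)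
  have e4 := one_sub_pow_le h1 (x * (n - y))
  have e5 : (ξ * B)⁻¹ * ((x * y : ℕ) * (p + r)) ≤ y := by
    rw [inv_mul_le_iff₀ (by positivity)]
    push_cast
    have : (x : ℝ) * (p + r) ≤ ξ * B := by
      rw [← hξn, mul_assoc]
      exact mul_le_mul_of_nonneg_left hs hξ0.le
    nlinarith [mul_le_mul_of_nonneg_right this (Nat.cast_nonneg (α := ℝ) y)]
  have e6 : (c - 2) * (1 - 4 * ξ) * x ≤ p * (x * (n - y) : ℕ) := by
    push_cast [Nat.cast_sub hyn]
    have h2 : (n : ℝ) * (1 - 4 * ξ) ≤ n - y := by nlinarith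
    have h3 : (c - 2) * (1 - 4 * ξ) ≤ n * p * (1 - 4 * ξ) :=
      mul_le_mul_of_nonneg_right hp (by linarith)
    have h4 := mul_le_mul_of_nonneg_left h2 h0
    nlinarith [mul_le_mul_of_nonneg_right (h3.trans (by linarith : n * p * (1 - 4 * ξ) ≤ p * (n - y)))
      hx'.le]
  have hq : (0 : ℝ) ≤ (1 - p) ^ (x * (n - y)) := pow_nonneg (by linarith) _
  have hpr : (0 : ℝ) ≤ (p + r) ^ (y + 2) := pow_nonneg (by linarith) _
  calc (n.choose x : ℝ) * n.choose (y - x) *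
      ((x * y).choose (y + 2) * ((p + r) ^ (y + 2) * (1 - p) ^ (x * (n - y))))
      = (n.choose x : ℝ) * n.choose (y - x) *
      ((x * y).choose (y + 2) * (p + r) ^ (y + 2) * (1 - p) ^ (x * (n - y))) := by ring
    _ ≤ Real.exp (ξ * n - x * Real.log ξ) *
        Real.exp (3 * ξ * n - (y - x : ℕ) * Real.log (3 * ξ)) *
        (Real.exp ((ξ * B)⁻¹ * ((x * y : ℕ) * (p + r)) - (y + 2 : ℕ) * Real.log (ξ * B)⁻¹) *
          Real.exp (-(p * (x * (n - y) : ℕ)))) := by gcongr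
    _ ≤ Real.exp (2 * Real.log ξ + 2 * Real.log B - 0.8 * x) := by
        rw [← Real.exp_add, ← Real.exp_add, ← Real.exp_add]
        apply Real.exp_le_exp.2
        rw [Real.log_inv, hlB, Real.log_mul (by norm_num) hξ0.ne']
        push_cast [Nat.cast_sub hxy]
        push_cast at e5 e6
        have h3 : Real.log 3 ≤ Real.log B := Real.log_le_log (by norm_num) (by linarith)
        have h4 := mul_le_mul_of_nonneg_left hy' (show 0 ≤ 1 - Real.log 3 + Real.log B by linarith)
        have h5 := mul_le_mul_of_nonneg_right (dense_exponent_le hc hξ1) hx'.le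
        rw [mul_assoc 3 ξ, hξn]
        nlinarith
    _ = B ^ 2 / (n : ℝ) ^ 2 * ((x : ℝ) ^ 2 * Real.exp (-(0.8 * x))) := by
        rw [sub_eq_add_neg, Real.exp_add, Real.exp_add, two_mul, two_mul, Real.exp_add,
          Real.exp_add, Real.exp_log hξ0, Real.exp_log hB0, hξ]
        ring

theorem exists_dense_bound (hc : 20 ≤ c) : ∃ K : ℝ, ∀ (n x₀ : ℕ) (p r : ℝ), 0 ≤ p → p ≤ 1 → 0 ≤ r →
    r ≤ 1 → c - 2 ≤ n * p → n * (p + r) ≤ c + 2 → (x₀ : ℝ) ≤ 0.000191 * n →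
    bern (allEdges n) p (fun S => bern (allEdges n) r fun R =>
      ind (¬ NoDense (gr (S ∪ R)) (gr S) x₀)) ≤ K / (n : ℝ) ^ 2 := by
  have hsum : Summable fun x : ℕ => (x : ℝ) ^ 3 * Real.exp (-0.8 * x) :=
    Real.summable_pow_mul_exp_neg_nat_mul 3 (by norm_num)
  refine ⟨(c + 2) ^ 2 * (4 * ∑' x : ℕ, (x : ℝ) ^ 3 * Real.exp (-0.8 * x)), ?_⟩
  intro n x₀ p r h0 h1 hr0 hr1 hp hs hx₀
  refine (bern_dense_le h0 h1 hr0 hr1 x₀).trans ?_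
  have key : ∀ x ∈ Finset.Ioc 0 x₀, ∑ y ∈ Finset.Icc x (4 * x), (n.choose x : ℝ) * n.choose (y - x) *
      ((x * y).choose (y + 2) * ((p + r) ^ (y + 2) * (1 - p) ^ (x * (n - y)))) ≤
      (c + 2) ^ 2 / (n : ℝ) ^ 2 * 4 * ((x : ℝ) ^ 3 * Real.exp (-0.8 * x)) := by
    intro x hx
    rw [Finset.mem_Ioc] at hx
    have hxn : (x : ℝ) ≤ 0.000191 * n := le_trans (by exact_mod_cast hx.2) hx₀
    refine (Finset.sum_le_card_nsmul _ _ _ fun y hy =>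
      dense_term_le hc h0 h1 hr0 hp hs hx.1 hxn (Finset.mem_Icc.1 hy).1 (Finset.mem_Icc.1 hy).2).trans ?_
    rw [Nat.card_Icc, nsmul_eq_mul]
    have h4 : ((4 * x + 1 - x : ℕ) : ℝ) ≤ 4 * x := by
      have : 4 * x + 1 - x ≤ 4 * x := by omega
      exact_mod_cast this
    refine (mul_le_mul_of_nonneg_right h4 (by positivity)).trans (le_of_eq ?_)
    rw [neg_mul]
    ring
  refine (Finset.sum_le_sum key).trans ?_
  rw [← Finset.mul_sum]
  have := hsum.sum_le_tsum (Finset.Ioc 0 x₀) (fun x _ => by positivity)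
  calc (c + 2) ^ 2 / (n : ℝ) ^ 2 * 4 * ∑ x ∈ Finset.Ioc 0 x₀, (x : ℝ) ^ 3 * Real.exp (-0.8 * x)
      ≤ (c + 2) ^ 2 / (n : ℝ) ^ 2 * 4 * ∑' x : ℕ, (x : ℝ) ^ 3 * Real.exp (-0.8 * x) := by gcongr
    _ = _ := by ring

end DenseSum

section HallSum

variable {n D : ℕ} {q c : ℝ}

lemma hall_exponent_le_of_cubic {a a₀ L : ℝ} (ha : 0.0055 ≤ a) (ha₀ : 0 < a₀) (hL : -Real.log a₀ ≤ L)
    (h : 9 * a ^ 3 + (1.6 + 2 * (L - 1) + 0.511 - 9 * 1.0055 + 0.005) * a ^ 2 +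
      (2 * a₀ - 0.0055 * (L - 1) - 0.511 * 0.0055) * a - 0.0055 * a₀ ≤ 0) :
    1.6 * a - a * Real.log a - (a - 0.0055) * Real.log (0.6 * a) - 9 * a * (1.0055 - a) ≤
      -(0.005 * a) := by
  have h0 : 0 < a := by linarith
  have h6 : -Real.log 0.6 ≤ 0.511 := by
    have := log_le_div_of_pow_le (a := (0.6 : ℝ)⁻¹) (m := 92) (k := 47) (by norm_num) (by norm_num)
      (by norm_num)
    rw [Real.log_inv] at this
    refine this.trans ?_
    norm_num
  have h1 : -Real.log a ≤ L - 1 + a₀ / a := by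
    have := Real.log_le_sub_one_of_pos (x := a₀ / a) (by positivity)
    rw [Real.log_div ha₀.ne' h0.ne'] at this
    linarith
  rw [Real.log_mul (by norm_num) h0.ne']
  have h2 := mul_le_mul_of_nonneg_left h1 (show 0 ≤ a + (a - 0.0055) by linarith)
  have h3 := mul_le_mul_of_nonneg_left h6 (show 0 ≤ a - 0.0055 by linarith)
  have h4 : 1.6 * a + (a + (a - 0.0055)) * (L - 1 + a₀ / a) + (a - 0.0055) * 0.511 -
      9 * a * (1.0055 - a) + 0.005 * a = (9 * a ^ 3 + (1.6 + 2 * (L - 1) + 0.511 - 9 * 1.0055 + 0.005) * a ^ 2 +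
      (2 * a₀ - 0.0055 * (L - 1) - 0.511 * 0.0055) * a - 0.0055 * a₀) / a := by
    field_simp
    ring
  have h5 := div_nonpos_of_nonpos_of_nonneg h h0.le
  linarith

lemma hall_exponent_le {a : ℝ} (h1 : 0.0055 ≤ a) (h2 : a ≤ 0.51) :
    1.6 * a - a * Real.log a - (a - 0.0055) * Real.log (0.6 * a) - 9 * a * (1.0055 - a) ≤
      -(0.005 * a) := by
  have key : ∀ (l u a₀ : ℝ) (k m : ℕ), 0 < m → 0 < a₀ → a₀⁻¹ ^ m ≤ 2.7182818283 ^ k → l ≤ a → a ≤ u →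
      (0 ≤ (a - l) ^ 3 → 0 ≤ (a - l) ^ 2 * (u - a) → 0 ≤ (a - l) * (u - a) ^ 2 → 0 ≤ (u - a) ^ 3 →
        9 * a ^ 3 + (1.6 + 2 * ((k / m : ℝ) - 1) + 0.511 - 9 * 1.0055 + 0.005) * a ^ 2 +
      (2 * a₀ - 0.0055 * ((k / m : ℝ) - 1) - 0.511 * 0.0055) * a - 0.0055 * a₀ ≤ 0) →
      1.6 * a - a * Real.log a - (a - 0.0055) * Real.log (0.6 * a) - 9 * a * (1.0055 - a) ≤
      -(0.005 * a) := by
    intro l u a₀ k m hm ha₀ hk hl hu h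
    refine hall_exponent_le_of_cubic (a₀ := a₀) (L := k / m) h1 ha₀ ?_ ?_
    · rw [← Real.log_inv]
      exact log_le_div_of_pow_le hm (by positivity) hk
    · have hl' : 0 ≤ a - l := by linarith
      have hu' : 0 ≤ u - a := by linarith
      exact h (by positivity) (by positivity) (by positivity) (by positivity)
  rcases le_total a 0.0165 with h | h
  · refine key 0.0055 0.0165 0.0119 164 37 (by norm_num) (by norm_num) (by norm_num) h1 h ?_
    intros; push_cast; linarith
  rcases le_total a 0.0495 with h' | h'
  · refine key 0.0165 0.0495 0.0229 34 9 (by norm_num) (by norm_num) (by norm_num) h h' ?_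
    intros; push_cast; linarith
  rcases le_total a 0.1485 with h | h
  · refine key 0.0495 0.1485 0.0688 83 31 (by norm_num) (by norm_num) (by norm_num) h' h ?_
    intros; push_cast; linarith
  rcases le_total a 0.4455 with h' | h'
  · refine key 0.1485 0.4455 0.206 49 31 (by norm_num) (by norm_num) (by norm_num) h h' ?_
    intros; push_cast; linarith
  · refine key 0.4455 0.68161 0.575 5 9 (by norm_num) (by norm_num) (by norm_num) h' (by linarith) ?_
    intros; push_cast; linarith

lemma hall_term_le (h0 : 0 ≤ q) (h1 : q ≤ 1) (hq : 9 ≤ n * q) (hqc : n * q ≤ c) (hD : 0.0055 * (n : ℝ) ≤ D)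
    (hD' : (D : ℝ) ≤ 0.01 * n) {i : ℕ} (hi : D ≤ i) (hi' : 2 * i ≤ n + D) :
    (n.choose i : ℝ) * n.choose (n + D - i) * (1 - q) ^ (i * (n + D - i) - n) ≤
      Real.exp (c - 0.0000275 * n) := by
  have hn : (0 : ℝ) < n := by
    rcases Nat.eq_zero_or_pos n with rfl | h
    · simp at hq; linarith
    · exact_mod_cast h
  have hiR : (D : ℝ) ≤ i := by exact_mod_cast hi
  have hiR' : 2 * (i : ℝ) ≤ n + D := by exact_mod_cast hi'
  have hin : i ≤ n := by
    have : (i : ℝ) ≤ n := by linarith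
    exact_mod_cast this
  set a := (i : ℝ) / n with ha
  have han : a * n = i := by rw [ha]; field_simp
  have ha1 : 0.0055 ≤ a := by rw [ha, le_div_iff₀ hn]; linarith
  have ha2 : a ≤ 0.51 := by rw [ha, div_le_iff₀ hn]; linarith
  have ha0 : 0 < a := by linarith
  have e1 := choose_le_exp ha0 n i
  have e2 := choose_le_exp (t := 0.6 * a) (by positivity) n (i - D)
  have e3 := one_sub_pow_le h1 (i * (n + D - i) - n)
  have hs : n.choose (n + D - i) = n.choose (i - D) := by
    rw [← Nat.choose_symm (show i - D ≤ n by omega)]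
    congr 1
    omega
  have e4 : (i : ℝ) * (n + D - i) - n ≤ (i * (n + D - i) - n : ℕ) := by
    have : (i * (n + D - i) : ℕ) ≤ (i * (n + D - i) - n) + n := by omega
    have : ((i * (n + D - i) : ℕ) : ℝ) ≤ ((i * (n + D - i) - n : ℕ) : ℝ) + n := by exact_mod_cast this
    rw [Nat.cast_mul, Nat.cast_sub (show i ≤ n + D by omega), Nat.cast_add] at this
    linarith
  rw [hs]
  refine (mul_le_mul (mul_le_mul e1 e2 (by positivity) (by positivity)) e3
    (pow_nonneg (by linarith) _) (by positivity)).trans ?_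
  rw [← Real.exp_add, ← Real.exp_add]
  apply Real.exp_le_exp.2
  have f1 := mul_le_mul_of_nonneg_left (hall_exponent_le ha1 ha2) hn.le
  have f2 : Real.log (0.6 * a) ≤ 0 := Real.log_nonpos (by positivity) (by linarith)
  have f3 := mul_le_mul_of_nonpos_right hD f2
  have f4 := mul_le_mul_of_nonneg_left e4 h0
  have f5 : 9 * a * (1.0055 * n - i) ≤ q * (i * (n + D - i)) := by
    have : 9 * a * (1.0055 * n - i) ≤ (n * q) * a * (n + D - i) := by
      apply mul_le_mul (mul_le_mul_of_nonneg_right hq ha0.le) (by linarith) (by nlinarith) (by positivity)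
    refine this.trans (le_of_eq ?_)
    rw [← han]; ring
  rw [Nat.cast_sub hi]
  have f6 : 0.0055 * (n : ℝ) ≤ a * n := by rw [han]; linarith
  rw [← han] at f5 f4 ⊢
  nlinarith

theorem bern_hall_le_exp (h0 : 0 ≤ q) (h1 : q ≤ 1) (hq : 9 ≤ n * q) (hqc : n * q ≤ c) {δ : ℕ}
    (hD : 0.0055 * (n : ℝ) ≤ (δ + 1 : ℕ)) (hD' : ((δ + 1 : ℕ) : ℝ) ≤ 0.01 * n) :
    bern (allEdges n) q (fun S => bern (allEdges n) q fun T => ind (∃ A Y : Finset (Fin n),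
      (∀ a ∈ A, ∀ y ∈ Y, (a < y → s(a, y) ∉ S) ∧ (y < a → s(a, y) ∉ T)) ∧ n + δ < A.card + Y.card)) ≤
      n * Real.exp (c - 0.0000275 * n) := by
  refine (bern_hall_le h0 h1).trans ?_
  refine (Finset.sum_le_card_nsmul _ _ (Real.exp (c - 0.0000275 * n)) fun i hi => ?_).trans ?_
  · rw [Finset.mem_Icc] at hi
    rw [show n + δ + 1 - i = n + (δ + 1) - i by omega]
    rcases le_total (2 * i) (n + (δ + 1)) with h | h
    · exact hall_term_le h0 h1 hq hqc hD hD' hi.1 h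
    · have := hall_term_le h0 h1 hq hqc hD hD' (i := n + (δ + 1) - i) (by omega) (by omega)
      rw [show n + (δ + 1) - (n + (δ + 1) - i) = i by omega, mul_comm (n + (δ + 1) - i)] at this
      rwa [mul_comm (n.choose i : ℝ)]
  · rw [Nat.card_Icc, nsmul_eq_mul]
    gcongr
    omega

end HallSum

section Parameters

/-- The size `⌊a n⌋`. -/
noncomputable def sz (a : ℝ) (n : ℕ) : ℕ := ⌊a * n⌋₊

/-- The bound on the length of short cycles. -/
noncomputable def cycLen (c : ℝ) (n : ℕ) : ℕ := ⌊Real.log n / (4 * Real.log c)⌋₊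

/-- The number of paths left by the merging procedure. -/
noncomputable def pathNum (n : ℕ) : ℕ := ⌊n / Real.log n ^ 2⌋₊

/-- The number of merging rounds needed for `k` paths. -/
noncomputable def roundNum (n k : ℕ) : ℕ := ⌈Real.log (n / (2 * ((k : ℝ) - 1))) / Real.log 3⌉₊

/-- A bound on the initial number of paths. -/
noncomputable def pathBound (n : ℕ) : ℕ := sz 0.00019 n + sz 0.000035 n / 2 + 1

/-- The requirements on the size of `n`. -/
structure Large (c : ℝ) (n : ℕ) : Prop where
  twenty_le : 20 ≤ c
  log_ge : 10000000 * c ≤ Real.log n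
  loglog : 8 * Real.log (Real.log n) + 10 ≤ Real.log n / (4 * c)
  log_pow : Real.log n ^ 4 ≤ 0.00000000000001 * n

variable {c : ℝ} {n : ℕ}

lemma eventually_large (hc : 20 ≤ c) : ∀ᶠ n : ℕ in Filter.atTop, Large c n := by
  have hL : Filter.Tendsto (fun n : ℕ => Real.log n) Filter.atTop Filter.atTop :=
    Real.tendsto_log_atTop.comp tendsto_natCast_atTop_atTop
  have h1 := hL.eventually_ge_atTop (10000000 * c)
  have h2 : ∀ᶠ x : ℝ in Filter.atTop, 8 * Real.log x + 10 ≤ x / (4 * c) := by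
    have h := Real.isLittleO_log_id_atTop.bound (show (0 : ℝ) < 1 / (64 * c) by positivity)
    filter_upwards [h, Filter.eventually_ge_atTop (80 * c), Filter.eventually_ge_atTop 0] with x hx hx' hx0
    rw [Real.norm_eq_abs, Real.norm_eq_abs, id, abs_of_nonneg hx0] at hx
    have h3 := (le_abs_self _).trans hx
    have h4 : 10 ≤ x / (8 * c) := by rw [le_div_iff₀ (by positivity)]; linarith
    have h5 : x / (4 * c) = 8 * (1 / (64 * c) * x) + x / (8 * c) := by field_simp; ring
    linarith
  have h3 : ∀ᶠ x : ℝ in Filter.atTop, Real.log x ^ 4 ≤ 0.00000000000001 * x := by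
    have h := (Real.isLittleO_pow_log_id_atTop (n := 4)).bound (show (0 : ℝ) < 0.00000000000001 by norm_num)
    filter_upwards [h, Filter.eventually_ge_atTop 0] with x hx hx0
    rw [Real.norm_eq_abs, Real.norm_eq_abs, id, abs_of_nonneg hx0] at hx
    exact (le_abs_self _).trans hx
  filter_upwards [h1, hL.eventually h2, tendsto_natCast_atTop_atTop.eventually h3] with n a b d
  exact ⟨hc, a, b, d⟩

lemma sz_le {a : ℝ} (ha : 0 ≤ a) (n : ℕ) : (sz a n : ℝ) ≤ a * n := Nat.floor_le (by positivity)

lemma lt_sz (a : ℝ) (n : ℕ) : a * n < sz a n + 1 := Nat.lt_floor_add_one _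

namespace Large

lemma log_big (h : Large c n) : 200000000 ≤ Real.log n := by linarith [h.twenty_le, h.log_ge]

lemma sq_log_le (h : Large c n) : Real.log n ^ 2 ≤ 0.0000001 * √n := by
  rw [← pow_le_pow_iff_left₀ (by positivity) (by positivity) two_ne_zero, mul_pow,
    Real.sq_sqrt (by positivity), ← pow_mul]
  linarith [h.log_pow]

lemma sqrt_big (h : Large c n) : 10000000 * Real.log n ^ 2 ≤ √n := by linarith [h.sq_log_le]

lemma log_le (h : Large c n) : Real.log n ≤ 0.000000000000001 * n := by
  have h1 := h.log_big
  have h2 := h.log_pow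
  nlinarith [pow_le_pow_left₀ (by norm_num) h1 3]

lemma n_big (h : Large c n) : 100000000000000000 ≤ (n : ℝ) := by linarith [h.log_big, h.log_le]

lemma cycLen_lt (h : Large c n) : Real.log n / (4 * c) < cycLen c n + 1 := by
  have hc := h.twenty_le
  refine lt_of_le_of_lt ?_ (Nat.lt_floor_add_one _)
  have := Real.log_pos (show 1 < c by linarith)
  have := Real.log_le_self (show 0 ≤ c by linarith)
  have := h.log_big
  gcongr

lemma cycLen_big (h : Large c n) : 1000000 ≤ (cycLen c n : ℝ) := by
  have hc := h.twenty_le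
  have h1 := h.cycLen_lt
  have : 2500000 ≤ Real.log n / (4 * c) := by
    rw [le_div_iff₀ (by linarith)]; linarith [h.log_ge]
  linarith

lemma cycLen_mul_le (h : Large c n) : cycLen c n * Real.log c ≤ Real.log n / 4 := by
  have hc := h.twenty_le
  have h1 := Real.log_pos (show 1 < c by linarith)
  have h2 : (cycLen c n : ℝ) ≤ Real.log n / (4 * Real.log c) :=
    Nat.floor_le (div_nonneg (by linarith [h.log_big]) (by positivity))
  rw [le_div_iff₀ (by positivity)] at h2
  linarith

lemma cycLen_le (h : Large c n) : (cycLen c n : ℝ) ≤ Real.log n := by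
  have h1 := h.cycLen_mul_le
  have : 1 ≤ Real.log c := by
    rw [Real.le_log_iff_exp_le (by linarith [h.twenty_le])]
    linarith [Real.exp_one_lt_d9, h.twenty_le]
  have h3 := h.log_big
  nlinarith [Nat.cast_nonneg (α := ℝ) (cycLen c n)]

lemma pathNum_le (h : Large c n) : pathNum n * Real.log n ^ 2 ≤ n := by
  have h1 := h.log_big
  have h2 : (pathNum n : ℝ) ≤ n / Real.log n ^ 2 := Nat.floor_le (by positivity)
  rwa [le_div_iff₀ (by positivity)] at h2

lemma one_le_pathNum (h : Large c n) : 1 ≤ pathNum n := by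
  have h1 := h.log_big
  apply Nat.le_floor
  rw [Nat.cast_one, le_div_iff₀ (by positivity), one_mul]
  have := h.log_pow
  nlinarith [h.n_big, pow_le_pow_left₀ (by norm_num) h1 2]

lemma pathNum_ge (h : Large c n) : n ≤ 2 * pathNum n * Real.log n ^ 2 := by
  have h1 := h.log_big
  have h2 : n / Real.log n ^ 2 < pathNum n + 1 := Nat.lt_floor_add_one _
  rw [div_lt_iff₀ (by positivity)] at h2
  have h3 : 1 ≤ (pathNum n : ℝ) := by exact_mod_cast h.one_le_pathNum
  nlinarith [sq_nonneg (Real.log n)]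

lemma log_three_ge : (12 : ℝ) / 11 ≤ Real.log 3 := by
  have := div_le_log_of_le_pow (a := 3) (m := 11) (k := 12) (by norm_num) (by norm_num) (by norm_num)
  exact_mod_cast this

lemma pathBound_le (n : ℕ) : (pathBound n : ℝ) ≤ 0.0002075 * n + 1 := by
  have h1 := sz_le (show (0 : ℝ) ≤ 0.00019 by norm_num) n
  have h2 := sz_le (show (0 : ℝ) ≤ 0.000035 by norm_num) n
  have h3 : ((sz 0.000035 n / 2 : ℕ) : ℝ) ≤ sz 0.000035 n / 2 := Nat.cast_div_le
  unfold pathBound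
  push_cast
  linarith

lemma log_div_nonneg (h : Large c n) {k : ℕ} (hk : k ∈ Finset.Ioc 1 (pathBound n)) :
    0 ≤ Real.log (n / (2 * ((k : ℝ) - 1))) := by
  rw [Finset.mem_Ioc] at hk
  have h1 : (1 : ℝ) < k := by exact_mod_cast hk.1
  have h2 : (k : ℝ) ≤ pathBound n := by exact_mod_cast hk.2
  have := pathBound_le n
  have := h.n_big
  apply Real.log_nonneg
  rw [le_div_iff₀ (by linarith)]
  linarith

lemma roundNum_le (h : Large c n) {k : ℕ} (hk : k ∈ Finset.Ioc 1 (pathBound n)) :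
    (roundNum n k : ℝ) ≤ 1 + 11 / 12 * Real.log (n / (2 * ((k : ℝ) - 1))) := by
  have h0 := h.log_div_nonneg hk
  have h3 := log_three_ge
  have h1 : (roundNum n k : ℝ) < Real.log (n / (2 * ((k : ℝ) - 1))) / Real.log 3 + 1 :=
    Nat.ceil_lt_add_one (by positivity)
  have h2 : Real.log (n / (2 * ((k : ℝ) - 1))) / Real.log 3 ≤
      Real.log (n / (2 * ((k : ℝ) - 1))) / (12 / 11) := by gcongr
  linarith

lemma sum_roundNum_le (h : Large c n) :
    ∑ k ∈ Finset.Ioc (pathNum n) (pathBound n), 2 * (roundNum n k : ℝ) ≤ 0.00385 * n := by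
  have hn := h.n_big
  obtain ⟨K, hK⟩ : ∃ K, pathBound n = K + 1 := ⟨_, rfl⟩
  have hKn : (K : ℝ) ≤ 0.0002075 * n := by
    have := pathBound_le n
    rw [hK] at this
    push_cast at this
    linarith
  have h1 : ∑ k ∈ Finset.Ioc (pathNum n) (pathBound n), 2 * (roundNum n k : ℝ) ≤
      ∑ k ∈ Finset.Ioc 1 (pathBound n), 2 * (1 + 11 / 12 * Real.log (n / (2 * ((k : ℝ) - 1)))) := by
    have hs : Finset.Ioc (pathNum n) (pathBound n) ⊆ Finset.Ioc 1 (pathBound n) :=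
      Finset.Ioc_subset_Ioc_left h.one_le_pathNum
    refine (Finset.sum_le_sum fun k hk => mul_le_mul_of_nonneg_left (h.roundNum_le (hs hk))
      zero_le_two).trans (Finset.sum_le_sum_of_subset_of_nonneg hs fun k hk _ => ?_)
    have := h.log_div_nonneg hk
    positivity
  have h2 : ∑ k ∈ Finset.Ioc 1 (pathBound n), 2 * (1 + 11 / 12 * Real.log (n / (2 * ((k : ℝ) - 1)))) =
      ∑ i ∈ Finset.range K, (2 + 11 / 6 * (Real.log (n / 2) - Real.log ((i + 1 : ℕ) : ℝ))) := by
    symm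
    refine Finset.sum_bij (fun i _ => i + 2) (fun i hi => ?_) (fun _ _ _ _ h => by simpa using h)
      (fun k hk => ?_) (fun i _ => ?_)
    · rw [Finset.mem_range] at hi
      rw [Finset.mem_Ioc]
      omega
    · rw [Finset.mem_Ioc] at hk
      exact ⟨k - 2, Finset.mem_range.2 (by omega), by omega⟩
    · rw [← Real.log_div (by positivity) (by positivity), div_div]
      push_cast
      rw [show (i : ℝ) + 2 - 1 = i + 1 by ring]
      ring
  have h3 : ∑ i ∈ Finset.range K, Real.log ((i + 1 : ℕ) : ℝ) = Real.log (K.factorial : ℝ) := by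
    rw [← Finset.prod_range_add_one_eq_factorial, Nat.cast_prod,
      Real.log_prod fun i _ => Nat.cast_ne_zero.2 (Nat.succ_ne_zero i)]
  refine (h1.trans_eq h2).trans ?_
  rw [Finset.sum_add_distrib, ← Finset.mul_sum, Finset.sum_sub_distrib, h3, Finset.sum_const,
    Finset.sum_const, Finset.card_range, nsmul_eq_mul, nsmul_eq_mul]
  rcases Nat.eq_zero_or_pos K with rfl | hK0
  · simp; linarith
  have hK' : (0 : ℝ) < K := by exact_mod_cast hK0
  have h4 : K * Real.log K - K ≤ Real.log (K.factorial : ℝ) := by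
    have := pow_div_factorial_le (y := K) (t := 1) hK'.le one_pos K
    rw [Real.log_one, mul_zero, sub_zero, one_mul, ← Real.log_le_iff_le_exp (by positivity),
      Real.log_div (by positivity) (by positivity), Real.log_pow] at this
    linarith
  have h5 : Real.log (n / 2) - Real.log K ≤ 6.8 + 0.0002075 * n / K := by
    have e1 := log_le_div_of_pow_le (a := (0.000415 : ℝ)⁻¹) (m := 5) (k := 39) (by norm_num)
      (by norm_num) (by norm_num)
    have e2 := Real.log_le_sub_one_of_pos (x := 0.000415 * (n / 2) / K) (by positivity)
    rw [Real.log_div (by positivity) (by positivity), Real.log_mul (by norm_num) (by positivity)] at e2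
    rw [Real.log_inv] at e1
    push_cast at e1
    have e3 : 0.000415 * ((n : ℝ) / 2) / K = 0.0002075 * n / K := by ring
    linarith
  have h6 : K * (Real.log (n / 2) - Real.log K) ≤ 6.8 * K + 0.0002075 * n := by
    refine (mul_le_mul_of_nonneg_left h5 hK'.le).trans (le_of_eq ?_)
    field_simp
  linarith

lemma roundNum_step (h : Large c n) {k : ℕ} (hk : k ∈ Finset.Ioc (pathNum n) (pathBound n)) :
    2 * roundNum n k + 1 ≤ cycLen c n ∧ n ≤ 4 * (3 ^ roundNum n k * (k / 2)) := by
  have hn := h.n_big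
  have hL := h.log_big
  have hk1 := Finset.Ioc_subset_Ioc_left h.one_le_pathNum hk
  have ht := h.roundNum_le hk1
  rw [Finset.mem_Ioc] at hk hk1
  have hm : (pathNum n : ℝ) + 1 ≤ k := by exact_mod_cast hk.1
  have hm1 : (1 : ℝ) ≤ pathNum n := by exact_mod_cast h.one_le_pathNum
  have hpos : 0 < 2 * ((k : ℝ) - 1) := by linarith
  constructor
  · have h1 : (n : ℝ) / (2 * ((k : ℝ) - 1)) ≤ Real.log n ^ 2 := by
      rw [div_le_iff₀ hpos]
      have := h.pathNum_ge
      nlinarith [sq_nonneg (Real.log n)]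
    have h2 := Real.log_le_log (by positivity) h1
    rw [Real.log_pow] at h2
    have h3 := h.cycLen_lt
    have h4 := h.loglog
    have h5 := Real.log_nonneg (show 1 ≤ Real.log n by linarith)
    have : ((2 * roundNum n k + 1 : ℕ) : ℝ) < cycLen c n + 1 := by
      push_cast at h2 ⊢
      linarith
    have : 2 * roundNum n k + 1 < cycLen c n + 1 := by exact_mod_cast this
    omega
  · have h1 : (n : ℝ) / (2 * ((k : ℝ) - 1)) ≤ 3 ^ roundNum n k := by
      have h3 := log_three_ge
      have := Nat.le_ceil (Real.log (n / (2 * ((k : ℝ) - 1))) / Real.log 3)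
      rw [div_le_iff₀ (by linarith)] at this
      rw [← Real.log_le_log_iff (by positivity) (by positivity), Real.log_pow]
      exact this
    rw [div_le_iff₀ hpos] at h1
    have h2 : (k : ℝ) - 1 ≤ 2 * (k / 2 : ℕ) := by
      have : k ≤ 2 * (k / 2) + 1 := by omega
      have : (k : ℝ) ≤ 2 * (k / 2 : ℕ) + 1 := by exact_mod_cast this
      linarith
    have h3 : (n : ℝ) ≤ 4 * (3 ^ roundNum n k * (k / 2 : ℕ)) := by
      have := mul_le_mul_of_nonneg_left h2 (show (0 : ℝ) ≤ 3 ^ roundNum n k by positivity)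
      linarith
    exact_mod_cast h3

lemma linkNumbers (h : Large c n) :
    LinkNumbers n (sz 0.00019 n) (sz 0.005 n) (sz 0.1 n) (sz 0.0046 n) (sz 0.000035 n)
      (sz 0.000001 n) (cycLen c n) (pathNum n) (pathBound n) (roundNum n) := by
  have hn := h.n_big
  have a1 := sz_le (show (0 : ℝ) ≤ 0.00019 by norm_num) n
  have a2 := sz_le (show (0 : ℝ) ≤ 0.000035 by norm_num) n
  have a3 := sz_le (show (0 : ℝ) ≤ 0.000001 by norm_num) n
  have a4 := sz_le (show (0 : ℝ) ≤ 0.005 by norm_num) n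
  have a5 := sz_le (show (0 : ℝ) ≤ 0.0046 by norm_num) n
  have a6 := sz_le (show (0 : ℝ) ≤ 0.1 by norm_num) n
  have b1 := lt_sz 0.00019 n
  have b5 := lt_sz 0.0046 n
  have b6 := lt_sz 0.1 n
  have h12 : ((n / 12 : ℕ) : ℝ) ≤ n / 12 := Nat.cast_div_le
  refine ⟨?_, ?_, ?_, ?_, ?_, ?_, ?_, ?_, fun k hk => h.roundNum_step hk⟩
  · have : (4 : ℝ) ≤ sz 0.0046 n := by linarith
    exact_mod_cast this
  · have : (4 : ℝ) * sz 0.1 n + 4 ≤ n := by linarith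
    exact_mod_cast this
  · have : ((n / 12 : ℕ) : ℝ) + 1 + sz 0.005 n ≤ sz 0.1 n := by linarith
    exact_mod_cast this
  · have : (2 : ℝ) * sz 0.005 n ≤ sz 0.1 n := by linarith
    exact_mod_cast this
  · have : (sz 0.000035 n : ℝ) ≤ sz 0.00019 n := by linarith
    exact_mod_cast this
  · unfold pathBound
    omega
  · have : (sz 0.0046 n : ℝ) + 3 ≤ n := by linarith
    exact_mod_cast this
  · have h1 := h.sum_roundNum_le
    have : 4 * (sz 0.000035 n : ℝ) + sz 0.000001 n + 3 * sz 0.00019 n +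
        ∑ k ∈ Finset.Ioc (pathNum n) (pathBound n), 2 * (roundNum n k : ℝ) ≤ sz 0.0046 n := by linarith
    exact_mod_cast this

end Large

end Parameters

section TailBounds

/-- The bound on the maximum degree. -/
noncomputable def degBound (n : ℕ) : ℕ := ⌊4 * Real.log n⌋₊

namespace Large

variable {c p q : ℝ} {n : ℕ}

lemma n_pos (h : Large c n) : (0 : ℝ) < n := by linarith [h.n_big]

lemma exp_le (h : Large c n) {x : ℝ} (hx : x ≤ -(2 * Real.log n)) : Real.exp x ≤ 1 / (n : ℝ) ^ 2 := by
  refine (Real.exp_le_exp.2 hx).trans (le_of_eq ?_)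
  rw [Real.exp_neg, two_mul, Real.exp_add, Real.exp_log h.n_pos, one_div, sq]

lemma lt_sqrt (n : ℕ) : √(n : ℝ) < (n.sqrt + 1 : ℕ) := by
  rw [Real.sqrt_lt' (by positivity)]
  have := Nat.lt_succ_sqrt n
  rw [sq]
  exact_mod_cast this

lemma expansion_le (h : Large c n) {a : ℝ} (ha : 0.0000001 ≤ a) :
    ((n : ℝ) + 1) ^ 2 * Real.exp (-(a * n)) ≤ 1 / (n : ℝ) ^ 2 := by
  have hn := h.n_big
  have h1 : ((n : ℝ) + 1) ^ 2 ≤ Real.exp (4 * Real.log n) := by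
    have : Real.exp (4 * Real.log n) = (n : ℝ) ^ 4 := by
      rw [← Real.exp_log h.n_pos, ← Real.exp_nat_mul, Real.exp_log h.n_pos]
      norm_num
    rw [this, show (4 : ℕ) = 2 * 2 by rfl, pow_mul]
    apply pow_le_pow_left₀ (by positivity)
    nlinarith
  refine (mul_le_mul_of_nonneg_right h1 (Real.exp_pos _).le).trans ?_
  rw [← Real.exp_add]
  apply h.exp_le
  have := h.log_le
  nlinarith

lemma hall_le (h : Large c n) : n * Real.exp (c - 0.0000275 * n) ≤ 1 / (n : ℝ) ^ 2 := by
  rw [← Real.exp_log h.n_pos, ← Real.exp_add, Real.exp_log h.n_pos]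
  apply h.exp_le
  linarith [h.log_le, h.log_ge, h.twenty_le]

lemma common_le (h : Large c n) (h0 : 0 ≤ q) (hq : n * q ≤ c) :
    ((n ^ 2).choose (n.sqrt + 1) : ℝ) * (q * q) ^ (n.sqrt + 1) ≤ 1 / (n : ℝ) ^ 2 := by
  have hs := lt_sqrt n
  have e := choose_mul_pow_le (a := q * q) (t := Real.exp 1) (mul_nonneg h0 h0) (Real.exp_pos 1) (n ^ 2)
    (n.sqrt + 1)
  refine e.trans (h.exp_le ?_)
  rw [Real.log_exp, mul_one]
  have h1 : ((n ^ 2 : ℕ) : ℝ) * (q * q) ≤ c ^ 2 := by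
    push_cast
    have := pow_le_pow_left₀ (mul_nonneg h.n_pos.le h0) hq 2
    nlinarith
  have h2 : Real.exp 1 * (((n ^ 2 : ℕ) : ℝ) * (q * q)) ≤ 3 * c ^ 2 :=
    mul_le_mul (by linarith [Real.exp_one_lt_d9]) h1 (by positivity) (by norm_num)
  have h3 := h.log_ge
  have h4 := h.twenty_le
  have h5 := h.sqrt_big
  have h6 : c ^ 2 ≤ Real.log n ^ 2 := pow_le_pow_left₀ (by linarith) (by linarith) 2
  have h7 := h.log_big
  nlinarith

lemma degree_le (h : Large c n) (h0 : 0 ≤ p) (hp : n * p ≤ c) :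
    n * ((n.choose (degBound n + 1) : ℝ) * p ^ (degBound n + 1)) ≤ 1 / (n : ℝ) ^ 2 := by
  have e := choose_mul_pow_le (t := Real.exp 1) h0 (Real.exp_pos 1) n (degBound n + 1)
  refine (mul_le_mul_of_nonneg_left e h.n_pos.le).trans ?_
  rw [Real.log_exp, mul_one]
  nth_rewrite 1 [← Real.exp_log h.n_pos]
  rw [← Real.exp_add]
  apply h.exp_le
  have h1 : 4 * Real.log n < (degBound n + 1 : ℕ) := by
    push_cast
    exact Nat.lt_floor_add_one _
  have h2 : Real.exp 1 * (n * p) ≤ 3 * c :=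
    mul_le_mul (by linarith [Real.exp_one_lt_d9]) hp (mul_nonneg h.n_pos.le h0) (by norm_num)
  linarith [h.log_ge, h.twenty_le]

lemma cycles_le (h : Large c n) (hp : n * p = c) :
    (Real.exp 1)⁻¹ ^ (n.sqrt + 1) * Real.exp (Real.exp 1 * ∑ i ∈ Finset.Icc 3 (cycLen c n), (n * p) ^ i) ≤
      1 / (n : ℝ) ^ 2 := by
  have hc := h.twenty_le
  have hL := h.log_big
  set Q := c ^ cycLen c n with hQ
  have h1 : ∑ i ∈ Finset.Icc 3 (cycLen c n), (n * p) ^ i ≤ Real.log n * Q := by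
    rw [hp]
    refine (Finset.sum_le_card_nsmul _ _ Q fun i hi => pow_le_pow_right₀ (by linarith)
      (Finset.mem_Icc.1 hi).2).trans ?_
    rw [nsmul_eq_mul, Nat.card_Icc]
    refine mul_le_mul_of_nonneg_right (le_trans ?_ h.cycLen_le) (by positivity)
    exact_mod_cast (show cycLen c n + 1 - 3 ≤ cycLen c n by omega)
  have h2 : Q ^ 4 ≤ n := by
    rw [← Real.log_le_log_iff (by positivity) h.n_pos, Real.log_pow, hQ, Real.log_pow]
    have := h.cycLen_mul_le
    push_cast
    linarith
  have h3 : Real.log n * Q ≤ 0.001 * √n := by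
    rw [← pow_le_pow_iff_left₀ (by positivity) (by positivity) (show 4 ≠ 0 by norm_num), mul_pow, mul_pow,
      show √(n : ℝ) ^ 4 = (n : ℝ) ^ 2 by
        rw [show (4 : ℕ) = 2 * 2 by rfl, pow_mul, Real.sq_sqrt h.n_pos.le]]
    refine (mul_le_mul h.log_pow h2 (by positivity) (by positivity)).trans ?_
    nlinarith [h.n_pos]
  have h4 : Real.exp 1 * ∑ i ∈ Finset.Icc 3 (cycLen c n), (n * p) ^ i ≤ 3 * (0.001 * √n) :=
    mul_le_mul (by linarith [Real.exp_one_lt_d9]) (h1.trans h3)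
      (Finset.sum_nonneg fun i _ => by rw [hp]; positivity) (by norm_num)
  rw [← Real.exp_neg, ← Real.exp_nat_mul, ← Real.exp_add]
  apply h.exp_le
  have hs := lt_sqrt n
  have := h.sqrt_big
  nlinarith

lemma sprinkle_le (h : Large c n) :
    ((setsUpToCard (Fin n) (sz 0.0046 n)).card : ℝ) * (setsUpToCard (Sym2 (Fin n)) (pathNum n)).card *
      (setsUpToCard (Fin n) (sz 0.00019 n)).card * ((0.15 : ℝ)⁻¹ ^ sz 0.0102 n *
        (1 - 2 / n * (1 - 0.15)) ^ ((n / 4 - sz 0.00019 n) * (n / 4 - sz 0.00019 n) / 2)) ≤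
      1 / (n : ℝ) ^ 2 := by
  have hn := h.n_big
  have hL := h.log_big
  have w1 := sz_le (show (0 : ℝ) ≤ 0.0046 by norm_num) n
  have x1 := sz_le (show (0 : ℝ) ≤ 0.00019 by norm_num) n
  have j1 := sz_le (show (0 : ℝ) ≤ 0.0102 by norm_num) n
  have e1 := card_setsUpToCard_le (α := Fin n) (t := 0.0046) (by norm_num) (by norm_num) (sz 0.0046 n)
  have e2 := card_setsUpToCard_le (α := Sym2 (Fin n)) (t := 1 / (n : ℝ) ^ 2) (by positivity)
    (by rw [div_le_one (by positivity)]; nlinarith) (pathNum n)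
  have e3 := card_setsUpToCard_le (α := Fin n) (t := 0.00019) (by norm_num) (by norm_num) (sz 0.00019 n)
  set b := (n / 4 - sz 0.00019 n) * (n / 4 - sz 0.00019 n) / 2 with hb
  have e4 := one_sub_pow_le (p := 2 / (n : ℝ) * (1 - 0.15))
    (by rw [div_mul_eq_mul_div, div_le_one (by positivity)]; linarith) b
  have e5 : (0.15 : ℝ)⁻¹ ^ sz 0.0102 n = Real.exp (-(sz 0.0102 n * Real.log 0.15)) := by
    rw [← mul_neg, Real.exp_nat_mul, Real.exp_neg, Real.exp_log (by norm_num)]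
  rw [e5]
  rw [Fintype.card_fin] at e1 e3
  have hq : (0 : ℝ) ≤ (1 - 2 / n * (1 - 0.15)) ^ b := by
    apply pow_nonneg
    rw [sub_nonneg, div_mul_eq_mul_div, div_le_one (by positivity)]
    linarith
  refine (mul_le_mul (mul_le_mul (mul_le_mul e1 e2 (by positivity) (by positivity)) e3 (by positivity)
    (by positivity)) (mul_le_mul_of_nonneg_left e4 (Real.exp_pos _).le)
    (mul_nonneg (Real.exp_pos _).le hq) (by positivity)).trans ?_
  rw [← Real.exp_add, ← Real.exp_add, ← Real.exp_add, ← Real.exp_add]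
  apply h.exp_le
  have l1 := log_le_div_of_pow_le (a := (0.0046 : ℝ)⁻¹) (m := 13) (k := 70) (by norm_num) (by norm_num)
    (by norm_num)
  have l2 := log_le_div_of_pow_le (a := (0.00019 : ℝ)⁻¹) (m := 5) (k := 43) (by norm_num) (by norm_num)
    (by norm_num)
  have l3 := log_le_div_of_pow_le (a := (0.15 : ℝ)⁻¹) (m := 10) (k := 19) (by norm_num) (by norm_num)
    (by norm_num)
  rw [Real.log_inv] at l1 l2 l3
  push_cast at l1 l2 l3
  have f1 : -((sz 0.0046 n : ℝ) * Real.log 0.0046) ≤ 0.0046 * n * (70 / 13) := by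
    rw [← mul_neg]
    exact mul_le_mul w1 l1 (by rw [neg_nonneg]; exact Real.log_nonpos (by norm_num) (by norm_num))
      (by positivity)
  have f2 : -((sz 0.00019 n : ℝ) * Real.log 0.00019) ≤ 0.00019 * n * (43 / 5) := by
    rw [← mul_neg]
    exact mul_le_mul x1 l2 (by rw [neg_nonneg]; exact Real.log_nonpos (by norm_num) (by norm_num))
      (by positivity)
  have f3 : -((sz 0.0102 n : ℝ) * Real.log 0.15) ≤ 0.0102 * n * (19 / 10) := by
    rw [← mul_neg]
    exact mul_le_mul j1 l3 (by rw [neg_nonneg]; exact Real.log_nonpos (by norm_num) (by norm_num))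
      (by positivity)
  have f4 : 1 / (n : ℝ) ^ 2 * Fintype.card (Sym2 (Fin n)) ≤ 1 := by
    rw [div_mul_eq_mul_div, one_mul, div_le_one (by positivity), Sym2.card, Fintype.card_fin,
      Nat.choose_two_right]
    have : (n + 1) * (n + 1 - 1) / 2 ≤ n ^ 2 := by
      have h1 : 0 < n := by exact_mod_cast h.n_pos
      apply Nat.div_le_of_le_mul
      rw [Nat.add_sub_cancel]
      nlinarith
    exact_mod_cast this
  have f5 : -((pathNum n : ℝ) * Real.log (1 / (n : ℝ) ^ 2)) ≤ 0.0001 * n := by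
    rw [one_div, Real.log_inv, Real.log_pow, mul_neg, neg_neg]
    have h1 := h.pathNum_le
    have h2 : 200000000 * (pathNum n * Real.log n) ≤ n := by
      refine le_trans ?_ h1
      rw [mul_left_comm, sq]
      exact mul_le_mul_of_nonneg_left (mul_le_mul_of_nonneg_right hL (by linarith)) (by positivity)
    push_cast
    linarith
  have f6 : 0.0529 * (n : ℝ) ≤ 2 / n * (1 - 0.15) * b := by
    have h1 : (0.2498 : ℝ) * n ≤ (n / 4 - sz 0.00019 n : ℕ) := by
      have a1 : n ≤ 4 * (n / 4 - sz 0.00019 n) + 4 * sz 0.00019 n + 3 := by omega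
      have a2 : (n : ℝ) ≤ 4 * (n / 4 - sz 0.00019 n : ℕ) + 4 * sz 0.00019 n + 3 := by exact_mod_cast a1
      linarith
    have h2 := mul_le_mul h1 h1 (by positivity) (by positivity)
    have h3 : ((n / 4 - sz 0.00019 n : ℕ) : ℝ) * (n / 4 - sz 0.00019 n : ℕ) ≤ 2 * b + 1 := by
      have : (n / 4 - sz 0.00019 n) * (n / 4 - sz 0.00019 n) ≤ 2 * b + 1 := by omega
      exact_mod_cast this
    rw [div_mul_eq_mul_div, div_mul_eq_mul_div, le_div_iff₀ h.n_pos]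
    nlinarith
  have := h.log_le
  linarith

end Large

end TailBounds

section ThreeRounds

variable {n : ℕ} {q r : ℝ}

/-- The probability of an event depending on three independent random edge sets. -/
noncomputable def tri (n : ℕ) (q r : ℝ)
    (P : Finset (Sym2 (Fin n)) → Finset (Sym2 (Fin n)) → Finset (Sym2 (Fin n)) → Prop) : ℝ :=
  bern (allEdges n) q fun S => bern (allEdges n) q fun T => bern (allEdges n) r fun R => ind (P S T R)

variable {P Q : Finset (Sym2 (Fin n)) → Finset (Sym2 (Fin n)) → Finset (Sym2 (Fin n)) → Prop}

lemma tri_mono (h0 : 0 ≤ q) (h1 : q ≤ 1) (hr0 : 0 ≤ r) (hr1 : r ≤ 1)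
    (h : ∀ S ⊆ allEdges n, ∀ T ⊆ allEdges n, ∀ R ⊆ allEdges n, P S T R → Q S T R) :
    tri n q r P ≤ tri n q r Q :=
  bern_mono h0 h1 fun S hS => bern_mono h0 h1 fun T hT => bern_mono hr0 hr1 fun R hR =>
    ind_mono (h S hS T hT R hR)

lemma tri_or_le (h0 : 0 ≤ q) (h1 : q ≤ 1) (hr0 : 0 ≤ r) (hr1 : r ≤ 1) {a b : ℝ}
    (hP : tri n q r P ≤ a) (hQ : tri n q r Q ≤ b) :
    tri n q r (fun S T R => P S T R ∨ Q S T R) ≤ a + b := by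
  refine le_trans ?_ (add_le_add hP hQ)
  unfold tri
  simp only [← bern_add]
  exact bern_mono h0 h1 fun S hS => bern_mono h0 h1 fun T hT => bern_mono hr0 hr1 fun R hR =>
    ind_or_le _ _

lemma tri_union {p : ℝ} (hp : 1 - (1 - (1 - (1 - q) * (1 - q))) * (1 - r) = p)
    (Q : Finset (Sym2 (Fin n)) → Prop) :
    tri n q r (fun S T R => Q (S ∪ T ∪ R)) = bern (allEdges n) p fun S => ind (Q S) := by
  rw [← hp, ← bern_union, ← bern_union]
  rfl

lemma tri_union_left (q r : ℝ) (Q : Finset (Sym2 (Fin n)) → Finset (Sym2 (Fin n)) → Prop) :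
    tri n q r (fun S T R => Q (S ∪ T) R) =
      bern (allEdges n) (1 - (1 - q) * (1 - q)) fun S => bern (allEdges n) r fun R => ind (Q S R) := by
  rw [← bern_union]
  rfl

lemma tri_union_fst (q r : ℝ) (Q : Finset (Sym2 (Fin n)) → Prop) :
    tri n q r (fun S T _ => Q (S ∪ T)) =
      bern (allEdges n) (1 - (1 - q) * (1 - q)) fun S => ind (Q S) := by
  rw [tri_union_left q r fun S _ => Q S]
  simp only [bern_const]

lemma tri_pair (q r : ℝ) (Q : Finset (Sym2 (Fin n)) → Finset (Sym2 (Fin n)) → Prop) :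
    tri n q r (fun S T _ => Q S T) =
      bern (allEdges n) q fun S => bern (allEdges n) q fun T => ind (Q S T) := by
  unfold tri
  simp only [bern_const]

lemma prG_eq_bern (n : ℕ) (p : ℝ) (Q : SimpleGraph (Fin n) → Prop) :
    prG n p Q = bern (allEdges n) p fun S => ind (Q (gr S)) := by
  classical
  refine Finset.sum_congr rfl fun S _ => ?_
  by_cases h : Q (gr S)
  · rw [Set.indicator_of_mem (by exact h)]
    simp only [ind_true h, mul_one]
  · rw [Set.indicator_of_notMem (by exact h)]
    simp only [ind_false h, mul_zero]

end ThreeRounds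

section Assembly

variable {n : ℕ} {c : ℝ}

/-- The orientation of the pairs in the first set upwards and of those in the second set downwards. -/
def arcs (S T : Finset (Sym2 (Fin n))) (u v : Fin n) : Prop :=
  (u < v ∧ s(u, v) ∈ S) ∨ (v < u ∧ s(u, v) ∈ T)

lemma arcCover_of_forall {S T R : Finset (Sym2 (Fin n))} {ℓ δ s : ℕ} (hS : S ⊆ allEdges n)
    (h1 : ¬ ∃ A Y : Finset (Fin n),
      (∀ a ∈ A, ∀ y ∈ Y, (a < y → s(a, y) ∉ S) ∧ (y < a → s(a, y) ∉ T)) ∧ n + δ < A.card + Y.card)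
    (h2 : ¬ ∃ K : Finset (Sym2 (Fin n)), K.card = s + 1 ∧ K ⊆ allEdges n ∧ K ⊆ S ∧ K ⊆ T)
    (h3 : ¬ ∃ F : Finset (List (Fin n)), F.card = s + 1 ∧ (∀ l ∈ F, l.Nodup ∧ 3 ≤ l.length ∧
      l.length ≤ ℓ ∧ l.IsChain (gr (S ∪ T ∪ R)).Adj ∧ ClosedUp (gr (S ∪ T ∪ R)).Adj l) ∧
      ∀ l ∈ F, ∀ l' ∈ F, ∀ x ∈ l, x ∈ l' → l = l') :
    ArcCover (gr (S ∪ T ∪ R)) (gr (S ∪ T)) (arcs S T) ℓ δ s where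
  arc u v h := by
    rw [SimpleGraph.fromEdgeSet_adj]
    rcases h with ⟨h, h'⟩ | ⟨h, h'⟩
    · exact ⟨Finset.mem_coe.2 (Finset.mem_union_left _ h'), h.ne⟩
    · exact ⟨Finset.mem_coe.2 (Finset.mem_union_right _ h'), h.ne'⟩
  hall A Y h := by
    rw [Fintype.card_fin]
    by_contra hlt
    exact h1 ⟨A, Y, fun a ha y hy => ⟨fun hay hs => h a ha y hy (Or.inl ⟨hay, hs⟩),
      fun hay hs => h a ha y hy (Or.inr ⟨hay, hs⟩)⟩, not_le.1 hlt⟩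
  double E h := by
    by_contra hlt
    obtain ⟨K, hKE, hK⟩ := Finset.exists_subset_card_eq (show s + 1 ≤ E.card by omega)
    have key : ∀ e ∈ K, e ∈ S ∧ e ∈ T := by
      intro e he
      obtain ⟨u, v, rfl, h | h, h' | h'⟩ := h e (hKE he)
      · exact absurd h.1 h'.1.not_gt
      · exact ⟨h.2, Sym2.eq_swap ▸ h'.2⟩
      · exact ⟨Sym2.eq_swap ▸ h'.2, h.2⟩
      · exact absurd h.1 h'.1.not_gt
    exact h2 ⟨K, hK, fun e he => hS (key e he).1, fun e he => (key e he).1, fun e he => (key e he).2⟩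
  cycles F h h' := by
    by_contra hlt
    obtain ⟨K, hKF, hK⟩ := Finset.exists_subset_card_eq (show s + 1 ≤ F.card by omega)
    exact h3 ⟨K, hK, fun l hl => h l (hKF hl), fun l hl l' hl' => h' l (hKF hl) l' (hKF hl')⟩

namespace Large

lemma robustHam (h : Large c n) {S T R : Finset (Sym2 (Fin n))}
    (dense : NoDense (gr (S ∪ T ∪ R)) (gr (S ∪ T)) (sz 0.00019 n))
    (red : ∀ W : Finset (Fin n), W.card = sz 0.000035 n →
      4 * sz 0.000035 n < (cl (gr (S ∪ T ∪ R)) W).card)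
    (small : ∀ W : Finset (Fin n), sz 0.00019 n ≤ W.card → W.card ≤ sz 0.005 n + sz 0.000035 n →
      4 * W.card + sz 0.000001 n < (cl (gr (S ∪ T)) W).card)
    (mid : ∀ W : Finset (Fin n), sz 0.005 n ≤ W.card → W.card ≤ sz 0.1 n →
      4 * W.card + sz 0.0046 n < (cl (gr (S ∪ T)) W).card)
    (large : ∀ W : Finset (Fin n), sz 0.1 n ≤ W.card → 4 * W.card ≤ n →
      3 * W.card + sz 0.0046 n ≤ (cl (gr (S ∪ T)) W).card)
    (deg : ¬ ∃ v : Fin n, degBound n + 1 ≤ (nbS (gr (S ∪ T ∪ R)) {v}).card)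
    (ha : ArcCover (gr (S ∪ T ∪ R)) (gr (S ∪ T)) (arcs S T) (cycLen c n) (sz 0.0055 n) n.sqrt)
    (hc : Closes (gr (S ∪ T ∪ R)) (gr (S ∪ T)) (sz 0.00019 n) (sz 0.0046 n) (pathNum n) (sz 0.0102 n)) :
    RobustHam n (gr (S ∪ T ∪ R)) := by
  have hn := h.n_big
  have hL := h.log_big
  have hs : (n.sqrt : ℝ) ≤ √n := Real.nat_sqrt_le_real_sqrt
  have hss := Real.sq_sqrt h.n_pos.le
  have hsq := h.sq_log_le
  obtain ⟨X, hX, hXc⟩ := ha.exists_shortCyclesMeet (Δ := degBound n) fun v => by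
    by_contra hv
    exact deg ⟨v, by omega⟩
  have a1 := sz_le (show (0 : ℝ) ≤ 0.0055 by norm_num) n
  have a2 := sz_le (show (0 : ℝ) ≤ 0.000035 by norm_num) n
  have a4 := sz_le (show (0 : ℝ) ≤ 0.00019 by norm_num) n
  have a5 := sz_le (show (0 : ℝ) ≤ 0.0046 by norm_num) n
  have b1 := lt_sz 0.00019 n
  have b2 := lt_sz 0.0102 n
  have b3 := lt_sz 0.000001 n
  have b4 := lt_sz 0.005 n
  have hη : n.sqrt * cycLen c n * (degBound n + 1) ≤ sz 0.000001 n := by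
    have h1 : (degBound n : ℝ) ≤ 4 * Real.log n := Nat.floor_le (by positivity)
    have h2 : (n.sqrt : ℝ) * cycLen c n * (degBound n + 1) ≤ √n * Real.log n * (5 * Real.log n) :=
      mul_le_mul (mul_le_mul hs h.cycLen_le (by positivity) (by positivity)) (by linarith) (by positivity)
        (by positivity)
    have h3 : √n * Real.log n * (5 * Real.log n) ≤ 0.0000005 * n := by
      have := mul_le_mul_of_nonneg_left hsq (Real.sqrt_nonneg n)
      nlinarith
    have : (n.sqrt : ℝ) * cycLen c n * (degBound n + 1) ≤ sz 0.000001 n := by linarith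
    exact_mod_cast this
  refine robust_of_closes ⟨?_, dense, red, small, mid, ?_, hX, hXc.trans hη⟩ h.linkNumbers ?_ ?_ ha ?_ ?_ hc
  · rw [gr_union (S ∪ T) R]
    exact le_sup_left
  · rwa [Fintype.card_fin]
  · have : (sz 0.00019 n : ℝ) ≤ sz 0.005 n := by linarith
    exact_mod_cast this
  · have : 4 * (sz 0.000035 n : ℝ) ≤ sz 0.00019 n := by linarith
    exact_mod_cast this
  · have : 0 < (cycLen c n : ℝ) := by linarith [h.cycLen_big]
    exact_mod_cast this
  · have h1 : ((n / cycLen c n : ℕ) : ℝ) ≤ n / 1000000 := by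
      refine Nat.cast_div_le.trans ?_
      have := h.cycLen_big
      gcongr
    have h2 : (pathNum n : ℝ) ≤ 0.00001 * n := by
      have := h.pathNum_le
      have h3 : 100000 ≤ Real.log n ^ 2 := by nlinarith
      nlinarith [mul_le_mul_of_nonneg_left h3 (Nat.cast_nonneg (α := ℝ) (pathNum n))]
    have h3 : √(n : ℝ) ≤ 0.00001 * n := by
      have : 100000 ≤ √(n : ℝ) := by nlinarith [h.sqrt_big]
      nlinarith
    have : (sz 0.0055 n : ℝ) + sz 0.0046 n + (2 * n.sqrt + (n / cycLen c n : ℕ)) + pathNum n ≤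
        sz 0.0102 n := by linarith
    exact_mod_cast this

lemma exists_round_probability (h : Large c n) : ∃ q : ℝ, 0 ≤ q ∧ q ≤ 1 ∧ 9 ≤ n * q ∧ n * q ≤ c ∧
    c - 2 ≤ n * (1 - (1 - q) * (1 - q)) ∧ n * (1 - (1 - q) * (1 - q) + 2 / n) ≤ c + 2 ∧
    1 - (1 - (1 - (1 - q) * (1 - q))) * (1 - 2 / n) = c / n := by
  have hn := h.n_big
  have hc := h.twenty_le
  have hcn : c ≤ n := by linarith [h.log_ge, h.log_le]
  have hn2 : (0 : ℝ) < n - 2 := by linarith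
  set x := ((n : ℝ) - c) / (n - 2) with hx
  have hxn : x * (n - 2) = n - c := by rw [hx]; field_simp
  have hx0 : 0 ≤ x := div_nonneg (by linarith) hn2.le
  have hx1 : x ≤ 1 := by rw [hx, div_le_one hn2]; linarith
  have h1 : √x * √x = x := Real.mul_self_sqrt hx0
  have h2 : 0 ≤ √x := Real.sqrt_nonneg x
  have h3 : √x ≤ 1 := Real.sqrt_le_one.2 hx1
  have hnx : n - c ≤ n * x := by nlinarith
  have hnx' : (n : ℝ) * x ≤ n - (c - 2) := by nlinarith
  have h4 : x ≤ √x := by nlinarith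
  refine ⟨1 - √x, by linarith, by linarith, ?_, ?_, ?_, ?_, ?_⟩
  · nlinarith [mul_nonneg h.n_pos.le (sq_nonneg (1 - √x))]
  · nlinarith [mul_le_mul_of_nonneg_left h4 h.n_pos.le]
  · rw [sub_sub_cancel, h1]; linarith
  · rw [sub_sub_cancel, h1, mul_add, mul_div_cancel₀ _ h.n_pos.ne']; linarith
  · rw [sub_sub_cancel, sub_sub_cancel, h1, one_sub_div h.n_pos.ne', mul_div_assoc', hxn]
    field_simp
    ring

theorem prG_le (h : Large c n) {K : ℝ} (hK : ∀ (n x₀ : ℕ) (p r : ℝ), 0 ≤ p → p ≤ 1 → 0 ≤ r →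
    r ≤ 1 → c - 2 ≤ n * p → n * (p + r) ≤ c + 2 → (x₀ : ℝ) ≤ 0.000191 * n →
    bern (allEdges n) p (fun S => bern (allEdges n) r fun R =>
      ind (¬ NoDense (gr (S ∪ R)) (gr S) x₀)) ≤ K / (n : ℝ) ^ 2) :
    prG n (c / n) (fun G => ¬ RobustHam n G) ≤ (K + 9) / (n : ℝ) ^ 2 := by
  obtain ⟨q, h0, h1, hq9, hqc, hH, hG, hp⟩ := h.exists_round_probability
  have hn := h.n_big
  have hc := h.twenty_le
  have hn1 : 1 ≤ n := by
    have : (1 : ℝ) ≤ n := by linarith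
    exact_mod_cast this
  have hr0 : 0 ≤ 2 / (n : ℝ) := by positivity
  have hr1 : 2 / (n : ℝ) ≤ 1 := by rw [div_le_one h.n_pos]; linarith
  have hp0 : 0 ≤ c / (n : ℝ) := by positivity
  have hp1 : c / (n : ℝ) ≤ 1 := by rw [div_le_one h.n_pos]; linarith [h.log_ge, h.log_le]
  have hpc : n * (c / n) = c := mul_div_cancel₀ _ h.n_pos.ne'
  have hH0 : 0 ≤ 1 - (1 - q) * (1 - q) := by nlinarith
  have hH1 : 1 - (1 - q) * (1 - q) ≤ 1 := by nlinarith
  have hH18 : 18 ≤ n * (1 - (1 - q) * (1 - q)) := by linarith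
  have a0 := sz_le (show (0 : ℝ) ≤ 0.00019 by norm_num) n
  have a1 := sz_le (show (0 : ℝ) ≤ 0.000035 by norm_num) n
  have a2 := sz_le (show (0 : ℝ) ≤ 0.000001 by norm_num) n
  have a3 := sz_le (show (0 : ℝ) ≤ 0.005 by norm_num) n
  have a4 := sz_le (show (0 : ℝ) ≤ 0.0046 by norm_num) n
  have a5 := sz_le (show (0 : ℝ) ≤ 0.1 by norm_num) n
  have a6 := sz_le (show (0 : ℝ) ≤ 0.0055 by norm_num) n
  have b0 := lt_sz 0.00019 n
  have b1 := lt_sz 0.000035 n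
  have b3 := lt_sz 0.005 n
  have b5 := lt_sz 0.1 n
  have b6 := lt_sz 0.0055 n
  have e6 : (0.000001 : ℝ) ≥ 0.0000001 := by norm_num
  have dense := (tri_union_left (n := n) q (2 / n)
    fun S R => ¬ NoDense (gr (S ∪ R)) (gr S) (sz 0.00019 n)).trans_le
    (hK n (sz 0.00019 n) _ _ hH0 hH1 hr0 hr1 hH hG (by linarith))
  have red := (tri_union (n := n) hp fun S => ¬ ∀ W : Finset (Fin n), W.card = sz 0.000035 n →
    4 * sz 0.000035 n < (cl (gr S) W).card).trans_le
    ((bern_red_event_le hp0 hp1 hn1 (by linarith) (by linarith) (by linarith)).trans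
      (h.expansion_le le_rfl))
  have small := (tri_union_fst (n := n) q (2 / n) fun S => ¬ ∀ W : Finset (Fin n),
    sz 0.00019 n ≤ W.card → W.card ≤ sz 0.005 n + sz 0.000035 n →
      4 * W.card + sz 0.000001 n < (cl (gr S) W).card).trans_le
    ((bern_small_event_le hH0 hH1 hn1 hH18 (by linarith) (by linarith) (by linarith)).trans
      (h.expansion_le e6))
  have mid := (tri_union_fst (n := n) q (2 / n) fun S => ¬ ∀ W : Finset (Fin n),
    sz 0.005 n ≤ W.card → W.card ≤ sz 0.1 n → 4 * W.card + sz 0.0046 n < (cl (gr S) W).card).trans_le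
    ((bern_mid_event_le hH0 hH1 hn1 hH18 (by linarith) a5 a4).trans (h.expansion_le e6))
  have large := (tri_union_fst (n := n) q (2 / n) fun S => ¬ ∀ W : Finset (Fin n),
    sz 0.1 n ≤ W.card → 4 * W.card ≤ n → 3 * W.card + sz 0.0046 n ≤ (cl (gr S) W).card).trans_le
    ((bern_large_event_le hH0 hH1 hn1 hH18 (by linarith) a4).trans (h.expansion_le e6))
  have deg := (tri_union (n := n) hp fun S => ∃ v : Fin n, degBound n + 1 ≤ (nbS (gr S) {v}).card).trans_le
    ((bern_degree_le hp0 hp1 _).trans (h.degree_le hp0 hpc.le))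
  have hall := (tri_pair (n := n) q (2 / n) fun S T => ∃ A Y : Finset (Fin n),
      (∀ a ∈ A, ∀ y ∈ Y, (a < y → s(a, y) ∉ S) ∧ (y < a → s(a, y) ∉ T)) ∧
        n + sz 0.0055 n < A.card + Y.card).trans_le
    ((bern_hall_le_exp h0 h1 hq9 hqc (by push_cast; linarith) (by push_cast; linarith)).trans h.hall_le)
  have common := (tri_pair (n := n) q (2 / n) fun S T => ∃ K : Finset (Sym2 (Fin n)),
      K.card = n.sqrt + 1 ∧ K ⊆ allEdges n ∧ K ⊆ S ∧ K ⊆ T).trans_le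
    ((bern_common_le h0 h1 _).trans (h.common_le h0 hqc))
  have cycles := (tri_union (n := n) hp fun S => ∃ F : Finset (List (Fin n)), F.card = n.sqrt + 1 ∧
      (∀ l ∈ F, l.Nodup ∧ 3 ≤ l.length ∧ l.length ≤ cycLen c n ∧ l.IsChain (gr S).Adj ∧
        ClosedUp (gr S).Adj l) ∧ ∀ l ∈ F, ∀ l' ∈ F, ∀ x ∈ l, x ∈ l' → l = l').trans_le
    ((bern_cycles_le hp0 hp1 (Real.one_le_exp zero_le_one) _ _).trans (h.cycles_le hpc))
  have closes : tri n q (2 / n) (fun S T R => ¬ Closes (gr (S ∪ T) ⊔ gr R) (gr (S ∪ T)) (sz 0.00019 n)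
      (sz 0.0046 n) (pathNum n) (sz 0.0102 n)) ≤ 1 / (n : ℝ) ^ 2 :=
    bern_le_const h0 h1 fun S _ => bern_le_const h0 h1 fun T _ =>
      (bern_not_closes_le (θ := 0.15) hr0 hr1 (by norm_num) (by norm_num) (Nat.mul_div_le _ 2)).trans
        h.sprinkle_le
  rw [prG_eq_bern, ← tri_union hp fun S => ¬ RobustHam n (gr S)]
  have total := tri_or_le h0 h1 hr0 hr1 dense <| tri_or_le h0 h1 hr0 hr1 red <|
    tri_or_le h0 h1 hr0 hr1 small <| tri_or_le h0 h1 hr0 hr1 mid <| tri_or_le h0 h1 hr0 hr1 large <|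
    tri_or_le h0 h1 hr0 hr1 deg <| tri_or_le h0 h1 hr0 hr1 hall <| tri_or_le h0 h1 hr0 hr1 common <|
    tri_or_le h0 h1 hr0 hr1 cycles closes
  refine le_trans (tri_mono h0 h1 hr0 hr1 fun S hS T hT R hR hbad => ?_) (total.trans (le_of_eq (by ring)))
  by_contra hgood
  simp only [not_or] at hgood
  obtain ⟨g1, g2, g3, g4, g5, g6, g7, g8, g9, g10⟩ := hgood
  refine hbad (h.robustHam (not_not.1 g1) (not_not.1 g2) (not_not.1 g3) (not_not.1 g4) (not_not.1 g5) g6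
    (arcCover_of_forall hS g7 g8 g9) ?_)
  rw [gr_union (S ∪ T) R]
  exact not_not.1 g10

end Large

end Assembly

/-- Let `c ≥ 20` be a constant and `G ~ G(n, c/n)`.  Then with
probability `1 − o(n⁻¹)`: for every `U ⊆ V_{4,blue}(G)` and every matching `M` on
`V_{4,blue}(G) \ U`, the graph `G'[V(G') \ U] ∪ M` (where `G'` is the subgraph of `G`
induced by `V_{4,black}(G) ∪ V_{4,blue}(G)`) has a Hamilton cycle containing every
edge of `M`. -/
theorem strong_four_core_robustly_hamiltonian (c : ℝ) (hc : 20 ≤ c) :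
    Tendsto
      (fun n : ℕ => (n : ℝ) * prG n (c / n) (fun G => ¬ RobustHam n G))
      atTop (nhds 0) := by
  obtain ⟨K, hK⟩ := exists_dense_bound hc
  have h1 : Tendsto (fun n : ℕ => (K + 9) / (n : ℝ)) atTop (nhds 0) :=
    tendsto_const_div_atTop_nhds_zero_nat (K + 9)
  refine tendsto_of_tendsto_of_tendsto_of_le_of_le' tendsto_const_nhds h1 ?_ ?_
  · filter_upwards [eventually_large hc] with n h
    refine mul_nonneg (Nat.cast_nonneg n) ?_
    rw [prG_eq_bern]
    refine bern_nonneg (by have := h.n_pos; positivity) ?_ fun S _ => ind_nonneg _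
    rw [div_le_one h.n_pos]
    linarith [h.log_ge, h.log_le, h.n_big]
  · filter_upwards [eventually_large hc] with n h
    refine (mul_le_mul_of_nonneg_left (h.prG_le hK) (Nat.cast_nonneg n)).trans (le_of_eq ?_)
    have := h.n_pos
    field_simp
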